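/- Consider the set F of all digit sets D ⊆ {0,1,2}³ with |D| = 7 such that the fractal 3-cube K(D) of order 3 is connected and possesses the one-point intersection property. Call D, D′ ∈ F equivalent if there exists a bi-Lipschitz homeomorphism K(D) → K(D′). Then F has exactly 12 equivalence classes, of which exactly 5 consist of digit sets D for which K(D) is a dendrite and exactly 7 consist of digit sets D for which K(D) is not a dendrite. -/

import Mathlib

open Pointwise

/-- `ℝ³` as Euclidean space. -/
abbrev E3 := EuclideanSpace ℝ (Fin 3)

/-- `D` is a digit set of order 3: `D ⊆ {0,1,2}³`. -/
def IsDigitSet3 (D : Set E3) : Prop :=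
  ∀ d ∈ D, ∀ i : Fin 3, ∃ m : ℕ, m < 3 ∧ d i = m

/-- The piece `(K + d)/3` of a fractal cube of order 3. -/
noncomputable def piece (K : Set E3) (d : E3) : Set E3 := (3 : ℝ)⁻¹ • (K + {d})

/-- `K` is the fractal 3-cube of order 3 with digit set `D`. -/
def IsFractalCube3 (D K : Set E3) : Prop :=
  K.Nonempty ∧ IsCompact K ∧ (3 : ℝ) • K = K + D

/-- A set `K ⊆ ℝ³` is a dendrite if it is compact, connected, locally connected and contains
no subset homeomorphic to a circle. -/
def IsDendrite (K : Set E3) : Prop :=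
  IsCompact K ∧ IsConnected K ∧ LocallyConnectedSpace K ∧
    ¬ ∃ C : Set E3, C ⊆ K ∧ Nonempty (C ≃ₜ Metric.sphere (0 : EuclideanSpace ℝ (Fin 2)) 1)

/-- The family of digit sets `D ⊆ {0,1,2}³` with `7` digits whose fractal cube is connected
and possesses the one-point intersection property. -/
def GoodDigitSets : Set (Set E3) :=
  {D | IsDigitSet3 D ∧ D.ncard = 7 ∧
    ∃ K : Set E3, IsFractalCube3 D K ∧ IsConnected K ∧
      ∀ di ∈ D, ∀ dj ∈ D, di ≠ dj → (piece K di ∩ piece K dj).Subsingleton}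

/-- Two digit sets are Lipschitz equivalent if there is a bi-Lipschitz homeomorphism between
their fractal cubes. -/
def LipEquiv (D D' : GoodDigitSets) : Prop :=
  ∃ K K' : Set E3, IsFractalCube3 D K ∧ IsFractalCube3 D' K' ∧
    ∃ (φ : K → K') (L : ℝ), 1 ≤ L ∧ Function.Bijective φ ∧
      ∀ x y : K, L⁻¹ * ‖(x : E3) - (y : E3)‖ ≤ ‖(φ x : E3) - (φ y : E3)‖ ∧
        ‖(φ x : E3) - (φ y : E3)‖ ≤ L * ‖(x : E3) - (y : E3)‖

set_option linter.unusedSectionVars false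
namespace FC

open Set Filter Topology

/-- An abstract self-similar space with 7 pieces and glueing relation `R`. -/
structure IFS (R : Fin 7 → Fin 7 → Fin 7 → Fin 7 → Prop) (X : Type) [MetricSpace X] where
  S : Fin 7 → X → X
  c : Fin 7 → X
  dist_S : ∀ d x y, dist (S d x) (S d y) = dist x y / 3
  cover : ∀ x, ∃ d y, S d y = x
  S_c : ∀ d, S d (c d) = c d
  c_inj : Function.Injective c
  glue : ∀ d e x y, d ≠ e → (S d x = S e y ↔ ∃ a b, R d e a b ∧ x = c a ∧ y = c b)
  glue_dist : ∀ d e a b x y, R d e a b →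
    dist (S d (S a x)) (S e (S b y)) = dist (S d x) (S e y) / 3

/-- Combinatorial conditions on the glueing relation. -/
structure Ok (R : Fin 7 → Fin 7 → Fin 7 → Fin 7 → Prop) (par : Fin 7 → Fin 7 → Fin 7) : Prop where
  irr : ∀ d e a b, R d e a b → d ≠ e ∧ a ≠ d ∧ b ≠ e
  symm : ∀ d e a b, R d e a b → R e d b a
  func : ∀ d e e' a b b', R d e a b → R d e' a b' → e = e' ∧ b = b'
  par_ne : ∀ d e, e ≠ d → par d e ≠ d
  par_adj : ∀ d e, e ≠ d → par d e = e ∨ ∃ a b, R e (par d e) a b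
  cl_closed : ∀ d e e' a b, R e e' a b → e ≠ d → e' ≠ d → (par d)^[6] e = (par d)^[6] e'
  star : ∀ d e a b, R d e a b → (par d)^[6] a = (par d)^[6] e
  conn : ∀ d e, e ≠ d → ∃ e' a b, R d e' a b ∧ (par d)^[6] e' = (par d)^[6] e

/-- `f` is locally constant at `x`. -/
def LC {X A : Type} [TopologicalSpace X] (f : X → A) (x : X) : Prop := ∀ᶠ y in 𝓝 x, f y = f x

def cl (par : Fin 7 → Fin 7 → Fin 7) (d e : Fin 7) : Fin 7 := (par d)^[6] e

section basic

variable {R : Fin 7 → Fin 7 → Fin 7 → Fin 7 → Prop} {par : Fin 7 → Fin 7 → Fin 7}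
  {X : Type} [MetricSpace X] (F : IFS R X)

namespace IFS

/-- word maps -/
def W : List (Fin 7) → X → X
  | [] => id
  | d :: u => F.S d ∘ W u

@[simp] lemma W_nil (x : X) : F.W [] x = x := rfl
@[simp] lemma W_cons (d : Fin 7) (u : List (Fin 7)) (x : X) : F.W (d :: u) x = F.S d (F.W u x) := rfl

lemma W_append (u v : List (Fin 7)) (x : X) : F.W (u ++ v) x = F.W u (F.W v x) := by
  induction u with
  | nil => rfl
  | cons d u ih => simp [ih]

lemma dist_W (u : List (Fin 7)) (x y : X) : dist (F.W u x) (F.W u y) = dist x y / 3 ^ u.length := by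
  induction u with
  | nil => simp
  | cons d u ih => simp [F.dist_S, ih, pow_succ]; field_simp

lemma S_inj (d : Fin 7) : Function.Injective (F.S d) := by
  intro x y h
  have := F.dist_S d x y
  rw [h, dist_self] at this
  exact dist_eq_zero.1 (by linarith)

lemma W_inj (u : List (Fin 7)) : Function.Injective (F.W u) := by
  induction u with
  | nil => exact Function.injective_id
  | cons d u ih => exact (F.S_inj d).comp ih

lemma S_cont (d : Fin 7) : Continuous (F.S d) := by
  have : LipschitzWith 1 (F.S d) := LipschitzWith.of_dist_le_mul fun x y => by
    rw [F.dist_S]; simp; linarith [dist_nonneg (x := x) (y := y)]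
  exact this.continuous

lemma W_cont (u : List (Fin 7)) : Continuous (F.W u) := by
  induction u with
  | nil => exact continuous_id
  | cons d u ih => exact (F.S_cont d).comp ih

lemma W_rep (d : Fin 7) (n : ℕ) : F.W (List.replicate n d) (F.c d) = F.c d := by
  induction n with
  | zero => rfl
  | succ n ih => simp [List.replicate_succ, ih, F.S_c]

lemma cover_W (n : ℕ) (x : X) : ∃ u : List (Fin 7), u.length = n ∧ ∃ y, F.W u y = x := by
  induction n generalizing x with
  | zero => exact ⟨[], rfl, x, rfl⟩
  | succ n ih =>
    obtain ⟨d, y, rfl⟩ := F.cover x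
    obtain ⟨u, hu, z, rfl⟩ := ih y
    exact ⟨d :: u, by simp [hu], z, rfl⟩

variable [CompactSpace X]

lemma exists_small {ε : ℝ} (hε : 0 < ε) : ∃ n : ℕ, ∀ u : List (Fin 7), n ≤ u.length →
    ∀ x y, dist (F.W u x) (F.W u y) < ε := by
  obtain ⟨C, hC⟩ := (Metric.isBounded_iff.1 (isCompact_univ (X := X)).isBounded)
  have hC' : ∀ x y : X, dist x y ≤ max C 1 := fun x y => (hC trivial trivial).trans (le_max_left _ _)
  obtain ⟨n, hn⟩ := exists_pow_lt_of_lt_one (show 0 < ε / max C 1 by positivity) (show (1/3 : ℝ) < 1 by norm_num)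
  refine ⟨n, fun u hu x y => ?_⟩
  rw [F.dist_W]
  have h1 : (0:ℝ) < 3 ^ u.length := by positivity
  rw [div_lt_iff₀ h1]
  have h2 : (1/3 : ℝ)^n * max C 1 < ε := by
    rwa [lt_div_iff₀ (by positivity)] at hn
  have h3 : (3:ℝ)^n ≤ 3 ^ u.length := pow_le_pow_right₀ (by norm_num) hu
  have h4 : (1/3 : ℝ)^n * 3^n = 1 := by rw [← mul_pow]; norm_num
  have h5 : max C 1 < ε * 3^n := by
    have h6 : (0:ℝ) < 3^n := by positivity
    have := mul_lt_mul_of_pos_right h2 h6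
    calc max C 1 = (1/3 : ℝ)^n * 3^n * max C 1 := by rw [h4, one_mul]
      _ = (1/3 : ℝ)^n * max C 1 * 3^n := by ring
      _ < _ := this
  calc dist x y ≤ max C 1 := hC' x y
    _ < ε * 3^n := h5
    _ ≤ _ := by gcongr

lemma range_W_closed (u : List (Fin 7)) : IsClosed (range (F.W u)) :=
  (isCompact_range (F.W_cont u)).isClosed

lemma range_S_closed (d : Fin 7) : IsClosed (range (F.S d)) :=
  (isCompact_range (F.S_cont d)).isClosed

/-- outside of small pieces around `p`. -/
lemma exists_not_mem {x p : X} (h : x ≠ p) : ∃ n : ℕ, ∀ u : List (Fin 7), n ≤ u.length →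
    p ∈ range (F.W u) → x ∉ range (F.W u) := by
  obtain ⟨n, hn⟩ := F.exists_small (dist_pos.2 h)
  refine ⟨n, fun u hu hp hx => ?_⟩
  obtain ⟨y, rfl⟩ := hp
  obtain ⟨z, rfl⟩ := hx
  exact lt_irrefl _ (hn u hu z y)

/-- Neighbourhoods are detected on pieces. -/
lemma mem_nhds_iff {x : X} {V : Set X} : V ∈ 𝓝 x ↔ ∀ d y, F.S d y = x → F.S d ⁻¹' V ∈ 𝓝 y := by
  constructor
  · rintro h d y rfl
    exact (F.S_cont d).continuousAt h
  · intro h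
    have key : ∀ d, ∀ᶠ z in 𝓝 x, z ∈ range (F.S d) → z ∈ V := by
      intro d
      by_cases hx : x ∈ range (F.S d)
      · obtain ⟨y, rfl⟩ := hx
        have h1 := h d y rfl
        obtain ⟨O, hO, hOo, hyO⟩ := _root_.mem_nhds_iff.1 h1
        have hc : IsClosed (F.S d '' Oᶜ) :=
          ((hOo.isClosed_compl.isCompact).image (F.S_cont d)).isClosed
        have : F.S d y ∉ F.S d '' Oᶜ := by
          rintro ⟨z, hz, hzy⟩
          rw [F.S_inj d hzy] at hz
          exact hz hyO
        filter_upwards [hc.isOpen_compl.mem_nhds this] with z hz hz'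
        obtain ⟨w, rfl⟩ := hz'
        by_contra hV
        exact hz ⟨w, fun hw => hV (hO hw), rfl⟩
      · filter_upwards [(F.range_S_closed d).isOpen_compl.mem_nhds hx] with z hz hz'
        exact absurd hz' hz
    filter_upwards [eventually_all.2 key] with z hz
    obtain ⟨d, y, rfl⟩ := F.cover z
    exact hz d ⟨y, rfl⟩

lemma eventually_iff {x : X} {P : X → Prop} : (∀ᶠ z in 𝓝 x, P z) ↔
    ∀ d y, F.S d y = x → ∀ᶠ z in 𝓝 y, P (F.S d z) := F.mem_nhds_iff

lemma LC_iff {A : Type} {f : X → A} {x : X} : LC f x ↔ ∀ d y, F.S d y = x → LC (f ∘ F.S d) y := by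
  unfold LC
  rw [F.eventually_iff]
  constructor
  · rintro h d y rfl
    exact h d y rfl
  · rintro h d y rfl
    exact h d y rfl

lemma LC.comp_S {A : Type} {f : X → A} {d : Fin 7} {y : X} (h : LC f (F.S d y)) :
    LC (f ∘ F.S d) y := (F.LC_iff.1 h) d y rfl

/-- the walk lemma. -/
lemma cl_const (ok : Ok R par) {A : Type} (g : Fin 7 → A) (d : Fin 7)
    (h : ∀ e e' a b, R e e' a b → e ≠ d → e' ≠ d → g e = g e') (e : Fin 7) (he : e ≠ d) :
    g e = g (cl par d e) := by
  have : ∀ n, ∀ e, e ≠ d → (par d)^[n] e ≠ d ∧ g e = g ((par d)^[n] e) := by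
    intro n
    induction n with
    | zero => intro e he; exact ⟨he, rfl⟩
    | succ n ih =>
      intro e he
      rw [Function.iterate_succ_apply]
      have h1 := ok.par_ne d e he
      obtain ⟨h2, h3⟩ := ih _ h1
      refine ⟨h2, ?_⟩
      rw [← h3]
      rcases ok.par_adj d e he with h4 | ⟨a, b, h4⟩
      · rw [h4]
      · exact h _ _ _ _ h4 he h1
  exact (this 6 e he).2

lemma cl_const' (ok : Ok R par) {A : Type} (g : Fin 7 → A) (d : Fin 7)
    (h : ∀ e e' a b, R e e' a b → e ≠ d → e' ≠ d → g e = g e') (e e' : Fin 7) (he : e ≠ d)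
    (he' : e' ≠ d) (hc : cl par d e = cl par d e') : g e = g e' := by
  rw [cl_const ok g d h e he, cl_const ok g d h e' he', hc]

lemma graph_const (ok : Ok R par) {A : Type} (g : Fin 7 → A)
    (h : ∀ e e' a b, R e e' a b → g e = g e') (e e' : Fin 7) : g e = g e' := by
  have : ∀ e, g e = g 0 := by
    intro e
    by_cases he : e = 0
    · rw [he]
    obtain ⟨e', a, b, h1, h2⟩ := ok.conn 0 e he
    have := cl_const' ok g 0 (fun e e' a b h' _ _ => h e e' a b h') e e' he (ok.irr _ _ _ _ h1).1.symm h2.symm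
    rw [this, ← h _ _ _ _ h1]
  rw [this e, this e']

lemma R_eq {d e a b : Fin 7} (ok : Ok R par) (h : R d e a b) : F.S d (F.c a) = F.S e (F.c b) :=
  (F.glue d e _ _ (ok.irr _ _ _ _ h).1).2 ⟨a, b, h, rfl, rfl⟩

lemma const_of_pieces (ok : Ok R par) {A : Type} {f : X → A}
    (h : ∀ d x y, f (F.S d x) = f (F.S d y)) (x y : X) : f x = f y := by
  have key := graph_const ok (fun e => f (F.c e)) (fun e e' a b hR => by
    have := F.R_eq ok hR
    show f (F.c e) = f (F.c e')
    rw [← F.S_c e, ← F.S_c e', h e _ (F.c a), this, h e' (F.c b)])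
  obtain ⟨d, x, rfl⟩ := F.cover x
  obtain ⟨e, y, rfl⟩ := F.cover y
  rw [h d x (F.c d), h e y (F.c e), F.S_c, F.S_c]
  exact key d e

lemma const_of_LC (F : IFS R X) (ok : Ok R par) {A : Type} {f : X → A} (h : ∀ x, LC f x) (x y : X) :
    f x = f y := by
  have hopen : ∀ a, IsOpen (f ⁻¹' {a}) := by
    intro a
    rw [isOpen_iff_mem_nhds]
    intro x hx
    filter_upwards [h x] with y hy
    rw [mem_preimage, hy]; exact hx
  obtain ⟨δ, hδ, hb⟩ := lebesgue_number_lemma_of_metric (isCompact_univ (X := X)) hopen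
    (fun x _ => mem_iUnion.2 ⟨f x, rfl⟩)
  obtain ⟨n, hn⟩ := F.exists_small hδ
  have key : ∀ n, ∀ f : X → A, (∀ u : List (Fin 7), u.length = n → ∀ x y, f (F.W u x) = f (F.W u y)) →
      ∀ x y, f x = f y := by
    intro n
    induction n with
    | zero => intro f hf x y; exact hf [] rfl x y
    | succ n ih =>
      intro f hf
      apply F.const_of_pieces ok
      intro d
      apply ih (f ∘ F.S d)
      intro u hu x y
      exact hf (d :: u) (by simp [hu]) x y
  apply key n f
  intro u hu x y
  obtain ⟨i, hi⟩ := hb (F.W u x) trivial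
  have h1 := hi (Metric.mem_ball_self hδ)
  have h2 := hi (show F.W u y ∈ Metric.ball (F.W u x) δ from hn u hu.ge y x)
  rw [mem_preimage, mem_singleton_iff] at h1 h2
  rw [h1, h2]

end IFS
end basic
end FC

set_option linter.unusedSectionVars false
namespace FC

open Set Filter Topology

/-- `a` is a mark of the piece `d`. -/
def Mk (R : Fin 7 → Fin 7 → Fin 7 → Fin 7 → Prop) (d a : Fin 7) : Prop := ∃ e b, R d e a b

/-- possible exits of a piece whose last digit is `d` -/
def Ex (R : Fin 7 → Fin 7 → Fin 7 → Fin 7 → Prop) (d a : Fin 7) : Prop :=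
  Mk R d a ∨ (a = d ∧ ∃ d', Mk R d' a)

/-- number of components of the graph minus `d` -/
def cn (par : Fin 7 → Fin 7 → Fin 7) (d : Fin 7) : ℕ :=
  ((Finset.univ.filter (· ≠ d)).image (cl par d)).card

/-- any three exits of a piece lie in at most two classes relative to the next digit -/
def Chk2 (R : Fin 7 → Fin 7 → Fin 7 → Fin 7 → Prop) (par : Fin 7 → Fin 7 → Fin 7) : Prop :=
  ∀ d d', d ≠ d' → ∃ k₁ k₂, ∀ b, Ex R d b →
    (if b = d' then d' else cl par d' b) = k₁ ∨ (if b = d' then d' else cl par d' b) = k₂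

section top
variable {X : Type} [TopologicalSpace X]

def LS (k : ℕ) (p : X) : Prop := ∃ f : X → Fin k, (∀ᶠ x in 𝓝[≠] p, LC f x) ∧
  ∀ i, ∃ᶠ x in 𝓝[≠] p, f x = i

def Split (k : ℕ) (p : X) : Prop := ∃ f : X → Fin k, (∀ x, x ≠ p → LC f x) ∧
  ∀ i, ∃ x, x ≠ p ∧ f x = i

def Sep (r p q : X) : Prop := p ≠ r ∧ q ≠ r ∧ ∃ f : X → Bool, (∀ x, x ≠ r → LC f x) ∧ f p ≠ f q

def Conj (p q : X) : Prop := p ≠ q ∧ ∀ r, ¬ Sep r p q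
end top

namespace IFS

variable {R : Fin 7 → Fin 7 → Fin 7 → Fin 7 → Prop} {par : Fin 7 → Fin 7 → Fin 7}
  {X : Type} [MetricSpace X] [CompactSpace X] (F : IFS R X)

/-- `q` is such that `W u q` lies in the piece `u` only. -/
def In : List (Fin 7) → X → Prop
  | [], _ => True
  | d :: u, q => (∀ e y, F.S e y = F.S d (F.W u q) → e = d) ∧ In u q

lemma In_append (u v : List (Fin 7)) (q : X) : F.In (u ++ v) q ↔ F.In u (F.W v q) ∧ F.In v q := by
  induction u with
  | nil => simp [In]
  | cons d u ih => simp [In, ih, F.W_append, and_assoc]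

lemma c_single (ok : Ok R par) {e a : Fin 7} {y : X} (h : F.S e y = F.c a) : e = a ∧ y = F.c a := by
  by_cases he : e = a
  · subst he
    exact ⟨rfl, F.S_inj e (by rw [h, F.S_c])⟩
  · exfalso
    rw [← F.S_c a] at h
    obtain ⟨x, b, h1, h2, h3⟩ := (F.glue e a _ _ he).1 h
    exact (ok.irr _ _ _ _ h1).2.2 (F.c_inj h3).symm

lemma W_eq_c (ok : Ok R par) {u : List (Fin 7)} {a : Fin 7} {y : X} (h : F.W u y = F.c a) :
    u = List.replicate u.length a ∧ y = F.c a := by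
  induction u with
  | nil => exact ⟨rfl, h⟩
  | cons d u ih =>
    obtain ⟨h1, h2⟩ := F.c_single ok h
    obtain ⟨h3, h4⟩ := ih h2
    refine ⟨?_, h4⟩
    rw [h1, List.length_cons, List.replicate_succ, ← h3]

lemma In_rep (ok : Ok R par) (n : ℕ) (a : Fin 7) : F.In (List.replicate n a) (F.c a) := by
  induction n with
  | zero => trivial
  | succ n ih =>
    rw [List.replicate_succ]
    refine ⟨fun e y h => ?_, ih⟩
    rw [F.W_rep, F.S_c] at h
    exact (F.c_single ok h).1

lemma eventually_W {u : List (Fin 7)} {q : X} (h : F.In u q) {P : X → Prop} :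
    (∀ᶠ z in 𝓝 (F.W u q), P z) ↔ ∀ᶠ z in 𝓝 q, P (F.W u z) := by
  induction u generalizing P with
  | nil => rfl
  | cons d u ih =>
    rw [F.eventually_iff]
    constructor
    · intro h'
      exact (ih h.2).1 (h' d _ rfl)
    · intro h' e y hy
      obtain rfl := h.1 e y hy
      obtain rfl := F.S_inj e hy
      exact (ih h.2).2 h'

lemma eventually_W_ne {u : List (Fin 7)} {q : X} (h : F.In u q) {P : X → Prop} :
    (∀ᶠ z in 𝓝[≠] (F.W u q), P z) ↔ ∀ᶠ z in 𝓝[≠] q, P (F.W u z) := by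
  rw [eventually_nhdsWithin_iff, eventually_nhdsWithin_iff, F.eventually_W h]
  simp [(F.W_inj u).eq_iff]

lemma range_W_nhds {u : List (Fin 7)} {q : X} (h : F.In u q) : range (F.W u) ∈ 𝓝 (F.W u q) :=
  (F.eventually_W h (P := fun z => z ∈ range (F.W u))).2 (Eventually.of_forall fun z => ⟨z, rfl⟩)

lemma LC_comp_W {A : Type} {f : X → A} {u : List (Fin 7)} {y : X} (h : LC f (F.W u y)) :
    LC (f ∘ F.W u) y := (F.W_cont u).continuousAt h

lemma LC_off_W {A : Type} {f : X → A} {u : List (Fin 7)} {q : X}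
    (h : ∀ y, y ≠ F.W u q → LC f y) : ∀ y, y ≠ q → LC (f ∘ F.W u) y :=
  fun y hy => F.LC_comp_W (h _ ((F.W_inj u).ne hy))

lemma LC_off_S {A : Type} {f : X → A} {d : Fin 7} {q : X}
    (h : ∀ y, y ≠ F.S d q → LC f y) : ∀ y, y ≠ q → LC (f ∘ F.S d) y :=
  fun y hy => F.LC_comp_W (u := [d]) (h _ ((F.S_inj d).ne hy))

/-- `f` is constant on pieces avoiding the exceptional point. -/
lemma piece_const (ok : Ok R par) {A : Type} {f : X → A} {p : X} (h : ∀ y, y ≠ p → LC f y)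
    {u : List (Fin 7)} (hp : p ∉ range (F.W u)) (x y : X) : f (F.W u x) = f (F.W u y) := by
  apply F.const_of_LC (f := f ∘ F.W u) ok
  intro x
  exact F.LC_comp_W (h _ fun h' => hp ⟨x, h'⟩)

lemma piece_const_S (ok : Ok R par) {A : Type} {f : X → A} {p : X} (h : ∀ y, y ≠ p → LC f y)
    {d : Fin 7} (hp : p ∉ range (F.S d)) (x y : X) : f (F.S d x) = f (F.S d y) :=
  F.piece_const ok h (u := [d]) hp x y

lemma comp_const (ok : Ok R par) {A : Type} {f : X → A} {p : X} (h : ∀ y, y ≠ p → LC f y)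
    {d : Fin 7} (hp : ∀ e y, F.S e y = p → e = d) {e e' : Fin 7} (he : e ≠ d) (he' : e' ≠ d)
    (hc : cl par d e = cl par d e') (y y' : X) : f (F.S e y) = f (F.S e' y') := by
  have hpc : ∀ e, e ≠ d → ∀ x y, f (F.S e x) = f (F.S e y) := fun e he x y =>
    F.piece_const_S ok h (by rintro ⟨z, hz⟩; exact he (hp e z hz)) x y
  rw [hpc e he y (F.c e), hpc e' he' y' (F.c e')]
  refine cl_const' ok (fun e => f (F.S e (F.c e))) d ?_ e e' he he' hc
  intro e e' a b hR he he'
  show f (F.S e (F.c e)) = f (F.S e' (F.c e'))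
  rw [hpc e he _ (F.c a), F.R_eq ok hR, hpc e' he']

lemma top_exit (ok : Ok R par) {p : X} {d : Fin 7} (hp : ∀ e y, F.S e y = p → e = d)
    {e : Fin 7} (he : e ≠ d) : ∃ a, Mk R d a ∧ cl par d a = cl par d e ∧ F.S d (F.c a) ≠ p ∧
      ∀ (A : Type) (f : X → A), (∀ y, y ≠ p → LC f y) → ∀ y, f (F.S e y) = f (F.S d (F.c a)) := by
  obtain ⟨e', a, b, hR, hc⟩ := ok.conn d e he
  have hee := ok.irr _ _ _ _ hR
  refine ⟨a, ⟨e', b, hR⟩, ?_, ?_, ?_⟩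
  · rw [← show cl par d e' = cl par d e from hc]
    exact ok.star _ _ _ _ hR
  · intro h
    rw [F.R_eq ok hR] at h
    exact hee.1 (hp _ _ h).symm
  · intro A f hf y
    rw [F.R_eq ok hR]
    exact F.comp_const ok hf hp he hee.1.symm hc.symm _ _

lemma exit_of_not_In (ok : Ok R par) (u : List (Fin 7)) (d : Fin 7) (q : X)
    (h : ¬ F.In (u ++ [d]) q) : ∃ b, Ex R d b ∧ q = F.c b := by
  induction u with
  | nil =>
    simp only [List.nil_append, In, and_true, W_nil, not_forall] at h
    obtain ⟨e, y, h1, h2⟩ := h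
    obtain ⟨a, b, h3, h4, h5⟩ := (F.glue e d _ _ h2).1 h1
    exact ⟨b, Or.inl ⟨e, a, ok.symm _ _ _ _ h3⟩, h5⟩
  | cons x u ih =>
    by_cases h0 : F.In (u ++ [d]) q
    · have : ¬ ∀ e y, F.S e y = F.S x (F.W (u ++ [d]) q) → e = x := fun h' => h ⟨h', h0⟩
      simp only [not_forall] at this
      obtain ⟨e, y, h1, h2⟩ := this
      obtain ⟨a, b, h3, h4, h5⟩ := (F.glue e x _ _ h2).1 h1
      have h6 := F.W_eq_c ok h5
      have h7 : d = b := by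
        have : d ∈ u ++ [d] := by simp
        rw [h6.1] at this
        exact List.eq_of_mem_replicate this
      exact ⟨b, Or.inr ⟨h7.symm, x, e, a, ok.symm _ _ _ _ h3⟩, h6.2⟩
    · exact ih h0

/-- Every outside point is connected to an exit. -/
lemma outside (ok : Ok R par) (u : List (Fin 7)) (d : Fin 7) (q : X) (h : F.In (u ++ [d]) q)
    (x : X) (hx : x ∉ range (F.W (u ++ [d]))) : ∃ b, Ex R d b ∧ F.c b ≠ q ∧
      ∀ (A : Type) (f : X → A), (∀ y, y ≠ F.W (u ++ [d]) q → LC f y) →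
        f x = f (F.W (u ++ [d]) (F.c b)) := by
  induction u generalizing x with
  | nil =>
    obtain ⟨e, y, rfl⟩ := F.cover x
    have he : e ≠ d := by rintro rfl; exact hx ⟨y, rfl⟩
    obtain ⟨a, h1, -, h2, h3⟩ := F.top_exit ok (p := F.S d q) h.1 he
    refine ⟨a, Or.inl h1, ?_, fun A f hf => h3 A f hf y⟩
    rintro rfl; exact h2 rfl
  | cons t u ih =>
    obtain ⟨e, y, rfl⟩ := F.cover x
    have step : ∀ y, y ∉ range (F.W (u ++ [d])) → ∃ b, Ex R d b ∧ F.c b ≠ q ∧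
      ∀ (A : Type) (f : X → A), (∀ y, y ≠ F.W (t :: u ++ [d]) q → LC f y) →
        f (F.S t y) = f (F.W (t :: u ++ [d]) (F.c b)) := by
      intro y hy
      obtain ⟨b, h1, h2, h3⟩ := ih h.2 y hy
      exact ⟨b, h1, h2, fun A f hf => h3 A (f ∘ F.S t) (F.LC_off_S hf)⟩
    by_cases he : e = t
    · subst he
      exact step y fun ⟨z, hz⟩ => hx ⟨z, by simp [hz]⟩
    · obtain ⟨a, h1, -, h2, h3⟩ := F.top_exit ok (p := F.W (t :: u ++ [d]) q) h.1 he
      by_cases ha : F.c a ∈ range (F.W (u ++ [d]))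
      · obtain ⟨z, hz⟩ := ha
        have h6 := F.W_eq_c ok hz
        have h7 : d = a := by
          have : d ∈ u ++ [d] := by simp
          rw [h6.1] at this
          exact List.eq_of_mem_replicate this
        have h8 : F.W (t :: u ++ [d]) (F.c a) = F.S t (F.c a) := by
          have h9 := hz
          rw [h6.2] at h9
          simp only [List.cons_append, W_cons, h9]
        refine ⟨a, Or.inr ⟨h7.symm, t, h1⟩, ?_, fun A f hf => ?_⟩
        · rintro rfl; exact h2 h8.symm
        · rw [h3 A f hf, h8]
      · obtain ⟨b, h4, h5, h6⟩ := step _ ha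
        exact ⟨b, h4, h5, fun A f hf => by rw [h3 A f hf, h6 A f hf]⟩

/-- Global structure of functions locally constant off a fixed point. -/
lemma cd_global (ok : Ok R par) {A : Type} {f : X → A} {d : Fin 7}
    (h : ∀ y, y ≠ F.c d → LC f y) {m : ℕ} {e : Fin 7} (he : e ≠ d) (y : X) :
    f (F.W (List.replicate m d) (F.S e y)) = f (F.c (cl par d e)) := by
  have hs : ∀ e y, F.S e y = F.c d → e = d := fun e y h => (F.c_single ok h).1
  induction m generalizing f y e with
  | zero =>
    have : f (F.S e y) = f (F.S e (F.c e)) := F.comp_const ok h hs he he rfl _ _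
    show f (F.S e y) = _
    rw [this]
    have := cl_const ok (fun e => f (F.S e (F.c e))) d (fun e e' a b hR he he' => by
      refine F.comp_const ok h hs he he' ?_ _ _
      exact ok.cl_closed _ _ _ _ _ hR he he') e he
    rw [F.S_c] at this ⊢
    rw [this, F.S_c]
  | succ m ih =>
    have hf1 : ∀ y, y ≠ F.c d → LC (f ∘ F.S d) y :=
      F.LC_off_S (d := d) (q := F.c d) (by rwa [F.S_c])
    have h1 := ih hf1 he y
    rw [List.replicate_succ]
    show (f ∘ F.S d) _ = _
    rw [h1]
    obtain ⟨a, h2, h3, h4, h5⟩ := F.top_exit ok hs he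
    have h6 := ih (f := f) h (e := e) he (y := F.c e)
    have ha : a ≠ d := by
      obtain ⟨_, _, hR⟩ := h2; exact (ok.irr _ _ _ _ hR).2.1
    have h7 : f (F.c e) = f (F.S d (F.c a)) := by
      have := h5 A f h (F.c e); rwa [F.S_c] at this
    have h8 : ∀ e, e ≠ d → cl par d e ≠ d := by
      intro e he
      have : ∀ n, ∀ e, e ≠ d → (par d)^[n] e ≠ d := by
        intro n
        induction n with
        | zero => intro e he; exact he
        | succ n ih => intro e he; rw [Function.iterate_succ_apply]; exact ih _ (ok.par_ne _ _ he)
      exact this 6 e he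
    -- values at fixed points agree with values at representatives
    have h9 : ∀ g : X → A, (∀ y, y ≠ F.c d → LC g y) → ∀ e, e ≠ d → g (F.c e) = g (F.c (cl par d e)) := by
      intro g hg e he
      have := cl_const ok (fun e => g (F.S e (F.c e))) d (fun e e' a b hR he he' => by
        refine F.comp_const ok hg hs he he' ?_ _ _
        exact ok.cl_closed _ _ _ _ _ hR he he') e he
      simpa [F.S_c] using this
    rw [← h9 f h e he, h7]
    have := h9 _ hf1 a ha
    rw [h3] at this
    exact this.symm

lemma exists_digit (ok : Ok R par) {d : Fin 7} {x : X} (hx : x ≠ F.c d) :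
    ∃ m e y, e ≠ d ∧ x = F.W (List.replicate m d) (F.S e y) := by
  obtain ⟨n, hn⟩ := F.exists_not_mem hx
  have hx' := hn (List.replicate n d) (by simp) ⟨_, F.W_rep d n⟩
  clear hn hx
  induction n generalizing x with
  | zero => exact absurd ⟨x, rfl⟩ hx'
  | succ n ih =>
    obtain ⟨e, y, rfl⟩ := F.cover x
    by_cases he : e = d
    · subst he
      obtain ⟨m, e', y', h1, h2⟩ := ih (x := y) (fun ⟨z, hz⟩ => hx' ⟨z, by
        rw [List.replicate_succ]; simp [hz]⟩)
      exact ⟨m + 1, e', y', h1, by rw [List.replicate_succ]; simp [h2]⟩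
    · exact ⟨0, e, y, he, rfl⟩

lemma values_global (ok : Ok R par) {A : Type} [DecidableEq A] {f : X → A} {d : Fin 7}
    (h : ∀ y, y ≠ F.c d → LC f y) : ∃ L : Finset A, L.card ≤ cn par d ∧
      ∀ x, x ≠ F.c d → f x ∈ L := by
  refine ⟨((Finset.univ.filter (· ≠ d)).image (cl par d)).image (fun e => f (F.c e)),
    Finset.card_image_le, fun x hx => ?_⟩
  obtain ⟨m, e, y, he, rfl⟩ := F.exists_digit ok hx
  rw [F.cd_global ok h he]
  exact Finset.mem_image_of_mem (fun e => f (F.c e)) (Finset.mem_image_of_mem _ (by simp [he]))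

lemma small_LC {P : X → Prop} {q : X} {u : ℕ → List (Fin 7)} {x : ℕ → X}
    (hl : ∀ n, (u n).length = n) (hW : ∀ n, F.W (u n) (x n) = q)
    (h : ∀ᶠ x in 𝓝[≠] q, P x) : ∃ N, ∀ n, N ≤ n → ∀ y, y ≠ x n → P (F.W (u n) y) := by
  rw [eventually_nhdsWithin_iff, Metric.eventually_nhds_iff] at h
  obtain ⟨ε, hε, h⟩ := h
  obtain ⟨N, hN⟩ := F.exists_small hε
  refine ⟨N, fun n hn y hy => ?_⟩
  apply h
  · have := hN (u n) (by rw [hl]; exact hn) y (x n)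
    rwa [hW] at this
  · intro h'
    rw [mem_singleton_iff, ← hW n] at h'
    exact hy (F.W_inj _ h')

lemma values_local (ok : Ok R par) {A : Type} [DecidableEq A] {f : X → A} {d : Fin 7}
    (h : ∀ᶠ x in 𝓝[≠] (F.c d), LC f x) : ∃ L : Finset A, L.card ≤ cn par d ∧
      ∀ᶠ x in 𝓝[≠] (F.c d), f x ∈ L := by
  obtain ⟨N, hN⟩ := F.small_LC (u := fun n => List.replicate n d) (x := fun _ => F.c d)
    (fun n => by simp) (fun n => F.W_rep d n) h
  have h1 : ∀ y, y ≠ F.c d → LC (f ∘ F.W (List.replicate N d)) y := fun y hy =>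
    F.LC_comp_W (hN N le_rfl y hy)
  obtain ⟨L, hL, hL'⟩ := F.values_global ok h1
  refine ⟨L, hL, ?_⟩
  have := (F.eventually_W_ne (F.In_rep ok N d) (P := fun x => f x ∈ L)).2
    (eventually_nhdsWithin_iff.2 (Eventually.of_forall hL'))
  rwa [F.W_rep] at this

lemma LS_of_W {k : ℕ} {u : List (Fin 7)} {q : X} (hu : F.In u q) (h : LS k (F.W u q)) : LS k q := by
  obtain ⟨f, h1, h2⟩ := h
  refine ⟨f ∘ F.W u, ?_, fun i => ?_⟩
  · rw [F.eventually_W_ne hu] at h1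
    filter_upwards [h1] with x hx
    exact F.LC_comp_W hx
  · have := h2 i
    rw [Filter.Frequently, F.eventually_W_ne hu] at this
    exact this

lemma LS_single (ok : Ok R par) {k : ℕ} {d : Fin 7} (h : LS k (F.c d)) : k ≤ cn par d := by
  obtain ⟨f, h1, h2⟩ := h
  obtain ⟨L, hL, hL'⟩ := F.values_local ok h1
  have : L = Finset.univ := Finset.eq_univ_of_forall fun i => by
    obtain ⟨x, hx, hx'⟩ := ((h2 i).and_eventually hL').exists
    rwa [hx] at hx'
  rw [this] at hL
  simpa using hL

lemma glue_pieces (ok : Ok R par) {d e a b : Fin 7} (hR : R d e a b) {t : Fin 7} {y : X}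
    (h : F.S t y = F.S d (F.c a)) : (t = d ∧ y = F.c a) ∨ (t = e ∧ y = F.c b) := by
  by_cases htd : t = d
  · subst htd; exact Or.inl ⟨rfl, F.S_inj _ h⟩
  · right
    obtain ⟨a', b', h1, h2, h3⟩ := (F.glue t d _ _ htd).1 h
    obtain rfl := F.c_inj h3
    have := ok.func _ _ _ _ _ _ hR (ok.symm _ _ _ _ h1)
    obtain ⟨rfl, rfl⟩ := this
    exact ⟨rfl, h2⟩

lemma eventually_glue (ok : Ok R par) {d e a b : Fin 7} (hR : R d e a b) {P : X → Prop} :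
    (∀ᶠ z in 𝓝 (F.S d (F.c a)), P z) ↔ (∀ᶠ z in 𝓝 (F.c a), P (F.S d z)) ∧
      (∀ᶠ z in 𝓝 (F.c b), P (F.S e z)) := by
  rw [F.eventually_iff]
  constructor
  · intro h
    exact ⟨h d _ rfl, h e _ (F.R_eq ok hR).symm⟩
  · rintro ⟨h1, h2⟩ t y hy
    rcases F.glue_pieces ok hR hy with ⟨rfl, rfl⟩ | ⟨rfl, rfl⟩
    · exact h1
    · exact h2

lemma eventually_glue_ne (ok : Ok R par) {d e a b : Fin 7} (hR : R d e a b) {P : X → Prop} :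
    (∀ᶠ z in 𝓝[≠] (F.S d (F.c a)), P z) ↔ (∀ᶠ z in 𝓝[≠] (F.c a), P (F.S d z)) ∧
      (∀ᶠ z in 𝓝[≠] (F.c b), P (F.S e z)) := by
  simp only [eventually_nhdsWithin_iff]
  rw [F.eventually_glue ok hR]
  rw [F.R_eq ok hR]
  nth_rw 1 [← F.R_eq ok hR]
  simp [(F.S_inj _).eq_iff]

lemma LS_glue (ok : Ok R par) {k : ℕ} {d e a b : Fin 7} (hR : R d e a b)
    (h : LS k (F.S d (F.c a))) : k ≤ cn par a + cn par b := by
  obtain ⟨f, h1, h2⟩ := h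
  obtain ⟨h3, h4⟩ := (F.eventually_glue_ne ok hR).1 h1
  obtain ⟨L, hL, hL'⟩ := F.values_local (f := f ∘ F.S d) ok
    (h3.mono fun x hx => F.LC_comp_W (u := [d]) hx)
  obtain ⟨M, hM, hM'⟩ := F.values_local (f := f ∘ F.S e) ok
    (h4.mono fun x hx => F.LC_comp_W (u := [e]) hx)
  have h5 : ∀ᶠ z in 𝓝[≠] (F.S d (F.c a)), f z ∈ L ∪ M := (F.eventually_glue_ne ok hR).2
    ⟨hL'.mono fun x hx => Finset.mem_union_left _ hx, hM'.mono fun x hx => Finset.mem_union_right _ hx⟩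
  have : L ∪ M = Finset.univ := Finset.eq_univ_of_forall fun i => by
    obtain ⟨x, hx, hx'⟩ := ((h2 i).and_eventually h5).exists
    rwa [hx] at hx'
  have h6 := Finset.card_union_le L M
  rw [this] at h6
  simp at h6
  omega

end IFS
end FC

set_option linter.unusedSectionVars false
set_option linter.unusedVariables false
namespace FC

open Set Filter Topology

namespace IFS

variable {R : Fin 7 → Fin 7 → Fin 7 → Fin 7 → Prop} {par : Fin 7 → Fin 7 → Fin 7}
  {X : Type} [MetricSpace X] [CompactSpace X] (F : IFS R X)

lemma cl_ne (ok : Ok R par) {d e : Fin 7} (he : e ≠ d) : cl par d e ≠ d := by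
  have : ∀ n, ∀ e, e ≠ d → (par d)^[n] e ≠ d := by
    intro n
    induction n with
    | zero => intro e he; exact he
    | succ n ih => intro e he; rw [Function.iterate_succ_apply]; exact ih _ (ok.par_ne _ _ he)
  exact this 6 e he

noncomputable def dig (x : X) : Fin 7 := (F.cover x).choose
noncomputable def tl (x : X) : X := (F.cover x).choose_spec.choose

lemma dig_tl (x : X) : F.S (F.dig x) (F.tl x) = x := (F.cover x).choose_spec.choose_spec

noncomputable def pre : ℕ → X → List (Fin 7)
  | 0, _ => []
  | n + 1, x => F.dig x :: pre n (F.tl x)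

lemma pre_length (n : ℕ) (x : X) : (F.pre n x).length = n := by
  induction n generalizing x with
  | zero => rfl
  | succ n ih => simp [pre, ih]

lemma W_pre (n : ℕ) (x : X) : F.W (F.pre n x) (F.tl^[n] x) = x := by
  induction n generalizing x with
  | zero => rfl
  | succ n ih => simp [pre, ih, F.dig_tl]

lemma pre_succ (n : ℕ) (x : X) : F.pre (n + 1) x = F.pre n x ++ [F.dig (F.tl^[n] x)] := by
  induction n generalizing x with
  | zero => rfl
  | succ n ih => rw [pre, ih]; rfl

def Sing (x : X) : Prop := ∀ e y, F.S e y = x → e = F.dig x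

lemma In_pre (n : ℕ) (x : X) (h : ∀ m, m < n → F.Sing (F.tl^[m] x)) : F.In (F.pre n x) (F.tl^[n] x) := by
  induction n generalizing x with
  | zero => trivial
  | succ n ih =>
    refine ⟨?_, ?_⟩
    · have := h 0 (by omega)
      rw [Function.iterate_succ_apply, F.W_pre, F.dig_tl]
      exact this
    · exact ih (F.tl x) fun m hm => h (m + 1) (by omega)

lemma not_sing (ok : Ok R par) {x : X} (h : ¬ F.Sing x) :
    ∃ d e a b, R d e a b ∧ x = F.S d (F.c a) := by
  simp only [Sing, not_forall] at h
  obtain ⟨e, y, h1, h2⟩ := h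
  rw [← F.dig_tl x] at h1
  obtain ⟨a, b, h3, h4, h5⟩ := (F.glue _ _ _ _ h2).1 h1
  refine ⟨e, F.dig x, a, b, h3, ?_⟩
  rw [← F.dig_tl x, ← h1, h4]

lemma eq_c_of_dig {x : X} {d : Fin 7} (h : ∀ n, F.dig (F.tl^[n] x) = d) : x = F.c d := by
  by_contra hx
  obtain ⟨n, hn⟩ := F.exists_not_mem hx
  refine hn (List.replicate n d) (by simp) ⟨_, F.W_rep d n⟩ ?_
  have : F.pre n x = List.replicate n d := by
    clear hn hx
    induction n with
    | zero => rfl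
    | succ n ih => rw [pre_succ, ih, h, List.replicate_succ']
  rw [← this]
  exact ⟨_, F.W_pre n x⟩

lemma no_LS3 (ok : Ok R par) (ck : Chk2 R par) {k : ℕ} (hk : 3 ≤ k) {p : X}
    (hs : ∀ n, F.Sing (F.tl^[n] p))
    (hne : ∀ N, ∃ n, N ≤ n ∧ F.dig (F.tl^[n] p) ≠ F.dig (F.tl^[n+1] p)) : ¬ LS k p := by
  rintro ⟨f, h1, h2⟩
  obtain ⟨N, hN⟩ := F.small_LC (u := fun n => F.pre n p) (x := fun n => F.tl^[n] p)
    (fun n => F.pre_length n p) (fun n => F.W_pre n p) h1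
  have hN := hN N le_rfl
  set x := F.tl^[N] p with hx
  have hIn := F.In_pre N p (fun m _ => hs m)
  set g := f ∘ F.W (F.pre N p) with hg
  have hgL : ∀ y, y ≠ x → LC g y := fun y hy => F.LC_comp_W (hN y hy)
  have hsx : ∀ n, F.Sing (F.tl^[n] x) := fun n => by
    rw [hx, ← Function.iterate_add_apply]; exact hs _
  have hz : ∀ i, ∃ z, z ≠ x ∧ g z = i := by
    intro i
    have := h2 i
    rw [← F.W_pre N p, Filter.Frequently, F.eventually_W_ne hIn] at this
    have : ∃ᶠ y in 𝓝[≠] x, g y = i := this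
    obtain ⟨z, h3, h4⟩ := (this.and_eventually self_mem_nhdsWithin).exists
    exact ⟨z, h4, h3⟩
  choose z hzx hzg using hz
  choose M hM using fun i => F.exists_not_mem (hzx i)
  obtain ⟨n, hn, hd⟩ := hne (N + ∑ i, M i)
  obtain ⟨n, rfl⟩ : ∃ m, n = m + N := ⟨n - N, by omega⟩
  have hnM : ∀ i, M i ≤ n + 1 := fun i => by
    have := Finset.single_le_sum (f := M) (fun j _ => Nat.zero_le _) (Finset.mem_univ i)
    omega
  rw [show n + N + 1 = (n + 1) + N by ring, Function.iterate_add_apply, Function.iterate_add_apply _ (n+1), ← hx] at hd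
  set d := F.dig (F.tl^[n] x) with hdd
  set q := F.tl^[n+1] x with hq
  have hIn' := F.In_pre (n+1) x (fun m _ => hsx m)
  have hWq : F.W (F.pre n x ++ [d]) q = x := by rw [hdd, ← pre_succ, F.W_pre]
  have hout : ∀ i, ∃ b, Ex R d b ∧ F.c b ≠ q ∧ g (z i) = g (F.W (F.pre n x ++ [d]) (F.c b)) := by
    intro i
    obtain ⟨b, h3, h4, h5⟩ := F.outside ok (F.pre n x) d q (by rw [hdd, ← pre_succ]; exact hIn') (z i) (by
      rw [hdd, ← pre_succ]
      exact hM i _ (by rw [F.pre_length]; exact hnM i) ⟨_, F.W_pre _ _⟩)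
    exact ⟨b, h3, h4, h5 _ g (by rw [hWq]; exact hgL)⟩
  choose b hb1 hb2 hb3 using hout
  obtain ⟨k₁, k₂, hkk⟩ := ck d (F.dig q) hd
  have hh : ∀ y, y ≠ q → LC (g ∘ F.W (F.pre n x ++ [d])) y := F.LC_off_W (by rw [hWq]; exact hgL)
  have same : ∀ i j, (if b i = F.dig q then F.dig q else cl par (F.dig q) (b i)) =
      (if b j = F.dig q then F.dig q else cl par (F.dig q) (b j)) → i = j := by
    intro i j hij
    rw [← hzg i, ← hzg j, hb3, hb3]
    split_ifs at hij with h5 h6 h6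
    · rw [h5, h6]
    · exact absurd hij.symm (cl_ne ok h6)
    · exact absurd hij (cl_ne ok h5)
    · have := F.comp_const ok hh (hsx (n+1)) h5 h6 hij (F.c (b i)) (F.c (b j))
      rw [F.S_c, F.S_c] at this
      exact this
  have e0 := hkk (b ⟨0, by omega⟩) (hb1 _)
  have e1 := hkk (b ⟨1, by omega⟩) (hb1 _)
  have e2 := hkk (b ⟨2, by omega⟩) (hb1 _)
  have s01 := same ⟨0, by omega⟩ ⟨1, by omega⟩
  have s02 := same ⟨0, by omega⟩ ⟨2, by omega⟩
  have s12 := same ⟨1, by omega⟩ ⟨2, by omega⟩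
  simp only [Fin.mk.injEq] at s01 s02 s12
  rcases e0 with e0 | e0 <;> rcases e1 with e1 | e1 <;> rcases e2 with e2 | e2 <;>
    first
    | exact absurd (s01 (e0.trans e1.symm)) (by norm_num)
    | exact absurd (s02 (e0.trans e2.symm)) (by norm_num)
    | exact absurd (s12 (e1.trans e2.symm)) (by norm_num)

lemma LS3_loc (ok : Ok R par) (ck : Chk2 R par) {k : ℕ} (hk : 3 ≤ k) {p : X} (h : LS k p) :
    (∃ w d, F.In w (F.c d) ∧ p = F.W w (F.c d) ∧ k ≤ cn par d) ∨
    (∃ w d e a b, R d e a b ∧ F.In w (F.S d (F.c a)) ∧ p = F.W w (F.S d (F.c a)) ∧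
      k ≤ cn par a + cn par b) := by
  by_cases hs : ∀ n, F.Sing (F.tl^[n] p)
  · left
    by_cases hne : ∀ N, ∃ n, N ≤ n ∧ F.dig (F.tl^[n] p) ≠ F.dig (F.tl^[n+1] p)
    · exact absurd h (F.no_LS3 ok ck hk hs hne)
    push Not at hne
    obtain ⟨N, hN⟩ := hne
    have h1 : ∀ n, F.dig (F.tl^[n] (F.tl^[N] p)) = F.dig (F.tl^[N] p) := by
      intro n
      induction n with
      | zero => rfl
      | succ n ih =>
        rw [← ih, ← Function.iterate_add_apply, ← Function.iterate_add_apply]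
        have := hN (n + N) (by omega)
        rw [this]
        congr 2
        omega
    have h2 := F.eq_c_of_dig h1
    have hIn := F.In_pre N p (fun m _ => hs m)
    have hW := F.W_pre N p
    rw [h2] at hIn hW
    refine ⟨_, _, hIn, hW.symm, ?_⟩
    rw [← hW] at h
    exact F.LS_single ok (F.LS_of_W hIn h)
  · right
    push Not at hs
    classical
    have hIn := F.In_pre (Nat.find hs) p (fun m hm => by
      have := Nat.find_min hs hm; push Not at this; exact this)
    obtain ⟨d, e, a, b, hR, hx⟩ := F.not_sing ok (Nat.find_spec hs)
    have hW := F.W_pre (Nat.find hs) p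
    rw [hx] at hIn hW
    refine ⟨_, d, e, a, b, hR, hIn, hW.symm, ?_⟩
    rw [← hW] at h
    exact F.LS_glue ok hR (F.LS_of_W hIn h)

end IFS
end FC

set_option linter.unusedSectionVars false
set_option linter.unusedVariables false
namespace FC

open Set Filter Topology

lemma LS_of_inj {X : Type} [TopologicalSpace X] {A : Type} {k : ℕ} (hk : 0 < k) {p : X} (f : X → A)
    (hf : ∀ᶠ x in 𝓝[≠] p, LC f x) (g : Fin k → A) (hg : Function.Injective g)
    (h : ∀ i, ∃ᶠ x in 𝓝[≠] p, f x = g i) : LS k p := by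
  have : Nonempty (Fin k) := ⟨⟨0, hk⟩⟩
  refine ⟨Function.invFun g ∘ f, hf.mono fun x hx => ?_, fun i => (h i).mono fun x hx => ?_⟩
  · exact hx.mono fun y hy => by simp [hy]
  · simp [hx, Function.leftInverse_invFun hg i]

lemma LS_mono {X : Type} [TopologicalSpace X] {j k : ℕ} (hj : 0 < j) (hjk : j ≤ k) {p : X}
    (h : LS k p) : LS j p := by
  obtain ⟨f, h1, h2⟩ := h
  exact LS_of_inj hj f h1 (Fin.castLE hjk) (Fin.castLE_injective hjk) fun i => h2 _

namespace IFS

variable {R : Fin 7 → Fin 7 → Fin 7 → Fin 7 → Prop} {par : Fin 7 → Fin 7 → Fin 7}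
  {X : Type} [MetricSpace X] [CompactSpace X] (F : IFS R X)

/-- glueing of functions on the pieces -/
noncomputable def ext {A : Type} (f : Fin 7 → X → A) (x : X) : A := f (F.dig x) (F.tl x)

lemma ext_S {A : Type} {f : Fin 7 → X → A} {e : Fin 7} {y : X}
    (h : ∀ d a b, R d e a b → F.S e y = F.S d (F.c a) → f d (F.c a) = f e (F.c b)) :
    F.ext f (F.S e y) = f e y := by
  unfold ext
  by_cases he : F.dig (F.S e y) = e
  · have := F.dig_tl (F.S e y)
    rw [he] at this ⊢
    rw [F.S_inj e this]
  · obtain ⟨a, b, h3, h4, h5⟩ := (F.glue _ _ _ _ he).1 (F.dig_tl (F.S e y))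
    have := h _ _ _ h3 (by rw [← h4]; exact (F.dig_tl _).symm)
    rw [← h4, ← h5] at this
    exact this

lemma ext_LC {A : Type} {f : Fin 7 → X → A} {P : Set X} (hP : IsClosed P)
    (h : ∀ d e a b, R d e a b → F.S d (F.c a) ∉ P → f d (F.c a) = f e (F.c b)) {x : X} (hx : x ∉ P)
    (hf : ∀ t z, F.S t z = x → LC (f t) z) : LC (F.ext f) x := by
  rw [F.LC_iff]
  rintro t z rfl
  have h1 : ∀ᶠ z' in 𝓝 z, F.S t z' ∉ P := (F.S_cont t).continuousAt (hP.isOpen_compl.mem_nhds hx)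
  have h2 : ∀ z', F.S t z' ∉ P → F.ext f (F.S t z') = f t z' := fun z' hz' =>
    F.ext_S fun d a b hR he => h d t a b hR (by rwa [← he])
  filter_upwards [h1, hf t z rfl] with z' h3 h4
  show F.ext f (F.S t z') = F.ext f (F.S t z)
  rw [h2 z' h3, h2 z hx, h4]

/-- the set of top level glue points -/
def GP : Set X := {x | ∃ d e a b, R d e a b ∧ x = F.S d (F.c a)}

lemma GP_finite : F.GP.Finite := by
  apply (Set.finite_range (fun z : Fin 7 × Fin 7 => F.S z.1 (F.c z.2))).subset
  rintro x ⟨d, e, a, b, h, rfl⟩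
  exact ⟨(d, a), rfl⟩

lemma GP_ne (p : X) : ∀ᶠ x in 𝓝[≠] p, x ∉ F.GP := by
  have h : IsClosed (F.GP \ {p}) := (F.GP_finite.subset sdiff_subset).isClosed
  rw [eventually_nhdsWithin_iff]
  filter_upwards [h.isOpen_compl.mem_nhds (x := p) (by simp)] with x hx hxp hx'
  exact hx ⟨hx', hxp⟩

lemma loc_ext {A : Type} {f : Fin 7 → X → A} {p : X}
    (hf : ∀ t y, F.S t y = p → ∀ᶠ z in 𝓝[≠] y, LC (f t) z) : ∀ᶠ x in 𝓝[≠] p, LC (F.ext f) x := by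
  have key : ∀ᶠ x in 𝓝[≠] p, ∀ t z, F.S t z = x → LC (f t) z := by
    rw [eventually_nhdsWithin_iff, F.eventually_iff]
    rintro t y hy
    subst hy
    -- near p every single point
    have h1 := F.GP_ne (F.S t y)
    rw [eventually_nhdsWithin_iff] at h1
    have h2 := (F.eventually_iff.1 h1) t y rfl
    have h3 := hf t y rfl
    rw [eventually_nhdsWithin_iff] at h3
    filter_upwards [h2, h3] with z h4 h5 hz t' z' hz'
    have h6 := h4 hz
    have : t' = t := by
      by_contra hne
      obtain ⟨a, b, h7, h8, h9⟩ := (F.glue _ _ _ _ hne).1 hz'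
      exact h6 ⟨t', t, a, b, h7, by rw [← hz', h8]⟩
    subst this
    obtain rfl := F.S_inj _ hz'
    exact h5 (fun h => hz (by rw [mem_singleton_iff] at h ⊢; rw [h]))
  filter_upwards [F.GP_ne p, key] with x h1 h2
  exact F.ext_LC F.GP_finite.isClosed (fun d e a b hR h => absurd ⟨d, e, a, b, hR, rfl⟩ h) h1 h2

lemma freq_S {P : X → Prop} {d : Fin 7} {p : X} (h : ∃ᶠ z in 𝓝[≠] p, P (F.S d z)) :
    ∃ᶠ x in 𝓝[≠] (F.S d p), P x := by
  intro h'
  apply h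
  rw [eventually_nhdsWithin_iff] at h' ⊢
  filter_upwards [(F.eventually_iff.1 h') d p rfl] with z hz hzp
  exact hz fun h => hzp (F.S_inj d h)

lemma loc_ext_freq {A : Type} {f : Fin 7 → X → A} {d : Fin 7} {p : X} {i : A}
    (h : ∃ᶠ z in 𝓝[≠] p, f d z = i) : ∃ᶠ x in 𝓝[≠] (F.S d p), F.ext f x = i := by
  apply F.freq_S
  have h1 := F.GP_ne (F.S d p)
  rw [eventually_nhdsWithin_iff] at h1
  have h2 := (F.eventually_iff.1 h1) d p rfl
  have h3 : ∀ᶠ z in 𝓝[≠] p, F.S d z ∉ F.GP := by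
    rw [eventually_nhdsWithin_iff]
    filter_upwards [h2] with z hz hzp
    exact hz fun h => hzp (F.S_inj d h)
  refine (h.and_eventually h3).mono fun z hz => ?_
  rw [F.ext_S, hz.1]
  intro d' a b hR he
  exact absurd ⟨d', d, a, b, hR, he⟩ hz.2

lemma LS_S {k : ℕ} {p : X} (h : LS k p) (d : Fin 7) : LS k (F.S d p) := by
  obtain ⟨f, h1, h2⟩ := h
  refine ⟨F.ext (fun t x => if t = d then f x else f p), F.loc_ext ?_, fun i => F.loc_ext_freq ?_⟩
  · intro t y hy
    by_cases ht : t = d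
    · subst ht; obtain rfl := F.S_inj _ hy; simpa using h1
    · simp only [ht, if_false]
      exact Eventually.of_forall fun z => Eventually.of_forall fun z => rfl
  · simpa using h2 i

lemma LS_W {k : ℕ} {p : X} (h : LS k p) (w : List (Fin 7)) : LS k (F.W w p) := by
  induction w with
  | nil => exact h
  | cons d w ih => exact F.LS_S ih d

lemma lab_wd (ok : Ok R par) {d e e' : Fin 7} {m m' : ℕ} {y y' : X} (he : e ≠ d) (he' : e' ≠ d)
    (h : F.W (List.replicate m d) (F.S e y) = F.W (List.replicate m' d) (F.S e' y')) :
    cl par d e = cl par d e' := by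
  have key : ∀ k (e e' : Fin 7) (y y' : X), e ≠ d → e' ≠ d →
      F.S e y = F.W (List.replicate k d) (F.S e' y') → cl par d e = cl par d e' := by
    intro k e e' y y' he he' h
    cases k with
    | zero =>
      by_cases hee : e = e'
      · rw [hee]
      · obtain ⟨a, b, h1, h2, h3⟩ := (F.glue _ _ _ _ hee).1 h
        exact ok.cl_closed _ _ _ _ _ h1 he he'
    | succ k =>
      rw [List.replicate_succ, W_cons] at h
      obtain ⟨a, b, h1, h2, h3⟩ := (F.glue _ _ _ _ he).1 h
      have hb := (ok.irr _ _ _ _ h1).2.2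
      have h4 := F.W_eq_c ok h3
      have h5 : e' = b := (F.c_single ok h4.2).1
      have := ok.star _ _ _ _ (ok.symm _ _ _ _ h1)
      rw [h5]; exact this.symm
  induction m generalizing m' with
  | zero => exact key m' e e' y y' he he' h
  | succ m ih =>
    cases m' with
    | zero => exact (key (m+1) e' e y' y he' he h.symm).symm
    | succ m' =>
      rw [List.replicate_succ, List.replicate_succ] at h
      exact ih (F.S_inj _ h)

open Classical in
/-- the label function at `c d` -/
noncomputable def lab (par : Fin 7 → Fin 7 → Fin 7) (d : Fin 7) (x : X) : Fin 7 :=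
  if h : ∃ e, e ≠ d ∧ ∃ m y, x = F.W (List.replicate m d) (F.S e y) then cl par d h.choose else d

lemma lab_W (ok : Ok R par) {d e : Fin 7} (he : e ≠ d) (m : ℕ) (y : X) :
    F.lab par d (F.W (List.replicate m d) (F.S e y)) = cl par d e := by
  have h : ∃ e', e' ≠ d ∧ ∃ m' y', F.W (List.replicate m d) (F.S e y) =
    F.W (List.replicate m' d) (F.S e' y') := ⟨e, he, m, y, rfl⟩
  unfold lab
  rw [dif_pos h]
  obtain ⟨h1, m', y', h2⟩ := h.choose_spec
  exact (F.lab_wd ok he h1 h2).symm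

lemma lab_S (ok : Ok R par) {d e : Fin 7} (he : e ≠ d) (y : X) :
    F.lab par d (F.S e y) = cl par d e := F.lab_W ok he 0 y

lemma lab_c (ok : Ok R par) {d e : Fin 7} (he : e ≠ d) :
    F.lab par d (F.c e) = cl par d e := by rw [← F.S_c e]; exact F.lab_S ok he _

lemma lab_Sd (ok : Ok R par) {d : Fin 7} {x : X} (hx : x ≠ F.c d) :
    F.lab par d (F.S d x) = F.lab par d x := by
  obtain ⟨m, e, y, he, rfl⟩ := F.exists_digit ok hx
  rw [F.lab_W ok he]
  exact F.lab_W ok he (m+1) y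

lemma lab_LC (ok : Ok R par) {d : Fin 7} {x : X} (hx : x ≠ F.c d) : LC (F.lab par d) x := by
  obtain ⟨n, hn⟩ := F.exists_not_mem hx
  have hx' := hn (List.replicate n d) (by simp) ⟨_, F.W_rep d n⟩
  clear hn hx
  induction n generalizing x with
  | zero => exact absurd ⟨x, rfl⟩ hx'
  | succ n ih =>
    rw [F.LC_iff]
    rintro t z rfl
    by_cases ht : t = d
    · subst ht
      have hz : z ∉ range (F.W (List.replicate n t)) := by
        rintro ⟨y, rfl⟩
        exact hx' ⟨y, by rw [List.replicate_succ]; rfl⟩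
      have hzc : z ≠ F.c t := by rintro rfl; exact hz ⟨_, F.W_rep t n⟩
      filter_upwards [ih hz, isOpen_compl_singleton.mem_nhds hzc] with y hy hyc
      show F.lab par t (F.S t y) = F.lab par t (F.S t z)
      rw [F.lab_Sd ok hyc, F.lab_Sd ok hzc, hy]
    · exact Eventually.of_forall fun y => by
        show F.lab par d (F.S t y) = F.lab par d (F.S t z)
        rw [F.lab_S ok ht, F.lab_S ok ht]

lemma lab_freq (ok : Ok R par) {d e : Fin 7} (he : e ≠ d) :
    ∃ᶠ x in 𝓝[≠] (F.c d), F.lab par d x = cl par d e := by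
  intro h
  obtain ⟨N, hN⟩ := F.small_LC (u := fun n => List.replicate n d) (x := fun _ => F.c d)
    (fun n => by simp) (fun n => F.W_rep d n) h
  exact hN N le_rfl (F.S e (F.c e)) (by rw [F.S_c]; exact F.c_inj.ne he) (F.lab_W ok he N _)

/-- labels as injections -/
lemma exists_labels (par : Fin 7 → Fin 7 → Fin 7) (d : Fin 7) {k : ℕ} (hk : k ≤ cn par d) : ∃ g : Fin k → Fin 7,
    Function.Injective g ∧ ∀ i, ∃ e, e ≠ d ∧ cl par d e = g i := by
  obtain ⟨g⟩ := (Function.Embedding.nonempty_iff_card_le (α := Fin k)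
    (β := ((Finset.univ.filter (· ≠ d)).image (cl par d)))).2 (by
      rw [Fintype.card_fin, Fintype.card_coe]; exact hk)
  refine ⟨fun i => (g i).1, fun i j h => g.injective (Subtype.ext h), fun i => ?_⟩
  have := (g i).2
  simp only [Finset.mem_image, Finset.mem_filter, Finset.mem_univ, true_and] at this
  exact this

lemma LS_c (ok : Ok R par) {d : Fin 7} {k : ℕ} (hk0 : 0 < k) (hk : k ≤ cn par d) :
    LS k (F.c d) := by
  obtain ⟨g, hg, hg'⟩ := exists_labels par d hk
  refine LS_of_inj hk0 (F.lab par d) (eventually_nhdsWithin_iff.2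
    (Eventually.of_forall fun x hx => F.lab_LC ok hx)) g hg fun i => ?_
  obtain ⟨e, he, h⟩ := hg' i
  rw [← h]
  exact F.lab_freq ok he

lemma Split_c (ok : Ok R par) {d : Fin 7} {k : ℕ} (hk0 : 0 < k) (hk : k ≤ cn par d) :
    Split k (F.c d) := by
  obtain ⟨g, hg, hg'⟩ := exists_labels par d hk
  have : Nonempty (Fin k) := ⟨⟨0, hk0⟩⟩
  refine ⟨Function.invFun g ∘ F.lab par d, fun x hx => ?_, fun i => ?_⟩
  · exact (F.lab_LC ok hx).mono fun y hy => by simp [hy]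
  · obtain ⟨e, he, h⟩ := hg' i
    exact ⟨F.c e, F.c_inj.ne he, by simp [F.lab_c ok he, h, Function.leftInverse_invFun hg i]⟩

lemma LS_glue_of (ok : Ok R par) {d e a b : Fin 7} (hR : R d e a b) {k : ℕ} (hk0 : 0 < k)
    (hk : k ≤ cn par a + cn par b) : LS k (F.S d (F.c a)) := by
  obtain ⟨g, hg, hg'⟩ := exists_labels par a le_rfl
  obtain ⟨g', hg1, hg1'⟩ := exists_labels par b le_rfl
  refine LS_mono hk0 hk ?_
  have hde := (ok.irr _ _ _ _ hR).1
  have hinj : Function.Injective (Sum.map g g') := Sum.map_injective.2 ⟨hg, hg1⟩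
  refine LS_of_inj (by omega) (F.ext (fun t x => if t = d then Sum.inl (F.lab par a x) else
    Sum.inr (F.lab par b x))) (F.loc_ext ?_) (Sum.map g g' ∘ finSumFinEquiv.symm)
    (hinj.comp finSumFinEquiv.symm.injective) ?_
  · intro t y hy
    rcases F.glue_pieces ok hR hy with ⟨rfl, rfl⟩ | ⟨rfl, rfl⟩
    · refine eventually_nhdsWithin_iff.2 (Eventually.of_forall fun x hx => ?_)
      exact (F.lab_LC (par := par) ok hx).mono fun y hy => by simp [hy]
    · refine eventually_nhdsWithin_iff.2 (Eventually.of_forall fun x hx => ?_)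
      exact (F.lab_LC (par := par) ok hx).mono fun y hy => by simp [hy, hde.symm]
  · intro i
    obtain ⟨j, rfl⟩ := finSumFinEquiv.surjective i
    rw [Function.comp_apply, Equiv.symm_apply_apply]
    rcases j with j | j
    · apply F.loc_ext_freq
      obtain ⟨e, he, h⟩ := hg' j
      refine (F.lab_freq ok he).mono fun x hx => ?_
      simp [hx, h]
    · rw [F.R_eq ok hR]
      apply F.loc_ext_freq
      obtain ⟨e, he, h⟩ := hg1' j
      refine (F.lab_freq ok he).mono fun x hx => ?_
      simp [hx, h, hde.symm]

end IFS
end FC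

set_option linter.unusedSectionVars false
set_option linter.unusedVariables false
namespace FC

open Set Filter Topology

/-- glue tables of the 12 classes: the entry `deab` means `d.a = e.b`. -/
def tb : Fin 12 → List ℕ := ![
  [120, 340, 560, 1002, 1220, 1342, 1562, 2102, 3004, 3124, 3440, 3564, 4304, 5006, 5126, 5346, 5660, 6506],
  [120, 340, 1002, 1220, 1342, 1560, 2102, 2562, 3004, 3124, 3440, 4304, 5106, 5226, 5662, 6526],
  [120, 340, 1002, 1220, 1342, 1561, 2102, 3004, 3124, 3440, 4304, 5116, 5661, 6516],
  [120, 460, 1002, 1220, 1462, 2102, 3453, 4006, 4126, 4335, 4553, 4660, 5435, 6406],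
  [120, 1002, 1220, 1461, 2102, 3453, 4116, 4335, 4553, 4661, 5435, 6416],
  [120, 1002, 1220, 1341, 1561, 2102, 3114, 3441, 3564, 4314, 5116, 5346, 5661, 6516],
  [120, 1002, 1220, 1341, 2102, 3114, 3441, 3561, 4314, 4564, 5316, 5446, 5664, 6546],
  [120, 1002, 1220, 1341, 2102, 3114, 3441, 3563, 4314, 5336, 5663, 6536],
  [142, 251, 360, 1024, 1351, 1460, 2015, 2342, 2560, 3006, 3115, 3224, 3442, 3551, 3660, 4106, 4324, 4651, 5206, 5315, 5642, 6306, 6415, 6524],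
  [360, 1351, 2342, 3006, 3115, 3224, 3442, 3551, 3660, 4324, 5315, 6306],
  [240, 1231, 2004, 2113, 2331, 2440, 2562, 3213, 4204, 5226, 5662, 6526],
  [120, 1002, 1220, 1351, 2102, 3115, 3551, 4564, 5315, 5446, 5664, 6546]]

/-- parent tables -/
def pt : Fin 12 → Fin 7 → ℕ := ![
  ![5131110, 5030210, 5030200, 5043100, 5040100, 6530100, 6030100],
  ![5131110, 5230210, 5130200, 5143100, 5140100, 6530100, 6130100],
  ![5131110, 5530210, 5130200, 5143100, 5140100, 6530100, 6130100],
  ![4414110, 4404210, 4404200, 4403100, 6543100, 4504100, 6404100],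
  ![4414110, 4433210, 4414200, 4413100, 6543100, 4514100, 6414100],
  ![5131110, 5333210, 5131200, 5143100, 5141100, 6531100, 6131100],
  ![5331110, 5333210, 5331200, 5443100, 5341100, 6531100, 6331100],
  ![5331110, 5333210, 5331200, 5543100, 5341100, 6531100, 6331100],
  ![3311310, 3230010, 3310200, 4213000, 3240000, 3510000, 6210000],
  ![3331310, 3330310, 3330230, 6543210, 3340330, 3530330, 6330330],
  ![5222110, 5222010, 5543210, 5223020, 5242020, 6522020, 6222020],
  ![5351110, 5353210, 5351200, 5443100, 5341100, 6541100, 6351100]]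

def Rt (i : Fin 12) (d e a b : Fin 7) : Prop :=
  d.val * 1000 + e.val * 100 + a.val * 10 + b.val ∈ tb i

instance (i : Fin 12) (d e a b : Fin 7) : Decidable (Rt i d e a b) := by unfold Rt; infer_instance

def parT (i : Fin 12) (d e : Fin 7) : Fin 7 := Fin.ofNat 7 ((pt i d / 10 ^ e.val) % 10)

/-- decoding of table entries -/
def dc (n : ℕ) : Fin 7 × Fin 7 × Fin 7 × Fin 7 :=
  (Fin.ofNat 7 (n / 1000), Fin.ofNat 7 (n / 100 % 10), Fin.ofNat 7 (n / 10 % 10), Fin.ofNat 7 (n % 10))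

lemma dc_eq (d e a b : Fin 7) : dc (d.val * 1000 + e.val * 100 + a.val * 10 + b.val) = (d, e, a, b) := by
  unfold dc
  have h1 := d.2; have h2 := e.2; have h3 := a.2; have h4 := b.2
  ext <;> simp [Fin.ofNat] <;> omega

lemma Rt_all (i : Fin 12) {P : Fin 7 → Fin 7 → Fin 7 → Fin 7 → Prop}
    (h : ∀ n ∈ tb i, P (dc n).1 (dc n).2.1 (dc n).2.2.1 (dc n).2.2.2) :
    ∀ d e a b, Rt i d e a b → P d e a b := by
  intro d e a b hR
  have := h _ hR
  rwa [dc_eq] at this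

lemma okT (i : Fin 12) : Ok (Rt i) (parT i) where
  irr := Rt_all i (by revert i; decide +kernel)
  symm := Rt_all i (P := fun d e a b => Rt i e d b a) (by revert i; decide +kernel)
  func := by
    intro d e e' a b b' h h'
    have h1 := Rt_all i (P := fun d e a b => ∀ n ∈ tb i, (dc n).1 = d → (dc n).2.2.1 = a →
      e = (dc n).2.1 ∧ b = (dc n).2.2.2) (by clear h h'; revert i; decide +kernel) d e a b h _ h'
    rw [dc_eq] at h1
    exact h1 rfl rfl
  par_ne := by revert i; decide +kernel
  par_adj := by
    intro d e he
    have h : parT i d e = e ∨ ∃ n ∈ tb i, Rt i (dc n).1 (dc n).2.1 (dc n).2.2.1 (dc n).2.2.2 ∧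
        (dc n).1 = e ∧ (dc n).2.1 = parT i d e := by
      revert he e d i; decide +kernel
    rcases h with h | ⟨n, -, h, rfl, h'⟩
    · exact Or.inl h
    · exact Or.inr ⟨_, _, by rw [← h']; exact h⟩
  cl_closed := by
    intro d
    exact Rt_all i (P := fun e e' a b => e ≠ d → e' ≠ d → (parT i d)^[6] e = (parT i d)^[6] e')
      (by revert d i; decide +kernel)
  star := Rt_all i (P := fun d e a b => (parT i d)^[6] a = (parT i d)^[6] e)
      (by revert i; decide +kernel)
  conn := by
    intro d e he
    have h : ∃ n ∈ tb i, (dc n).1 = d ∧ Rt i (dc n).1 (dc n).2.1 (dc n).2.2.1 (dc n).2.2.2 ∧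
      (parT i d)^[6] (dc n).2.1 = (parT i d)^[6] e := by
      revert he e d i; decide +kernel
    obtain ⟨n, hn, rfl, h2, h3⟩ := h
    exact ⟨_, _, _, h2, h3⟩

lemma Rt_dc (i : Fin 12) : ∀ n ∈ tb i, Rt i (dc n).1 (dc n).2.1 (dc n).2.2.1 (dc n).2.2.2 := by
  revert i; decide +kernel

lemma Mk_iff (i : Fin 12) (d a : Fin 7) : Mk (Rt i) d a ↔ ∃ n ∈ tb i, (dc n).1 = d ∧ (dc n).2.2.1 = a := by
  constructor
  · rintro ⟨e, b, h⟩
    exact ⟨_, h, by rw [dc_eq], by rw [dc_eq]⟩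
  · rintro ⟨n, h, rfl, rfl⟩
    exact ⟨_, _, Rt_dc i n h⟩

instance (i : Fin 12) (d a : Fin 7) : Decidable (Mk (Rt i) d a) := decidable_of_iff' _ (Mk_iff i d a)
instance (i : Fin 12) (d a : Fin 7) : Decidable (Ex (Rt i) d a) := by unfold Ex; infer_instance

lemma ckT (i : Fin 12) : Chk2 (Rt i) (parT i) := by
  have key : ∀ d d', d ≠ d' → ∃ k₁ k₂, ∀ b, (if b = d' then d' else cl (parT i) d' b) = k₁ ∨
      (if b = d' then d' else cl (parT i) d' b) = k₂ ∨ ¬ Ex (Rt i) d b := by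
    revert i; decide +kernel
  intro d d' h
  obtain ⟨k₁, k₂, hk⟩ := key d d' h
  exact ⟨k₁, k₂, fun b hb => by rcases hk b with h | h | h; exacts [Or.inl h, Or.inr h, absurd hb h]⟩

/-- the list of `cn` -/
def cnL (i : Fin 12) (d : Fin 7) : ℕ := cn (parT i) d

end FC

set_option linter.unusedSectionVars false
set_option linter.unusedVariables false
namespace FC

open Set Filter Topology

section inv
variable {X Y : Type} [TopologicalSpace X] [TopologicalSpace Y] (φ : X ≃ₜ Y)

lemma LC_homeo {A : Type} {f : X → A} {x : X} (h : LC f x) : LC (f ∘ φ.symm) (φ x) := by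
  have : Tendsto φ.symm (𝓝 (φ x)) (𝓝 x) := by
    have := φ.symm.continuous.tendsto (φ x)
    rwa [φ.symm_apply_apply] at this
  filter_upwards [this h] with y hy
  have hy : f (φ.symm y) = f x := hy
  simp [hy]

lemma tendsto_ne (x : X) : Tendsto φ.symm (𝓝[≠] (φ x)) (𝓝[≠] x) := by
  rw [tendsto_nhdsWithin_iff]
  refine ⟨?_, ?_⟩
  · have := φ.symm.continuous.tendsto (φ x)
    rw [φ.symm_apply_apply] at this
    exact this.mono_left nhdsWithin_le_nhds
  · filter_upwards [self_mem_nhdsWithin] with y hy h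
    apply hy
    rw [mem_singleton_iff] at h ⊢
    rw [← h, φ.apply_symm_apply]

lemma LS_homeo {k : ℕ} {p : X} (h : LS k p) : LS k (φ p) := by
  obtain ⟨f, h1, h2⟩ := h
  refine ⟨f ∘ φ.symm, ?_, fun i h => ?_⟩
  · filter_upwards [(tendsto_ne φ p).eventually h1] with y hy
    have := LC_homeo φ hy
    rwa [φ.apply_symm_apply] at this
  · apply h2 i
    have := tendsto_ne φ.symm (φ p)
    rw [φ.symm_apply_apply, φ.symm_symm] at this
    filter_upwards [this.eventually h] with x hx
    simpa using hx

lemma LS_homeo' {k : ℕ} {p : X} (h : LS k (φ p)) : LS k p := by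
  simpa using LS_homeo φ.symm h

lemma LC_off_homeo {A : Type} {f : X → A} {p : X} (h : ∀ x, x ≠ p → LC f x) :
    ∀ y, y ≠ φ p → LC (f ∘ φ.symm) y := by
  intro y hy
  have := LC_homeo φ (h (φ.symm y) fun h' => hy (by rw [← h', φ.apply_symm_apply]))
  rwa [φ.apply_symm_apply] at this

lemma Split_homeo {k : ℕ} {p : X} (h : Split k p) : Split k (φ p) := by
  obtain ⟨f, h1, h2⟩ := h
  refine ⟨f ∘ φ.symm, LC_off_homeo φ h1, fun i => ?_⟩
  obtain ⟨x, hx, hx'⟩ := h2 i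
  exact ⟨φ x, φ.injective.ne hx, by simpa using hx'⟩

lemma Split_homeo' {k : ℕ} {p : X} (h : Split k (φ p)) : Split k p := by
  simpa using Split_homeo φ.symm h

lemma Sep_homeo {r p q : X} (h : Sep r p q) : Sep (φ r) (φ p) (φ q) := by
  obtain ⟨h1, h2, f, h3, h4⟩ := h
  exact ⟨φ.injective.ne h1, φ.injective.ne h2, f ∘ φ.symm, LC_off_homeo φ h3, by simpa using h4⟩

lemma Sep_homeo' {p q : X} {r : Y} (h : Sep r (φ p) (φ q)) : Sep (φ.symm r) p q := by
  simpa using Sep_homeo φ.symm h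

lemma Conj_homeo {p q : X} (h : Conj p q) : Conj (φ p) (φ q) :=
  ⟨φ.injective.ne h.1, fun r hr => h.2 _ (Sep_homeo' φ hr)⟩

end inv

section invdefs
variable (X : Type) [TopologicalSpace X]
def I2 : Prop := ∃ p : X, Split 2 p
def I3 : Prop := ∃ p : X, LS 3 p
def I5 : Prop := ∃ p : X, LS 5 p
def Q1 : Prop := ∃ p : X, LS 3 p ∧ ¬ LS 5 p
def Q2 : Prop := ∃ p : X, LS 5 p ∧ ¬ LS 6 p
def T2 : Prop := ∃ p : X, LS 3 p ∧ ¬ LS 4 p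
def T1 : Prop := ∃ p : X, LS 4 p ∧ ¬ Split 4 p
def T3 : Prop := ∃ p q : X, LS 3 p ∧ ¬ LS 4 p ∧ Split 3 p ∧ Conj p q
def DC : Prop := ∃ p q₁ q₂ : X, Conj p q₁ ∧ Conj p q₂ ∧ Sep p q₁ q₂
def WW : Prop := ∃ p : X, LS 3 p ∧ ¬ LS 4 p ∧ Split 3 p ∧
  (∃ q, q ≠ p ∧ ∀ r, Sep r p q → ¬ (LS 3 r ∧ ¬ LS 4 r)) ∧
  (∃ q, q ≠ p ∧ ∀ r, Sep r p q → ¬ LS 4 r)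
end invdefs

section invs
variable {X Y : Type} [TopologicalSpace X] [TopologicalSpace Y]

lemma I2_h (φ : X ≃ₜ Y) (h : I2 X) : I2 Y := let ⟨p, h⟩ := h; ⟨φ p, Split_homeo φ h⟩
lemma I3_h (φ : X ≃ₜ Y) (h : I3 X) : I3 Y := let ⟨p, h⟩ := h; ⟨φ p, LS_homeo φ h⟩
lemma I5_h (φ : X ≃ₜ Y) (h : I5 X) : I5 Y := let ⟨p, h⟩ := h; ⟨φ p, LS_homeo φ h⟩
lemma Q1_h (φ : X ≃ₜ Y) (h : Q1 X) : Q1 Y :=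
  let ⟨p, h, h'⟩ := h; ⟨φ p, LS_homeo φ h, fun h2 => h' (LS_homeo' φ h2)⟩
lemma Q2_h (φ : X ≃ₜ Y) (h : Q2 X) : Q2 Y :=
  let ⟨p, h, h'⟩ := h; ⟨φ p, LS_homeo φ h, fun h2 => h' (LS_homeo' φ h2)⟩
lemma T2_h (φ : X ≃ₜ Y) (h : T2 X) : T2 Y :=
  let ⟨p, h, h'⟩ := h; ⟨φ p, LS_homeo φ h, fun h2 => h' (LS_homeo' φ h2)⟩
lemma T1_h (φ : X ≃ₜ Y) (h : T1 X) : T1 Y :=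
  let ⟨p, h, h'⟩ := h; ⟨φ p, LS_homeo φ h, fun h2 => h' (Split_homeo' φ h2)⟩
lemma T3_h (φ : X ≃ₜ Y) (h : T3 X) : T3 Y :=
  let ⟨p, q, h1, h2, h3, h4⟩ := h
  ⟨φ p, φ q, LS_homeo φ h1, fun h' => h2 (LS_homeo' φ h'), Split_homeo φ h3, Conj_homeo φ h4⟩
lemma DC_h (φ : X ≃ₜ Y) (h : DC X) : DC Y :=
  let ⟨p, q, q', h1, h2, h3⟩ := h
  ⟨φ p, φ q, φ q', Conj_homeo φ h1, Conj_homeo φ h2, Sep_homeo φ h3⟩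
lemma WW_h (φ : X ≃ₜ Y) (h : WW X) : WW Y :=
  let ⟨p, h1, h2, h3, ⟨q, h4, h5⟩, ⟨q', h6, h7⟩⟩ := h
  ⟨φ p, LS_homeo φ h1, fun h' => h2 (LS_homeo' φ h'), Split_homeo φ h3,
    ⟨φ q, φ.injective.ne h4, fun r hr ⟨h8, h9⟩ => h5 _ (Sep_homeo' φ hr)
      ⟨LS_homeo φ.symm h8, fun h' => h9 (LS_homeo' φ.symm h')⟩⟩,
    ⟨φ q', φ.injective.ne h6, fun r hr h8 => h7 _ (Sep_homeo' φ hr) (LS_homeo φ.symm h8)⟩⟩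

end invs

section toplem
variable {X : Type} [TopologicalSpace X]

open Classical in
lemma sep_aux {A : Type} {f : X → A} {p q e : X} {U : Set X} (hU : IsClosed U)
    (hp : U ∈ 𝓝 p) (hf : ∀ x, x ≠ p → LC f x)
    (h : ∀ x ∈ U, x ≠ e → U ∈ 𝓝 x ∨ f x ≠ f q) (x : X) (hx : x ≠ e) :
    LC (fun x => decide (x ∉ U ∧ f x = f q)) x := by
  by_cases hxU : x ∈ U
  · rcases h x hxU hx with h1 | h1
    · filter_upwards [h1] with y hy
      simp [hy, hxU]
    · by_cases hxp : x = p
      · subst hxp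
        filter_upwards [hp] with y hy
        simp [hy, hxU]
      filter_upwards [hf x hxp] with y hy
      simp [hy, h1]
  · have hxp : x ≠ p := by rintro rfl; exact hxU (mem_of_mem_nhds hp)
    filter_upwards [hf x hxp, hU.isOpen_compl.mem_nhds hxU] with y hy hyU
    have hyU : y ∉ U := hyU
    simp [hy, hyU, hxU]

/-- single exit lemma -/
lemma single_exit {A : Type} {f : X → A} {p q e : X} {U : Set X} (hU : IsClosed U) (he : e ∈ U)
    (hpe : p ≠ e) (hp : U ∈ 𝓝 p) (hq : q ∉ U) (hf : ∀ x, x ≠ p → LC f x)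
    (h : ∀ x ∈ U, x ≠ e → U ∈ 𝓝 x ∨ f x ≠ f q) : Sep e p q := by
  classical
  refine ⟨hpe, by rintro rfl; exact hq he, _, sep_aux hU hp hf h, ?_⟩
  simp [hq, mem_of_mem_nhds hp]

end toplem

namespace IFS

variable {R : Fin 7 → Fin 7 → Fin 7 → Fin 7 → Prop} {par : Fin 7 → Fin 7 → Fin 7}
  {X : Type} [MetricSpace X] [CompactSpace X] (F : IFS R X)

/-- outside points connect to the boundary -/
lemma outside_top (F : IFS R X) (ok : Ok R par) {A : Type} {f : X → A} {p q : X} {U : Set X} (hU : IsClosed U)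
    (hp : U ∈ 𝓝 p) (hq : q ∉ U) (hf : ∀ x, x ≠ p → LC f x) :
    ∃ x ∈ U, U ∉ 𝓝 x ∧ f x = f q := by
  classical
  by_contra hcon
  push Not at hcon
  have h : ∀ x ∈ U, x ≠ q → U ∈ 𝓝 x ∨ f x ≠ f q := fun x hx _ => by
    by_contra h'; push Not at h'; exact hcon x hx h'.1 h'.2
  have h1 := sep_aux hU hp hf h
  have h2 : ∀ x, LC (fun x => decide (x ∉ U ∧ f x = f q)) x := by
    intro x
    by_cases hx : x = q
    · subst hx
      have hxp : x ≠ p := by rintro rfl; exact hq (mem_of_mem_nhds hp)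
      filter_upwards [hf x hxp, hU.isOpen_compl.mem_nhds hq] with y hy hyU
      have hyU : y ∉ U := hyU
      simp [hy, hyU, hq]
    · exact h1 x hx
  have h3 := F.const_of_LC ok h2 p q
  simp [hq, mem_of_mem_nhds hp] at h3

lemma classify (ok : Ok R par) (p : X) :
    ((∀ n, F.Sing (F.tl^[n] p)) ∧ ∀ N, ∃ n, N ≤ n ∧ F.dig (F.tl^[n] p) ≠ F.dig (F.tl^[n+1] p)) ∨
    (∃ w d, F.In w (F.c d) ∧ p = F.W w (F.c d)) ∨
    (∃ w d e a b, R d e a b ∧ F.In w (F.S d (F.c a)) ∧ p = F.W w (F.S d (F.c a))) := by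
  by_cases hs : ∀ n, F.Sing (F.tl^[n] p)
  · by_cases hne : ∀ N, ∃ n, N ≤ n ∧ F.dig (F.tl^[n] p) ≠ F.dig (F.tl^[n+1] p)
    · exact Or.inl ⟨hs, hne⟩
    push Not at hne
    obtain ⟨N, hN⟩ := hne
    have h1 : ∀ n, F.dig (F.tl^[n] (F.tl^[N] p)) = F.dig (F.tl^[N] p) := by
      intro n
      induction n with
      | zero => rfl
      | succ n ih =>
        rw [← ih, ← Function.iterate_add_apply, ← Function.iterate_add_apply]
        have := hN (n + N) (by omega)
        rw [this]
        congr 2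
        omega
    have h2 := F.eq_c_of_dig h1
    have hIn := F.In_pre N p (fun m _ => hs m)
    have hW := F.W_pre N p
    rw [h2] at hIn hW
    exact Or.inr (Or.inl ⟨_, _, hIn, hW.symm⟩)
  · push Not at hs
    classical
    have hIn := F.In_pre (Nat.find hs) p (fun m hm => by
      have := Nat.find_min hs hm; push Not at this; exact this)
    obtain ⟨d, e, a, b, hR, hx⟩ := F.not_sing ok (Nat.find_spec hs)
    have hW := F.W_pre (Nat.find hs) p
    rw [hx] at hIn hW
    exact Or.inr (Or.inr ⟨_, d, e, a, b, hR, hIn, hW.symm⟩)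

lemma LS_upg (F : IFS R X) (ok : Ok R par) (ck : Chk2 R par) {j k : ℕ} (hj : 3 ≤ j) (hk : 0 < k)
    (h1 : ∀ d, j ≤ cn par d → k ≤ cn par d)
    (h2 : ∀ d e a b, R d e a b → j ≤ cn par a + cn par b → k ≤ cn par a + cn par b)
    {p : X} (h : LS j p) : LS k p := by
  rcases F.LS3_loc ok ck hj h with ⟨w, d, -, rfl, h3⟩ | ⟨w, d, e, a, b, hR, -, rfl, h3⟩
  · exact F.LS_W (F.LS_c ok hk (h1 d h3)) w
  · exact F.LS_W (F.LS_glue_of ok hR hk (h2 _ _ _ _ hR h3)) w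

lemma no_LS (F : IFS R X) (ok : Ok R par) (ck : Chk2 R par) {j : ℕ} (hj : 3 ≤ j)
    (h1 : ∀ d, cn par d < j) (h2 : ∀ d e a b, R d e a b → cn par a + cn par b < j) (p : X) : ¬ LS j p := by
  intro h
  rcases F.LS3_loc ok ck hj h with ⟨w, d, -, rfl, h3⟩ | ⟨w, d, e, a, b, hR, -, rfl, h3⟩
  · exact absurd h3 (by have := h1 d; omega)
  · exact absurd h3 (by have := h2 _ _ _ _ hR; omega)

/-- points reachable by words in `{x,y,z}` -/
def Ln (x y z : Fin 7) : ℕ → X → Prop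
  | 0, _ => True
  | n + 1, r => ∃ t, (t = x ∨ t = y ∨ t = z) ∧ ∃ r', F.S t r' = r ∧ Ln x y z n r'

lemma line (ok : Ok R par) {x y z : Fin 7} (h1 : R x y z x) (h2 : R y z z x) {A : Type} :
    ∀ (n : ℕ) (f : X → A) (r : X), (∀ p, p ≠ r → LC f p) → ¬ F.Ln x y z n r → f (F.c x) = f (F.c z) := by
  intro n
  induction n with
  | zero => intro f r _ h; exact absurd trivial h
  | succ n ih =>
    intro f r hf h
    have key : ∀ t, (t = x ∨ t = y ∨ t = z) → f (F.S t (F.c x)) = f (F.S t (F.c z)) := by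
      intro t ht
      by_cases hr : r ∈ range (F.S t)
      · obtain ⟨r', rfl⟩ := hr
        exact ih (f ∘ F.S t) r' (F.LC_off_S hf) fun h' => h ⟨t, ht, r', rfl, h'⟩
      · exact F.piece_const_S ok hf hr _ _
    have k1 := key x (by simp)
    have k2 := key y (by simp)
    have k3 := key z (by simp)
    rw [F.S_c] at k1
    rw [F.S_c] at k3
    rw [k1, F.R_eq ok h1, k2, F.R_eq ok h2, k3]

end IFS

section simple
variable {X : Type} [MetricSpace X] [CompactSpace X]

lemma I2_c {i : Fin 12} (F : IFS (Rt i) X) (d : Fin 7) (h : 2 ≤ cn (parT i) d) : I2 X :=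
  ⟨F.c d, F.Split_c (okT i) (by norm_num) h⟩

lemma I3_c {i : Fin 12} (F : IFS (Rt i) X) (d : Fin 7) (h : 3 ≤ cn (parT i) d) : I3 X :=
  ⟨F.c d, F.LS_c (okT i) (by norm_num) h⟩

lemma I3_not {i : Fin 12} (F : IFS (Rt i) X) (hi : i = 0 ∨ i = 1) : ¬ I3 X := by
  rintro ⟨p, hp⟩
  refine F.no_LS (okT i) (ckT i) le_rfl ?_ (Rt_all i ?_) p hp
  · rcases hi with rfl | rfl <;> decide +kernel
  · rcases hi with rfl | rfl <;> decide +kernel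

lemma I5_c {i : Fin 12} (F : IFS (Rt i) X) (d : Fin 7) (h : 5 ≤ cn (parT i) d) : I5 X :=
  ⟨F.c d, F.LS_c (okT i) (by norm_num) h⟩

lemma I5_glue {i : Fin 12} (F : IFS (Rt i) X) (d e a b : Fin 7) (hR : Rt i d e a b)
    (h : 5 ≤ cn (parT i) a + cn (parT i) b) : I5 X :=
  ⟨_, F.LS_glue_of (okT i) hR (by norm_num) h⟩

lemma I5_not {i : Fin 12} (F : IFS (Rt i) X) (hi : i = 4 ∨ i = 7) : ¬ I5 X := by
  rintro ⟨p, hp⟩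
  refine F.no_LS (okT i) (ckT i) (by norm_num) ?_ (Rt_all i ?_) p hp
  · rcases hi with rfl | rfl <;> decide +kernel
  · rcases hi with rfl | rfl <;> decide +kernel

lemma Q1_11 (F : IFS (Rt 11) X) : Q1 X :=
  ⟨F.c 1, F.LS_c (okT 11) (by norm_num) (by decide +kernel), fun h =>
    absurd (F.LS_single (okT 11) h) (by decide +kernel)⟩

lemma Q1_not {i : Fin 12} (F : IFS (Rt i) X) (hi : i = 9 ∨ i = 10) : ¬ Q1 X := by
  rintro ⟨p, hp, hp'⟩
  refine hp' (F.LS_upg (okT i) (ckT i) le_rfl (by norm_num) ?_ (Rt_all i ?_) hp)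
  · rcases hi with rfl | rfl <;> decide +kernel
  · rcases hi with rfl | rfl <;> decide +kernel

lemma Q2_10 (F : IFS (Rt 10) X) : Q2 X :=
  ⟨F.c 2, F.LS_c (okT 10) (by norm_num) (by decide +kernel), fun h =>
    absurd (F.LS_single (okT 10) h) (by decide +kernel)⟩

lemma Q2_not (F : IFS (Rt 9) X) : ¬ Q2 X := by
  rintro ⟨p, hp, hp'⟩
  exact hp' (F.LS_upg (okT 9) (ckT 9) (by norm_num) (by norm_num) (by decide +kernel)
    (Rt_all 9 (by decide +kernel)) hp)

lemma T2_c {i : Fin 12} (F : IFS (Rt i) X) (d : Fin 7) (h : cn (parT i) d = 3) : T2 X :=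
  ⟨F.c d, F.LS_c (okT i) (by norm_num) (by omega), fun h' => by
    have := F.LS_single (okT i) h'; omega⟩

lemma T2_not (F : IFS (Rt 3) X) : ¬ T2 X := by
  rintro ⟨p, hp, hp'⟩
  exact hp' (F.LS_upg (okT 3) (ckT 3) (by norm_num) (by norm_num) (by decide +kernel)
    (Rt_all 3 (by decide +kernel)) hp)

end simple
end FC

set_option linter.unusedSectionVars false
set_option linter.unusedVariables false
namespace FC

open Set Filter Topology

section cyc6
variable {X : Type} [MetricSpace X] [CompactSpace X]

def Adj (i : Fin 12) (d e : Fin 7) : Prop := ∃ a b, Rt i d e a b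
instance (i : Fin 12) (d e : Fin 7) : Decidable (Adj i d e) := by unfold Adj; infer_instance

lemma chkA : ∀ d a1 a2 : Fin 7, ∃ e a b, Rt 8 d e a b ∧ a ≠ a1 ∧ a ≠ a2 := by
  have h : ∀ d a1 a2 : Fin 7, ∃ n ∈ tb 8, (dc n).1 = d ∧ (dc n).2.2.1 ≠ a1 ∧ (dc n).2.2.1 ≠ a2 := by
    decide +kernel
  intro d a1 a2
  obtain ⟨n, hn, h1, h2, h3⟩ := h d a1 a2
  exact ⟨_, _, _, h1 ▸ Rt_dc 8 _ hn, h2, h3⟩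

lemma chkB : ∀ d0 d1 a0 b0 : Fin 7, Rt 8 d0 d1 a0 b0 →
    ∃ e a b, Rt 8 d0 e a b ∧ a ≠ a0 ∧ e ≠ d1 := by
  have h : ∀ d d1 a0 : Fin 7, ∃ n ∈ tb 8, (dc n).1 = d ∧ (dc n).2.2.1 ≠ a0 ∧ (dc n).2.1 ≠ d1 := by
    decide +kernel
  intro d d1 a0 b0 _
  obtain ⟨n, hn, h1, h2, h3⟩ := h d d1 a0
  exact ⟨_, _, _, h1 ▸ Rt_dc 8 _ hn, h2, h3⟩

lemma chkC : ∀ d0 d1 a0 b0 : Fin 7, Rt 8 d0 d1 a0 b0 → ∃ r, ∀ e, e ≠ d0 → e ≠ d1 →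
    ∃ m, (m ≠ d0 ∧ m ≠ d1) ∧ (r ≠ d0 ∧ r ≠ d1) ∧ (e = m ∨ Adj 8 e m) ∧ (m = r ∨ Adj 8 m r) :=
  Rt_all 8 (by decide +kernel)

lemma two_pieces {R : Fin 7 → Fin 7 → Fin 7 → Fin 7 → Prop} {par : Fin 7 → Fin 7 → Fin 7}
    (F : IFS R X) (ok : Ok R par) (x : X) : ∃ a1 a2, ∀ e y, F.S e y = x → e = a1 ∨ e = a2 := by
  by_cases h : F.Sing x
  · exact ⟨_, F.dig x, fun e y hy => Or.inl (h e y hy)⟩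
  · obtain ⟨d, e, a, b, hR, rfl⟩ := F.not_sing ok h
    exact ⟨d, e, fun t y hy => (F.glue_pieces ok hR hy).imp And.left And.left⟩

lemma cyc6_one (F : IFS (Rt 8) X) {A : Type} (p : X) (f : X → A) (hf : ∀ x, x ≠ p → LC f x) :
    ∃ v, ∀ d, p ∉ range (F.S d) → ∀ x, f (F.S d x) = v := by
  by_cases h : F.Sing p
  · have hc : ∀ d e e' : Fin 7, e ≠ d → e' ≠ d → cl (parT 8) d e = cl (parT 8) d e' := by decide +kernel
    obtain ⟨e0, he0⟩ : ∃ e0, e0 ≠ F.dig p := exists_ne _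
    refine ⟨f (F.S e0 (F.c 0)), fun d hd x => ?_⟩
    have hd : d ≠ F.dig p := by
      rintro rfl
      exact hd ⟨_, F.dig_tl p⟩
    exact F.comp_const (okT 8) hf h hd he0 (hc _ _ _ hd he0) _ _
  · obtain ⟨d0, d1, a, b, hR, rfl⟩ := F.not_sing (okT 8) h
    obtain ⟨r, hr⟩ := chkC _ _ _ _ hR
    have hn : ∀ e, e ≠ d0 → e ≠ d1 → F.S d0 (F.c a) ∉ range (F.S e) := by
      rintro e h0 h1 ⟨y, hy⟩
      rcases F.glue_pieces (okT 8) hR hy with h | h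
      · exact h0 h.1
      · exact h1 h.1
    have hadj : ∀ e m, (e ≠ d0 ∧ e ≠ d1) → (m ≠ d0 ∧ m ≠ d1) → (e = m ∨ Adj 8 e m) → ∀ x y,
        f (F.S e x) = f (F.S m y) := by
      rintro e m he hm (rfl | ⟨a', b', hR'⟩) x y
      · exact F.piece_const_S (okT 8) hf (hn _ he.1 he.2) _ _
      · rw [F.piece_const_S (okT 8) hf (hn _ he.1 he.2) x (F.c a'), F.R_eq (okT 8) hR']
        exact F.piece_const_S (okT 8) hf (hn _ hm.1 hm.2) _ _
    refine ⟨f (F.S r (F.c 0)), fun d hd x => ?_⟩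
    have h0 : d ≠ d0 := by rintro rfl; exact hd ⟨_, rfl⟩
    have h1 : d ≠ d1 := by rintro rfl; exact hd ⟨_, (F.R_eq (okT 8) hR).symm⟩
    obtain ⟨m, hm, hr', h2, h3⟩ := hr d h0 h1
    rw [hadj d m ⟨h0, h1⟩ hm h2 x (F.c 0), hadj m r hm hr' h3]

lemma cyc6_n (F : IFS (Rt 8) X) {A : Type} : ∀ (n : ℕ) (p : X) (f : X → A), (∀ x, x ≠ p → LC f x) →
    ∃ v, ∀ u : List (Fin 7), u.length = n + 1 → p ∉ range (F.W u) → ∀ x, f (F.W u x) = v := by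
  intro n
  induction n with
  | zero =>
    intro p f hf
    obtain ⟨v, hv⟩ := cyc6_one F p f hf
    refine ⟨v, fun u hu hp x => ?_⟩
    obtain ⟨d, rfl⟩ := List.length_eq_one_iff.1 hu
    exact hv d hp x
  | succ n ih =>
    intro p f hf
    obtain ⟨v, hv⟩ := cyc6_one F p f hf
    refine ⟨v, fun u hu hp x => ?_⟩
    obtain ⟨d, u, rfl⟩ : ∃ d u', u = d :: u' := by cases u with
      | nil => simp at hu
      | cons d u => exact ⟨d, u, rfl⟩
    by_cases hd : p ∈ range (F.S d)
    · obtain ⟨p', rfl⟩ := hd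
      obtain ⟨v', hv'⟩ := ih p' (f ∘ F.S d) (F.LC_off_S hf)
      have h1 : f (F.W (d :: u) x) = v' := by
        refine hv' u (by simpa using hu) ?_ x
        rintro ⟨y, hy⟩
        exact hp ⟨y, by simp [hy]⟩
      obtain ⟨e, a, b, hR, he, ha⟩ : ∃ e a b, Rt 8 d e a b ∧ F.S d p' ∉ range (F.S e) ∧
          p' ∉ range (F.S a) := by
        by_cases h : F.Sing (F.S d p')
        · obtain ⟨a1, a2, h12⟩ := two_pieces F (okT 8) p'
          obtain ⟨e, a, b, hR, h1, h2⟩ := chkA d a1 a2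
          refine ⟨e, a, b, hR, ?_, ?_⟩
          · rintro ⟨y, hy⟩
            exact ((okT 8).irr _ _ _ _ hR).1 ((h d _ rfl).trans (h e _ hy).symm)
          · rintro ⟨y, hy⟩
            rcases h12 _ _ hy with h | h
            · exact h1 h
            · exact h2 h
        · obtain ⟨d0, d1, a, b, hR, hx⟩ := F.not_sing (okT 8) h
          have hR2 : ∃ d1' a' b', Rt 8 d d1' a' b' ∧ p' = F.c a' := by
            rcases F.glue_pieces (okT 8) hR hx with ⟨rfl, h⟩ | ⟨rfl, h⟩
            · exact ⟨_, _, _, hR, h⟩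
            · exact ⟨_, _, _, (okT 8).symm _ _ _ _ hR, h⟩
          obtain ⟨d1', a', b', hR2, rfl⟩ := hR2
          obtain ⟨e, a, b, hR3, h1, h2⟩ := chkB _ _ _ _ hR2
          refine ⟨e, a, b, hR3, ?_, ?_⟩
          · rintro ⟨y, hy⟩
            rcases F.glue_pieces (okT 8) hR2 hy with h | h
            · exact ((okT 8).irr _ _ _ _ hR3).1 h.1.symm
            · exact h2 h.1
          · rintro ⟨y, hy⟩
            exact h1 (F.c_single (okT 8) hy).1
      rw [h1]
      have h2 := hv' (List.replicate (n+1) a) (by simp) (by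
        rintro ⟨y, hy⟩
        rw [List.replicate_succ, F.W_cons] at hy
        exact ha ⟨_, hy⟩) (F.c a)
      rw [F.W_rep] at h2
      rw [← h2, Function.comp, F.R_eq (okT 8) hR]
      exact hv e he _
    · exact hv d hd _

lemma I2_not (F : IFS (Rt 8) X) : ¬ I2 X := by
  rintro ⟨p, f, hf, h⟩
  obtain ⟨x, hx, hx1⟩ := h 0
  obtain ⟨y, hy, hy1⟩ := h 1
  have hlt : 0 < min (dist x p) (dist y p) := lt_min (dist_pos.2 hx) (dist_pos.2 hy)
  obtain ⟨n, hn⟩ := F.exists_small hlt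
  obtain ⟨v, hv⟩ := cyc6_n F n p f hf
  have key : ∀ z, min (dist x p) (dist y p) ≤ dist z p → f z = v := by
    intro z hz
    obtain ⟨u, hu, y, rfl⟩ := F.cover_W (n+1) z
    refine hv u hu ?_ y
    rintro ⟨q, rfl⟩
    exact absurd (hn u (by omega) y q) (not_lt.2 hz)
  have := (key x (min_le_left _ _)).trans (key y (min_le_right _ _)).symm
  rw [hx1, hy1] at this
  exact absurd this (by decide)

end cyc6
end FC

set_option linter.unusedSectionVars false
set_option linter.unusedVariables false
namespace FC

open Set Filter Topology

lemma Split_of_inj {X : Type} [TopologicalSpace X] {A : Type} {k : ℕ} (hk : 0 < k) {p : X} (f : X → A)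
    (hf : ∀ x, x ≠ p → LC f x) (g : Fin k → A) (hg : Function.Injective g)
    (h : ∀ i, ∃ x, x ≠ p ∧ f x = g i) : Split k p := by
  have : Nonempty (Fin k) := ⟨⟨0, hk⟩⟩
  refine ⟨Function.invFun g ∘ f, fun x hx => ?_, fun i => ?_⟩
  · exact (hf x hx).mono fun y hy => by simp [hy]
  · obtain ⟨x, h1, h2⟩ := h i
    exact ⟨x, h1, by simp [h2, Function.leftInverse_invFun hg i]⟩

lemma not_Split_of {X : Type} [TopologicalSpace X] {k : ℕ} {p : X}
    (h : ∀ f : X → Fin k, (∀ x, x ≠ p → LC f x) → ∃ L : Finset (Fin k), L.card < k ∧ ∀ x, x ≠ p → f x ∈ L) :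
    ¬ Split k p := by
  rintro ⟨f, hf, h1⟩
  obtain ⟨L, hL, h2⟩ := h f hf
  have : L = Finset.univ := by
    rw [Finset.eq_univ_iff_forall]
    intro i
    obtain ⟨x, hx, rfl⟩ := h1 i
    exact h2 x hx
  rw [this] at hL
  simp at hL

namespace IFS

variable {R : Fin 7 → Fin 7 → Fin 7 → Fin 7 → Prop} {par : Fin 7 → Fin 7 → Fin 7}
  {X : Type} [MetricSpace X] [CompactSpace X] (F : IFS R X)

lemma c_cl (ok : Ok R par) {A : Type} {g : X → A} {a : Fin 7} (h : ∀ y, y ≠ F.c a → LC g y)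
    {e : Fin 7} (he : e ≠ a) : g (F.c e) = g (F.c (cl par a e)) := by
  have := F.cd_global ok h (m := 0) he (F.c e)
  rwa [F.S_c] at this

lemma c_same (ok : Ok R par) {A : Type} {g : X → A} {a : Fin 7} (h : ∀ y, y ≠ F.c a → LC g y)
    {e e' : Fin 7} (he : e ≠ a) (he' : e' ≠ a) (hc : cl par a e = cl par a e') :
    g (F.c e) = g (F.c e') := by
  rw [F.c_cl ok h he, F.c_cl ok h he', hc]

lemma c_val (ok : Ok R par) {A : Type} {g : X → A} {a : Fin 7} (h : ∀ y, y ≠ F.c a → LC g y)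
    {x : X} (hx : x ≠ F.c a) : ∃ e, e ≠ a ∧ g x = g (F.c e) := by
  obtain ⟨m, e, y, he, rfl⟩ := F.exists_digit ok hx
  exact ⟨e, he, by rw [F.cd_global ok h he, ← F.c_cl ok h he]⟩

lemma c_const (ok : Ok R par) {A : Type} {g : X → A} {a : Fin 7} (h : ∀ y, y ≠ F.c a → LC g y)
    (h1 : ∀ e e', e ≠ a → e' ≠ a → cl par a e = cl par a e') {x y : X} (hx : x ≠ F.c a) (hy : y ≠ F.c a) :
    g x = g y := by
  obtain ⟨e, he, h2⟩ := F.c_val ok h hx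
  obtain ⟨e', he', h3⟩ := F.c_val ok h hy
  rw [h2, h3, F.c_same ok h he he' (h1 _ _ he he')]

lemma ext_off {A : Type} {f : Fin 7 → X → A} {p : X}
    (h : ∀ d e a b, R d e a b → F.S d (F.c a) ≠ p → f d (F.c a) = f e (F.c b))
    (hf : ∀ t z, F.S t z ≠ p → LC (f t) z) : ∃ g : X → A, (∀ x, x ≠ p → LC g x) ∧
      ∀ t z, F.S t z ≠ p → g (F.S t z) = f t z := by
  refine ⟨F.ext f, fun x hx => ?_, fun t z hz => ?_⟩
  · refine F.ext_LC (P := {p}) isClosed_singleton h hx ?_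
    rintro t z rfl
    exact hf t z hx
  · exact F.ext_S fun d a b hR he => h d t a b hR (by rwa [← he])

lemma ext_step {A : Type} {g : X → A} {p : X} {t : Fin 7} (hg : ∀ x, x ≠ p → LC g x) (k : Fin 7 → Fin 7)
    (hk : ∀ d e a b, R d e a b → F.S d (F.c a) ≠ F.S t p →
      g (F.c (if d = t then a else k d)) = g (F.c (if e = t then b else k e))) :
    ∃ f : X → A, (∀ x, x ≠ F.S t p → LC f x) ∧ (∀ y, y ≠ p → f (F.S t y) = g y) ∧
      ∀ e y, e ≠ t → F.S e y ≠ F.S t p → f (F.S e y) = g (F.c (k e)) := by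
  obtain ⟨f, h1, h2⟩ := F.ext_off (p := F.S t p)
    (f := fun e y => if e = t then g y else g (F.c (k e))) (by
      intro d e a b hR hp
      have := hk d e a b hR hp
      split_ifs at this ⊢ <;> exact this) (by
      intro e z hz
      by_cases he : e = t
      · subst he
        have : z ≠ p := by rintro rfl; exact hz rfl
        simpa using hg z this
      · exact Eventually.of_forall fun y => by simp [he])
  refine ⟨f, h1, fun y hy => ?_, fun e y he hy => ?_⟩
  · rw [h2 t y ((F.S_inj t).ne hy)]; simp
  · rw [h2 e y hy]; simp [he]

end IFS

section T1
variable {X : Type} [MetricSpace X] [CompactSpace X]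

lemma T1_5 (F : IFS (Rt 5) X) : T1 X := by
  have ok := okT 5
  have e1 : Rt 5 1 3 4 1 := by decide
  refine ⟨F.S 1 (F.c 4), F.LS_glue_of ok e1 (by norm_num) (by decide +kernel), not_Split_of ?_⟩
  intro f hf
  have hf3 : ∀ y, y ≠ F.c 1 → LC (f ∘ F.S 3) y := F.LC_off_S (by rw [← F.R_eq ok e1]; exact hf)
  have hf1 : ∀ y, y ≠ F.c 4 → LC (f ∘ F.S 1) y := F.LC_off_S hf
  have hn : ∀ e, e ≠ 1 → e ≠ 3 → F.S 1 (F.c 4) ∉ range (F.S e) := by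
    rintro e h0 h1 ⟨y, hy⟩
    rcases F.glue_pieces ok e1 hy with h | h
    · exact h0 h.1
    · exact h1 h.1
  have hc : ∀ e, e ≠ 1 → e ≠ 3 → ∀ x y, f (F.S e x) = f (F.S e y) := fun e h h' x y =>
    F.piece_const_S ok hf (hn e h h') x y
  have k4 : ∀ e e', e ≠ 4 → e' ≠ 4 → cl (parT 5) 4 e = cl (parT 5) 4 e' := by decide +kernel
  have h1 : ∀ y, y ≠ F.c 4 → f (F.S 1 y) = f (F.S 1 (F.c 6)) := fun y hy =>
    F.c_const ok hf1 k4 hy (F.c_inj.ne (by decide))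
  have h5 : ∀ y, f (F.S 5 y) = f (F.S 1 (F.c 6)) := fun y => by
    rw [F.R_eq ok (show Rt 5 1 5 6 1 by decide)]; exact hc 5 (by decide) (by decide) _ _
  have h0 : ∀ y, f (F.S 0 y) = f (F.S 1 (F.c 6)) := fun y => by
    rw [hc 0 (by decide) (by decide) y (F.c 2), F.R_eq ok (show Rt 5 0 1 2 0 by decide)]
    exact h1 _ (F.c_inj.ne (by decide))
  have h2 : ∀ y, f (F.S 2 y) = f (F.S 1 (F.c 6)) := fun y => by
    rw [hc 2 (by decide) (by decide) y (F.c 0), ← F.R_eq ok (show Rt 5 1 2 2 0 by decide)]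
    exact h1 _ (F.c_inj.ne (by decide))
  have h6 : ∀ y, f (F.S 6 y) = f (F.S 1 (F.c 6)) := fun y => by
    rw [hc 6 (by decide) (by decide) y (F.c 1), ← F.R_eq ok (show Rt 5 5 6 6 1 by decide)]
    exact h5 _
  have h36 : f (F.S 3 (F.c 6)) = f (F.S 1 (F.c 6)) := by
    rw [F.R_eq ok (show Rt 5 3 5 6 4 by decide)]; exact h5 _
  have h3 : ∀ e, e ≠ 1 → f (F.S 3 (F.c e)) ∈ ({f (F.S 1 (F.c 6)), f (F.S 3 (F.c 0)), f (F.S 3 (F.c 2))} : Finset (Fin 4)) := by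
    intro e he
    have : e = 0 ∨ e = 2 ∨ cl (parT 5) 1 e = cl (parT 5) 1 6 := by revert e; decide +kernel
    rcases this with rfl | rfl | h
    · simp
    · simp
    · have h := F.c_same ok hf3 he (by decide) h
      simp only [Function.comp_apply] at h
      rw [h, h36]; simp
  have h34 : f (F.S 3 (F.c 4)) = f (F.S 1 (F.c 6)) := by
    rw [← h36]
    exact F.c_same ok hf3 (by decide) (by decide) (by decide +kernel)
  have h4 : ∀ y, f (F.S 4 y) = f (F.S 1 (F.c 6)) := fun y => by
    rw [hc 4 (by decide) (by decide) y (F.c 1), ← F.R_eq ok (show Rt 5 3 4 4 1 by decide)]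
    exact h34
  refine ⟨{f (F.S 1 (F.c 6)), f (F.S 3 (F.c 0)), f (F.S 3 (F.c 2))}, lt_of_le_of_lt Finset.card_le_three (by norm_num : 3 < 4), fun x hx => ?_⟩
  obtain ⟨d, y, rfl⟩ := F.cover x
  have hd : ∀ d : Fin 7, d = 0 ∨ d = 1 ∨ d = 2 ∨ d = 3 ∨ d = 4 ∨ d = 5 ∨ d = 6 := by decide
  rcases hd d with rfl | rfl | rfl | rfl | rfl | rfl | rfl
  · rw [h0]; simp
  · rw [h1 y (by rintro rfl; exact hx rfl)]; simp
  · rw [h2]; simp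
  · obtain ⟨e, he, h⟩ := F.c_val ok hf3 (x := y) (by rintro rfl; exact hx (F.R_eq ok e1).symm)
    simp only [Function.comp_apply] at h
    rw [h]
    exact h3 e he
  · rw [h4]; simp
  · rw [h5]; simp
  · rw [h6]; simp

lemma T1_6 (F : IFS (Rt 6) X) : T1 X := by
  have ok := okT 6
  have e1 : Rt 6 3 4 4 1 := by decide
  refine ⟨F.S 3 (F.c 4), F.LS_glue_of ok e1 (by norm_num) (by decide +kernel), not_Split_of ?_⟩
  intro f hf
  have hf3 : ∀ y, y ≠ F.c 1 → LC (f ∘ F.S 4) y := F.LC_off_S (by rw [← F.R_eq ok e1]; exact hf)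
  have hf1 : ∀ y, y ≠ F.c 4 → LC (f ∘ F.S 3) y := F.LC_off_S hf
  have hn : ∀ e, e ≠ 3 → e ≠ 4 → F.S 3 (F.c 4) ∉ range (F.S e) := by
    rintro e h0 h1 ⟨y, hy⟩
    rcases F.glue_pieces ok e1 hy with h | h
    · exact h0 h.1
    · exact h1 h.1
  have hc : ∀ e, e ≠ 3 → e ≠ 4 → ∀ x y, f (F.S e x) = f (F.S e y) := fun e h h' x y =>
    F.piece_const_S ok hf (hn e h h') x y
  have k4 : ∀ e e', e ≠ 4 → e' ≠ 4 → cl (parT 6) 4 e = cl (parT 6) 4 e' := by decide +kernel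
  have h3 : ∀ y, y ≠ F.c 4 → f (F.S 3 y) = f (F.S 3 (F.c 6)) := fun y hy =>
    F.c_const ok hf1 k4 hy (F.c_inj.ne (by decide))
  have h5 : ∀ y, f (F.S 5 y) = f (F.S 3 (F.c 6)) := fun y => by
    rw [F.R_eq ok (show Rt 6 3 5 6 1 by decide)]; exact hc 5 (by decide) (by decide) _ _
  have h1 : ∀ y, f (F.S 1 y) = f (F.S 3 (F.c 6)) := fun y => by
    rw [hc 1 (by decide) (by decide) y (F.c 4), F.R_eq ok (show Rt 6 1 3 4 1 by decide)]
    exact h3 _ (F.c_inj.ne (by decide))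
  have h0 : ∀ y, f (F.S 0 y) = f (F.S 3 (F.c 6)) := fun y => by
    rw [hc 0 (by decide) (by decide) y (F.c 2), F.R_eq ok (show Rt 6 0 1 2 0 by decide)]
    exact h1 _
  have h2 : ∀ y, f (F.S 2 y) = f (F.S 3 (F.c 6)) := fun y => by
    rw [hc 2 (by decide) (by decide) y (F.c 0), ← F.R_eq ok (show Rt 6 1 2 2 0 by decide)]
    exact h1 _
  have h6 : ∀ y, f (F.S 6 y) = f (F.S 3 (F.c 6)) := fun y => by
    rw [hc 6 (by decide) (by decide) y (F.c 4), ← F.R_eq ok (show Rt 6 5 6 6 4 by decide)]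
    exact h5 _
  have h46 : f (F.S 4 (F.c 6)) = f (F.S 3 (F.c 6)) := by
    rw [F.R_eq ok (show Rt 6 4 5 6 4 by decide)]; exact h5 _
  have h4 : ∀ e, e ≠ 1 → f (F.S 4 (F.c e)) ∈ ({f (F.S 3 (F.c 6)), f (F.S 4 (F.c 0)), f (F.S 4 (F.c 2))} : Finset (Fin 4)) := by
    intro e he
    have : e = 0 ∨ e = 2 ∨ cl (parT 6) 1 e = cl (parT 6) 1 6 := by revert e; decide +kernel
    rcases this with rfl | rfl | h
    · simp
    · simp
    · have h := F.c_same ok hf3 he (by decide) h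
      simp only [Function.comp_apply] at h
      rw [h, h46]; simp
  refine ⟨{f (F.S 3 (F.c 6)), f (F.S 4 (F.c 0)), f (F.S 4 (F.c 2))}, lt_of_le_of_lt Finset.card_le_three (by norm_num : 3 < 4), fun x hx => ?_⟩
  obtain ⟨d, y, rfl⟩ := F.cover x
  have hd : ∀ d : Fin 7, d = 0 ∨ d = 1 ∨ d = 2 ∨ d = 3 ∨ d = 4 ∨ d = 5 ∨ d = 6 := by decide
  rcases hd d with rfl | rfl | rfl | rfl | rfl | rfl | rfl
  · rw [h0]; simp
  · rw [h1]; simp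
  · rw [h2]; simp
  · rw [h3 y (by rintro rfl; exact hx rfl)]; simp
  · obtain ⟨e, he, h⟩ := F.c_val ok hf3 (x := y) (by rintro rfl; exact hx (F.R_eq ok e1).symm)
    simp only [Function.comp_apply] at h
    rw [h]
    exact h4 e he
  · rw [h5]; simp
  · rw [h6]; simp

/-- constants for the step -/
def kG3 : Fin 7 → Fin 7 → Fin 7 :=
  ![fun _ => 0, ![0, 0, 0, 0, 0, 6, 6], fun _ => 0, fun _ => 0, fun _ => 0, ![1, 1, 1, 1, 1, 1, 6], fun _ => 1]

def simG3 (a b : Fin 7) : Prop := a = b ∨ ((a = 0 ∨ a = 2 ∨ a = 4) ∧ (b = 0 ∨ b = 2 ∨ b = 4))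
instance (a b : Fin 7) : Decidable (simG3 a b) := by unfold simG3; infer_instance

def lG3 (s t a : Fin 7) : Fin 7 :=
  if t = s then cl (parT 2) 1 a else if s = 5 ∧ t = 6 then 5 else 1

lemma G3_base (F : IFS (Rt 2) X) (s : Fin 7) (hs : s = 5 ∨ s = 6) : ∃ f : X → Fin 7,
    (∀ x, x ≠ F.S s (F.c 1) → LC f x) ∧ (f (F.c 0) = f (F.c 2) ∧ f (F.c 0) = f (F.c 4)) ∧
    ∀ i : Fin 4, ∃ x, x ≠ F.S s (F.c 1) ∧ f x = ![0, 1, 2, 5] i := by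
  have ok := okT 2
  have ck : ∀ s : Fin 7, s = 5 ∨ s = 6 → ∀ d e a b, Rt 2 d e a b → (d = s ∧ a = 1) ∨ (e = s ∧ b = 1) ∨
      lG3 s d a = lG3 s e b := by
    intro s hs
    refine Rt_all 2 ?_
    rcases hs with rfl | rfl <;> decide +kernel
  have hl : ∀ t a : Fin 7, ¬ (t = s ∧ a = 1) → (if t = s then F.lab (parT 2) 1 (F.c a) else lG3 s t 0)
      = lG3 s t a := by
    intro t a h
    by_cases ht : t = s
    · rw [if_pos ht, F.lab_c ok (fun h' => h ⟨ht, h'⟩), lG3, if_pos ht]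
    · simp [lG3, ht]
  obtain ⟨f, h1, h2⟩ := F.ext_off (p := F.S s (F.c 1))
    (f := fun t x => if t = s then F.lab (parT 2) 1 x else lG3 s t 0) (by
    intro d e a b hR hp
    have n1 : ¬ (d = s ∧ a = 1) := by rintro ⟨rfl, rfl⟩; exact hp rfl
    have n2 : ¬ (e = s ∧ b = 1) := by rintro ⟨rfl, rfl⟩; exact hp (F.R_eq ok hR)
    have h3 := ck s hs d e a b hR
    have h3 : lG3 s d a = lG3 s e b := by tauto
    rw [← hl d a n1, ← hl e b n2] at h3
    exact h3) (by
    intro t z hz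
    by_cases ht : t = s
    · subst ht
      have : z ≠ F.c 1 := by rintro rfl; exact hz rfl
      simpa using F.lab_LC ok this
    · exact Eventually.of_forall fun y => by simp [ht])
  have hn : ∀ t y, t ≠ s → ¬ (t = 1 ∨ t = 5) → F.S t y ≠ F.S s (F.c 1) := by
    intro t y ht h h'
    rcases hs with rfl | rfl
    · have := F.glue_pieces ok (show Rt 2 5 1 1 6 by decide) h'
      tauto
    · have := F.glue_pieces ok (show Rt 2 6 5 1 6 by decide) h'
      tauto
  have hv : ∀ t, t ≠ s → ¬ (t = 1 ∨ t = 5) → f (F.c t) = lG3 s t 0 := by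
    intro t h h'
    rw [← F.S_c t, h2 t _ (hn t _ h h'), if_neg h]
  have hw : ∀ a, a ≠ 1 → F.S s (F.c a) ≠ F.S s (F.c 1) ∧ f (F.S s (F.c a)) = cl (parT 2) 1 a := by
    intro a ha
    have : F.S s (F.c a) ≠ F.S s (F.c 1) := (F.S_inj s).ne (F.c_inj.ne ha)
    exact ⟨this, by rw [h2 s _ this, if_pos rfl, F.lab_c ok ha]⟩
  refine ⟨f, h1, ⟨?_, ?_⟩, ?_⟩
  · rw [hv 0, hv 2] <;> rcases hs with rfl | rfl <;> decide
  · rw [hv 0, hv 4] <;> rcases hs with rfl | rfl <;> decide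
  · intro i
    fin_cases i
    · exact ⟨_, (hw 0 (by decide)).1, by rw [(hw 0 (by decide)).2]; decide +kernel⟩
    · refine ⟨F.c 0, ?_, ?_⟩
      · rw [← F.S_c 0]
        exact hn _ _ (by rcases hs with rfl | rfl <;> decide) (by decide)
      · rw [hv 0] <;> rcases hs with rfl | rfl <;> decide
    · exact ⟨_, (hw 2 (by decide)).1, by rw [(hw 2 (by decide)).2]; decide +kernel⟩
    · exact ⟨_, (hw 5 (by decide)).1, by rw [(hw 5 (by decide)).2]; decide +kernel⟩

lemma G3_ind (F : IFS (Rt 2) X) (s : Fin 7) (hs : s = 5 ∨ s = 6) : ∀ w : List (Fin 7),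
    F.In w (F.S s (F.c 1)) → ∃ f : X → Fin 7,
    (∀ x, x ≠ F.W w (F.S s (F.c 1)) → LC f x) ∧ (f (F.c 0) = f (F.c 2) ∧ f (F.c 0) = f (F.c 4)) ∧
    ∀ i : Fin 4, ∃ x, x ≠ F.W w (F.S s (F.c 1)) ∧ f x = ![0, 1, 2, 5] i := by
  intro w
  induction w with
  | nil => intro _; exact G3_base F s hs
  | cons t w ih =>
    rintro ⟨hIn, hIn'⟩
    obtain ⟨g, g1, ⟨g2, g3⟩, g4⟩ := ih hIn'
    have ok := okT 2
    have hsim : ∀ a b, simG3 a b → g (F.c a) = g (F.c b) := by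
      rintro a b (rfl | ⟨rfl | rfl | rfl, rfl | rfl | rfl⟩) <;> simp_all
    have ck : ∀ t : Fin 7, ∀ d e a b, Rt 2 d e a b →
        simG3 (if d = t then a else kG3 t d) (if e = t then b else kG3 t e) := by
      intro t
      refine Rt_all 2 ?_
      revert t
      decide +kernel
    obtain ⟨f, h1, h2, h3⟩ := F.ext_step (t := t) g1 (kG3 t)
      (fun d e a b hR _ => hsim _ _ (ck t d e a b hR))
    have hv : ∀ a, (a = 0 ∨ a = 2 ∨ a = 4) → f (F.c a) = g (F.c (if a = t then a else kG3 t a)) := by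
      intro a ha
      by_cases h : a = t
      · subst h
        rw [if_pos rfl]
        conv_lhs => rw [← F.S_c a]
        refine h2 _ ?_
        intro h'
        cases w with
        | nil =>
          have := F.c_single ok h'.symm
          rcases hs with rfl | rfl <;> rcases ha with rfl | rfl | rfl <;> exact absurd this.1 (by decide)
        | cons t' w' =>
          have := F.W_eq_c ok (u := t' :: w') (y := F.S s (F.c 1)) h'.symm
          have := F.c_single ok this.2
          rcases hs with rfl | rfl <;> rcases ha with rfl | rfl | rfl <;> exact absurd this.1 (by decide)
      · rw [if_neg h]
        conv_lhs => rw [← F.S_c a]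
        exact h3 _ _ h (fun h' => h (hIn _ _ h'))
    have ck2 : ∀ t a b : Fin 7, (a = 0 ∨ a = 2 ∨ a = 4) → (b = 0 ∨ b = 2 ∨ b = 4) →
      simG3 (if a = t then a else kG3 t a) (if b = t then b else kG3 t b) := by decide +kernel
    refine ⟨f, h1, ⟨?_, ?_⟩, fun i => ?_⟩
    · rw [hv 0 (by decide), hv 2 (by decide)]; exact hsim _ _ (ck2 _ _ _ (by decide) (by decide))
    · rw [hv 0 (by decide), hv 4 (by decide)]; exact hsim _ _ (ck2 _ _ _ (by decide) (by decide))
    · obtain ⟨x, hx, hx'⟩ := g4 i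
      exact ⟨F.S t x, (F.S_inj t).ne hx, by rw [h2 x hx, hx']⟩

lemma T1_not (F : IFS (Rt 2) X) : ¬ T1 X := by
  rintro ⟨p, hp, hp'⟩
  apply hp'
  have ok := okT 2
  have fin : ∀ s : Fin 7, (s = 5 ∨ s = 6) → ∀ w, F.In w (F.S s (F.c 1)) → Split 4 (F.W w (F.S s (F.c 1))) := by
    intro s hs w hw
    obtain ⟨f, h1, -, h2⟩ := G3_ind F s hs w hw
    exact Split_of_inj (by norm_num) f h1 ![0, 1, 2, 5] (by decide) h2
  rcases F.LS3_loc ok (ckT 2) (by norm_num) hp with ⟨w, d, -, rfl, h3⟩ | ⟨w, d, e, a, b, hR, hIn, rfl, h3⟩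
  · exact absurd h3 ((by decide +kernel : ∀ d, ¬ 4 ≤ cn (parT 2) d) d)
  · have ck : ∀ d e a b, Rt 2 d e a b → 4 ≤ cn (parT 2) a + cn (parT 2) b →
        ((d = 5 ∨ d = 6) ∧ a = 1) ∨ ((e = 5 ∨ e = 6) ∧ b = 1) := Rt_all 2 (by decide +kernel)
    rcases ck d e a b hR h3 with ⟨h, rfl⟩ | ⟨h, rfl⟩
    · exact fin d h w hIn
    · rw [F.R_eq ok hR] at hIn ⊢
      exact fin e h w hIn

end T1
end FC

set_option linter.unusedSectionVars false
set_option linter.unusedVariables false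
namespace FC

open Set Filter Topology

namespace IFS

variable {R : Fin 7 → Fin 7 → Fin 7 → Fin 7 → Prop} {par : Fin 7 → Fin 7 → Fin 7}
  {X : Type} [MetricSpace X] [CompactSpace X] (F : IFS R X)

lemma seg (ok : Ok R par) {x y z : Fin 7} (h1 : R x y z x) (h2 : R y z z x) {A : Type}
    {f : X → A} {r : X} (hf : ∀ p, p ≠ r → LC f p) (t : Fin 7) :
    (∃ r', F.S t r' = r ∧ ∀ n, F.Ln x y z n r') ∨ f (F.S t (F.c x)) = f (F.S t (F.c z)) := by
  by_cases hr : r ∈ range (F.S t)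
  · obtain ⟨r', rfl⟩ := hr
    by_cases h : ∀ n, F.Ln x y z n r'
    · exact Or.inl ⟨r', rfl, h⟩
    · push Not at h
      obtain ⟨n, hn⟩ := h
      exact Or.inr (F.line ok h1 h2 n (f ∘ F.S t) r' (F.LC_off_S hf) hn)
  · exact Or.inr (F.piece_const_S ok hf hr _ _)

lemma Ln_c (ok : Ok R par) {x y z a : Fin 7} {n : ℕ} (h : F.Ln x y z (n + 1) (F.c a)) :
    a = x ∨ a = y ∨ a = z := by
  obtain ⟨t, ht, r', hr, -⟩ := h
  rwa [← (F.c_single ok hr).1]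

/-- a far point with a unique exit is separated -/
lemma sep_W (ok : Ok R par) {A : Type} {f : X → A} {u : List (Fin 7)} {d b : Fin 7} {q' q : X}
    (hIn : F.In (u ++ [d]) q') (hf : ∀ x, x ≠ F.W (u ++ [d]) q' → LC f x)
    (hq : q ∉ range (F.W (u ++ [d]))) (hb : F.c b ≠ q')
    (hq' : ∀ b', Ex R d b' → F.c b' ≠ q' → b' ≠ b → f (F.W (u ++ [d]) (F.c b')) ≠ f q) :
    Sep (F.W (u ++ [d]) (F.c b)) (F.W (u ++ [d]) q') q := by
  refine single_exit (F.range_W_closed (u ++ [d])) ⟨_, rfl⟩ ((F.W_inj _).ne hb.symm)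
    (F.range_W_nhds hIn) hq hf ?_
  rintro x ⟨y, rfl⟩ hxe
  by_cases hy : F.In (u ++ [d]) y
  · exact Or.inl (F.range_W_nhds hy)
  · right
    obtain ⟨b', hb', rfl⟩ := F.exit_of_not_In ok u d y hy
    refine hq' b' hb' ?_ ?_
    · intro h; rw [h] at hy; exact hy hIn
    · rintro rfl; exact hxe rfl

/-- relabelling -/
def perm (F : IFS R X) (σ : Fin 7 ≃ Fin 7) (h : ∀ d e a b, R d e a b ↔ R (σ d) (σ e) (σ a) (σ b)) : IFS R X where
  S d := F.S (σ d)
  c d := F.c (σ d)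
  dist_S d := F.dist_S (σ d)
  cover x := by
    obtain ⟨d, y, hy⟩ := F.cover x
    exact ⟨σ.symm d, y, by simpa using hy⟩
  S_c d := F.S_c (σ d)
  c_inj := F.c_inj.comp σ.injective
  glue d e x y hde := by
    rw [F.glue _ _ _ _ (σ.injective.ne hde)]
    constructor
    · rintro ⟨a, b, hR, rfl, rfl⟩
      exact ⟨σ.symm a, σ.symm b, by rw [h]; simpa using hR, by simp, by simp⟩
    · rintro ⟨a, b, hR, rfl, rfl⟩
      exact ⟨_, _, (h _ _ _ _).1 hR, rfl, rfl⟩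
  glue_dist d e a b x y hR := F.glue_dist _ _ _ _ _ _ ((h _ _ _ _).1 hR)

lemma eq_of_forall_W {d : Fin 7} {r : X} (F : IFS R X) (h : ∀ n, ∃ y, F.W (List.replicate n d) y = r) : r = F.c d := by
  by_contra hne
  obtain ⟨n, hn⟩ := F.exists_small (dist_pos.2 hne)
  obtain ⟨y, hy⟩ := h n
  have := hn (List.replicate n d) (by simp) y (F.c d)
  rw [hy, F.W_rep] at this
  exact lt_irrefl _ this

lemma exists_far (F : IFS R X) {p q : X} (h : q ≠ p) : ∃ N, ∀ u : List (Fin 7), N ≤ u.length → p ∈ range (F.W u) →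
    q ∉ range (F.W u) := by
  obtain ⟨n, hn⟩ := F.exists_small (dist_pos.2 h)
  refine ⟨n, ?_⟩
  rintro u hu ⟨y, rfl⟩ ⟨z, rfl⟩
  exact lt_irrefl _ (hn u hu z y)

lemma In_W_rep (ok : Ok R par) {w : List (Fin 7)} {d : Fin 7} (h : F.In w (F.c d)) (n : ℕ) :
    F.In ((w ++ List.replicate n d) ++ [d]) (F.c d) ∧
    F.W ((w ++ List.replicate n d) ++ [d]) (F.c d) = F.W w (F.c d) := by
  have e : (w ++ List.replicate n d) ++ [d] = w ++ List.replicate (n+1) d := by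
    rw [List.append_assoc, ← List.replicate_succ']
  rw [e]
  refine ⟨(F.In_append _ _ _).2 ⟨by rwa [F.W_rep], F.In_rep ok _ _⟩, by rw [F.W_append, F.W_rep]⟩

lemma not_mem_of_R (ok : Ok R par) {d e : Fin 7} (hde : d ≠ e) (h : ¬ ∃ a b, R d e a b) (x : X) :
    F.S d x ∉ range (F.S e) := by
  rintro ⟨y, hy⟩
  obtain ⟨a, b, hR, -, -⟩ := (F.glue d e x y hde).1 hy.symm
  exact h ⟨a, b, hR⟩

lemma R_uniq (F : IFS R X) {d e a b : Fin 7} (hR : ∀ a' b', R d e a' b' → a' = a ∧ b' = b) (hde : d ≠ e) {x : X}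
    (h : F.S d x ∈ range (F.S e)) : x = F.c a := by
  obtain ⟨y, hy⟩ := h
  obtain ⟨a', b', hR', rfl, -⟩ := (F.glue d e x y hde).1 hy.symm
  rw [(hR _ _ hR').1]

end IFS

section T3
variable {X : Type} [MetricSpace X] [CompactSpace X]

lemma G6_inter (F : IFS (Rt 5) X) : ∀ (n : ℕ) (r : X), F.Ln 1 3 4 (n+2) r → F.Ln 1 5 6 (n+2) r →
    ∃ r', F.S 1 r' = r ∧ F.Ln 1 3 4 (n+1) r' ∧ F.Ln 1 5 6 (n+1) r' := by
  intro n r h1 h2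
  have ok := okT 5
  obtain ⟨t, ht, r1, h3, h4⟩ := h1
  obtain ⟨t', ht', r2, h5, h6⟩ := h2
  by_cases htt : t = t'
  · subst htt
    have : t = 1 := (by decide : ∀ t : Fin 7, (t = 1 ∨ t = 3 ∨ t = 4) → (t = 1 ∨ t = 5 ∨ t = 6) → t = 1) t ht ht'
    subst this
    rw [← h3] at h5
    have := F.S_inj _ h5
    subst this
    exact ⟨_, h3, h4, h6⟩
  · obtain ⟨a, b, hR, rfl, rfl⟩ := (F.glue _ _ _ _ htt).1 (h3.trans h5.symm)
    have k1 := F.Ln_c ok h4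
    have k2 := F.Ln_c ok h6
    exfalso
    have ck : ∀ t t' a b, Rt 5 t t' a b → (t = 1 ∨ t = 3 ∨ t = 4) → (t' = 1 ∨ t' = 5 ∨ t' = 6) →
      (a = 1 ∨ a = 3 ∨ a = 4) → (b = 1 ∨ b = 5 ∨ b = 6) → False := Rt_all 5 (by decide +kernel)
    exact ck _ _ _ _ hR ht ht' k1 k2

lemma T3_5 (F : IFS (Rt 5) X) : T3 X := by
  have ok := okT 5
  have e1 : Rt 5 3 5 6 4 := by decide
  have y1 : Rt 5 1 3 4 1 := by decide
  have y2 : Rt 5 3 4 4 1 := by decide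
  have x1 : Rt 5 1 5 6 1 := by decide
  have x2 : Rt 5 5 6 6 1 := by decide
  refine ⟨F.c 1, F.S 3 (F.c 6), F.LS_c ok (by norm_num) (by decide +kernel), fun h =>
    absurd (F.LS_single ok h) (by decide +kernel), F.Split_c ok (by norm_num) (by decide +kernel), ?_, ?_⟩
  · intro h
    have := F.c_single ok h.symm
    exact absurd this.1 (by decide)
  rintro r ⟨hr1, hr2, f, hf, hne⟩
  have s1 := F.seg ok y1 y2 hf 1
  have s2 := F.seg ok x1 x2 hf 3
  have s3 := F.seg ok x1 x2 hf 1
  have s4 := F.seg ok y1 y2 hf 5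
  have k6 : ∀ n, ¬ F.Ln 1 3 4 (n+1) (F.c 6) := fun n h => absurd (F.Ln_c ok h) (by decide)
  have k4 : ∀ n, ¬ F.Ln 1 5 6 (n+1) (F.c 4) := fun n h => absurd (F.Ln_c ok h) (by decide)
  have A : (∃ r', F.S 1 r' = r ∧ ∀ n, F.Ln 1 3 4 n r') ∨ (∃ r', F.S 3 r' = r ∧ ∀ n, F.Ln 1 5 6 n r') := by
    by_contra hcon
    rw [not_or] at hcon
    have a1 := s1.resolve_left hcon.1
    have a2 := s2.resolve_left hcon.2
    rw [F.S_c, F.R_eq ok y1, a2] at a1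
    exact hne a1
  have B : (∃ r', F.S 1 r' = r ∧ ∀ n, F.Ln 1 5 6 n r') ∨ (∃ r', F.S 5 r' = r ∧ ∀ n, F.Ln 1 3 4 n r') := by
    by_contra hcon
    rw [not_or] at hcon
    have a1 := s3.resolve_left hcon.1
    have a2 := s4.resolve_left hcon.2
    rw [F.S_c, F.R_eq ok x1, a2, ← F.R_eq ok e1] at a1
    exact hne a1
  have uq : ∀ d e a b, Rt 5 d e a b → ∀ a' b', Rt 5 d e a' b' → a' = a ∧ b' = b := by
    have : ∀ d e a b, Rt 5 d e a b → ∀ n ∈ tb 5, (dc n).1 = d → (dc n).2.1 = e → (dc n).2.2.1 = a ∧ (dc n).2.2.2 = b :=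
      Rt_all 5 (by decide +kernel)
    intro d e a b hR a' b' hR'
    have := this d e a b hR _ hR'
    simpa [dc_eq] using this
  rcases A with ⟨r1, hr, hL⟩ | ⟨r1, hr, hL⟩ <;> rcases B with ⟨r2, hr', hL'⟩ | ⟨r2, hr', hL'⟩
  · have := F.S_inj _ (hr.trans hr'.symm)
    subst this
    apply hr1
    have hw : ∀ n r1, (∀ m, F.Ln 1 3 4 m r1) → (∀ m, F.Ln 1 5 6 m r1) →
        ∃ y, F.W (List.replicate n 1) y = r1 := by
      intro n
      induction n with
      | zero => intro r1 _ _; exact ⟨r1, rfl⟩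
      | succ n ih =>
        intro r1 h1 h2
        obtain ⟨r', h3, h4, h5⟩ := G6_inter F 0 r1 (h1 _) (h2 _)
        have h6 : ∀ m, F.Ln 1 3 4 m r' := by
          intro m
          cases m with
          | zero => trivial
          | succ m =>
            obtain ⟨r'', h7, h8, h9⟩ := G6_inter F m r1 (h1 _) (h2 _)
            rw [← h3] at h7
            rwa [← F.S_inj _ h7]
        have h6' : ∀ m, F.Ln 1 5 6 m r' := by
          intro m
          cases m with
          | zero => trivial
          | succ m =>
            obtain ⟨r'', h7, h8, h9⟩ := G6_inter F m r1 (h1 _) (h2 _)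
            rw [← h3] at h7
            rwa [← F.S_inj _ h7]
        obtain ⟨y, hy⟩ := ih r' h6 h6'
        exact ⟨y, by rw [List.replicate_succ, F.W_cons, hy, h3]⟩
    have := F.eq_of_forall_W (d := 1) (r := r1) fun n => hw n r1 hL hL'
    rw [← hr, this, F.S_c]
  · have : F.S 1 r1 ∈ range (F.S 5) := ⟨r2, hr'.trans hr.symm⟩
    have := F.R_uniq (uq _ _ _ _ x1) (by decide) this
    subst this
    exact k6 0 (hL _)
  · have : F.S 1 r2 ∈ range (F.S 3) := ⟨r1, hr.trans hr'.symm⟩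
    have := F.R_uniq (uq _ _ _ _ y1) (by decide) this
    subst this
    exact k4 0 (hL' _)
  · have : F.S 3 r1 ∈ range (F.S 5) := ⟨r2, hr'.trans hr.symm⟩
    have := F.R_uniq (uq _ _ _ _ e1) (by decide) this
    subst this
    exact hr2 hr

lemma T3_not (F : IFS (Rt 6) X) : ¬ T3 X := by
  rintro ⟨p, q, h1, h2, ⟨f, hf, hs⟩, hpq, hconj⟩
  have ok := okT 6
  rcases F.LS3_loc ok (ckT 6) le_rfl h1 with ⟨w, d, hIn, rfl, h3⟩ | ⟨w, d, e, a, b, hR, -, rfl, h3⟩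
  swap
  · have ck : ∀ d e a b, Rt 6 d e a b → 3 ≤ cn (parT 6) a + cn (parT 6) b → 4 ≤ cn (parT 6) a + cn (parT 6) b :=
      Rt_all 6 (by decide +kernel)
    exact h2 (F.LS_W (F.LS_glue_of ok hR (by norm_num) (ck _ _ _ _ hR h3)) w)
  have hd : d = 1 := (by decide +kernel : ∀ d, 3 ≤ cn (parT 6) d → d = 1) d h3
  subst hd
  obtain ⟨N, hN⟩ := F.exists_far hpq.symm
  obtain ⟨hIn', hW⟩ := F.In_W_rep ok hIn N
  set u := w ++ List.replicate N 1 with hu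
  have hq : q ∉ range (F.W (u ++ [1])) := hN _ (by simp [hu]; omega) ⟨_, hW⟩
  rw [← hW] at hf hs hconj hpq
  have hg : ∀ y, y ≠ F.c 1 → LC (f ∘ F.W (u ++ [1])) y := F.LC_off_W hf
  have ckEx : ∀ b, Ex (Rt 6) 1 b → b ≠ 1 → b = 0 ∨ b = 2 ∨ b = 4 := by decide +kernel
  have ckcl : ∀ b, b ≠ 1 → ∃ b', (b' = 0 ∨ b' = 2 ∨ b' = 4) ∧ cl (parT 6) 1 b = cl (parT 6) 1 b' := by decide +kernel
  have hval : ∀ x, x ≠ F.W (u ++ [1]) (F.c 1) → ∃ b, (b = 0 ∨ b = 2 ∨ b = 4) ∧ f x = f (F.W (u ++ [1]) (F.c b)) := by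
    intro x hx
    by_cases hxU : x ∈ range (F.W (u ++ [1]))
    · obtain ⟨y, rfl⟩ := hxU
      obtain ⟨b, hb, h⟩ := F.c_val ok hg (x := y) (by rintro rfl; exact hx rfl)
      obtain ⟨b', hb', h'⟩ := ckcl b hb
      have hb1 : b' ≠ 1 := by rintro rfl; revert hb'; decide
      exact ⟨b', hb', by rw [← Function.comp_apply (f := f), h, F.c_same ok hg hb hb1 h']; rfl⟩
    · obtain ⟨b, hb, hb1, h⟩ := F.outside ok u 1 _ hIn' x hxU
      refine ⟨b, ckEx b hb (by rintro rfl; exact hb1 rfl), h _ f hf⟩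
  have hinj : ∀ b b', (b = 0 ∨ b = 2 ∨ b = 4) → (b' = 0 ∨ b' = 2 ∨ b' = 4) →
      f (F.W (u ++ [1]) (F.c b)) = f (F.W (u ++ [1]) (F.c b')) → b = b' := by
    intro b b' hb hb' h
    by_contra hbb
    have ck : ∀ b b' : Fin 7, (b = 0 ∨ b = 2 ∨ b = 4) → (b' = 0 ∨ b' = 2 ∨ b' = 4) → b ≠ b' →
      ∃ b'', ∀ t, (t = 0 ∨ t = 2 ∨ t = 4) → t = b ∨ t = b' ∨ t = b'' := by decide
    obtain ⟨b'', hb''⟩ := ck b b' hb hb' hbb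
    have h3 : ∀ i : Fin 3, i ∈ ({f (F.W (u ++ [1]) (F.c b)), f (F.W (u ++ [1]) (F.c b''))} : Finset (Fin 3)) := by
      intro i
      obtain ⟨x, hx, rfl⟩ := hs i
      obtain ⟨t, ht, ht'⟩ := hval x hx
      rcases hb'' t ht with rfl | rfl | rfl
      · simp [ht']
      · simp [ht', h]
      · simp [ht']
    have h4 : (Finset.univ : Finset (Fin 3)).card ≤ 2 :=
      (Finset.card_le_card (fun i _ => h3 i)).trans Finset.card_le_two
    simp at h4
  obtain ⟨b, hb, hqb⟩ := hval q (by rintro rfl; exact hpq rfl)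
  refine hconj _ (F.sep_W ok (b := b) hIn' hf hq ?_ ?_)
  · intro h
    have := F.c_inj h
    subst this
    revert hb; decide
  · intro b' hb' hb1 hbb h
    exact hbb (hinj _ _ (ckEx b' hb' (by rintro rfl; exact hb1 rfl)) hb (h.trans hqb))

end T3
end FC

set_option linter.unusedSectionVars false
set_option linter.unusedVariables false
namespace FC

open Set Filter Topology

section DC
variable {X : Type} [MetricSpace X] [CompactSpace X]

lemma cyc2_K (F : IFS (Rt 1) X) : ∀ (n : ℕ) (f : X → Bool) (z : X), (∀ x, x ≠ z → LC f x) →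
    z ∉ range (F.W (List.replicate n 1)) → f (F.c 0) = f (F.c 4) → f (F.c 1) = f (F.c 0) := by
  have ok := okT 1
  have r01 : Rt 1 0 1 2 0 := by decide
  have r03 : Rt 1 0 3 4 0 := by decide
  have r13 : Rt 1 1 3 4 2 := by decide
  have r34 : Rt 1 3 4 4 0 := by decide
  have c0 : ∀ e e', e ≠ 0 → e' ≠ 0 → cl (parT 1) 0 e = cl (parT 1) 0 e' := by decide +kernel
  have c4 : ∀ e e', e ≠ 4 → e' ≠ 4 → cl (parT 1) 4 e = cl (parT 1) 4 e' := by decide +kernel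
  have uq : ∀ d e a b, Rt 1 d e a b → ∀ a' b', Rt 1 d e a' b' → a' = a ∧ b' = b := by
    have : ∀ d e a b, Rt 1 d e a b → ∀ n ∈ tb 1, (dc n).1 = d → (dc n).2.1 = e → (dc n).2.2.1 = a ∧ (dc n).2.2.2 = b :=
      Rt_all 1 (by decide +kernel)
    intro d e a b hR a' b' hR'
    have := this d e a b hR _ hR'
    simpa [dc_eq] using this
  intro n
  induction n with
  | zero => intro f z _ hz; exact absurd ⟨z, rfl⟩ hz
  | succ n ih =>
    intro f z hf hz h04
    have hc : ∀ e, z ∉ range (F.S e) → ∀ x y, f (F.S e x) = f (F.S e y) := fun e h x y =>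
      F.piece_const_S ok hf h x y
    by_cases h1 : z ∈ range (F.S 1)
    · obtain ⟨z', rfl⟩ := h1
      have hz' : z' ∉ range (F.W (List.replicate n 1)) := by
        rintro ⟨y, rfl⟩
        exact hz ⟨y, rfl⟩
      have hg : ∀ x, x ≠ z' → LC (f ∘ F.S 1) x := F.LC_off_S hf
      have h4 : F.S 1 z' ∉ range (F.S 4) := F.not_mem_of_R ok (by decide) (by decide +kernel) _
      have e0 : F.S 1 z' ∉ range (F.S 0) → f (F.S 1 (F.c 0)) = f (F.c 0) := by
        intro h
        rw [← F.R_eq ok r01, hc 0 h _ (F.c 0), F.S_c]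
      have e3 : F.S 1 z' ∉ range (F.S 3) → f (F.S 1 (F.c 4)) = f (F.c 4) := by
        intro h
        rw [F.R_eq ok r13, hc 3 h _ (F.c 4), F.R_eq ok r34, hc 4 h4 _ (F.c 4), F.S_c]
      have e1 : (f ∘ F.S 1) (F.c 1) = f (F.c 1) := by rw [Function.comp_apply, F.S_c]
      by_cases h0 : F.S 1 z' ∈ range (F.S 0)
      · have := F.R_uniq (uq _ _ _ _ (ok.symm _ _ _ _ r01)) (by decide) h0
        subst this
        have h3 : F.S 1 (F.c 0) ∉ range (F.S 3) := fun h => by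
          have := F.c_inj (F.R_uniq (uq _ _ _ _ r13) (by decide) h)
          revert this; decide
        have := F.c_const ok hg c0 (x := F.c 1) (y := F.c 4) (F.c_inj.ne (by decide)) (F.c_inj.ne (by decide))
        rw [e1] at this
        rw [this, Function.comp_apply, e3 h3, h04]
      · by_cases h3 : F.S 1 z' ∈ range (F.S 3)
        · have := F.R_uniq (uq _ _ _ _ r13) (by decide) h3
          subst this
          have := F.c_const ok hg c4 (x := F.c 1) (y := F.c 0) (F.c_inj.ne (by decide)) (F.c_inj.ne (by decide))
          rw [e1] at this
          rw [this, Function.comp_apply, e0 h0]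
        · have := ih (f ∘ F.S 1) z' hg hz' (by
            rw [Function.comp_apply, Function.comp_apply, e0 h0, e3 h3, h04])
          rw [e1] at this
          rw [this, Function.comp_apply, e0 h0]
    · have e1 : f (F.c 1) = f (F.S 1 (F.c 0)) := by
        conv_lhs => rw [← F.S_c 1]
        exact hc 1 h1 _ _
      by_cases h0 : z ∈ range (F.S 0)
      · obtain ⟨z', rfl⟩ := h0
        by_cases h3 : F.S 0 z' ∈ range (F.S 3)
        · have := F.R_uniq (uq _ _ _ _ r03) (by decide) h3
          subst this
          have := F.c_const ok (F.LC_off_S hf) c4 (x := F.c 2) (y := F.c 0) (F.c_inj.ne (by decide)) (F.c_inj.ne (by decide))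
          simp only [Function.comp_apply] at this
          rw [e1, ← F.R_eq ok r01, this, F.S_c]
        · have hs : ∀ e y, F.S e y = F.S 0 z' → e = 0 := by
            intro e y hy
            by_contra he
            obtain ⟨a, b, hR, -, -⟩ := (F.glue _ _ _ _ he).1 hy
            have : e = 1 ∨ e = 3 := by
              have ck : ∀ e d a b, Rt 1 e d a b → d = 0 → e = 1 ∨ e = 3 := Rt_all 1 (by decide +kernel)
              exact ck _ _ _ _ hR rfl
            rcases this with rfl | rfl
            · exact h1 ⟨y, hy⟩
            · exact h3 ⟨y, hy⟩
          have := F.comp_const ok hf hs (e := 1) (e' := 4) (by decide) (by decide) (by decide +kernel) (F.c 0) (F.c 4)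
          rw [e1, this, F.S_c, h04]
      · rw [e1, ← F.R_eq ok r01, hc 0 h0 _ (F.c 0), F.S_c]

lemma cyc2_conj (F : IFS (Rt 1) X) : Conj (F.c 1) (F.S 0 (F.c 4)) := by
  have ok := okT 1
  have r01 : Rt 1 0 1 2 0 := by decide
  have r03 : Rt 1 0 3 4 0 := by decide
  have r13 : Rt 1 1 3 4 2 := by decide
  have c0 : ∀ e e', e ≠ 0 → e' ≠ 0 → cl (parT 1) 0 e = cl (parT 1) 0 e' := by decide +kernel
  have c4 : ∀ e e', e ≠ 4 → e' ≠ 4 → cl (parT 1) 4 e = cl (parT 1) 4 e' := by decide +kernel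
  have uq : ∀ d e a b, Rt 1 d e a b → ∀ a' b', Rt 1 d e a' b' → a' = a ∧ b' = b := by
    have : ∀ d e a b, Rt 1 d e a b → ∀ n ∈ tb 1, (dc n).1 = d → (dc n).2.1 = e → (dc n).2.2.1 = a ∧ (dc n).2.2.2 = b :=
      Rt_all 1 (by decide +kernel)
    intro d e a b hR a' b' hR'
    have := this d e a b hR _ hR'
    simpa [dc_eq] using this
  refine ⟨fun h => absurd (F.c_single ok h.symm).1 (by decide), ?_⟩
  rintro r ⟨hr1, hr2, f, hf, hne⟩
  apply hne
  have hc : ∀ e, r ∉ range (F.S e) → ∀ x y, f (F.S e x) = f (F.S e y) := fun e h x y =>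
    F.piece_const_S ok hf h x y
  have q0 : r ∉ range (F.S 0) → f (F.S 0 (F.c 4)) = f (F.S 1 (F.c 0)) := by
    intro h; rw [hc 0 h _ (F.c 2), F.R_eq ok r01]
  have q3 : r ∉ range (F.S 3) → f (F.S 0 (F.c 4)) = f (F.S 1 (F.c 4)) := by
    intro h; rw [F.R_eq ok r03, hc 3 h _ (F.c 2), F.R_eq ok r13]
  have e1 : f (F.S 1 (F.c 1)) = f (F.c 1) := by rw [F.S_c]
  by_cases h1 : r ∈ range (F.S 1)
  · obtain ⟨r', rfl⟩ := h1
    have hg : ∀ x, x ≠ r' → LC (f ∘ F.S 1) x := F.LC_off_S hf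
    by_cases h0 : F.S 1 r' ∈ range (F.S 0)
    · have := F.R_uniq (uq _ _ _ _ (ok.symm _ _ _ _ r01)) (by decide) h0
      subst this
      have h3 : F.S 1 (F.c 0) ∉ range (F.S 3) := fun h => by
        have := F.c_inj (F.R_uniq (uq _ _ _ _ r13) (by decide) h)
        revert this; decide
      have := F.c_const ok hg c0 (x := F.c 1) (y := F.c 4) (F.c_inj.ne (by decide)) (F.c_inj.ne (by decide))
      simp only [Function.comp_apply, e1] at this
      rw [this, q3 h3]
    · by_cases h3 : F.S 1 r' ∈ range (F.S 3)
      · have := F.R_uniq (uq _ _ _ _ r13) (by decide) h3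
        subst this
        have := F.c_const ok hg c4 (x := F.c 1) (y := F.c 0) (F.c_inj.ne (by decide)) (F.c_inj.ne (by decide))
        simp only [Function.comp_apply, e1] at this
        rw [this, q0 h0]
      · have hrc : r' ≠ F.c 1 := by rintro rfl; exact hr1 (F.S_c 1).symm
        have : ∃ n, r' ∉ range (F.W (List.replicate n 1)) := by
          by_contra hcon
          push Not at hcon
          exact hrc (F.eq_of_forall_W hcon)
        obtain ⟨n, hn⟩ := this
        have := cyc2_K F n (f ∘ F.S 1) r' hg hn (by
          rw [Function.comp_apply, Function.comp_apply, ← q0 h0, q3 h3])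
        simp only [Function.comp_apply, e1] at this
        rw [this, q0 h0]
  · by_cases h0 : r ∈ range (F.S 0)
    · have h3 : r ∉ range (F.S 3) := by
        intro h
        obtain ⟨r', rfl⟩ := h0
        have := F.R_uniq (uq _ _ _ _ r03) (by decide) h
        rw [this] at hr2
        exact hr2 rfl
      rw [q3 h3, ← e1]; exact hc 1 h1 _ _
    · rw [q0 h0, ← e1]; exact hc 1 h1 _ _

def swC2 : Fin 7 ≃ Fin 7 where
  toFun := ![2, 1, 0, 5, 6, 3, 4]
  invFun := ![2, 1, 0, 5, 6, 3, 4]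
  left_inv := by decide
  right_inv := by decide

lemma DC_1 (F : IFS (Rt 1) X) : DC X := by
  have ok := okT 1
  have hsw : ∀ d e a b, Rt 1 d e a b → Rt 1 (swC2 d) (swC2 e) (swC2 a) (swC2 b) :=
    Rt_all 1 (by decide +kernel)
  have hss : ∀ d, swC2 (swC2 d) = d := by decide
  have h2 := cyc2_conj (F.perm swC2 fun d e a b => ⟨hsw d e a b, fun h => by
    have := hsw _ _ _ _ h
    rwa [hss, hss, hss, hss] at this⟩)
  have h2 : Conj (F.c 1) (F.S 2 (F.c 6)) := h2
  have h1 := cyc2_conj F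
  refine ⟨_, _, _, h1, h2, h1.1.symm, h2.1.symm, fun x => decide (F.lab (parT 1) 1 x = 0), fun x hx => ?_, ?_⟩
  · exact (F.lab_LC ok hx).mono fun y hy => by simp [hy]
  · show decide (F.lab (parT 1) 1 (F.S 0 (F.c 4)) = 0) ≠ decide (F.lab (parT 1) 1 (F.S 2 (F.c 6)) = 0)
    rw [F.lab_S ok (by decide), F.lab_S ok (by decide)]
    decide +kernel

lemma dc_W (F : IFS (Rt 0) X) {f : X → Bool} {u : List (Fin 7)} {d b0 : Fin 7} {q' q₁ q₂ : X}
    (hIn : F.In (u ++ [d]) q') (hf : ∀ x, x ≠ F.W (u ++ [d]) q' → LC f x)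
    (h1 : q₁ ∉ range (F.W (u ++ [d]))) (h2 : q₂ ∉ range (F.W (u ++ [d]))) (hne : f q₁ ≠ f q₂)
    (hb0 : ∀ b b', Ex (Rt 0) d b → Ex (Rt 0) d b' → F.c b ≠ q' → F.c b' ≠ q' → b ≠ b0 → b' ≠ b0 →
      f (F.W (u ++ [d]) (F.c b)) = f (F.W (u ++ [d]) (F.c b'))) :
    ∃ r, Sep r (F.W (u ++ [d]) q') q₁ ∨ Sep r (F.W (u ++ [d]) q') q₂ := by
  have ok := okT 0
  obtain ⟨b1, hb1, hc1, g1⟩ := F.outside ok u d q' hIn q₁ h1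
  obtain ⟨b2, hb2, hc2, g2⟩ := F.outside ok u d q' hIn q₂ h2
  have g1 := g1 _ f hf
  have g2 := g2 _ f hf
  refine ⟨F.W (u ++ [d]) (F.c b0), ?_⟩
  by_cases h : b1 = b0
  · left
    subst h
    have hb : b2 ≠ b1 := by rintro rfl; exact hne (g1.trans g2.symm)
    refine F.sep_W ok hIn hf h1 hc1 fun b' hb' hc' hbb h => ?_
    rw [hb0 b' b2 hb' hb2 hc' hc2 hbb hb, ← g2] at h
    exact hne h.symm
  · by_cases h' : b2 = b0
    · right
      subst h'
      refine F.sep_W ok hIn hf h2 hc2 fun b' hb' hc' hbb h => ?_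
      rw [hb0 b' b1 hb' hb1 hc' hc1 hbb (by assumption), ← g1] at h
      exact hne h
    · exact absurd (g1.trans ((hb0 _ _ hb1 hb2 hc1 hc2 h h').trans g2.symm)) hne

lemma dc_glue (F : IFS (Rt 0) X) {f : X → Bool} {w : List (Fin 7)} {d e a b : Fin 7} {q₁ q₂ : X}
    (hR : Rt 0 d e a b) (ha : a = 2 ∨ a = 4 ∨ a = 6) (hIn : F.In w (F.S d (F.c a)))
    (hf : ∀ x, x ≠ F.W w (F.S d (F.c a)) → LC f x)
    (h1 : q₁ ≠ F.W w (F.S d (F.c a))) (h2 : q₂ ≠ F.W w (F.S d (F.c a))) (hne : f q₁ ≠ f q₂) :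
    ∃ r, Sep r (F.W w (F.S d (F.c a))) q₁ ∨ Sep r (F.W w (F.S d (F.c a))) q₂ := by
  have ok := okT 0
  obtain ⟨N1, hN1⟩ := F.exists_far h1
  obtain ⟨N2, hN2⟩ := F.exists_far h2
  set N := max N1 N2 with hN
  have hNa : N1 ≤ N := le_max_left _ _
  have hNb : N2 ≤ N := le_max_right _ _
  set p := F.W w (F.S d (F.c a)) with hp
  -- words
  set u1 := w ++ [d] ++ List.replicate N a with hu1
  set u2 := w ++ [e] ++ List.replicate N b with hu2
  have hW1 : ∀ y, F.W (u1 ++ [a]) y = F.W w (F.S d (F.W (List.replicate (N+1) a) y)) := by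
    intro y
    rw [hu1, List.replicate_succ', F.W_append, F.W_append, F.W_append, F.W_append]; rfl
  have hW2 : ∀ y, F.W (u2 ++ [b]) y = F.W w (F.S e (F.W (List.replicate (N+1) b) y)) := by
    intro y
    rw [hu2, List.replicate_succ', F.W_append, F.W_append, F.W_append, F.W_append]; rfl
  have hp1 : F.W (u1 ++ [a]) (F.c a) = p := by rw [hW1, F.W_rep]
  have hp2 : F.W (u2 ++ [b]) (F.c b) = p := by rw [hW2, F.W_rep, ← F.R_eq ok hR]
  set U := range (F.W (u1 ++ [a])) ∪ range (F.W (u2 ++ [b])) with hU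
  have hUc : IsClosed U := (F.range_W_closed _).union (F.range_W_closed _)
  have hl : ∀ n (c : Fin 7), range (F.W (List.replicate n c)) ∈ 𝓝 (F.c c) := by
    intro n c
    have := F.range_W_nhds (F.In_rep ok n c)
    rwa [F.W_rep] at this
  have hUp : U ∈ 𝓝 p := by
    rw [hp]
    refine (F.eventually_W hIn (P := fun z => z ∈ U)).2 ?_
    refine (F.eventually_glue ok hR (P := fun z => F.W w z ∈ U)).2 ⟨?_, ?_⟩
    · filter_upwards [hl (N+1) a] with z hz
      obtain ⟨y, rfl⟩ := hz
      exact Or.inl ⟨y, hW1 y⟩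
    · filter_upwards [hl (N+1) b] with z hz
      obtain ⟨y, rfl⟩ := hz
      exact Or.inr ⟨y, hW2 y⟩
  have hq1 : q₁ ∉ U := by
    rintro (h | h)
    · exact hN1 _ (by simp [hu1]; omega) ⟨_, hp1⟩ h
    · exact hN1 _ (by simp [hu2]; omega) ⟨_, hp2⟩ h
  have hq2 : q₂ ∉ U := by
    rintro (h | h)
    · exact hN2 _ (by simp [hu1]; omega) ⟨_, hp1⟩ h
    · exact hN2 _ (by simp [hu2]; omega) ⟨_, hp2⟩ h
  -- constancy on the sides
  have hg2 : ∀ y, y ≠ F.c b → LC (f ∘ F.W (u2 ++ [b])) y := F.LC_off_W (by rw [hp2]; exact hf)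
  have cb : ∀ e e', e ≠ b → e' ≠ b → cl (parT 0) b e = cl (parT 0) b e' := by
    have : ∀ d e a b, Rt 0 d e a b → ∀ e e', e ≠ b → e' ≠ b → cl (parT 0) b e = cl (parT 0) b e' :=
      Rt_all 0 (by decide +kernel)
    exact this _ _ _ _ hR
  have ex1 : ∀ b', Ex (Rt 0) a b' → b' ≠ a → b' = 0 := by
    rcases ha with rfl | rfl | rfl <;> decide +kernel
  obtain ⟨b0, hb0⟩ := exists_ne b
  have bd : ∀ x ∈ U, U ∉ 𝓝 x → x = F.W (u1 ++ [a]) (F.c 0) ∨ f x = f (F.W (u2 ++ [b]) (F.c b0)) := by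
    rintro x (⟨y, rfl⟩ | ⟨y, rfl⟩) hx
    · left
      have : ¬ F.In (u1 ++ [a]) y := fun h => hx (mem_of_superset (F.range_W_nhds h) subset_union_left)
      obtain ⟨b', hb', rfl⟩ := F.exit_of_not_In ok u1 a y this
      have : b' ≠ a := by rintro rfl; rw [hp1] at hx; exact hx hUp
      rw [ex1 b' hb' this]
    · right
      have : y ≠ F.c b := by rintro rfl; rw [hp2] at hx; exact hx hUp
      exact F.c_const ok hg2 cb this (F.c_inj.ne hb0)
  have ha0 : F.c 0 ≠ F.c a := F.c_inj.ne (by rcases ha with rfl | rfl | rfl <;> decide)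
  have hpe : p ≠ F.W (u1 ++ [a]) (F.c 0) := by
    rw [← hp1]; exact (F.W_inj _).ne ha0.symm
  have fin : ∀ q, q ∉ U → f q ≠ f (F.W (u2 ++ [b]) (F.c b0)) → Sep (F.W (u1 ++ [a]) (F.c 0)) p q := by
    intro q hq hv
    refine single_exit hUc (Or.inl ⟨_, rfl⟩) hpe hUp hq hf fun x hx hxe => ?_
    by_cases h : U ∈ 𝓝 x
    · exact Or.inl h
    · right
      rw [(bd x hx h).resolve_left hxe]
      exact hv.symm
  by_cases h : f q₁ = f (F.W (u2 ++ [b]) (F.c b0))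
  · exact ⟨_, Or.inr (fin q₂ hq2 (by rw [← h]; exact hne.symm))⟩
  · exact ⟨_, Or.inl (fin q₁ hq1 h)⟩

lemma DC_not (F : IFS (Rt 0) X) : ¬ DC X := by
  rintro ⟨p, q₁, q₂, ⟨hp1, hc1⟩, ⟨hp2, hc2⟩, -, -, f, hf, hne⟩
  have ok := okT 0
  suffices ∃ r, Sep r p q₁ ∨ Sep r p q₂ by
    obtain ⟨r, h | h⟩ := this
    · exact hc1 _ h
    · exact hc2 _ h
  obtain ⟨N1, hN1⟩ := F.exists_far hp1.symm
  obtain ⟨N2, hN2⟩ := F.exists_far hp2.symm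
  rcases F.classify ok p with ⟨hs, hn⟩ | ⟨w, d, hIn, hp⟩ | ⟨w, d, e, a, b, hR, hIn, hp⟩
  · obtain ⟨n, hn1, hn2⟩ := hn (max N1 N2)
    have hNa : N1 ≤ max N1 N2 := le_max_left _ _
    have hNb : N2 ≤ max N1 N2 := le_max_right _ _
    have hpre := F.pre_succ n p
    have hIn := F.In_pre (n+1) p (fun m _ => hs m)
    have hW := F.W_pre (n+1) p
    have hlen := F.pre_length (n+1) p
    rw [hpre] at hIn hW hlen
    set d := F.dig (F.tl^[n] p)
    set d' := F.dig (F.tl^[n+1] p)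
    have hsing : ∀ e y, F.S e y = F.tl^[n+1] p → e = d' := hs (n+1)
    have ck : ∀ d d' : Fin 7, d ≠ d' → ∃ b0, ∀ b b', Ex (Rt 0) d b → Ex (Rt 0) d b' → b ≠ b0 → b' ≠ b0 →
        b = b' ∨ (b ≠ d' ∧ b' ≠ d' ∧ cl (parT 0) d' b = cl (parT 0) d' b') := by decide +kernel
    obtain ⟨b0, hb0⟩ := ck d d' hn2
    rw [← hW] at hf ⊢
    refine dc_W F (b0 := b0) hIn hf (hN1 _ (by omega) ⟨_, hW⟩) (hN2 _ (by omega) ⟨_, hW⟩) hne ?_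
    intro b b' hb hb' _ _ h1 h2
    rcases hb0 b b' hb hb' h1 h2 with rfl | ⟨h3, h4, h5⟩
    · rfl
    · have := F.comp_const ok (F.LC_off_W hf) hsing h3 h4 h5 (F.c b) (F.c b')
      rwa [F.S_c, F.S_c] at this
  · obtain ⟨hIn', hW⟩ := F.In_W_rep ok hIn (max N1 N2)
    have hNa : N1 ≤ max N1 N2 := le_max_left _ _
    have hNb : N2 ≤ max N1 N2 := le_max_right _ _
    rw [← hp] at hW
    have ck : ∀ d : Fin 7, ∃ b0, ∀ b b', (Ex (Rt 0) d b ∧ b ≠ d ∧ b ≠ b0) → (Ex (Rt 0) d b' ∧ b' ≠ d ∧ b' ≠ b0) →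
        cl (parT 0) d b = cl (parT 0) d b' := by decide +kernel
    obtain ⟨b0, hb0⟩ := ck d
    rw [← hW] at hf ⊢
    refine dc_W F (b0 := b0) hIn' hf (hN1 _ (by simp; omega) ⟨_, hW⟩) (hN2 _ (by simp; omega) ⟨_, hW⟩) hne ?_
    intro b b' hb hb' h1 h2 h3 h4
    have h1 : b ≠ d := by rintro rfl; exact h1 rfl
    have h2 : b' ≠ d := by rintro rfl; exact h2 rfl
    exact F.c_same ok (F.LC_off_W hf) h1 h2 (hb0 b b' ⟨hb, h1, h3⟩ ⟨hb', h2, h4⟩)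
  · have ck : ∀ d e a b, Rt 0 d e a b → (a = 2 ∨ a = 4 ∨ a = 6) ∨ (b = 2 ∨ b = 4 ∨ b = 6) :=
      Rt_all 0 (by decide +kernel)
    rcases ck d e a b hR with h | h
    · rw [hp] at hf hp1 hp2 ⊢
      exact dc_glue F hR h hIn hf hp1.symm hp2.symm hne
    · rw [F.R_eq ok hR] at hIn hp
      rw [hp] at hf hp1 hp2 ⊢
      exact dc_glue F (ok.symm _ _ _ _ hR) h hIn hf hp1.symm hp2.symm hne

end DC
end FC

set_option linter.unusedSectionVars false
set_option linter.unusedVariables false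
namespace FC

open Set Filter Topology

namespace IFS

variable {R : Fin 7 → Fin 7 → Fin 7 → Fin 7 → Prop} {par : Fin 7 → Fin 7 → Fin 7}
  {X : Type} [MetricSpace X] [CompactSpace X] (F : IFS R X)

/-- three-way splitting: values are determined by the three exits -/
lemma split3 (ok : Ok R par) {u : List (Fin 7)} {d x y z : Fin 7} (hIn : F.In (u ++ [d]) (F.c d))
    (ckEx : ∀ b, Ex R d b → b ≠ d → b = x ∨ b = y ∨ b = z)
    (hx : x ≠ d) (hy : y ≠ d) (hz : z ≠ d)
    (ckcl : ∀ b, b ≠ d → ∃ b', (b' = x ∨ b' = y ∨ b' = z) ∧ cl par d b = cl par d b')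
    {f : X → Fin 3} (hf : ∀ p, p ≠ F.W (u ++ [d]) (F.c d) → LC f p)
    (hs : ∀ i, ∃ p, p ≠ F.W (u ++ [d]) (F.c d) ∧ f p = i) :
    ∀ b b', (b = x ∨ b = y ∨ b = z) → (b' = x ∨ b' = y ∨ b' = z) →
      f (F.W (u ++ [d]) (F.c b)) = f (F.W (u ++ [d]) (F.c b')) → b = b' := by
  have hg : ∀ y, y ≠ F.c d → LC (f ∘ F.W (u ++ [d])) y := F.LC_off_W hf
  have hval : ∀ p, p ≠ F.W (u ++ [d]) (F.c d) → ∃ b, (b = x ∨ b = y ∨ b = z) ∧ f p = f (F.W (u ++ [d]) (F.c b)) := by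
    intro p hp
    by_cases hxU : p ∈ range (F.W (u ++ [d]))
    · obtain ⟨y', rfl⟩ := hxU
      obtain ⟨b, hb, h⟩ := F.c_val ok hg (x := y') (by rintro rfl; exact hp rfl)
      obtain ⟨b', hb', h'⟩ := ckcl b hb
      have hb1 : b' ≠ d := by rcases hb' with rfl | rfl | rfl <;> assumption
      exact ⟨b', hb', by rw [← Function.comp_apply (f := f), h, F.c_same ok hg hb hb1 h']; rfl⟩
    · obtain ⟨b, hb, hb1, h⟩ := F.outside ok u d _ hIn p hxU
      refine ⟨b, ckEx b hb (by rintro rfl; exact hb1 rfl), h _ f hf⟩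
  intro b b' hb hb' h
  by_contra hbb
  have ck : ∃ b'', ∀ t, (t = x ∨ t = y ∨ t = z) → t = b ∨ t = b' ∨ t = b'' := by
    rcases hb with rfl | rfl | rfl <;> rcases hb' with rfl | rfl | rfl
    · exact absurd rfl hbb
    · exact ⟨z, by tauto⟩
    · exact ⟨y, by tauto⟩
    · exact ⟨z, by tauto⟩
    · exact absurd rfl hbb
    · exact ⟨x, by tauto⟩
    · exact ⟨y, by tauto⟩
    · exact ⟨x, by tauto⟩
    · exact absurd rfl hbb
  obtain ⟨b'', hb''⟩ := ck
  have h3 : ∀ i : Fin 3, i ∈ ({f (F.W (u ++ [d]) (F.c b)), f (F.W (u ++ [d]) (F.c b''))} : Finset (Fin 3)) := by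
    intro i
    obtain ⟨p, hp, rfl⟩ := hs i
    obtain ⟨t, ht, ht'⟩ := hval p hp
    rcases hb'' t ht with rfl | rfl | rfl
    · simp [ht']
    · simp [ht', h]
    · simp [ht']
  have h4 : (Finset.univ : Finset (Fin 3)).card ≤ 2 :=
    (Finset.card_le_card (fun i _ => h3 i)).trans Finset.card_le_two
  simp at h4

/-- separation by a point inside a piece -/
lemma sep_in (ok : Ok R par) {A B : Type} {f : X → A} {h : X → B} {u : List (Fin 7)} {d : Fin 7} {q' q r : X}
    (hIn : F.In (u ++ [d]) q') (hf : ∀ x, x ≠ F.W (u ++ [d]) q' → LC f x)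
    (hq : q ∉ range (F.W (u ++ [d]))) (hr : ∀ y, y ≠ r → LC h y) (hqr : q' ≠ r)
    (hq' : ∀ b', Ex R d b' → F.c b' ≠ q' → h (F.c b') = h q' → f (F.W (u ++ [d]) (F.c b')) ≠ f q) 
    (hrIn : F.In (u ++ [d]) r) :
    Sep (F.W (u ++ [d]) r) (F.W (u ++ [d]) q') q := by
  set V : Set X := {y | h y = h q' ∨ y = r} with hV
  have hVn : ∀ y, y ≠ r → y ∈ V → V ∈ 𝓝 y := by
    intro y hy hyV
    filter_upwards [hr y hy] with z hz
    exact Or.inl (hz.trans (hyV.resolve_right hy))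
  have hVc : IsClosed V := by
    rw [← isOpen_compl_iff, isOpen_iff_mem_nhds]
    intro y hy
    have hy : ¬ (h y = h q' ∨ y = r) := hy
    push Not at hy
    filter_upwards [hr y hy.2, isOpen_compl_singleton.mem_nhds hy.2] with z hz hzr
    rintro (h1 | h1)
    · exact hy.1 (hz ▸ h1)
    · exact hzr h1
  refine single_exit (U := F.W (u ++ [d]) '' V) ?_ ⟨r, Or.inr rfl, rfl⟩ ((F.W_inj _).ne hqr) ?_ ?_ hf ?_
  · exact (hVc.isCompact.image (F.W_cont _)).isClosed
  · refine (F.eventually_W hIn).2 ?_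
    filter_upwards [hVn q' hqr (Or.inl rfl)] with z hz
    exact ⟨z, hz, rfl⟩
  · rintro ⟨y, -, rfl⟩; exact hq ⟨y, rfl⟩
  · rintro x ⟨y, hy, rfl⟩ hxe
    have hyr : y ≠ r := by rintro rfl; exact hxe rfl
    by_cases hyI : F.In (u ++ [d]) y
    · left
      refine (F.eventually_W hyI).2 ?_
      filter_upwards [hVn y hyr hy] with z hz
      exact ⟨z, hz, rfl⟩
    · right
      obtain ⟨b', hb', rfl⟩ := F.exit_of_not_In ok u d y hyI
      refine hq' b' hb' ?_ (hy.resolve_right hyr)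
      intro h; rw [h] at hyI; exact hyI hIn

end IFS

section WW
variable {X : Type} [MetricSpace X] [CompactSpace X]

lemma C_q (F : IFS (Rt 4) X) (w : List (Fin 7)) (hIn : F.In w (F.c 1))
    (h : ∀ n, F.Ln 1 4 6 n (F.W w (F.c 1))) : F.W w (F.c 1) = F.c 1 := by
  have ok := okT 4
  induction w with
  | nil => rfl
  | cons d w ih =>
    obtain ⟨hu, hIn'⟩ := hIn
    have h2 : (∀ n, F.Ln 1 4 6 n (F.W w (F.c 1))) ∧ (d = 1 ∨ d = 4 ∨ d = 6) := by
      have : ∀ n, F.Ln 1 4 6 n (F.W w (F.c 1)) ∧ (d = 1 ∨ d = 4 ∨ d = 6) := by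
        intro n
        obtain ⟨t, ht, r', hr, hl⟩ := h (n+1)
        have hr : F.S t r' = F.S d (F.W w (F.c 1)) := hr
        have := hu _ _ hr
        subst this
        rw [← F.S_inj _ hr]
        exact ⟨hl, ht⟩
      exact ⟨fun n => (this n).1, (this 0).2⟩
    have h3 := ih hIn' h2.1
    rw [F.W_cons, h3]
    rw [h3] at hu
    rcases h2.2 with rfl | rfl | rfl
    · exact F.S_c 1
    · have := hu _ _ (F.R_eq ok (show Rt 4 1 4 6 1 by decide +kernel))
      exact absurd this (by decide)
    · have := hu _ _ (F.R_eq ok (show Rt 4 4 6 6 1 by decide +kernel))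
      exact absurd this (by decide)

/-- removal of `r` does not separate the first bar -/
def CQ (F : IFS (Rt 4) X) (r : X) : Prop := ∀ f : X → Bool, (∀ x, x ≠ r → LC f x) →
  f (F.c 0) = f (F.c 1) ∧ f (F.c 1) = f (F.c 2)

lemma CQ_step (F : IFS (Rt 4) X) (r : X)
    (h : ∀ t r', (t = 0 ∨ t = 1 ∨ t = 2) → F.S t r' = r → CQ F r') : CQ F r := by
  intro f hf
  have ok := okT 4
  have key : ∀ t, (t = 0 ∨ t = 1 ∨ t = 2) → f (F.S t (F.c 0)) = f (F.S t (F.c 1)) ∧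
      f (F.S t (F.c 1)) = f (F.S t (F.c 2)) := by
    intro t ht
    by_cases hr : r ∈ range (F.S t)
    · obtain ⟨r', rfl⟩ := hr
      exact h t r' ht rfl (f ∘ F.S t) (F.LC_off_S hf)
    · exact ⟨F.piece_const_S ok hf hr _ _, F.piece_const_S ok hf hr _ _⟩
  have k0 := key 0 (by simp)
  have k1 := key 1 (by simp)
  have k2 := key 2 (by simp)
  have g1 := F.R_eq ok (show Rt 4 0 1 2 0 by decide +kernel)
  have g2 := F.R_eq ok (show Rt 4 1 2 2 0 by decide +kernel)
  rw [F.S_c] at k0 k1 k2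
  rw [g1] at k0
  rw [g2] at k1
  exact ⟨(k0.1.trans k0.2).trans k1.1, k1.2.trans (k2.1.trans k2.2)⟩

lemma CQ_c (F : IFS (Rt 4) X) (a : Fin 7) (ha : a = 4 ∨ a = 6) : CQ F (F.c a) := by
  intro f hf
  have ok := okT 4
  rcases ha with rfl | rfl <;>
  exact ⟨F.c_same ok hf (by decide) (by decide) (by decide +kernel),
    F.c_same ok hf (by decide) (by decide) (by decide +kernel)⟩

lemma CQ_W (F : IFS (Rt 4) X) (r : X) (w : List (Fin 7)) (hIn : F.In w r) (h : CQ F r) : CQ F (F.W w r) := by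
  induction w with
  | nil => exact h
  | cons d w ih =>
    obtain ⟨hu, hIn'⟩ := hIn
    refine CQ_step F _ fun t r' _ hr => ?_
    have hr : F.S t r' = F.S d (F.W w r) := hr
    have := hu _ _ hr
    subst this
    rw [F.S_inj _ hr]
    exact ih hIn'

lemma WW_4 (F : IFS (Rt 4) X) : WW X := by
  have ok := okT 4
  refine ⟨F.c 1, F.LS_c ok (by norm_num) (by decide +kernel), fun h => absurd (F.LS_single ok h) (by decide +kernel),
    F.Split_c ok (by norm_num) (by decide +kernel), ⟨F.c 6, F.c_inj.ne (by decide), ?_⟩,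
    ⟨F.c 2, F.c_inj.ne (by decide), ?_⟩⟩
  · rintro r ⟨hr1, hr2, f, hf, hne⟩ ⟨h3, h4⟩
    have hL : ∀ n, F.Ln 1 4 6 n r := by
      by_contra hcon
      push Not at hcon
      obtain ⟨n, hn⟩ := hcon
      exact hne (F.line ok (by decide +kernel) (by decide +kernel) n f r hf hn)
    rcases F.LS3_loc ok (ckT 4) le_rfl h3 with ⟨w, d, hIn, rfl, h5⟩ | ⟨w, d, e, a, b, hR, -, rfl, h5⟩
    · rcases (by decide +kernel : ∀ d, 3 ≤ cn (parT 4) d → d = 1 ∨ 4 ≤ cn (parT 4) d) d h5 with rfl | h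
      · exact hr1 (C_q F w hIn hL).symm
      · exact h4 (F.LS_W (F.LS_c ok (by norm_num) h) w)
    · have ck : ∀ d e a b, Rt 4 d e a b → 3 ≤ cn (parT 4) a + cn (parT 4) b → 4 ≤ cn (parT 4) a + cn (parT 4) b :=
        Rt_all 4 (by decide +kernel)
      exact h4 (F.LS_W (F.LS_glue_of ok hR (by norm_num) (ck _ _ _ _ hR h5)) w)
  · rintro r ⟨hr1, hr2, f, hf, hne⟩ h4
    suffices CQ F r from hne (this f hf).2
    rcases F.LS3_loc ok (ckT 4) (by norm_num) h4 with ⟨w, d, hIn, rfl, h3⟩ | ⟨w, d, e, a, b, hR, hIn, rfl, h3⟩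
    · have := (by decide +kernel : ∀ d, 4 ≤ cn (parT 4) d → d = 4) d h3
      subst this
      exact CQ_W F _ w hIn (CQ_c F _ (Or.inl rfl))
    · refine CQ_W F _ w hIn (CQ_step F _ fun t r' ht hr => ?_)
      have ck : ∀ d e a b, Rt 4 d e a b → 4 ≤ cn (parT 4) a + cn (parT 4) b →
          ((d = 0 ∨ d = 1 ∨ d = 2) → a = 6) ∧ ((e = 0 ∨ e = 1 ∨ e = 2) → b = 6) :=
        Rt_all 4 (by decide +kernel)
      obtain ⟨k1, k2⟩ := ck _ _ _ _ hR h3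
      rcases F.glue_pieces ok hR hr with ⟨rfl, rfl⟩ | ⟨rfl, rfl⟩
      · exact CQ_c F _ (Or.inr (k1 ht))
      · exact CQ_c F _ (Or.inr (k2 ht))

/-- interior separators for D1 -/
lemma D1_h (F : IFS (Rt 7) X) (b : Fin 7) (hb : b = 0 ∨ b = 2 ∨ b = 4) : ∃ (a : Fin 7) (h : X → Fin 7),
    cn (parT 7) a = 3 ∧ b ≠ a ∧ ¬ Mk (Rt 7) b a ∧
    (∀ y, y ≠ F.S b (F.c a) → LC h y) ∧ h (F.c b) ≠ h (F.c 1) := by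
  have ok := okT 7
  have main : ∀ a k, b ≠ 1 → b ≠ a → k ≠ a → cn (parT 7) a = 3 → ¬ Mk (Rt 7) b a →
      cl (parT 7) a b ≠ cl (parT 7) a k → 
      (∀ d e a' b', Rt 7 d e a' b' → (if d = b then a' else k) = (if e = b then b' else k)) →
      ∃ (a : Fin 7) (h : X → Fin 7), cn (parT 7) a = 3 ∧ b ≠ a ∧ ¬ Mk (Rt 7) b a ∧
    (∀ y, y ≠ F.S b (F.c a) → LC h y) ∧ h (F.c b) ≠ h (F.c 1) := by
    intro a k hb1 hba hka hcn hMk hcl hk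
    obtain ⟨f, h1, h2, h3⟩ := F.ext_step (t := b) (fun x hx => F.lab_LC ok (d := a) hx) (fun _ => k)
      (fun d e a' b' hR _ => by rw [hk _ _ _ _ hR])
    refine ⟨a, f, hcn, hba, hMk, h1, ?_⟩
    have e1 := h2 (F.c b) (F.c_inj.ne hba)
    rw [F.S_c] at e1
    have e2 := h3 1 (F.c 1) hb1.symm (by
      rw [F.S_c]
      intro h
      exact hb1 (F.c_single ok h.symm).1)
    rw [F.S_c] at e2
    rw [e1, e2, F.lab_c ok hba, F.lab_c ok hka]
    exact hcl
  rcases hb with rfl | rfl | rfl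
  · exact main 1 2 (by decide) (by decide) (by decide) (by decide +kernel) (by decide +kernel) (by decide +kernel)
      (Rt_all 7 (by decide +kernel))
  · exact main 1 0 (by decide) (by decide) (by decide) (by decide +kernel) (by decide +kernel) (by decide +kernel)
      (Rt_all 7 (by decide +kernel))
  · exact main 3 1 (by decide) (by decide) (by decide) (by decide +kernel) (by decide +kernel) (by decide +kernel)
      (Rt_all 7 (by decide +kernel))

lemma WW_not (F : IFS (Rt 7) X) : ¬ WW X := by
  rintro ⟨p, h1, h2, ⟨f, hf, hs⟩, ⟨q, hq1, hq2⟩, ⟨q', hq1', hq2'⟩⟩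
  have ok := okT 7
  rcases F.LS3_loc ok (ckT 7) le_rfl h1 with ⟨w, d, hIn, rfl, h3⟩ | ⟨w, d, e, a, b, hR, -, rfl, h3⟩
  swap
  · have ck : ∀ d e a b, Rt 7 d e a b → 3 ≤ cn (parT 7) a + cn (parT 7) b → 4 ≤ cn (parT 7) a + cn (parT 7) b :=
      Rt_all 7 (by decide +kernel)
    exact h2 (F.LS_W (F.LS_glue_of ok hR (by norm_num) (ck _ _ _ _ hR h3)) w)
  rcases (by decide +kernel : ∀ d, 3 ≤ cn (parT 7) d → d = 1 ∨ d = 3) d h3 with rfl | rfl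
  · obtain ⟨N, hN⟩ := F.exists_far hq1
    obtain ⟨hIn', hW⟩ := F.In_W_rep ok hIn N
    set u := w ++ List.replicate N 1 with hu
    have hq : q ∉ range (F.W (u ++ [1])) := hN _ (by simp [hu]; omega) ⟨_, hW⟩
    rw [← hW] at hf hs hq2
    have ckEx : ∀ b, Ex (Rt 7) 1 b → b ≠ 1 → b = 0 ∨ b = 2 ∨ b = 4 := by decide +kernel
    have hinj := F.split3 ok hIn' ckEx (by decide) (by decide) (by decide) (by decide +kernel) hf hs
    obtain ⟨b, hb, hb1, hqb⟩ := F.outside ok u 1 _ hIn' q hq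
    have hqb := hqb _ f hf
    have hb := ckEx b hb (by rintro rfl; exact hb1 rfl)
    obtain ⟨a, h, hcn, hba, hMk, hh, hne⟩ := D1_h F b hb
    have hx : F.In [b] (F.c a) := by
      refine ⟨fun e y hy => ?_, trivial⟩
      by_contra heb
      obtain ⟨a', b', hR, rfl, hc⟩ := (F.glue _ _ _ _ heb).1 hy
      rw [← F.c_inj hc] at hR
      exact hMk ⟨_, _, ok.symm _ _ _ _ hR⟩
    have hrIn : F.In (u ++ [1]) (F.S b (F.c a)) := by
      by_contra hcon
      obtain ⟨b', -, hb''⟩ := F.exit_of_not_In ok u 1 _ hcon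
      obtain ⟨e1, e2⟩ := F.c_single ok hb''
      rw [← e1] at e2
      exact hba (F.c_inj e2).symm
    have hLS : F.In (u ++ [1] ++ [b]) (F.c a) := (F.In_append _ _ _).2 ⟨hrIn, hx⟩
    have hWW : F.W (u ++ [1] ++ [b]) (F.c a) = F.W (u ++ [1]) (F.S b (F.c a)) := by
      rw [F.W_append]; rfl
    refine hq2 (F.W (u ++ [1]) (F.S b (F.c a))) (F.sep_in ok hIn' hf hq hh ?_ ?_ hrIn) ⟨?_, ?_⟩
    · intro h
      obtain ⟨e1, e2⟩ := F.c_single ok h.symm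
      rw [← e1] at e2
      exact hba (F.c_inj e2).symm
    · intro b' hb' hc hhb hfb
      have hb' := ckEx b' hb' (by rintro rfl; exact hc rfl)
      have := hinj _ _ hb' hb (hfb.trans hqb)
      subst this
      exact hne hhb
    · rw [← hWW]
      exact F.LS_W (F.LS_c ok (by norm_num) (by rw [hcn])) _
    · rw [← hWW]
      intro h4
      have := F.LS_single ok (F.LS_of_W hLS h4)
      omega
  · obtain ⟨N, hN⟩ := F.exists_far hq1'
    obtain ⟨hIn', hW⟩ := F.In_W_rep ok hIn N
    set u := w ++ List.replicate N 3 with hu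
    have hq : q' ∉ range (F.W (u ++ [3])) := hN _ (by simp [hu]; omega) ⟨_, hW⟩
    rw [← hW] at hf hs hq2'
    have ckEx : ∀ b, Ex (Rt 7) 3 b → b ≠ 3 → b = 1 ∨ b = 4 ∨ b = 6 := by decide +kernel
    have hinj := F.split3 ok hIn' ckEx (by decide) (by decide) (by decide) (by decide +kernel) hf hs
    obtain ⟨b, hb, hb1, hqb⟩ := F.outside ok u 3 _ hIn' q' hq
    have hqb := hqb _ f hf
    have hb := ckEx b hb (by rintro rfl; exact hb1 rfl)
    refine hq2' _ (F.sep_W ok (b := b) hIn' hf hq hb1 ?_) ?_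
    · intro b' hb' hc hbb hfb
      exact hbb (hinj _ _ (ckEx b' hb' (by rintro rfl; exact hc rfl)) hb (hfb.trans hqb))
    · rw [F.W_append]
      refine F.LS_W ?_ _
      show LS 4 (F.S 3 (F.c b))
      rcases hb with rfl | rfl | rfl
      · exact F.LS_glue_of ok (show Rt 7 3 1 1 4 by decide +kernel) (by norm_num) (by decide +kernel)
      · exact F.LS_glue_of ok (show Rt 7 3 4 4 1 by decide +kernel) (by norm_num) (by decide +kernel)
      · exact F.LS_glue_of ok (show Rt 7 3 5 6 3 by decide +kernel) (by norm_num) (by decide +kernel)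

end WW
end FC

set_option linter.unusedSectionVars false
set_option linter.unusedVariables false
namespace FC

open Set Filter Topology

section BL

variable {R : Fin 7 → Fin 7 → Fin 7 → Fin 7 → Prop} {par : Fin 7 → Fin 7 → Fin 7}
  {X Y : Type} [MetricSpace X] [CompactSpace X] [MetricSpace Y] [CompactSpace Y]

/-- initial words of a sequence -/
def wd : (ℕ → Fin 7) → ℕ → List (Fin 7)
  | _, 0 => []
  | a, n + 1 => a 0 :: wd (fun k => a (k + 1)) n

lemma wd_length (n : ℕ) : ∀ a, (wd a n).length = n := by
  induction n with
  | zero => intro a; rfl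
  | succ n ih => intro a; simp [wd, ih]

lemma wd_succ' (n : ℕ) : ∀ a, wd a (n+1) = wd a n ++ [a n] := by
  induction n with
  | zero => intro a; rfl
  | succ n ih => intro a; rw [wd, ih, wd]; rfl

/-- `x` has address `a` -/
def IFS.Ad (F : IFS R X) (a : ℕ → Fin 7) (x : X) : Prop := ∀ n, x ∈ range (F.W (wd a n))

lemma IFS.Ad_tail (F : IFS R X) {a : ℕ → Fin 7} {x : X} (h : F.Ad a x) :
    ∃ x', F.S (a 0) x' = x ∧ F.Ad (fun k => a (k+1)) x' := by
  obtain ⟨x', hx'⟩ := h 1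
  have hx' : F.S (a 0) x' = x := hx'
  refine ⟨x', hx', fun n => ?_⟩
  obtain ⟨z, hz⟩ := h (n+1)
  have hz : F.S (a 0) (F.W (wd (fun k => a (k+1)) n) z) = x := hz
  exact ⟨z, F.S_inj _ (hz.trans hx'.symm)⟩

lemma IFS.Ad_cons (F : IFS R X) {a : ℕ → Fin 7} {x : X} (d : Fin 7) (h : F.Ad a x) :
    F.Ad (fun k => Nat.casesOn k d a) (F.S d x) := by
  intro n
  cases n with
  | zero => exact ⟨_, rfl⟩
  | succ n =>
    obtain ⟨z, hz⟩ := h n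
    exact ⟨z, by simp [wd, hz]⟩

lemma IFS.exists_Ad (F : IFS R X) (x : X) : ∃ a, F.Ad a x := by
  refine ⟨fun n => F.dig (F.tl^[n] x), fun n => ⟨F.tl^[n] x, ?_⟩⟩
  have : wd (fun n => F.dig (F.tl^[n] x)) n = F.pre n x := by
    induction n with
    | zero => rfl
    | succ n ih => rw [wd_succ', ih, F.pre_succ]
  rw [this, F.W_pre]

lemma IFS.exists_pt (F : IFS R X) [Nonempty X] (a : ℕ → Fin 7) : ∃ x, F.Ad a x := by
  have := IsCompact.nonempty_iInter_of_sequence_nonempty_isCompact_isClosed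
    (fun n => range (F.W (wd a n))) (fun n => by
      rintro x ⟨y, rfl⟩
      rw [wd_succ', F.W_append]
      exact ⟨_, rfl⟩) (fun n => range_nonempty _) (isCompact_range (F.W_cont _)) (fun n => F.range_W_closed _)
  obtain ⟨x, hx⟩ := this
  exact ⟨x, fun n => mem_iInter.1 hx n⟩

/-- matched points -/
def Mt (F : IFS R X) (G : IFS R Y) (x : X) (y : Y) : Prop := ∃ a, F.Ad a x ∧ G.Ad a y

lemma Mt_tail {F : IFS R X} {G : IFS R Y} {x : X} {y : Y} (h : Mt F G x y) :
    ∃ d x' y', F.S d x' = x ∧ G.S d y' = y ∧ Mt F G x' y' := by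
  obtain ⟨a, h1, h2⟩ := h
  obtain ⟨x', hx, hx'⟩ := F.Ad_tail h1
  obtain ⟨y', hy, hy'⟩ := G.Ad_tail h2
  exact ⟨_, x', y', hx, hy, _, hx', hy'⟩

lemma Mt_cons {F : IFS R X} {G : IFS R Y} {x : X} {y : Y} (d : Fin 7) (h : Mt F G x y) :
    Mt F G (F.S d x) (G.S d y) := by
  obtain ⟨a, h1, h2⟩ := h
  exact ⟨_, F.Ad_cons d h1, G.Ad_cons d h2⟩

lemma sep_const (F : IFS R X) (C : ℝ) (hC : 0 ≤ C) (u v : List (Fin 7)) :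
    ∃ L : ℝ, 0 ≤ L ∧ (Disjoint (range (F.W u)) (range (F.W v)) → ∀ x y, C ≤ L * dist (F.W u x) (F.W v y)) := by
  by_cases h : Disjoint (range (F.W u)) (range (F.W v))
  · obtain ⟨r, hr, h2⟩ := Metric.exists_pos_forall_lt_edist (isCompact_range (F.W_cont u)) (F.range_W_closed v) h
    refine ⟨C / r, by positivity, fun _ x y => ?_⟩
    have h3 := h2 _ ⟨x, rfl⟩ _ ⟨y, rfl⟩
    rw [edist_nndist] at h3
    have h4 : (r : ℝ) < dist (F.W u x) (F.W v y) := by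
      rw [dist_nndist]; exact_mod_cast h3
    have hr' : (0:ℝ) < r := hr
    calc C = C / r * r := by field_simp
      _ ≤ _ := by gcongr
  · exact ⟨0, le_rfl, fun h' => absurd h' h⟩

lemma Mt_lip (ok : Ok R par) (F : IFS R X) (G : IFS R Y) : ∃ L : ℝ, 1 ≤ L ∧ ∀ x x' y y', Mt F G x y → Mt F G x' y' →
    dist y y' ≤ L * dist x x' := by
  obtain ⟨C, hC⟩ := (Metric.isBounded_iff.1 (isCompact_univ (X := Y)).isBounded)
  have hC' : ∀ x y : Y, dist x y ≤ max C 0 := fun x y => (hC trivial trivial).trans (le_max_left _ _)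
  set C' := max C 0 with hC'd
  have hC0 : 0 ≤ C' := le_max_right _ _
  choose K hK0 hK using fun i : Fin 7 × Fin 7 × Fin 7 × Fin 7 => sep_const F C' hC0 [i.1, i.2.1] [i.2.2.1, i.2.2.2]
  set L := 1 + ∑ i, K i with hL
  have hKL : ∀ i, K i ≤ L := fun i => by
    have := Finset.single_le_sum (f := K) (fun j _ => hK0 j) (Finset.mem_univ i)
    rw [hL]; linarith
  have hL1 : 1 ≤ L := by
    have := Finset.sum_nonneg (s := Finset.univ) (f := K) (fun j _ => hK0 j)
    rw [hL]; linarith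
  have key : ∀ n : ℕ, ∀ x x' y y', Mt F G x y → Mt F G x' y' → dist y y' ≤ L * dist x x' + C' / 3 ^ n := by
    intro n
    induction n with
    | zero =>
      intro x x' y y' _ _
      have := hC' y y'
      have h2 : 0 ≤ L * dist x x' := by positivity
      simp; linarith
    | succ n ih =>
      intro x x' y y' hm hm'
      obtain ⟨d, x1, y1, rfl, rfl, h1⟩ := Mt_tail hm
      obtain ⟨e, x1', y1', rfl, rfl, h1'⟩ := Mt_tail hm'
      have e3 : C' / 3 ^ (n+1) = C' / 3 ^ n / 3 := by rw [pow_succ]; field_simp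
      by_cases hde : d = e
      · subst hde
        rw [F.dist_S, G.dist_S, e3]
        have := ih _ _ _ _ h1 h1'
        linarith
      obtain ⟨a, x2, y2, rfl, rfl, h2⟩ := Mt_tail h1
      obtain ⟨b, x2', y2', rfl, rfl, h2'⟩ := Mt_tail h1'
      by_cases hdis : Disjoint (range (F.W [d, a])) (range (F.W [e, b]))
      · have h3 := hK (d, a, e, b) hdis x2 x2'
        have h3 : C' ≤ K (d, a, e, b) * dist (F.S d (F.S a x2)) (F.S e (F.S b x2')) := h3
        have h4 : K (d, a, e, b) * dist (F.S d (F.S a x2)) (F.S e (F.S b x2')) ≤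
          L * dist (F.S d (F.S a x2)) (F.S e (F.S b x2')) := by gcongr; exact hKL _
        have h5 := hC' (G.S d (G.S a y2)) (G.S e (G.S b y2'))
        have h6 : 0 ≤ C' / 3 ^ (n+1) := by positivity
        linarith
      · rw [not_disjoint_iff] at hdis
        obtain ⟨z, ⟨z1, hz1⟩, ⟨z2, hz2⟩⟩ := hdis
        have hz : F.S d (F.S a z1) = F.S e (F.S b z2) := hz1.trans hz2.symm
        obtain ⟨a', b', hR, ha, hb⟩ := (F.glue _ _ _ _ hde).1 hz
        have ha := (F.c_single ok ha).1
        have hb := (F.c_single ok hb).1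
        subst ha hb
        rw [F.glue_dist _ _ _ _ _ _ hR, G.glue_dist _ _ _ _ _ _ hR, e3]
        have := ih _ _ _ _ (Mt_cons d h2) (Mt_cons e h2')
        linarith
  refine ⟨L, hL1, fun x x' y y' h h' => ?_⟩
  have ht : Tendsto (fun n : ℕ => L * dist x x' + C' / 3 ^ n) atTop (𝓝 (L * dist x x' + 0)) := by
    refine tendsto_const_nhds.add ?_
    have : Tendsto (fun n : ℕ => C' * (1/3 : ℝ) ^ n) atTop (𝓝 (C' * 0)) :=
      (tendsto_pow_atTop_nhds_zero_of_lt_one (by norm_num) (by norm_num)).const_mul _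
    rw [mul_zero] at this
    refine this.congr fun n => ?_
    rw [one_div, inv_pow]; rfl
  rw [add_zero] at ht
  exact ge_of_tendsto' ht fun n => key n _ _ _ _ h h'

lemma exists_biLip (ok : Ok R par) (F : IFS R X) (G : IFS R Y) [Nonempty X] [Nonempty Y] :
    ∃ (φ : X → Y) (L : ℝ), 1 ≤ L ∧ Function.Bijective φ ∧
      ∀ x y, L⁻¹ * dist x y ≤ dist (φ x) (φ y) ∧ dist (φ x) (φ y) ≤ L * dist x y := by
  obtain ⟨L1, hL1, h1⟩ := Mt_lip ok F G
  obtain ⟨L2, hL2, h2⟩ := Mt_lip ok G F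
  have hs : ∀ {x y}, Mt F G x y → Mt G F y x := fun ⟨a, h, h'⟩ => ⟨a, h', h⟩
  have hex : ∀ x, ∃ y, Mt F G x y := fun x => by
    obtain ⟨a, ha⟩ := F.exists_Ad x
    obtain ⟨y, hy⟩ := G.exists_pt a
    exact ⟨y, a, ha, hy⟩
  have hey : ∀ y, ∃ x, Mt F G x y := fun y => by
    obtain ⟨a, ha⟩ := G.exists_Ad y
    obtain ⟨x, hx⟩ := F.exists_pt a
    exact ⟨x, a, hx, ha⟩
  choose φ hφ using hex
  have hL0 : 0 < max L1 L2 := lt_of_lt_of_le (by linarith) (le_max_left _ _)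
  have low : ∀ x y, dist x y ≤ max L1 L2 * dist (φ x) (φ y) := fun x y =>
    (h2 _ _ _ _ (hs (hφ x)) (hs (hφ y))).trans (by gcongr; exact le_max_right _ _)
  refine ⟨φ, max L1 L2, hL1.trans (le_max_left _ _), ⟨?_, ?_⟩, fun x y => ⟨?_, ?_⟩⟩
  · intro x y hxy
    have := low x y
    rw [hxy, dist_self, mul_zero] at this
    exact dist_le_zero.1 this
  · intro y
    obtain ⟨x, hx⟩ := hey y
    refine ⟨x, ?_⟩
    have := h1 _ _ _ _ (hφ x) hx
    rw [dist_self, mul_zero] at this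
    exact dist_le_zero.1 this
  · rw [inv_mul_le_iff₀ hL0]; exact low x y
  · exact (h1 _ _ _ _ (hφ x) (hφ y)).trans (by gcongr; exact le_max_left _ _)

end BL
end FC

set_option linter.unusedSectionVars false
set_option linter.unusedVariables false
namespace FC

open Set Filter Topology

/-- the circle -/
abbrev Cir := Metric.sphere (0 : EuclideanSpace ℝ (Fin 2)) 1

lemma Cir_cut (v : Cir) : IsPreconnected ({v}ᶜ : Set Cir) ∧ ({v}ᶜ : Set Cir).Infinite := by
  have : Fact (Module.finrank ℝ (EuclideanSpace ℝ (Fin 2)) = 1 + 1) := ⟨by simp⟩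
  have h1 := (stereographic' 1 v).symm_image_target_eq_source
  rw [stereographic'_target, stereographic'_source] at h1
  have h2 := (stereographic' 1 v).continuousOn_symm
  rw [stereographic'_target] at h2
  constructor
  · rw [← h1]
    exact isPreconnected_univ.image _ h2
  · rw [← h1]
    refine Set.Infinite.image ?_ ?_
    · have := (stereographic' 1 v).symm.injOn
      simpa using this
    · have : Infinite (EuclideanSpace ℝ (Fin 1)) :=
        Infinite.of_injective (fun n : ℕ => WithLp.toLp 2 (fun _ : Fin 1 => (n : ℝ))) (by
          intro m n h
          have := congrArg (fun x : EuclideanSpace ℝ (Fin 1) => x 0) h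
          simpa using this)
      exact infinite_univ

instance : Infinite Cir := by
  have : Nonempty Cir := ⟨⟨WithLp.toLp 2 ![1, 0], by simp [EuclideanSpace.norm_eq]⟩⟩
  exact infinite_univ_iff.1 ((Cir_cut (Classical.arbitrary _)).2.mono (subset_univ _))

lemma LC.cont {X A : Type} [TopologicalSpace X] [TopologicalSpace A] {f : X → A} {x : X} (h : LC f x) :
    ContinuousAt f x := by
  have : ContinuousAt (fun _ : X => f x) x := continuousAt_const
  exact this.congr (h.mono fun y hy => hy.symm)

section dend
variable {R : Fin 7 → Fin 7 → Fin 7 → Fin 7 → Prop} {par : Fin 7 → Fin 7 → Fin 7}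
  {X : Type} [MetricSpace X] [CompactSpace X] (F : IFS R X)

lemma IFS.preconn (F : IFS R X) (ok : Ok R par) : PreconnectedSpace X := by
  refine preconnectedSpace_of_forall_constant fun f hf x y => ?_
  refine F.const_of_LC ok (f := f) (fun z => ?_) x y
  have : {f z} ∈ 𝓝 (f z) := by simp
  exact (hf.continuousAt this)

lemma IFS.locConn (F : IFS R X) (ok : Ok R par) : LocallyConnectedSpace X := by
  have hp := F.preconn ok
  refine locallyConnectedSpace_iff_connected_subsets.2 fun x U hU => ?_
  obtain ⟨ε, hε, hb⟩ := Metric.mem_nhds_iff.1 hU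
  obtain ⟨n, hn⟩ := F.exists_small hε
  set T : Set (List (Fin 7)) := {u | u.length = n}
  have hT : T.Finite := List.finite_length_eq _ _
  refine ⟨⋃ u ∈ {u | u ∈ T ∧ x ∈ range (F.W u)}, range (F.W u), ?_, ?_, ?_⟩
  · have hc : IsClosed (⋃ u ∈ {u | u ∈ T ∧ x ∉ range (F.W u)}, range (F.W u)) :=
      (hT.subset fun u hu => hu.1).isClosed_biUnion fun u _ => F.range_W_closed u
    filter_upwards [hc.isOpen_compl.mem_nhds (show x ∈ _ by
      simp only [mem_compl_iff, mem_iUnion, not_exists]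
      rintro u hu hx
      exact hu.2 hx)] with y hy
    obtain ⟨u, hu, z, hz⟩ := F.cover_W n y
    simp only [mem_compl_iff, mem_iUnion, not_exists] at hy
    simp only [mem_iUnion]
    refine ⟨u, ⟨hu, ?_⟩, z, hz⟩
    by_contra hx
    exact hy u ⟨hu, hx⟩ ⟨z, hz⟩
  · refine isPreconnected_sUnion x _ ?_ ?_ |> fun h => by
      simpa [sUnion_image] using (h : IsPreconnected (⋃₀ ((fun u => range (F.W u)) '' {u | u ∈ T ∧ x ∈ range (F.W u)})))
    · rintro s ⟨u, hu, rfl⟩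
      exact hu.2
    · rintro s ⟨u, hu, rfl⟩
      exact isPreconnected_range (F.W_cont u)
  · intro y hy
    simp only [mem_iUnion] at hy
    obtain ⟨u, ⟨hu, ⟨a, rfl⟩⟩, ⟨b, rfl⟩⟩ := hy
    exact hb (hn u (le_of_eq hu.symm) b a)

/-- tree condition -/
def Tree (R : Fin 7 → Fin 7 → Fin 7 → Fin 7 → Prop) (par : Fin 7 → Fin 7 → Fin 7) : Prop :=
  ∀ d e a b, R d e a b → ∀ d' e' a' b', R d' e' a' b' → d' = d → cl par d e = cl par d e' → e = e' ∧ a = a'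

lemma IFS.tree_fun (F : IFS R X) (ok : Ok R par) (ht : Tree R par) {d e : Fin 7} (he : e ≠ d) :
    ∃ (g : X) (f : X → Bool), g ∈ range (F.S d) ∧ (∃ e' a b, R d e' a b ∧ g = F.S d (F.c a)) ∧ (∀ x, x ≠ g → LC f x) ∧
      (∀ z, F.S d z ≠ g → f (F.S d z) = false) ∧ (∀ z, F.S e z ≠ g → f (F.S e z) = true) := by
  obtain ⟨e1, a, b, hR, hc⟩ := ok.conn d e he
  have hc : cl par d e1 = cl par d e := hc
  set s : Fin 7 → Bool := fun e' => decide (e' ≠ d ∧ cl par d e' = cl par d e) with hs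
  have hd : ∀ e' a' b', R d e' a' b' → F.S d (F.c a') ≠ F.S d (F.c a) → s d = s e' := by
    intro e' a' b' hR' hne
    by_contra hcon
    have : cl par d e' = cl par d e := by
      by_contra h'
      exact hcon (by simp [hs, h'])
    obtain ⟨-, rfl⟩ := ht _ _ _ _ hR _ _ _ _ hR' rfl (hc.trans this.symm)
    exact hne rfl
  obtain ⟨f, h1, h2⟩ := F.ext_off (p := F.S d (F.c a)) (f := fun t _ => s t) (by
    intro d' e' a' b' hR' hne
    show s d' = s e'
    by_cases h1 : d' = d
    · subst h1
      exact hd _ _ _ hR' hne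
    by_cases h2 : e' = d
    · subst h2
      rw [F.R_eq ok hR'] at hne
      exact (hd _ _ _ (ok.symm _ _ _ _ hR') hne).symm
    have : cl par d d' = cl par d e' := ok.cl_closed d _ _ _ _ hR' h1 h2
    simp [hs, h1, h2, this]) (fun t z _ => by exact Filter.Eventually.of_forall fun _ => rfl)
  refine ⟨_, f, ⟨_, rfl⟩, ⟨_, _, _, hR, rfl⟩, h1, fun z hz => ?_, fun z hz => ?_⟩
  · rw [h2 _ _ hz]; simp [hs]
  · rw [h2 _ _ hz]; simp [hs, he]

lemma Cir_const {γ : Cir → X} (hγ : Continuous γ) (hi : Function.Injective γ) {g : X} {f : X → Bool}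
    (hf : ∀ x, x ≠ g → LC f x) {s t : Cir} (hs : γ s ≠ g) (ht : γ t ≠ g) : f (γ s) = f (γ t) := by
  have : ∃ v, v ≠ s ∧ v ≠ t ∧ ∀ r, r ≠ v → γ r ≠ g ∨ r = s := by
    by_cases hg : g ∈ range γ
    · obtain ⟨v, rfl⟩ := hg
      exact ⟨v, fun h => hs (by rw [h]), fun h => ht (by rw [h]), fun r hr => Or.inl (hi.ne hr)⟩
    · obtain ⟨v, hv⟩ := Infinite.exists_notMem_finset ({s, t} : Finset Cir)
      simp at hv
      exact ⟨v, hv.1, hv.2, fun r _ => Or.inl fun h => hg ⟨r, h⟩⟩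
  obtain ⟨v, h1, h2, h3⟩ := this
  refine (Cir_cut v).1.constant (f := f ∘ γ) (fun r hr => ?_) (x := s) (y := t) h1.symm h2.symm
  have hr : γ r ≠ g := by
    rcases h3 r hr with h | rfl
    · exact h
    · exact hs
  exact ((hf _ hr).cont.comp hγ.continuousAt).continuousWithinAt

lemma IFS.circle_piece (F : IFS R X) (ok : Ok R par) (ht : Tree R par) {γ : Cir → X} (hγ : Continuous γ)
    (hi : Function.Injective γ) : ∃ d, ∀ t, γ t ∈ range (F.S d) := by
  obtain ⟨x, ⟨s, rfl⟩, hx⟩ := ((infinite_range_of_injective hi).sdiff F.GP_finite).nonempty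
  obtain ⟨d, y, hy⟩ := F.cover (γ s)
  refine ⟨d, fun t => ?_⟩
  by_contra hcon
  obtain ⟨e, z, hz⟩ := F.cover (γ t)
  have hed : e ≠ d := by rintro rfl; exact hcon ⟨_, hz⟩
  obtain ⟨g, f, ⟨g', hg'⟩, ⟨e', a, b, hR, hg⟩, hf, h1, h2⟩ := F.tree_fun ok ht hed
  have hs : γ s ≠ g := by
    intro h
    exact hx (by rw [h, hg]; exact ⟨_, _, _, _, hR, rfl⟩)
  have ht : γ t ≠ g := by
    intro h
    exact hcon ⟨g', hg'.trans h.symm⟩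
  have := Cir_const hγ hi hf hs ht
  rw [← hy] at hs this
  rw [← hz] at ht this
  rw [h1 _ hs, h2 _ ht] at this
  exact absurd this (by decide)

lemma IFS.no_circle (F : IFS R X) (ok : Ok R par) (ht : Tree R par) {γ : Cir → X} (hγ : Continuous γ)
    (hi : Function.Injective γ) : False := by
  have key : ∀ n : ℕ, ∀ γ : Cir → X, Continuous γ → Function.Injective γ → ∃ u : List (Fin 7), u.length = n ∧
      ∀ t, γ t ∈ range (F.W u) := by
    intro n
    induction n with
    | zero => intro γ _ _; exact ⟨[], rfl, fun t => ⟨_, rfl⟩⟩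
    | succ n ih =>
      intro γ hγ hi
      obtain ⟨d, hd⟩ := F.circle_piece ok ht hγ hi
      choose γ' hγ' using hd
      have he : Topology.IsInducing (F.S d) := ((F.S_cont d).isClosedEmbedding (F.S_inj d)).isInducing
      have hcomp : F.S d ∘ γ' = γ := funext hγ'
      obtain ⟨u, hu, h⟩ := ih γ' (he.continuous_iff.2 (by rw [hcomp]; exact hγ))
        (fun s t h => hi (by rw [← hγ', ← hγ', h]))
      refine ⟨d :: u, by simp [hu], fun t => ?_⟩
      obtain ⟨z, hz⟩ := h t
      exact ⟨z, by rw [F.W_cons, hz, hγ']⟩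
  obtain ⟨s, t, hst⟩ := exists_pair_ne Cir
  obtain ⟨n, hn⟩ := F.exists_small (dist_pos.2 (hi.ne hst))
  obtain ⟨u, hu, h⟩ := key n γ hγ hi
  obtain ⟨a, ha⟩ := h s
  obtain ⟨b, hb⟩ := h t
  have := hn u (le_of_eq hu.symm) a b
  rw [ha, hb] at this
  exact lt_irrefl _ this

end dend

lemma treeT (i : Fin 12) (hi : i = 4 ∨ i = 7 ∨ i = 9 ∨ i = 10 ∨ i = 11) : Tree (Rt i) (parT i) := by
  refine Rt_all i ?_
  have : ∀ n ∈ tb i, ∀ m ∈ tb i, (dc m).1 = (dc n).1 → cl (parT i) (dc n).1 (dc n).2.1 = cl (parT i) (dc n).1 (dc m).2.1 →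
    (dc n).2.1 = (dc m).2.1 ∧ (dc n).2.2.1 = (dc m).2.2.1 := by
    rcases hi with rfl | rfl | rfl | rfl | rfl <;> decide +kernel
  intro n hn
  exact Rt_all i (this n hn)

end FC

set_option linter.unusedSectionVars false
set_option linter.unusedVariables false
namespace FC

open Set Filter Topology

/-! Digit `(x,y,z)` is encoded by the position `25x+5y+z`, a digit set by a bit mask. -/

/-- bit mask of pairs at distance `t` -/
def df (A t : ℕ) : ℕ := Nat.land A (Nat.shiftRight A t)
def gate (e x : ℕ) : ℕ := Nat.rec 0 (fun _ _ => x) e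
def tw (f : ℕ) : ℕ := Nat.land f (Nat.sub f 1)

/-- unit directions (up to sign) -/
def dirs : List ℕ := [1, 4, 5, 6, 19, 20, 21, 24, 25, 26, 29, 30, 31]

/-- possible successors `(δ₁, 3δ-δ₁)` of a direction -/
def exts : ℕ → List (ℕ × ℕ)
  | 1 => [(29, 32), (24, 27), (19, 22), (4, 7), (6, 3), (21, 18), (26, 23), (31, 28)]
  | 4 => [(21, 33), (29, 17)]
  | 5 => [(21, 36), (20, 35), (19, 34), (4, 11), (6, 9), (29, 14), (30, 15), (31, 16)]
  | 6 => [(19, 37), (31, 13)]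
  | 20 => [(19, 41), (21, 39)]
  | 24 => [(19, 53), (29, 43)]
  | 25 => [(19, 56), (20, 55), (21, 54), (24, 51), (26, 49), (29, 46), (30, 45), (31, 44)]
  | 26 => [(21, 57), (31, 47)]
  | 30 => [(29, 61), (31, 59)]
  | _ => []

def La1 (A : ℕ) : ℕ :=
  (Nat.lor (A.land (A.shiftRight 2)) (Nat.lor (Nat.rec 0 (fun _ _ => (A.land (A.shiftRight 58))) (A.land 
    (A.shiftRight 32))) (Nat.lor (Nat.rec 0 (fun _ _ => (A.land (A.shiftRight 48))) (A.land (A.shiftRight 27))) 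
    (Nat.lor (Nat.rec 0 (fun _ _ => (A.land (A.shiftRight 38))) (A.land (A.shiftRight 22))) (Nat.lor (Nat.rec 0 
    (fun _ _ => (A.land (A.shiftRight 8))) (A.land (A.shiftRight 7))) (Nat.lor (Nat.rec 0 (fun _ _ => (A.land 
    (A.shiftRight 12))) (A.land (A.shiftRight 3))) (Nat.lor (Nat.rec 0 (fun _ _ => (A.land (A.shiftRight 42))) 
    (A.land (A.shiftRight 18))) (Nat.lor (Nat.rec 0 (fun _ _ => (A.land (A.shiftRight 52))) (A.land (A.shiftRight 
    23))) (Nat.rec 0 (fun _ _ => (A.land (A.shiftRight 62))) (A.land (A.shiftRight 28)))))))))))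
def La4 (A : ℕ) : ℕ :=
  (Nat.lor (A.land (A.shiftRight 8)) (Nat.lor (Nat.rec 0 (fun _ _ => (A.land (A.shiftRight 42))) (A.land 
    (A.shiftRight 33))) (Nat.rec 0 (fun _ _ => (A.land (A.shiftRight 58))) (A.land (A.shiftRight 17)))))
def La5 (A : ℕ) : ℕ :=
  (Nat.lor (A.land (A.shiftRight 10)) (Nat.lor (Nat.rec 0 (fun _ _ => (A.land (A.shiftRight 42))) (A.land 
    (A.shiftRight 36))) (Nat.lor (Nat.rec 0 (fun _ _ => (A.land (A.shiftRight 40))) (A.land (A.shiftRight 35))) 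
    (Nat.lor (Nat.rec 0 (fun _ _ => (A.land (A.shiftRight 38))) (A.land (A.shiftRight 34))) (Nat.lor (Nat.rec 0 
    (fun _ _ => (A.land (A.shiftRight 8))) (A.land (A.shiftRight 11))) (Nat.lor (Nat.rec 0 (fun _ _ => (A.land 
    (A.shiftRight 12))) (A.land (A.shiftRight 9))) (Nat.lor (Nat.rec 0 (fun _ _ => (A.land (A.shiftRight 58))) 
    (A.land (A.shiftRight 14))) (Nat.lor (Nat.rec 0 (fun _ _ => (A.land (A.shiftRight 60))) (A.land (A.shiftRight 
    15))) (Nat.rec 0 (fun _ _ => (A.land (A.shiftRight 62))) (A.land (A.shiftRight 16)))))))))))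
def La6 (A : ℕ) : ℕ :=
  (Nat.lor (A.land (A.shiftRight 12)) (Nat.lor (Nat.rec 0 (fun _ _ => (A.land (A.shiftRight 38))) (A.land 
    (A.shiftRight 37))) (Nat.rec 0 (fun _ _ => (A.land (A.shiftRight 62))) (A.land (A.shiftRight 13)))))
def La20 (A : ℕ) : ℕ :=
  (Nat.lor (A.land (A.shiftRight 40)) (Nat.lor (Nat.rec 0 (fun _ _ => (A.land (A.shiftRight 38))) (A.land 
    (A.shiftRight 41))) (Nat.rec 0 (fun _ _ => (A.land (A.shiftRight 42))) (A.land (A.shiftRight 39)))))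
def La24 (A : ℕ) : ℕ :=
  (Nat.lor (A.land (A.shiftRight 48)) (Nat.lor (Nat.rec 0 (fun _ _ => (A.land (A.shiftRight 38))) (A.land 
    (A.shiftRight 53))) (Nat.rec 0 (fun _ _ => (A.land (A.shiftRight 58))) (A.land (A.shiftRight 43)))))
def La25 (A : ℕ) : ℕ :=
  (Nat.lor (A.land (A.shiftRight 50)) (Nat.lor (Nat.rec 0 (fun _ _ => (A.land (A.shiftRight 38))) (A.land 
    (A.shiftRight 56))) (Nat.lor (Nat.rec 0 (fun _ _ => (A.land (A.shiftRight 40))) (A.land (A.shiftRight 55))) 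
    (Nat.lor (Nat.rec 0 (fun _ _ => (A.land (A.shiftRight 42))) (A.land (A.shiftRight 54))) (Nat.lor (Nat.rec 0 
    (fun _ _ => (A.land (A.shiftRight 48))) (A.land (A.shiftRight 51))) (Nat.lor (Nat.rec 0 (fun _ _ => (A.land 
    (A.shiftRight 52))) (A.land (A.shiftRight 49))) (Nat.lor (Nat.rec 0 (fun _ _ => (A.land (A.shiftRight 58))) 
    (A.land (A.shiftRight 46))) (Nat.lor (Nat.rec 0 (fun _ _ => (A.land (A.shiftRight 60))) (A.land (A.shiftRight 
    45))) (Nat.rec 0 (fun _ _ => (A.land (A.shiftRight 62))) (A.land (A.shiftRight 44)))))))))))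
def La26 (A : ℕ) : ℕ :=
  (Nat.lor (A.land (A.shiftRight 52)) (Nat.lor (Nat.rec 0 (fun _ _ => (A.land (A.shiftRight 42))) (A.land 
    (A.shiftRight 57))) (Nat.rec 0 (fun _ _ => (A.land (A.shiftRight 62))) (A.land (A.shiftRight 47)))))
def La30 (A : ℕ) : ℕ :=
  (Nat.lor (A.land (A.shiftRight 60)) (Nat.lor (Nat.rec 0 (fun _ _ => (A.land (A.shiftRight 58))) (A.land 
    (A.shiftRight 61))) (Nat.rec 0 (fun _ _ => (A.land (A.shiftRight 62))) (A.land (A.shiftRight 59)))))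
def Lb1 (A : ℕ) : ℕ :=
  (Nat.lor (A.land (A.shiftRight 2)) (Nat.lor (Nat.rec 0 (fun _ _ => (A.land (A.shiftRight 58))) (A.land 
    (A.shiftRight 32))) (Nat.lor (Nat.rec 0 (fun _ _ => (La24 A)) (A.land (A.shiftRight 27))) (Nat.lor (Nat.rec 0 
    (fun _ _ => (A.land (A.shiftRight 38))) (A.land (A.shiftRight 22))) (Nat.lor (Nat.rec 0 (fun _ _ => (La4 A)) 
    (A.land (A.shiftRight 7))) (Nat.lor (Nat.rec 0 (fun _ _ => (La6 A)) (A.land (A.shiftRight 3))) (Nat.lor 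
    (Nat.rec 0 (fun _ _ => (A.land (A.shiftRight 42))) (A.land (A.shiftRight 18))) (Nat.lor (Nat.rec 0 (fun _ _ => 
    (La26 A)) (A.land (A.shiftRight 23))) (Nat.rec 0 (fun _ _ => (A.land (A.shiftRight 62))) (A.land (A.shiftRight 
    28)))))))))))
def Lb5 (A : ℕ) : ℕ :=
  (Nat.lor (A.land (A.shiftRight 10)) (Nat.lor (Nat.rec 0 (fun _ _ => (A.land (A.shiftRight 42))) (A.land 
    (A.shiftRight 36))) (Nat.lor (Nat.rec 0 (fun _ _ => (La20 A)) (A.land (A.shiftRight 35))) (Nat.lor (Nat.rec 0 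
    (fun _ _ => (A.land (A.shiftRight 38))) (A.land (A.shiftRight 34))) (Nat.lor (Nat.rec 0 (fun _ _ => (La4 A)) 
    (A.land (A.shiftRight 11))) (Nat.lor (Nat.rec 0 (fun _ _ => (La6 A)) (A.land (A.shiftRight 9))) (Nat.lor 
    (Nat.rec 0 (fun _ _ => (A.land (A.shiftRight 58))) (A.land (A.shiftRight 14))) (Nat.lor (Nat.rec 0 (fun _ _ => 
    (La30 A)) (A.land (A.shiftRight 15))) (Nat.rec 0 (fun _ _ => (A.land (A.shiftRight 62))) (A.land (A.shiftRight 
    16)))))))))))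
def Lb25 (A : ℕ) : ℕ :=
  (Nat.lor (A.land (A.shiftRight 50)) (Nat.lor (Nat.rec 0 (fun _ _ => (A.land (A.shiftRight 38))) (A.land 
    (A.shiftRight 56))) (Nat.lor (Nat.rec 0 (fun _ _ => (La20 A)) (A.land (A.shiftRight 55))) (Nat.lor (Nat.rec 0 
    (fun _ _ => (A.land (A.shiftRight 42))) (A.land (A.shiftRight 54))) (Nat.lor (Nat.rec 0 (fun _ _ => (La24 A)) 
    (A.land (A.shiftRight 51))) (Nat.lor (Nat.rec 0 (fun _ _ => (La26 A)) (A.land (A.shiftRight 49))) (Nat.lor 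
    (Nat.rec 0 (fun _ _ => (A.land (A.shiftRight 58))) (A.land (A.shiftRight 46))) (Nat.lor (Nat.rec 0 (fun _ _ => 
    (La30 A)) (A.land (A.shiftRight 45))) (Nat.rec 0 (fun _ _ => (A.land (A.shiftRight 62))) (A.land (A.shiftRight 
    44)))))))))))
/-- uniqueness violated -/
def bad (A : ℕ) : ℕ :=
  (Nat.lor (Nat.rec 0 (fun _ _ => (tw (A.land (A.shiftRight 2)))) (A.land (A.shiftRight 1))) (Nat.lor (Nat.rec 0 
    (fun _ _ => (tw (A.land (A.shiftRight 8)))) (A.land (A.shiftRight 4))) (Nat.lor (Nat.rec 0 (fun _ _ => (tw 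
    (A.land (A.shiftRight 10)))) (A.land (A.shiftRight 5))) (Nat.lor (Nat.rec 0 (fun _ _ => (tw (A.land 
    (A.shiftRight 12)))) (A.land (A.shiftRight 6))) (Nat.lor (Nat.rec 0 (fun _ _ => (tw (A.land (A.shiftRight 
    38)))) (A.land (A.shiftRight 19))) (Nat.lor (Nat.rec 0 (fun _ _ => (tw (A.land (A.shiftRight 40)))) (A.land 
    (A.shiftRight 20))) (Nat.lor (Nat.rec 0 (fun _ _ => (tw (A.land (A.shiftRight 42)))) (A.land (A.shiftRight 
    21))) (Nat.lor (Nat.rec 0 (fun _ _ => (tw (A.land (A.shiftRight 48)))) (A.land (A.shiftRight 24))) (Nat.lor 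
    (Nat.rec 0 (fun _ _ => (tw (A.land (A.shiftRight 50)))) (A.land (A.shiftRight 25))) (Nat.lor (Nat.rec 0 (fun _ 
    _ => (tw (A.land (A.shiftRight 52)))) (A.land (A.shiftRight 26))) (Nat.lor (Nat.rec 0 (fun _ _ => (tw (A.land 
    (A.shiftRight 58)))) (A.land (A.shiftRight 29))) (Nat.lor (Nat.rec 0 (fun _ _ => (tw (A.land (A.shiftRight 
    60)))) (A.land (A.shiftRight 30))) (Nat.rec 0 (fun _ _ => (tw (A.land (A.shiftRight 62)))) (A.land 
    (A.shiftRight 31)))))))))))))))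
def ee (A t l : ℕ) : ℕ := gate l (Nat.lor (df A t) (Nat.shiftLeft (df A t) t))
/-- vertices having a live neighbour -/
def HH (A : ℕ) : ℕ :=
  (Nat.lor (Nat.rec 0 (fun _ _ => (ee A 1 (Lb1 A))) (A.land (A.shiftRight 1))) (Nat.lor (Nat.rec 0 (fun _ _ => 
    (ee A 4 (La4 A))) (A.land (A.shiftRight 4))) (Nat.lor (Nat.rec 0 (fun _ _ => (ee A 5 (Lb5 A))) (A.land 
    (A.shiftRight 5))) (Nat.lor (Nat.rec 0 (fun _ _ => (ee A 6 (La6 A))) (A.land (A.shiftRight 6))) (Nat.lor 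
    (Nat.rec 0 (fun _ _ => (ee A 19 (A.land (A.shiftRight 38)))) (A.land (A.shiftRight 19))) (Nat.lor (Nat.rec 0 
    (fun _ _ => (ee A 20 (La20 A))) (A.land (A.shiftRight 20))) (Nat.lor (Nat.rec 0 (fun _ _ => (ee A 21 (A.land 
    (A.shiftRight 42)))) (A.land (A.shiftRight 21))) (Nat.lor (Nat.rec 0 (fun _ _ => (ee A 24 (La24 A))) (A.land 
    (A.shiftRight 24))) (Nat.lor (Nat.rec 0 (fun _ _ => (ee A 25 (Lb25 A))) (A.land (A.shiftRight 25))) (Nat.lor 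
    (Nat.rec 0 (fun _ _ => (ee A 26 (La26 A))) (A.land (A.shiftRight 26))) (Nat.lor (Nat.rec 0 (fun _ _ => (ee A 
    29 (A.land (A.shiftRight 58)))) (A.land (A.shiftRight 29))) (Nat.lor (Nat.rec 0 (fun _ _ => (ee A 30 (La30 
    A))) (A.land (A.shiftRight 30))) (Nat.rec 0 (fun _ _ => (ee A 31 (A.land (A.shiftRight 62)))) (A.land 
    (A.shiftRight 31)))))))))))))))
/-- the liveness functions -/
def LT (A : ℕ) : List (ℕ × ℕ) := [(1, (Lb1 A)), (4, (La4 A)), (5, (Lb5 A)), (6, (La6 A)), (19, (A.land (A.shiftRight 38))), (20, (La20 A)), (21, (A.land (A.shiftRight 42))), (24, (La24 A)), (25, (Lb25 A)), (26, (La26 A)), (29, (A.land (A.shiftRight 58))), (30, (La30 A)), (31, (A.land (A.shiftRight 62)))]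

def force {α : Type} (x : ℕ) (f : ℕ → α) : α := Nat.rec (f 0) (fun n _ => f (Nat.succ n)) x

/-- one flooding step -/
def fstep (A : ℕ) (l : List (ℕ × ℕ)) (c : ℕ) : ℕ :=
  List.rec c (fun x _ ih => force ih fun c => force (gate x.2 (df A x.1)) fun e =>
    Nat.lor c (Nat.lor (Nat.shiftLeft (Nat.land c e) x.1) (Nat.land (Nat.shiftRight c x.1) e))) l

/-- flooding shows that `A` is disconnected -/
def flood (A : ℕ) (n : ℕ) : ℕ → Bool :=
  Nat.rec (fun _ => false) (fun _ ih c => force (fstep A (LT A) c) fun c' =>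
    Bool.rec (ih c') (!(Nat.beq c A)) (Nat.beq c' c)) n

def leaf (b : ℕ) (sl : List (ℕ × ℕ)) (A : ℕ) : Bool :=
  Nat.rec (Nat.rec (Bool.rec (List.rec false (fun x _ ih => Bool.rec ih true (Nat.beq x.1 A)) sl) true (flood A 7 b))
    (fun _ _ => true) (bad A)) (fun _ _ => true) (Nat.sub A (HH A))

/-- search over all sets obtained by adding `n+1` positions from `l` -/
def go (b : ℕ) (sl : List (ℕ × ℕ)) (l : List (ℕ × ℕ)) : ℕ → ℕ → Bool :=
  List.rec (fun _ _ => true)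
    (fun x _ ih n A =>
      Bool.rec false (ih n A)
       (Nat.rec
        (force (Nat.lor A (Nat.shiftLeft 1 x.1)) fun B => Nat.rec (leaf b sl B)
          (fun m _ => Nat.rec (ih m B) (fun _ _ => true) (bad B)) n)
        (fun _ _ => true) (Nat.land A x.2))) l

def cd0 : List (ℕ × ℕ) :=
  [(1,0), (2,0), (5,0), (6,0), (7,0), (10,0), (11,0), (12,0), (25,0), (26,0), (27,0), (30,0), (31,0), (32,0), 
    (35,0), (36,0), (37,0), (50,0), (51,0), (52,0), (55,0), (56,0), (57,0), (61,0), (62,0)]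
def so0 : List (ℕ × ℕ) :=
  [(1152921505680589863,4155549950016), (1152921505680589895,5092698234944), 
    (1152921505680589925,4542942454080), (1152921505680590049,9284586348864), (1152921505680590919,9559464222784), 
    (1152921505680592967,4155583766592), (1152921505680593031,5231210930240), (1152921505680593093,4544016204160), 
    (1152921505680593121,14026391668608), (1152921505680593989,14029612107648), 
    (1152921505680594017,4155583799616), (1152921505680595011,14030685587328), 
    (1152921505680596001,5235505930560), (1152921505680596033,5098066985344), (1152921506754331687,8554670202944), 
    (1152921506754331719,4156623945794), (1152921506754331749,4404430020994), (1152921506754332743,9559464476738), 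
    (1152921506754334791,8554704019520), (1152921506754334855,4156657762370), (1152921506754334917,4405503771074), 
    (1152921506754335813,13894320113602), (1152921507828073509,4568940791680), 
    (1152921507828073541,4430428358594), (1152921507828076613,4568974608256), (1152921507828076677,4430462175170), 
    (1152921512123040801,11028571604864), (1152921512123043905,11028605421440), 
    (1152921538966586407,8558829936960), (1152921538966586439,8558796382594), (1152921538966586469,4160784695626), 
    (1152921538966586593,9284587618634), (1152921538966590533,13344564299978), 
    (1152921538966590561,8558999019840), (1152921538966592545,4160953778506), (1152921538966592577,4405504819914), 
    (1152921540040328199,5122856306560), (1152921540040328261,4430294141130), (1152921540040332353,5123025389440), 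
    (1152921540040334337,4430463224010), (1152921540073881607,17355398979648), 
    (1152921540073885761,17355399020928), (1152921540275208193,15664249157273), 
    (1152921541114070023,5122822752194), (1152921541114070053,4568773019850), 
    (1152921541248286727,17355416272962), (1152921541248287777,10684806449354), 
    (1152921542187811845,724817414076), (1152921542221365253,13232230377468), 
    (1152921542322028549,13369686624188), (1152921542322029569,10684812798204), 
    (1152921542355582977,14977054390243), (1152921546482779137,11028579223484), 
    (1152921546516332545,46213790295616), (1152921546616995841,19829317683072), 
    (1152921573326327879,8559903687040), (1152921573326327943,8559870132674), (1152921573326328005,4161858699660), 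
    (1152921573326328033,13201757948172), (1152921573326328901,13204978387212), 
    (1152921573326328929,8560038953344), (1152921573326329923,13206051866892), 
    (1152921573326330913,8559871181514), (1152921573326330945,4161993965964), (1152921574400069639,5261369001856), 
    (1152921574400069765,4430294403340), (1152921574400070689,5261504268160), (1152921574400072705,4430429669644), 
    (1152921575473811463,5261335447490), (1152921575473811525,4568773282060), 
    (1152921575540916231,17356489752642), (1152921575540920385,10616087234828), 
    (1152921576547553285,863330109372), (1152921576614658053,13370760103868), 
    (1152921576614662145,10616093329724), (1152921580842520577,11028613040060), 
    (1152921580909625345,19830391162752), (1152921607686067233,5261336496330), 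
    (1152921607686067265,5122824063244), (1152921608759809025,863465375676), (1152921608793362433,13232230418748), 
    (1152921644226838535,17357563232322), (1152921645300580357,13371833583548), 
    (1152921649595547649,19831464642432), (1152921649696210945,50955953358720), 
    (1152921679660318721,15664249198553), (1152921745125016609,11377369925834), 
    (1152921745125019713,17357649740172), (1152921746198758401,11377376274684), 
    (1152921746198761473,14059114858428), (1152921746232311809,14977054431523), 
    (1154047405587432455,17371501174848), (1154047405587432517,16695041204618), 
    (1154047405587436609,17371501216128), (1154047405587438593,16695041245898), 
    (1154047405620985863,4156226281536), (1154047405620990017,4156226322816), (1154047405654540295,7862952140864), 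
    (1154047405654541317,13946262136498), (1154047405688094725,4564417455680), 
    (1154047405822312449,10680450885184), (1154047406661177351,17371518468162), 
    (1154047406661177413,16695058497932), (1154047406694727687,8555346534464), 
    (1154047406694731781,14083718383218), (1154047406728282119,4157300277314), 
    (1154047406761836549,4425905022594), (1154047407734916101,13248332572668), 
    (1154047407734919173,13385788819388), (1154047407734919233,7868320891264), 
    (1154047407734920193,13946262177778), (1154047407768469509,4569617123200), 
    (1154047407768473601,5256980932160), (1154047407802023941,4431104690114), 
    (1154047412029883393,46213794226816), (1154047412029886465,19845419878272), 
    (1154047412063436801,11029247936384), (1154047473266724929,8560715284864), 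
    (1154047474306913281,13248332613948), (1154047474340466689,5262180599680), 
    (1154047475380654145,4162670297484), (1154047475414208513,4425906333644), (1154047476454395905,4431106001164), 
    (1154047544133681157,20199752017472), (1154047545207422977,11373014361664), 
    (1155173305561382919,12329718128704), (1155173306568017927,17372591947842), 
    (1155173306635124743,12329718382658), (1155173307641759749,13386862299068), 
    (1155173311936727041,19846493357952), (1157425105375068167,4156260098112), 
    (1157425105375069217,4156260131136), (1157425105375072321,4156260139392), (1157425105442177031,8001464836160), 
    (1157425105509285893,4565491205760), (1157425105542840321,16796986361728), 
    (1157425106381702151,17373665427522), (1157425106381702181,16832497451338), 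
    (1157425106448809991,8555380351040), (1157425106448811013,13946279429812), 
    (1157425106515918855,4157334093890), (1157425106583027717,4426978772674), 
    (1157425107455443973,13387935778748), (1157425107455444001,8005759836480), 
    (1157425107522551813,4569650939776), (1157425107522552833,5119541986944), (1157425107589660677,4431138506690), 
    (1157425109602930753,8006833586560), (1157425109670039553,5258054682240), 
    (1157425111750411265,19847566837632), (1157425111750414337,51986493851520), 
    (1157425111817519105,11029281752960), (1157425138661065761,8559675351360), 
    (1157425139734807553,5123701720960), (1157425139768360961,17355399186048), 
    (1157425140741440545,4161630110026), (1157425140808549377,4426979821514), (1157425141815182337,4431139555530), 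
    (1157425173020807233,8560749101440), (1157425174094548993,5262214416256), 
    (1157425175168286725,20131032548992), (1157425175168290817,52540544599680), 
    (1157425176242028545,11304294893184), (1157425177248665665,4162704114060), 
    (1157425177315774465,4426980083724), (1157425178322407425,4431139817740), 
    (1158551005281910789,16821676394368), (1158551005281911809,17371501381248), 
    (1158551005315465217,4156260296256), (1158551006355652613,16686384400322), 
    (1158551007362286593,16695041411018), (1159676905188753411,16822749874048), 
    (1160802805028488193,13946262342898), (1160802805062041601,8027234838080), 
    (1160802805095596033,7889795892864), (1188950302699552807,17376868573248), 
    (1188950302699552993,17038638608773), (1188950302699556961,17376868614528), 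
    (1188950303773294727,17376885866562), (1188950304847036453,13253699971068), 
    (1188950304847036549,13391156217788), (1188950304847036577,13602664773623), 
    (1188950309142003745,46213795537216), (1188950309142003841,19850787276672), 
    (1188950337092845601,39367191662912), (1188950371419033633,13253700012348), 
    (1190076201566208007,8580304938560), (1190076201566212161,8580474021440), (1190076201599762439,8580271384194), 
    (1190076201633316869,4182264776306), (1190076201767534593,10680457234034), 
    (1190076202606395399,7893110212480), (1190076202606399553,7893279295360), (1190076202673504261,4430299385330), 
    (1190076203680137223,7893076658114), (1190076203680141377,8580272695244), (1190076203713691653,4568778264050), 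
    (1190076203713691777,9310422158834), (1190076203713695745,4182433859186), (1190076204753879045,3495071319996), 
    (1190076204753879169,9310423428604), (1190076204753883137,4430468468210), 
    (1190076209048846337,11029255555004), (1190076270252134465,7893077969164), 
    (1190076270285688833,5261341740530), (1190076271325876225,3495240402876), 
    (1190076341152645121,11373020710514), (1193453902394032161,17376868779648), 
    (1194579801227132933,13387849518578), (1194579801260687361,8581150352960), 
    (1194579802300874753,7893955626880), (1196831601007263745,4183110190706), (1196831601040818177,4426985065714), 
    (1196831602047451137,4431144799730), (1224979100792258631,17377959346242), 
    (1224979100792262725,21505421918592), (1224979101866000453,13392229697468), 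
    (1224979101866004545,12678684262784), (1224979106160967745,19851860756352), 
    (1224979169511739457,12678685786508), (1229482698339254279,8581378688640), 
    (1229482698339255329,8581513954944), (1229482698339258433,8581547771520), (1229482698406363143,8581345134274), 
    (1229482698473472005,4183338780340), (1229482698507026433,13223573573172), 
    (1229482699345887239,8031622907776), (1229482699345888289,8031758174080), (1229482699345891393,8031791990656), 
    (1229482699480104965,4430299647540), (1229482700419629063,8031589353410), (1229482700419630113,8581346183114), 
    (1229482700419633217,52562690359680), (1229482700486737925,4568778526260), 
    (1229482700486737985,9241702944308), (1229482700486738945,4183474046644), (1229482701493370885,3633584015292), 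
    (1229482701493370945,9241703960124), (1229482701493371905,4430434913844), (1229482702567116865,8581346445324), 
    (1229482702634225665,4183507863220), (1229482703640858625,4430468730420), 
    (1229482705788338177,11029289371580), (1229482732631884833,8031590402250), 
    (1229482732698993665,5122829307444), (1229482733705626625,3633719281596), 
    (1229482733739180033,13232230583868), (1229482766991626305,8031590664460), 
    (1229482767058735105,5261342002740), (1229482768065368065,3633753098172), 
    (1229482769206214657,11304301495988), (1230608598246096901,13248263605812), 
    (1230608598279651329,8582190286464), (1230608599252730881,13248332779068), 
    (1230608599286284289,8032434505600), (1231734498152939523,13249337085492), 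
    (1232860398026227713,8581351427314), (1232860398059782145,4184150378164), (1232860399066415105,4431111245364), 
    (1265511496364851233,13253700177468), (1266637395231506433,8031595646450), 
    (1266637395265060865,7893083213364), (1266637396271693825,3634395613116), 
    (1297036694830186535,17379032825922), (1297036694830187557,21574141387072), 
    (1297036695903928357,13393303177148), (1297036695903929377,12747403731264), 
    (1297036700198895649,19852934236032), (1297036700198895745,52330007349120), 
    (1297036729189925921,12747405001034), (1333065492922892321,17038638815173), 
    (1405123084813336609,13602664980023), (1406248983679991809,12773239541234), 
    (1406248984720179201,12773240811004), (1409626683434074113,17379465365172), 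
    (1409626684440707073,16829709551548), (3458764582540023873,17383413252492), 
    (3458764583613765633,14084878370748), (3537577507366633473,17383759283892), 
    (3537577508373266433,16834003470268), (5764607525181719589,17519692259648), 
    (5764607525181719621,17384400265602), (5764607525181722693,17519692267904), 
    (5764607525181722757,17384400273858), (5764607526255461409,4294908092736), 
    (5764607526255464513,4294908100992), (5764607559541457925,13398670616828), 
    (5764607559541457953,8559844434240), (5764607559675674629,43908046106752), 
    (5764607559675675649,19514704251082), (5764607560615199745,5123870803840), 
    (5764607560648753153,17355399227328), (5764607560749416449,17492855474048), 
    (5764607591753716769,17519778726218), (5764607591753716801,17384486732172), 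
    (5764607592827454497,8698323312960), (5764607592827458561,14085951850428), 
    (5764607593901196293,13259084704062), (5764607593901199365,13398670625084), 
    (5764607593901199425,8560918184320), (5764607593901200385,13946365937662), 
    (5764607593968304133,43908062879872), (5764607593968308225,19445984774412), 
    (5764607594974938113,5124910737344), (5764607594974941185,5262383499136), 
    (5764607595042045953,17493928953728), (5764607626113451041,4300278071626), 
    (5764607627187192833,4431308638410), (5764607628260934657,4432348571914), (5764607661546934337,8699397063040), 
    (5764607662620676101,13259084712318), (5764607662654226437,43908079652992), 
    (5764607663694417921,5263423432640), (5764607663727968257,17495002433408), 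
    (5764607729192669249,4301352075660), (5764607730266411009,4431308900620), (5764607731340152833,4432348834124), 
    (5765733425088565253,43908297703552), (5765733425122115589,17519692424768), 
    (5765733425155670021,17384400430722), (5765733426162304001,17371501422528), 
    (5765733426162307073,17508957669248), (5765733426195857409,4294908257856), 
    (5765733492734297089,16695041452298), (5765733493808041985,16697205704972), 
    (5766859324995405829,43908314476672), (5766859326069147649,17510031148928), 
    (5769111124809090053,43908331249792), (5769111124876197893,17519692433024), 
    (5769111124943306757,17384400438978), (5769111125882831873,17511104628608), 
    (5769111125949939713,4294908266112), (5769111159168828417,16834644658378), 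
    (5800636322200682629,43908381569152), (5800636323274424353,17376868820928), 
    (5800636323274424449,17514325067648), (5801762222107525125,13398670781948), 
    (5801762222107525249,18140314717682), (5801762222107529217,14085865590258), 
    (5801762222141079553,8581319435840), (5801762223181266945,7894124709760), 
    (5836665119219646533,43908398342272), (5836665120293388353,17515398547328), 
    (5837791018052748289,13946262384178), (5837791018086301697,8719798314560), 
    (5837791019126489093,13259084869182), (5837791020200230913,7895164643264), 
    (5841168718847016965,13398670790204), (5841168718847017025,18071595241012), 
    (5841168718847017985,13948426636852), (5841168718914125825,8582393185920), 
    (5841168719920758785,8032637405056), (5842294616639930369,17520124757618), 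
    (5842294616673484801,17384832763572), (5842294617680117761,16835076949948), 
    (5842294618753859585,16695491037182), (5873819814031523841,4321758152306), 
    (5873819815071711233,4431313882610), (5873819816145453057,4432353816114), 
    (5908722713257574437,43908415115392), (5908722714331316257,17516472027008), 
    (5913226311878311937,8720872064640), (5913226312884944901,13259084877438), 
    (5913226313958686721,8033677338560), (5985283904842498049,4322832156340), (5985283905849131009,4431314144820), 
    (5985283906922872833,4432354078324), (8070450533321671713,8724321650560), (8070450533321674817,8724355467136), 
    (8070450534395413537,8586882705344), (8070450534395416641,8586916521920), (8070450566607668257,8724153878730), 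
    (8070450567681410049,4326282758076), (8070450567714963457,13232230625148), 
    (8070450568755151873,4431509712764), (8070450568889368577,13232247918462), 
    (8070450600967406625,8586714933514), (8070450600967409729,8724154140940), (8070450602041148417,5123904106364), 
    (8070450602041149441,9590670094204), (8070450602041151489,4326316574652), (8070450603114890241,4188844066814), 
    (8070450603114891265,9590670348158), (8070450603114893313,4431543529340), 
    (8070450603181998081,13233321398142), (8070450669686886465,8586715195724), 
    (8070450670760628225,5262416801660), (8070450671834370049,4188877883390), 
    (8070450671867920385,13234394877822), (8071576433228514305,13248332820348), 
    (8071576433262067713,8724997982080), (8071576434302259201,13248350113662), 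
    (8071576434335809537,8587559036864), (8072702334209099777,13249423593342), 
    (8074954133016150017,8725031798656), (8074954134022784001,13250497073022), 
    (8074954134089891841,8587592853440), (8106479330340634657,13253700218748), 
    (8106479331414376577,13253717512062), (8107605229207289857,8724159122930), 
    (8107605230247477249,4326959089596), (8107605231321219073,4432186044284), 
    (8142508128433340481,13254790991742), (8143634026226253825,8586720177714), 
    (8143634027266441217,7894158012284), (8143634028340183041,4189520398334), 
    (8144759927173283841,12360924000124), (8144759928247025665,12360924254078), 
    (8147011725980336129,8724159385140), (8147011726986969089,4326992906172), (8147011728060710913,4432219860860), 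
    (8214565722471268385,13255864471422), (8219069320018264065,8586720439924), 
    (8219069321024897025,8032670707580), (8219069322098638849,4189554214910)]
theorem go0 : go 1 so0 cd0 4 1152921504606846977 = true := by decide +kernel
def cd1 : List (ℕ × ℕ) :=
  [(1,0), (2,4612811918334231552), (5,0), (6,0), (7,0), (10,4612811918334230532), (11,0), 
    (12,1157425104234217473), (25,0), (26,0), (27,0), (30,0), (31,0), (32,0), (35,0), (36,0), (37,0), (51,0), 
    (52,1152921504606851073), (55,0), (56,0), (57,0), (60,4503599627374593), (61,0), (62,1125899906843652)]
def so1 : List (ℕ × ℕ) :=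
  [(1125935575203841,24428086502976), (1125936648945665,28827206755904), (1125937655578625,28277586208320), 
    (1125941816328193,33019230103104), (1125971008684033,33293972743744), (1126039728160769,24566599198272), 
    (1126041875644417,28965719451200), (1126043956019201,28278693766720), (1126044895543297,20169694586432), 
    (1126074020790273,20172915025472), (1126074960314369,24566734464576), (1126108313419777,20173988505152), 
    (1126141532307457,28970149684800), (1126142606049281,28832744547904), (3377839340521473,20190090700352), 
    (37154836545798273,20194384619072), (145241227602690081,20196531578432), (2306969048740528131,20200825497152)]
theorem go1 : go 1 so1 cd1 4 1125899906842625 = true := by decide +kernel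
def cd2 : List (ℕ × ℕ) :=
  [(0,1158551004141065220), (2,4617315517961606145), (5,0), (6,0), (7,0), (10,5765733422941081605), (11,0), 
    (12,5769111122661606405), (25,0), (26,0), (27,0), (30,0), (31,0), (32,0), (35,0), (36,0), (37,0), 
    (50,5769111122661606405), (52,5765733422941081605), (55,0), (56,0), (57,0), (60,4617315517961606145), (61,0), 
    (62,1158551004141065220)]
def so2 : List (ℕ × ℕ) :=
  [(2251799880796386,13957672154753), (2251800048568386,16728266682753), (2251801961171170,13270477387723), 
    (2251802196051970,13292292847603), (2251807329880130,16733720547723), (2251807396988930,13984941479603), 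
    (2251835482046466,15104762853273), (2251836455127106,16736940986763), (2251836522235906,13988161918643), 
    (2251836555788290,14967323899867), (2251870915526658,46488515094081), (2251876116463618,20100975113857), 
    (2251905241710594,20104195552897), (2251939433678914,16739087946123), (2251939500787714,13990308878003), 
    (2251939635003394,15104762861529), (2251941782487042,14967323908123), (2252008220262402,20106342512257), 
    (2252042546446338,50960382506625), (3377701868017730,16753043181963), (3377701935126530,14004264113843), 
    (3377770654601218,20120297748097), (6755401588542530,16755190141323), (6755401655651330,14006411073203), 
    (6755470375126018,20122444707457), (38280598980135106,16758410580363), (38280599047243906,14009631512243), 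
    (38280667766718594,20125665146497), (146366990037026914,16760557539723), (146366990104135714,14011778471603), 
    (146367058823610402,20127812105857), (1155173306568017990,16763777978763), 
    (1155173306635126790,14014998910643), (1155173375354601478,20131032544897), 
    (2308094811409743874,16728266889153), (2308094816543574018,43829612634817), 
    (2308094816610680834,17420915521153), (2308094845668820994,43829662954177), 
    (2308094845735927810,17424135960193), (2308094948647372802,43829696500417), 
    (2308094948714479618,17426282919553), (2309220711081711618,43829914550977), 
    (2309220711148818434,17440238155393), (2312598410802236418,43831005065857), 
    (2312598410869343234,17442385114753), (2344123608193828994,43834226291137), 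
    (2344123608260935810,17445605553793), (2380152403300188162,13292293054003), 
    (2380152410581499906,13297746918973), (2380152439706746882,13300967358013), 
    (2380152542685298690,13303114317373), (2381278305119637506,13317069553213), 
    (2384656004840162306,13319216512573), (2416181202231754882,13322436951613), 
    (2452209999250720802,43836373774657), (2452209999317827618,17447752513153), 
    (2524267593288646690,13324583910973), (2560296388227235842,17448184846003), 
    (2560296390307610626,16760990078973), (3461016315781711878,43839594999937), 
    (3461016315848818694,17450972952193), (3533073909819637766,13327804350013), 
    (4613937820388558915,16765924938123), (4613937820455667715,14017145870003), 
    (4613937889175142403,20133179504257), (6919780829602252803,43909388218432), 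
    (6919780829669359619,17453119911553), (6991838423640178691,13329951309373)]
theorem go2 : go 2 so2 cd2 4 2251799813685250 = true := by decide +kernel
def cd3 : List (ℕ × ℕ) :=
  [(0,1158551004141065220), (2,4617315517961606145), (5,36028797018964096), (6,0), (7,144115188075855904), 
    (10,5765733422941081605), (11,2305843009213693954), (12,5769111122661606405), (25,34493956096), (26,0), 
    (27,137472507904), (30,0), (31,0), (32,0), (35,137472507904), (36,0), (37,34493956096), 
    (50,5769111122661606405), (51,2305843009213693954), (52,5765733422941081605), (55,144115188075855904), (56,0), 
    (57,36028797018964096), (60,4617315517961606145), (62,1158551004141065220)]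
def so3 : List (ℕ × ℕ) :=
  [(2305843051223842818,43812432766657), (2305843085516472322,43813506508417), 
    (2305843114641719298,43813556827777), (2305843154202394626,43814580250177), 
    (2305843217620271106,43814647342657), (2306968916636733442,43828538893057), 
    (2306968945761980418,43828589212417), (2306968980054609922,43828605985537), 
    (2306969048740532226,43828622758657), (2310346616357258242,43830686376577), 
    (2310346645482505218,43830736695937), (2310346679775134722,43830753469057), 
    (2310346748461057026,43830770242177), (2341871813748850818,43833907601857), 
    (2341871842874097794,43833957921217), (2341871877166727298,43833974694337), 
    (2341871945852649602,39435944956353), (2342997708286988418,43834209518017), 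
    (2346375408007513218,43834243064257), (2377900610767814722,43834981343617), 
    (2377900639893061698,43835031662977), (2377900674185691202,39437001924993), 
    (2377900742871613506,43835065209217), (2379026505305952322,43835283259777), 
    (2382404205026477122,43835316806017), (2413929402418069698,43835367125377), 
    (2449958204805742626,43836055085377), (2449958233930989602,39438058893633), 
    (2449958268223619106,43836122177857), (2449958336909541410,43836138950977), 
    (2451084099343880226,43836357001537), (2454461799064405026,43836390547777), 
    (2522015793474961506,43836457640257), (3458764521336733702,39441229799553), 
    (3458764550461980678,43839326630017), (3458764584754610182,43839343403137), 
    (3458764653440532486,43839360176257), (3494793312986988678,43839662092417), 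
    (3530822110005952582,43839678865537), (3602879704043880486,43839695638657), 
    (6917529035157274627,39511023018048), (6917529064282521603,43909119848512), 
    (6917529098575151107,43909136621632), (6917529167261073411,43909153394752), 
    (6953557826807529603,43909455310912), (6989586623826493507,43909472084032), 
    (7061644217864421411,43909488857152)]
theorem go3 : go 2 so3 cd3 4 2305843009213693954 = true := by decide +kernel
def cd4 : List (ℕ × ℕ) :=
  [(1,2308094809027381248), (2,4617315517961606145), (5,180143985094819968), (6,0), (7,180143985094819872), 
    (10,5765733422941081605), (11,2308094809027379202), (12,5769111122661606405), (25,171932909568), (26,0), 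
    (27,171832246272), (30,0), (31,0), (32,0), (35,137606725632), (36,0), (37,34527510528), 
    (50,5769111122661606405), (51,2305843009213696002), (52,5765733422941081605), (55,144115188075856032), (56,0), 
    (57,36028797018964128), (60,4617315517961606145), (61,2251799813687298)]
def so4 : List (ℕ × ℕ) :=
  [(4611686094730166273,43882225985152), (4683743619981508673,43903700820352), 
    (4683743683399385153,43903767912832)]
theorem go4 : go 1 so4 cd4 4 4611686018427387905 = true := by decide +kernel
def cd5 : List (ℕ × ℕ) :=
  [(0,5770237022568453124), (1,2308094809027381248), (2,5770237022568453121), (5,180143985094819968), 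
    (7,180143985094819872), (10,5770237022568452101), (11,2308094809027379202), (12,5770237022568449029), 
    (25,171932909568), (26,0), (27,171832246272), (30,0), (31,0), (32,0), (35,137606725632), (36,0), 
    (37,34527510528), (50,5769111122661610501), (51,2305843009213696002), (52,5765733422941082629), 
    (55,144115188075856032), (57,36028797018964128), (60,4617315517961606149), (61,2251799813687298), 
    (62,1158551004141065221)]
def so5 : List (ℕ × ℕ) :=
  [(72057670340706368,43469909124742)]
theorem go5 : go 64 so5 cd5 4 72057594037928000 = true := by decide +kernel

end FC

set_option linter.unusedSectionVars false
set_option linter.unusedVariables false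
namespace FC

open Set Filter Topology

abbrev Z3 := ℤ × ℤ × ℤ

def Df (D : Set Z3) (δ : Z3) : Prop := ∃ a ∈ D, ∃ b ∈ D, a - b = δ
def Fx (D : Set Z3) (δ : Z3) : Prop := Df D (δ + δ)
def Live (D : Set Z3) (δ : Z3) : Prop :=
  Fx D δ ∨ ∃ δ1, Df D (δ + δ + δ - δ1) ∧ (Fx D δ1 ∨ ∃ δ2, Df D (δ1 + δ1 + δ1 - δ2) ∧ Fx D δ2)

/-- combinatorial properties of good digit sets -/
structure Comb (D : Set Z3) : Prop where
  box : ∀ d ∈ D, (0 ≤ d.1 ∧ d.1 ≤ 2) ∧ (0 ≤ d.2.1 ∧ d.2.1 ≤ 2) ∧ (0 ≤ d.2.2 ∧ d.2.2 ≤ 2)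
  card : D.ncard = 7
  uniq : ∀ d ∈ D, ∀ e ∈ D, d ≠ e → ∀ a ∈ D, ∀ b ∈ D, ∀ a' ∈ D, ∀ b' ∈ D,
    a - b = (e - d) + (e - d) → a' - b' = (e - d) + (e - d) → a = a'
  conn : ∀ C ⊆ D, C.Nonempty → (∀ d ∈ C, ∀ e ∈ D, Live D (e - d) → e ∈ C) → C = D

lemma Df.neg {D : Set Z3} {δ : Z3} (h : Df D δ) : Df D (-δ) := by
  obtain ⟨a, ha, b, hb, rfl⟩ := h
  exact ⟨b, hb, a, ha, by abel⟩

lemma Fx.neg {D : Set Z3} {δ : Z3} (h : Fx D δ) : Fx D (-δ) := by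
  have := Df.neg h
  rwa [neg_add] at this

lemma Live.neg {D : Set Z3} {δ : Z3} (h : Live D δ) : Live D (-δ) := by
  rcases h with h | ⟨d1, h1, h | ⟨d2, h2, h⟩⟩
  · exact Or.inl h.neg
  · refine Or.inr ⟨-d1, ?_, Or.inl h.neg⟩
    convert h1.neg using 1; abel
  · refine Or.inr ⟨-d1, ?_, Or.inr ⟨-d2, ?_, h.neg⟩⟩
    · convert h1.neg using 1; abel
    · convert h2.neg using 1; abel

def TT (δ : Z3) : ℤ := 25 * δ.1 + 5 * δ.2.1 + δ.2.2

def Msk (A : ℕ) (D : Set Z3) : Prop := ∀ n, A.testBit n = true ↔ ∃ d ∈ D, TT d = n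

lemma df_bit (A t n : ℕ) : (df A t).testBit n = (A.testBit n && A.testBit (t + n)) := by
  unfold df
  show (A &&& (A >>> t)).testBit n = _
  simp

lemma df_ne {A t n : ℕ} (h1 : A.testBit n = true) (h2 : A.testBit (n + t) = true) : df A t ≠ 0 := by
  intro h
  have := df_bit A t n
  rw [h, add_comm t, h1, h2] at this
  simp at this

lemma df_ex {A t : ℕ} (h : df A t ≠ 0) : ∃ n, A.testBit n = true ∧ A.testBit (n + t) = true := by
  obtain ⟨n, hn⟩ := Nat.exists_testBit_of_ne_zero h
  rw [df_bit, Bool.and_eq_true, add_comm t] at hn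
  exact ⟨n, hn⟩

section snd
variable {A : ℕ} {D : Set Z3}

/-- the difference box -/
def Bx (k : ℤ) (δ : Z3) : Prop := (-k ≤ δ.1 ∧ δ.1 ≤ k) ∧ (-k ≤ δ.2.1 ∧ δ.2.1 ≤ k) ∧ (-k ≤ δ.2.2 ∧ δ.2.2 ≤ k)

lemma TT_inj {a b : Z3} (ha : Bx 2 a) (hb : Bx 2 b) (h : TT a = TT b) : a = b := by
  obtain ⟨a1, a2, a3⟩ := a
  obtain ⟨b1, b2, b3⟩ := b
  simp only [Bx, TT] at *
  ext <;> simp <;> omega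

lemma TT_sub (a b : Z3) : TT (a - b) = TT a - TT b := by
  simp only [TT, Prod.fst_sub, Prod.snd_sub]; ring

lemma TT_add (a b : Z3) : TT (a + b) = TT a + TT b := by
  simp only [TT, Prod.fst_add, Prod.snd_add]; ring

lemma TT_neg (a : Z3) : TT (-a) = - TT a := by
  simp only [TT, Prod.fst_neg, Prod.snd_neg]; ring

lemma sub_Bx (hc : Comb D) {a b : Z3} (ha : a ∈ D) (hb : b ∈ D) : Bx 2 (a - b) := by
  have h1 := hc.box a ha
  have h2 := hc.box b hb
  simp only [Bx, Prod.fst_sub, Prod.snd_sub]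
  omega

lemma Df.bx (hc : Comb D) {δ : Z3} (h : Df D δ) : Bx 2 δ := by
  obtain ⟨a, ha, b, hb, rfl⟩ := h
  exact sub_Bx hc ha hb

lemma Fx.bx (hc : Comb D) {δ : Z3} (h : Fx D δ) : Bx 1 δ := by
  have := Df.bx hc h
  simp only [Bx, Prod.fst_add, Prod.snd_add] at *
  omega

lemma Df.df (hm : Msk A D) {δ : Z3} (hc : Comb D) (h : Df D δ) : df A (TT δ).natAbs ≠ 0 := by
  obtain ⟨a, ha, b, hb, rfl⟩ := h
  have ha' := hc.box a ha
  have hb' := hc.box b hb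
  have h1 : A.testBit (TT a).toNat = true := (hm _).2 ⟨a, ha, by simp only [TT]; omega⟩
  have h2 : A.testBit (TT b).toNat = true := (hm _).2 ⟨b, hb, by simp only [TT]; omega⟩
  have h3 : 0 ≤ TT a := by simp only [TT]; omega
  have h4 : 0 ≤ TT b := by simp only [TT]; omega
  rw [TT_sub]
  rcases le_total (TT b) (TT a) with h | h
  · refine df_ne h2 ?_
    convert h1 using 2; omega
  · refine df_ne h1 ?_
    convert h2 using 2; omega

lemma df_Df (hm : Msk A D) {δ : Z3} (hc : Comb D) (hδ : Bx 2 δ) (h : df A (TT δ).natAbs ≠ 0) : Df D δ := by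
  obtain ⟨n, h1, h2⟩ := df_ex h
  obtain ⟨a, ha, ha'⟩ := (hm _).1 h1
  obtain ⟨b, hb, hb'⟩ := (hm _).1 h2
  push_cast at hb'
  rcases le_total 0 (TT δ) with h | h
  · refine ⟨b, hb, a, ha, TT_inj (sub_Bx hc hb ha) hδ ?_⟩
    rw [TT_sub, ha', hb', abs_of_nonneg h]; ring
  · refine ⟨a, ha, b, hb, TT_inj (sub_Bx hc ha hb) hδ ?_⟩
    rw [TT_sub, ha', hb', abs_of_nonpos h]; ring

lemma dirs_unit : ∀ t ∈ dirs, ∃ δ : Z3, Bx 1 δ ∧ TT δ = t := by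
  have : ∀ t ∈ dirs, ∃ x : Fin 3, ∃ y : Fin 3, ∃ z : Fin 3,
    25 * ((x.val : ℤ) - 1) + 5 * ((y.val : ℤ) - 1) + ((z.val : ℤ) - 1) = t := by decide +kernel
  intro t ht
  obtain ⟨x, y, z, h⟩ := this t ht
  exact ⟨((x.val : ℤ) - 1, (y.val : ℤ) - 1, (z.val : ℤ) - 1), by simp only [Bx]; omega, h⟩

lemma ext_tab : ∀ x y z x' y' z' : Fin 3, (x ≠ 1 ∨ y ≠ 1 ∨ z ≠ 1) →
    (|3 * ((x.val : ℤ) - 1) - ((x'.val : ℤ) - 1)| ≤ 2 ∧ |3 * ((y.val : ℤ) - 1) - ((y'.val : ℤ) - 1)| ≤ 2 ∧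
      |3 * ((z.val : ℤ) - 1) - ((z'.val : ℤ) - 1)| ≤ 2) →
    (x = x' ∧ y = y' ∧ z = z') ∨
    ((25 * ((x'.val : ℤ) - 1) + 5 * ((y'.val : ℤ) - 1) + ((z'.val : ℤ) - 1)).natAbs,
      (25 * (3 * ((x.val : ℤ) - 1) - ((x'.val : ℤ) - 1)) + 5 * (3 * ((y.val : ℤ) - 1) - ((y'.val : ℤ) - 1)) +
        (3 * ((z.val : ℤ) - 1) - ((z'.val : ℤ) - 1))).natAbs) ∈
      exts (25 * ((x.val : ℤ) - 1) + 5 * ((y.val : ℤ) - 1) + ((z.val : ℤ) - 1)).natAbs := by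
  decide +kernel

lemma dirs_tab : ∀ x y z : Fin 3, (x ≠ 1 ∨ y ≠ 1 ∨ z ≠ 1) →
    (25 * ((x.val : ℤ) - 1) + 5 * ((y.val : ℤ) - 1) + ((z.val : ℤ) - 1)).natAbs ∈ dirs := by
  decide +kernel

lemma unit_fin {a : ℤ} (h : -1 ≤ a ∧ a ≤ 1) : ∃ x : Fin 3, (x.val : ℤ) - 1 = a :=
  ⟨⟨(a + 1).toNat, by omega⟩, by simp; omega⟩

lemma dirs_mem {δ : Z3} (hδ : Bx 1 δ) (h0 : δ ≠ 0) : (TT δ).natAbs ∈ dirs := by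
  obtain ⟨a, b, c⟩ := δ
  obtain ⟨x, rfl⟩ := unit_fin hδ.1
  obtain ⟨y, rfl⟩ := unit_fin hδ.2.1
  obtain ⟨z, rfl⟩ := unit_fin hδ.2.2
  refine dirs_tab x y z ?_
  by_contra hcon
  push Not at hcon
  obtain ⟨rfl, rfl, rfl⟩ := hcon
  exact h0 rfl

lemma exts_mem {δ ε : Z3} (hδ : Bx 1 δ) (h0 : δ ≠ 0) (hε : Bx 1 ε) (h : Bx 2 (δ + δ + δ - ε)) :
    δ = ε ∨ ((TT ε).natAbs, (TT (δ + δ + δ - ε)).natAbs) ∈ exts (TT δ).natAbs := by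
  obtain ⟨a, b, c⟩ := δ
  obtain ⟨a', b', c'⟩ := ε
  obtain ⟨x, rfl⟩ := unit_fin hδ.1
  obtain ⟨y, rfl⟩ := unit_fin hδ.2.1
  obtain ⟨z, rfl⟩ := unit_fin hδ.2.2
  obtain ⟨x', rfl⟩ := unit_fin hε.1
  obtain ⟨y', rfl⟩ := unit_fin hε.2.1
  obtain ⟨z', rfl⟩ := unit_fin hε.2.2
  have h1 : x ≠ 1 ∨ y ≠ 1 ∨ z ≠ 1 := by
    by_contra hcon
    push Not at hcon
    obtain ⟨rfl, rfl, rfl⟩ := hcon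
    exact h0 rfl
  simp only [Bx, Prod.fst_add, Prod.snd_add, Prod.fst_sub, Prod.snd_sub] at h
  rcases ext_tab x y z x' y' z' h1 ⟨abs_le.2 (by omega), abs_le.2 (by omega), abs_le.2 (by omega)⟩ with h2 | h2
  · obtain ⟨rfl, rfl, rfl⟩ := h2
    exact Or.inl rfl
  · refine Or.inr ?_
    simp only [TT, Prod.fst_add, Prod.snd_add, Prod.fst_sub, Prod.snd_sub]
    convert h2 using 4 <;> ring

/-- specification of liveness -/
def Lsp : ℕ → ℕ → ℕ → Prop
  | 0, A, t => df A (2 * t) ≠ 0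
  | n + 1, A, t => df A (2 * t) ≠ 0 ∨ ∃ x ∈ exts t, df A x.2 ≠ 0 ∧ Lsp n A x.1

lemma natAbs_two (δ : Z3) : (TT (δ + δ)).natAbs = 2 * (TT δ).natAbs := by
  rw [TT_add]; omega

lemma Fx.lsp (hm : Msk A D) (hc : Comb D) {δ : Z3} (h : Fx D δ) : FC.df A (2 * (TT δ).natAbs) ≠ 0 := by
  have := Df.df hm hc h
  rwa [natAbs_two] at this

lemma Lsp.zero_le {n A t : ℕ} (h : FC.df A (2 * t) ≠ 0) : Lsp n A t := by
  cases n with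
  | zero => exact h
  | succ n => exact Or.inl h

lemma Df.pred (hc : Comb D) {δ ε : Z3} (h : Df D (δ + δ + δ - ε)) (hε : Bx 1 ε) : Bx 1 δ := by
  have := Df.bx hc h
  simp only [Bx, Prod.fst_add, Prod.snd_add, Prod.fst_sub, Prod.snd_sub] at *
  omega

lemma Df.pred0 (hc : Comb D) {δ ε : Z3} (h : Df D (δ + δ + δ - ε)) (h0 : δ ≠ 0) : ε ≠ 0 := by
  rintro rfl
  have := Df.bx hc h
  apply h0
  obtain ⟨a, b, c⟩ := δ
  simp only [Bx, Prod.fst_add, Prod.snd_add, Prod.fst_sub, Prod.snd_sub, Prod.fst_zero, Prod.snd_zero] at this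
  ext <;> simp <;> omega

lemma Live.bx (hc : Comb D) {δ : Z3} (h : Live D δ) : Bx 1 δ := by
  rcases h with h | ⟨d1, h1, h | ⟨d2, h2, h⟩⟩
  · exact h.bx hc
  · exact h1.pred hc (h.bx hc)
  · exact h1.pred hc (h2.pred hc (h.bx hc))

lemma Live.lsp (hm : Msk A D) (hc : Comb D) {δ : Z3} (h0 : δ ≠ 0) (h : Live D δ) : Lsp 2 A (TT δ).natAbs := by
  have hb := h.bx hc
  rcases h with h | ⟨d1, h1, h⟩
  · exact Lsp.zero_le (h.lsp hm hc)
  have hb1 : Bx 1 d1 := by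
    rcases h with h | ⟨d2, h2, h⟩
    · exact h.bx hc
    · exact h2.pred hc (h.bx hc)
  have h01 := h1.pred0 hc h0
  have hl : Lsp 1 A (TT d1).natAbs := by
    rcases h with h | ⟨d2, h2, h⟩
    · exact Lsp.zero_le (h.lsp hm hc)
    · rcases exts_mem hb1 h01 (h.bx hc) (h2.bx hc) with rfl | h3
      · exact Lsp.zero_le (h.lsp hm hc)
      · exact Or.inr ⟨_, h3, Df.df hm hc h2, h.lsp hm hc⟩
  rcases exts_mem hb h0 hb1 (h1.bx hc) with rfl | h3
  · rcases hl with hl | ⟨x, hx, hl, hl'⟩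
    · exact Or.inl hl
    · exact Or.inr ⟨x, hx, hl, Or.inl hl'⟩
  · exact Or.inr ⟨_, h3, Df.df hm hc h1, hl⟩

lemma lor_eq (a b : ℕ) : Nat.lor a b = a ||| b := rfl

lemma gate_eq (e x : ℕ) : (Nat.rec 0 (fun _ _ => x) e : ℕ) = if e = 0 then 0 else x := by
  cases e <;> simp

lemma gate_ne {e x : ℕ} : gate e x ≠ 0 ↔ e ≠ 0 ∧ x ≠ 0 := by
  unfold gate; rw [gate_eq]; split_ifs <;> simp_all

lemma lor_ne {a b : ℕ} : Nat.lor a b ≠ 0 ↔ a ≠ 0 ∨ b ≠ 0 := by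
  rw [lor_eq]
  simp [Nat.or_eq_zero_iff]
  tauto

lemma gate_ne' {e x : ℕ} : (Nat.rec 0 (fun _ _ => x) e : ℕ) ≠ 0 ↔ e ≠ 0 ∧ x ≠ 0 := gate_ne

lemma df_fold (A t : ℕ) : A.land (A.shiftRight t) = df A t := rfl

lemma LT_sp (A : ℕ) : ∀ p ∈ LT A, p.1 ∈ dirs ∧ (Lsp 2 A p.1 → p.2 ≠ 0) := by
  intro p hp
  simp only [LT, List.mem_cons, List.not_mem_nil, or_false] at hp
  rcases hp with rfl | rfl | rfl | rfl | rfl | rfl | rfl | rfl | rfl | rfl | rfl | rfl | rfl <;>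
  (refine ⟨by simp only [dirs, List.mem_cons, true_or, or_true], ?_⟩
   simp only [Lsp, exts, List.mem_cons, List.not_mem_nil, or_false, false_and, exists_false, exists_eq_or_imp,
    exists_eq_left, La1, La4, La5, La6, La20, La24, La25, La26, La30, Lb1, Lb5, Lb25, lor_ne, gate_ne', df_fold,
    Nat.reduceMul]
   first | done | exact id | skip)

lemma LT_dirs (A : ℕ) : ∀ t ∈ dirs, ∃ p ∈ LT A, p.1 = t := by
  intro t ht
  simp only [dirs, List.mem_cons, List.not_mem_nil, or_false] at ht
  rcases ht with rfl | rfl | rfl | rfl | rfl | rfl | rfl | rfl | rfl | rfl | rfl | rfl | rfl <;> simp [LT]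

lemma Live.lt (hm : Msk A D) (hc : Comb D) {δ : Z3} (h0 : δ ≠ 0) (h : Live D δ) : ∃ p ∈ LT A, p.1 = (TT δ).natAbs ∧ p.2 ≠ 0 := by
  obtain ⟨p, hp, h1⟩ := LT_dirs A _ (dirs_mem (h.bx hc) h0)
  exact ⟨p, hp, h1, (LT_sp A p hp).2 (by rw [h1]; exact h.lsp hm hc h0)⟩

lemma HH_sp (A : ℕ) : ∀ p ∈ LT A, ∀ n, (gate (df A p.1) (ee A p.1 p.2)).testBit n = true → (HH A).testBit n = true := by
  intro p hp n
  have e : ∀ x y, (Nat.rec 0 (fun _ _ => x) y : ℕ) = gate y x := fun _ _ => rfl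
  simp only [HH, e, df_fold, lor_eq, Nat.testBit_or, Bool.or_eq_true]
  simp only [LT, List.mem_cons, List.not_mem_nil, or_false] at hp
  rcases hp with rfl | rfl | rfl | rfl | rfl | rfl | rfl | rfl | rfl | rfl | rfl | rfl | rfl <;>
  (simp only [df_fold]; intro h; simp only [h, true_or, or_true])

end snd

end FC

set_option linter.unusedSectionVars false
set_option linter.unusedVariables false
namespace FC

open Set Filter Topology

section snd
variable {A : ℕ} {D : Set Z3}

/-- the mask `A` encodes a subset of `D` -/
def Sk (A : ℕ) (D : Set Z3) : Prop := ∀ n, A.testBit n = true → ∃ d ∈ D, TT d = n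

lemma two_bits {f : ℕ} (h : tw f ≠ 0) : ∃ n m, n ≠ m ∧ f.testBit n = true ∧ f.testBit m = true := by
  by_contra hcon
  push Not at hcon
  apply h
  by_cases h0 : f = 0
  · subst h0; rfl
  obtain ⟨n, hn⟩ := Nat.exists_testBit_of_ne_zero h0
  have hf : f = 2 ^ n := by
    apply Nat.eq_of_testBit_eq
    intro m
    rw [Nat.testBit_two_pow]
    by_cases hnm : n = m
    · subst hnm; simp [hn]
    · simp [hnm, hcon n m hnm hn]
  rw [hf]
  show (2 ^ n) &&& (2 ^ n - 1) = 0
  rw [Nat.and_two_pow_sub_one_eq_mod, Nat.mod_self]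

lemma bad_sp (A : ℕ) (h : bad A ≠ 0) : ∃ t ∈ dirs, df A t ≠ 0 ∧ tw (df A (2 * t)) ≠ 0 := by
  simp only [bad, lor_ne, gate_ne', df_fold] at h
  simpa only [dirs, List.mem_cons, List.not_mem_nil, or_false, exists_eq_or_imp, exists_eq_left, Nat.reduceMul] using h

lemma dirs_pos : ∀ t ∈ dirs, 0 < t := by decide

lemma bad_zero (hs : Sk A D) (hc : Comb D) : bad A = 0 := by
  by_contra hb
  obtain ⟨t, ht, h1, h2⟩ := bad_sp A hb
  obtain ⟨δ, hδ, hδt⟩ := dirs_unit t ht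
  have tp := dirs_pos t ht
  obtain ⟨n, hn, hn'⟩ := df_ex h1
  obtain ⟨d, hd, hdn⟩ := hs _ hn
  obtain ⟨e, he, hen⟩ := hs _ hn'
  obtain ⟨n1, n2, hne, hb1, hb2⟩ := two_bits h2
  rw [df_bit, Bool.and_eq_true] at hb1 hb2
  obtain ⟨b1, hb1D, hb1n⟩ := hs _ hb1.1
  obtain ⟨a1, ha1D, ha1n⟩ := hs _ hb1.2
  obtain ⟨b2, hb2D, hb2n⟩ := hs _ hb2.1
  obtain ⟨a2, ha2D, ha2n⟩ := hs _ hb2.2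
  have hed : e - d = δ := by
    refine TT_inj (sub_Bx hc he hd) ?_ ?_
    · simp only [Bx] at *; omega
    · rw [TT_sub, hδt, hdn, hen]; push_cast; ring
  have hde : d ≠ e := by
    rintro rfl
    rw [hdn] at hen; push_cast at hen; omega
  have hB : Bx 2 (δ + δ) := by
    simp only [Bx, Prod.fst_add, Prod.snd_add] at *; omega
  have k1 : a1 - b1 = (e - d) + (e - d) := by
    rw [hed]
    refine TT_inj (sub_Bx hc ha1D hb1D) hB ?_
    rw [TT_sub, TT_add, ha1n, hb1n, hδt]; push_cast; ring
  have k2 : a2 - b2 = (e - d) + (e - d) := by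
    rw [hed]
    refine TT_inj (sub_Bx hc ha2D hb2D) hB ?_
    rw [TT_sub, TT_add, ha2n, hb2n, hδt]; push_cast; ring
  have := hc.uniq d hd e he hde a1 ha1D b1 hb1D a2 ha2D b2 hb2D k1 k2
  subst this
  rw [ha1n] at ha2n
  push_cast at ha2n
  omega

lemma gate_val {e x : ℕ} (h : e ≠ 0) : gate e x = x := by
  unfold gate; rw [gate_eq, if_neg h]

lemma D_ne {d : Z3} (hc : Comb D) : {d} ≠ D := by
  rintro rfl
  have := hc.card
  simp at this

lemma Comb.nbr (hc : Comb D) {d : Z3} (hd : d ∈ D) : ∃ e ∈ D, e ≠ d ∧ Live D (e - d) := by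
  by_contra hcon
  push Not at hcon
  refine D_ne (d := d) hc (hc.conn _ (by simpa using hd) (by simp) ?_)
  intro d' hd' e he hl
  rw [Set.mem_singleton_iff] at hd' ⊢
  subst hd'
  by_contra hne
  exact hcon e he hne hl

lemma TT_nonneg (hc : Comb D) {d : Z3} (hd : d ∈ D) : 0 ≤ TT d := by
  have := hc.box d hd
  simp only [TT]; omega

lemma Msk.bit (hm : Msk A D) (hc : Comb D) {d : Z3} (hd : d ∈ D) : A.testBit (TT d).toNat = true :=
  (hm _).2 ⟨d, hd, by have := TT_nonneg hc hd; omega⟩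

lemma HH_all (hm : Msk A D) (hc : Comb D) : Nat.sub A (HH A) = 0 := by
  have key : ∀ n, A.testBit n = true → (HH A).testBit n = true := by
    intro n hn
    obtain ⟨d, hd, hdn⟩ := (hm n).1 hn
    obtain ⟨e, he, hne, hl⟩ := hc.nbr hd
    obtain ⟨p, hp, hp1, hp2⟩ := hl.lt hm hc (sub_ne_zero.2 hne)
    have e0 := TT_nonneg hc he
    have be := hm.bit hc he
    rw [TT_sub, hdn] at hp1
    apply HH_sp A p hp n
    rcases le_total (n : ℤ) (TT e) with h | h
    · have h1 : (df A p.1).testBit n = true := by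
        rw [df_bit, hn, Bool.true_and]
        convert be using 2; omega
      have h2 : df A p.1 ≠ 0 := by intro h0; rw [h0] at h1; simp at h1
      rw [gate_val h2, ee, gate_val hp2, lor_eq, Nat.testBit_or, h1, Bool.true_or]
    · have h1 : (df A p.1).testBit (TT e).toNat = true := by
        rw [df_bit, be, Bool.true_and]
        convert hn using 2; omega
      have h2 : df A p.1 ≠ 0 := by intro h0; rw [h0] at h1; simp at h1
      rw [gate_val h2, ee, gate_val hp2, lor_eq, Nat.testBit_or]
      have h3 : (Nat.shiftLeft (df A p.1) p.1).testBit n = true := by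
        show (df A p.1 <<< p.1).testBit n = true
        rw [Nat.testBit_shiftLeft, Bool.and_eq_true]
        refine ⟨by simp; omega, ?_⟩
        convert h1 using 2; omega
      rw [h3, Bool.or_true]
  have hle : A ≤ HH A := by
    have : A &&& HH A = A := by
      apply Nat.eq_of_testBit_eq
      intro n
      rw [Nat.testBit_and]
      by_cases h : A.testBit n = true
      · rw [h, key n h]; rfl
      · simp at h; rw [h]; rfl
    calc A = A &&& HH A := this.symm
      _ ≤ HH A := Nat.and_le_right
  exact Nat.sub_eq_zero_of_le hle

lemma force_eq {α : Type} (x : ℕ) (f : ℕ → α) : force x f = f x := by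
  cases x <;> rfl

lemma fstep_nil (A c : ℕ) : fstep A [] c = c := rfl

lemma fstep_cons (A : ℕ) (x : ℕ × ℕ) (l : List (ℕ × ℕ)) (c n : ℕ) : (fstep A (x :: l) c).testBit n = true ↔
    (fstep A l c).testBit n = true ∨
    (x.1 ≤ n ∧ (fstep A l c).testBit (n - x.1) = true ∧ (gate x.2 (df A x.1)).testBit (n - x.1) = true) ∨
    ((fstep A l c).testBit (x.1 + n) = true ∧ (gate x.2 (df A x.1)).testBit n = true) := by
  have : fstep A (x :: l) c = force (fstep A l c) fun c => force (gate x.2 (df A x.1)) fun e =>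
    Nat.lor c (Nat.lor (Nat.shiftLeft (Nat.land c e) x.1) (Nat.land (Nat.shiftRight c x.1) e)) := rfl
  rw [this, force_eq, force_eq]
  show ((fstep A l c) ||| ((((fstep A l c) &&& (gate x.2 (df A x.1))) <<< x.1) |||
    (((fstep A l c) >>> x.1) &&& (gate x.2 (df A x.1))))).testBit n = true ↔ _
  simp [Nat.testBit_or, Nat.testBit_and, Nat.testBit_shiftLeft, Nat.testBit_shiftRight]

lemma gate_bit {e x n : ℕ} (h : (gate e x).testBit n = true) : x.testBit n = true := by
  unfold gate at h; rw [gate_eq] at h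
  split_ifs at h
  · simp at h
  · exact h

lemma fstep_sub (A : ℕ) (l : List (ℕ × ℕ)) (c : ℕ) (hc : ∀ n, c.testBit n = true → A.testBit n = true) :
    ∀ n, (fstep A l c).testBit n = true → A.testBit n = true := by
  induction l with
  | nil => exact hc
  | cons x l ih =>
    intro n hn
    rw [fstep_cons] at hn
    rcases hn with h | ⟨h0, h1, h2⟩ | ⟨h1, h2⟩
    · exact ih n h
    · have := gate_bit h2
      rw [df_bit, Bool.and_eq_true] at this
      convert this.2 using 2; omega
    · have := gate_bit h2
      rw [df_bit, Bool.and_eq_true] at this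
      exact this.1

lemma fstep_mono (A : ℕ) (l : List (ℕ × ℕ)) (c n : ℕ) (h : c.testBit n = true) :
    (fstep A l c).testBit n = true := by
  induction l with
  | nil => exact h
  | cons x l ih => rw [fstep_cons]; exact Or.inl ih

lemma fstep_up (A : ℕ) (l : List (ℕ × ℕ)) (c n : ℕ) (x : ℕ × ℕ) (hx : x ∈ l) (h : c.testBit n = true)
    (hg : (gate x.2 (df A x.1)).testBit n = true) : (fstep A l c).testBit (n + x.1) = true := by
  induction l with
  | nil => simp at hx
  | cons y l ih =>
    rw [fstep_cons]
    rcases List.mem_cons.1 hx with rfl | hx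
    · refine Or.inr (Or.inl ⟨by omega, ?_, ?_⟩)
      · rw [Nat.add_sub_cancel]; exact fstep_mono A l c n h
      · rw [Nat.add_sub_cancel]; exact hg
    · exact Or.inl (ih hx)

lemma fstep_dn (A : ℕ) (l : List (ℕ × ℕ)) (c n : ℕ) (x : ℕ × ℕ) (hx : x ∈ l) (h : c.testBit (n + x.1) = true)
    (hg : (gate x.2 (df A x.1)).testBit n = true) : (fstep A l c).testBit n = true := by
  induction l with
  | nil => simp at hx
  | cons y l ih =>
    rw [fstep_cons]
    rcases List.mem_cons.1 hx with rfl | hx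
    · refine Or.inr (Or.inr ⟨?_, hg⟩)
      rw [add_comm]; exact fstep_mono A l c _ h
    · exact Or.inl (ih hx)

lemma flood_sp (A n : ℕ) : ∀ c, (∀ k, c.testBit k = true → A.testBit k = true) → flood A n c = true →
    ∃ c', (∀ k, c.testBit k = true → c'.testBit k = true) ∧ (∀ k, c'.testBit k = true → A.testBit k = true) ∧
      fstep A (LT A) c' = c' ∧ c' ≠ A := by
  induction n with
  | zero => intro c _ h; exact absurd h (by simp [flood])
  | succ n ih =>
    intro c hc h
    have e : flood A (n + 1) c = force (fstep A (LT A) c) fun c' =>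
      Bool.rec (flood A n c') (!(Nat.beq c A)) (Nat.beq c' c) := rfl
    rw [e, force_eq] at h
    by_cases hb : Nat.beq (fstep A (LT A) c) c = true
    · rw [hb] at h
      refine ⟨c, fun _ h => h, hc, Nat.eq_of_beq_eq_true hb, ?_⟩
      rintro rfl
      simp at h
    · rw [Bool.not_eq_true] at hb
      rw [hb] at h
      obtain ⟨c', h1, h2, h3⟩ := ih _ (fstep_sub A _ c hc) h
      exact ⟨c', fun k hk => h1 k (fstep_mono A _ c k hk), h2, h3⟩

lemma flood_no (hm : Msk A D) (hc : Comb D) {k : ℕ} (hk : A.testBit k = true) (n : ℕ) : flood A n (2 ^ k) = false := by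
  rw [← Bool.not_eq_true]
  intro h
  obtain ⟨c, h1, h2, h3, h4⟩ := flood_sp A n _ (by
    intro j hj; rw [Nat.testBit_two_pow] at hj; simp at hj; rwa [← hj]) h
  have hck := h1 k (by rw [Nat.testBit_two_pow]; simp)
  obtain ⟨d0, hd0, hd0k⟩ := (hm k).1 hk
  have hC := hc.conn {d | d ∈ D ∧ c.testBit (TT d).toNat = true} (fun _ h => h.1)
    ⟨d0, hd0, by rw [hd0k]; simpa using hck⟩ (by
      rintro d ⟨hd, hdc⟩ e he hl
      refine ⟨he, ?_⟩
      by_cases hne : e = d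
      · subst hne; exact hdc
      obtain ⟨p, hp, hp1, hp2⟩ := hl.lt hm hc (sub_ne_zero.2 hne)
      have e0 := TT_nonneg hc he
      have d0 := TT_nonneg hc hd
      have be := hm.bit hc he
      have bd := hm.bit hc hd
      rw [TT_sub] at hp1
      rw [← h3]
      rcases le_total (TT d) (TT e) with h | h
      · have : (TT e).toNat = (TT d).toNat + p.1 := by omega
        rw [this]
        refine fstep_up A _ c _ p hp hdc ?_
        rw [gate_val hp2, df_bit, bd, Bool.true_and]
        convert be using 2; omega
      · refine fstep_dn A _ c _ p hp ?_ ?_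
        · convert hdc using 2; omega
        · rw [gate_val hp2, df_bit, be, Bool.true_and]
          convert bd using 2; omega)
  apply h4
  apply Nat.eq_of_testBit_eq
  intro j
  rw [Bool.eq_iff_iff]
  refine ⟨h2 j, fun hj => ?_⟩
  obtain ⟨d, hd, hdj⟩ := (hm j).1 hj
  rw [← hC] at hd
  have := hd.2
  rwa [hdj] at this

lemma leaf_sp (hm : Msk A D) (hc : Comb D) {k : ℕ} (hk : A.testBit k = true) (sl : List (ℕ × ℕ))
    (h : leaf (2 ^ k) sl A = true) : ∃ x ∈ sl, x.1 = A := by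
  unfold leaf at h
  rw [HH_all hm hc, bad_zero (fun n hn => (hm n).1 hn) hc, flood_no hm hc hk] at h
  change (List.rec false (fun x _ ih => Bool.rec ih true (Nat.beq x.1 A)) sl : Bool) = true at h
  induction sl with
  | nil => exact absurd h (by simp)
  | cons x l ih =>
    change (Bool.rec (List.rec false (fun x _ ih => Bool.rec ih true (Nat.beq x.1 A)) l) true (Nat.beq x.1 A) : Bool)
      = true at h
    by_cases hx : Nat.beq x.1 A = true
    · exact ⟨x, by simp, Nat.eq_of_beq_eq_true hx⟩
    · rw [Bool.not_eq_true] at hx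
      rw [hx] at h
      obtain ⟨y, hy, hy'⟩ := ih h
      exact ⟨y, by simp [hy], hy'⟩

lemma go_cons {b : ℕ} {sl l : List (ℕ × ℕ)} {x : ℕ × ℕ} {n A : ℕ} (h : go b sl (x :: l) n A = true) :
    go b sl l n A = true ∧ (Nat.land A x.2 = 0 →
      (n = 0 → leaf b sl (A ||| (1 <<< x.1)) = true) ∧
      (∀ m, n = m + 1 → bad (A ||| (1 <<< x.1)) = 0 → go b sl l m (A ||| (1 <<< x.1)) = true)) := by
  have e : go b sl (x :: l) n A = Bool.rec false (go b sl l n A)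
       (Nat.rec
        (force (Nat.lor A (Nat.shiftLeft 1 x.1)) fun B => Nat.rec (leaf b sl B)
          (fun m _ => Nat.rec (go b sl l m B) (fun _ _ => true) (bad B)) n)
        (fun _ _ => true) (Nat.land A x.2) : Bool) := rfl
  rw [e] at h
  have e2 : ∀ (p q : Bool), (Bool.rec false q p : Bool) = true → q = true ∧ p = true := by decide
  obtain ⟨h1, h2⟩ := e2 _ _ h
  refine ⟨h1, fun h0 => ?_⟩
  rw [h0] at h2
  change force (A ||| (1 <<< x.1)) (fun B => Nat.rec (leaf b sl B)
          (fun m _ => Nat.rec (go b sl l m B) (fun _ _ => true) (bad B)) n) = true at h2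
  rw [force_eq] at h2
  constructor
  · rintro rfl; exact h2
  · rintro m rfl hb
    change (Nat.rec (go b sl l m (A ||| (1 <<< x.1))) (fun _ _ => true) (bad (A ||| (1 <<< x.1))) : Bool) = true at h2
    rw [hb] at h2
    exact h2

lemma go_sp (hc : Comb D) {Q : Finset ℕ} (hQ : ∀ n : ℕ, n ∈ Q ↔ ∃ d ∈ D, TT d = n) {k : ℕ} (sl : List (ℕ × ℕ))
    (l : List (ℕ × ℕ)) : ∀ n A, go (2 ^ k) sl l n A = true → A.testBit k = true →
    (∀ j, A.testBit j = true → j ∈ Q) → (∀ j ∈ Q, A.testBit j = true ∨ ∃ x ∈ l, x.1 = j) →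
    (Q.filter (fun j => A.testBit j = false)).card = n + 1 →
    (∀ x ∈ l, x.1 ∈ Q → ∀ j ∈ Q, x.2.testBit j = false) →
    ∃ x ∈ sl, Msk x.1 D := by
  induction l with
  | nil =>
    intro n A _ _ _ h1 h2 _
    exfalso
    have : Q.filter (fun j => A.testBit j = false) = ∅ := by
      apply Finset.filter_eq_empty_iff.2
      intro j hj
      rcases h1 j hj with h | ⟨x, hx, _⟩
      · simp [h]
      · simp at hx
    rw [this] at h2
    simp at h2
  | cons x l ih =>
    intro n A hgo hk h0 h1 h2 h3
    obtain ⟨g1, g2⟩ := go_cons hgo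
    by_cases hx : x.1 ∈ Q ∧ A.testBit x.1 = false
    · have hz : Nat.land A x.2 = 0 := by
        apply Nat.eq_of_testBit_eq
        intro j
        show (A &&& x.2).testBit j = _
        rw [Nat.testBit_and]
        by_cases hj : A.testBit j = true
        · rw [h3 x (by simp) hx.1 j (h0 j hj)]; simp
        · simp at hj; simp [hj]
      obtain ⟨g3, g4⟩ := g2 hz
      set B := A ||| (1 <<< x.1) with hB
      have hbit : ∀ j, B.testBit j = true ↔ A.testBit j = true ∨ x.1 = j := by
        intro j
        rw [hB, Nat.testBit_or, Nat.one_shiftLeft, Nat.testBit_two_pow]; simp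
      have hB0 : ∀ j, B.testBit j = true → j ∈ Q := by
        intro j hj
        rcases (hbit j).1 hj with h | rfl
        · exact h0 j h
        · exact hx.1
      have hB1 : ∀ j ∈ Q, B.testBit j = true ∨ ∃ x ∈ l, x.1 = j := by
        intro j hj
        rcases h1 j hj with h | ⟨y, hy, hyj⟩
        · exact Or.inl ((hbit j).2 (Or.inl h))
        · rcases List.mem_cons.1 hy with rfl | hy
          · exact Or.inl ((hbit j).2 (Or.inr hyj))
          · exact Or.inr ⟨y, hy, hyj⟩
      have hcard : (Q.filter (fun j => B.testBit j = false)).card = n := by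
        have : Q.filter (fun j => B.testBit j = false) = (Q.filter (fun j => A.testBit j = false)).erase x.1 := by
          ext j
          simp only [Finset.mem_filter, Finset.mem_erase]
          have := hbit j
          rw [← Bool.not_eq_true, this, ← Bool.not_eq_true, eq_comm]
          tauto
        rw [this, Finset.card_erase_of_mem (by simp [hx.1, hx.2]), h2]
        rfl
      have hkB : B.testBit k = true := (hbit k).2 (Or.inl hk)
      cases n with
      | zero =>
        have hMk : Msk B D := by
          intro j
          rw [← hQ]
          refine ⟨hB0 j, fun hj => ?_⟩
          by_contra hcon
          rw [Finset.card_eq_zero] at hcard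
          have : j ∈ Q.filter (fun j => B.testBit j = false) := by
            simp only [Finset.mem_filter]; exact ⟨hj, by simpa using hcon⟩
          rw [hcard] at this
          simp at this
        obtain ⟨y, hy, hyB⟩ := leaf_sp hMk hc hkB sl (g3 rfl)
        exact ⟨y, hy, by rw [hyB]; exact hMk⟩
      | succ m =>
        exact ih m B (g4 m rfl (bad_zero (fun j hj => (hQ j).1 (hB0 j hj)) hc)) hkB hB0 hB1 hcard
          (fun y hy => h3 y (by simp [hy]))
    · refine ih n A g1 hk h0 ?_ h2 (fun y hy => h3 y (by simp [hy]))
      intro j hj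
      rcases h1 j hj with h | ⟨y, hy, hyj⟩
      · exact Or.inl h
      · rcases List.mem_cons.1 hy with rfl | hy
        · left
          rw [hyj] at hx
          by_contra hcon
          exact hx ⟨hj, by simpa using hcon⟩
        · exact Or.inr ⟨y, hy, hyj⟩

end snd

end FC

set_option linter.unusedSectionVars false
set_option linter.unusedVariables false
namespace FC

open Set Filter Topology

/-- the conclusion of the classification -/
def ConclI (D : Set Z3) (i : Fin 12) (v : Fin 7 → Z3) : Prop := Function.Injective v ∧ range v = D ∧
  (∀ d e a b, (d ≠ e ∧ v a - v b = (v e - v d) + (v e - v d)) ↔ Rt i d e a b) ∧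
  ∀ d e, d ≠ e → Live D (v e - v d) → Fx D (v e - v d)

def Concl (D : Set Z3) : Prop := ∃ (i : Fin 12) (v : Fin 7 → Z3), ConclI D i v

def pv (c : ℕ) (j : Fin 7) : ℕ := c / 64 ^ j.val % 64
def pd (a b : ℕ) : ℕ := (a - b) + (b - a)

/-- check of a solution -/
def Chk (x : ℕ × ℕ) : Prop :=
  (∀ j, x.1.testBit (pv x.2 j) = true) ∧ (∀ d e : Fin 7, d ≠ e → pv x.2 d ≠ pv x.2 e) ∧
  (∀ n ∈ tb (Fin.ofNat 12 (x.2 / 64 ^ 7)), (dc n).1 ≠ (dc n).2.1 ∧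
    pv x.2 (dc n).2.2.1 + 2 * pv x.2 (dc n).1 = pv x.2 (dc n).2.2.2 + 2 * pv x.2 (dc n).2.1 ∧
    pd (pv x.2 (dc n).1) (pv x.2 (dc n).2.1) ∈ dirs) ∧
  (∀ d e : Fin 7, d ≠ e → pd (pv x.2 d) (pv x.2 e) ∉ dirs ∨ df x.1 (2 * pd (pv x.2 d) (pv x.2 e)) = 0 ∨
    ∃ n ∈ tb (Fin.ofNat 12 (x.2 / 64 ^ 7)), (dc n).1 = d ∧ (dc n).2.1 = e) ∧
  ∀ p ∈ LT x.1, df x.1 p.1 = 0 ∨ p.2 = 0 ∨ df x.1 (2 * p.1) ≠ 0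

instance (x : ℕ × ℕ) : Decidable (Chk x) := by unfold Chk; infer_instance

lemma chk0 : ∀ x ∈ so0, Chk x := by decide +kernel
lemma chk1 : ∀ x ∈ so1, Chk x := by decide +kernel
lemma chk2 : ∀ x ∈ so2, Chk x := by decide +kernel
lemma chk3 : ∀ x ∈ so3, Chk x := by decide +kernel
lemma chk4 : ∀ x ∈ so4, Chk x := by decide +kernel
lemma chk5 : ∀ x ∈ so5, Chk x := by decide +kernel

lemma tb_Rt : ∀ i, ∀ n ∈ tb i, Rt i (dc n).1 (dc n).2.1 (dc n).2.2.1 (dc n).2.2.2 := by decide +kernel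

lemma concl_of_chk {D : Set Z3} (hc : Comb D) {x : ℕ × ℕ} (hm : Msk x.1 D) (h : Chk x) :
    ∃ v, ConclI D (Fin.ofNat 12 (x.2 / 64 ^ 7)) v := by
  obtain ⟨h1, h2, h3, h4, h5⟩ := h
  set i := Fin.ofNat 12 (x.2 / 64 ^ 7) with hi
  choose v hvD hvT using fun j => (hm _).1 (h1 j)
  have hinj : Function.Injective v := by
    intro d e hde
    by_contra hne
    apply h2 d e hne
    have := hvT d
    rw [hde, hvT e] at this
    exact_mod_cast this.symm
  have hr : range v = D := by
    refine Set.eq_of_subset_of_ncard_le (by rintro _ ⟨j, rfl⟩; exact hvD j) ?_ (Set.finite_of_ncard_ne_zero (by rw [hc.card]; simp))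
    rw [hc.card, ← Set.image_univ, Set.ncard_image_of_injective _ hinj, Set.ncard_univ]
    simp
  have hpd : ∀ d e, pd (pv x.2 d) (pv x.2 e) = (TT (v e - v d)).natAbs := by
    intro d e
    rw [TT_sub, hvT, hvT, pd]; omega
  have hfwd : ∀ d e a b, Rt i d e a b → d ≠ e ∧ v a - v b = (v e - v d) + (v e - v d) := by
    refine Rt_all i ?_
    intro n hn
    obtain ⟨k1, k2, k3⟩ := h3 n hn
    refine ⟨k1, ?_⟩
    rw [hpd] at k3
    obtain ⟨δ, hδ, hδt⟩ := dirs_unit _ k3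
    have hB : Bx 1 (v (dc n).2.1 - v (dc n).1) := by
      have hB2 := sub_Bx hc (hvD (dc n).2.1) (hvD (dc n).1)
      rcases le_total 0 (TT (v (dc n).2.1 - v (dc n).1)) with h | h
      · rw [TT_inj (b := δ) hB2 (by simp only [Bx] at *; omega) (by omega)]; exact hδ
      · rw [TT_inj (b := -δ) hB2 (by simp only [Bx, Prod.fst_neg, Prod.snd_neg] at *; omega) (by rw [TT_neg]; omega)]
        simp only [Bx, Prod.fst_neg, Prod.snd_neg] at *; omega
    refine TT_inj (sub_Bx hc (hvD _) (hvD _)) ?_ ?_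
    · simp only [Bx, Prod.fst_add, Prod.snd_add] at *; omega
    · rw [TT_add, TT_sub, TT_sub, hvT, hvT, hvT, hvT]
      have := congrArg (Nat.cast (R := ℤ)) k2
      push_cast at this ⊢
      linarith
  refine ⟨v, hinj, hr, fun d e a b => ⟨?_, hfwd d e a b⟩, ?_⟩
  · rintro ⟨hne, hrel⟩
    have hF : Fx D (v e - v d) := ⟨v a, hvD a, v b, hvD b, hrel⟩
    have hne' : v e - v d ≠ 0 := sub_ne_zero.2 fun h => hne (hinj h).symm
    rcases h4 d e hne with h | h | ⟨n, hn, hn1, hn2⟩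
    · exact absurd (by rw [hpd]; exact dirs_mem (hF.bx hc) hne') h
    · rw [hpd] at h
      exact absurd h (hF.lsp hm hc)
    · have hR := tb_Rt i n hn
      rw [hn1, hn2] at hR
      obtain ⟨_, hrel'⟩ := hfwd _ _ _ _ hR
      have e1 := hc.uniq _ (hvD d) _ (hvD e) (fun h => hne (hinj h)) _ (hvD a) _ (hvD b) _ (hvD _) _ (hvD _) hrel hrel'
      have e2 : b = (dc n).2.2.2 := by
        apply hinj
        rw [← e1, ← hrel] at hrel'
        exact (sub_right_injective hrel').symm
      rw [hinj e1, e2]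
      exact hR
  · intro d e hne hl
    obtain ⟨p, hp, hp1, hp2⟩ := hl.lt hm hc (sub_ne_zero.2 fun h => hne (hinj h).symm)
    rcases h5 p hp with h | h | h
    · exact absurd h (by rw [hp1]; exact Df.df hm hc ⟨_, hvD e, _, hvD d, rfl⟩)
    · exact absurd h hp2
    · refine df_Df hm hc ?_ (by rwa [natAbs_two, ← hp1])
      have := hl.bx hc
      simp only [Bx, Prod.fst_add, Prod.snd_add] at *; omega

end FC

set_option linter.unusedSectionVars false
set_option linter.unusedVariables false
namespace FC

open Set Filter Topology

/-- an involutive symmetry of the cube with its linear part -/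
structure Sy where
  g : Z3 → Z3
  L : Z3 → Z3
  gg : ∀ a, g (g a) = a
  LL : ∀ a, L (L a) = a
  add : ∀ a b, L (a + b) = L a + L b
  sub : ∀ a b, L (a - b) = L a - L b
  gsub : ∀ a b, g a - g b = L (a - b)
  box : ∀ d : Z3, ((0 ≤ d.1 ∧ d.1 ≤ 2) ∧ (0 ≤ d.2.1 ∧ d.2.1 ≤ 2) ∧ (0 ≤ d.2.2 ∧ d.2.2 ≤ 2)) →
    ((0 ≤ (g d).1 ∧ (g d).1 ≤ 2) ∧ (0 ≤ (g d).2.1 ∧ (g d).2.1 ≤ 2) ∧ (0 ≤ (g d).2.2 ∧ (g d).2.2 ≤ 2))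

namespace Sy
variable (s : Sy) {D : Set Z3}

lemma g_inj : Function.Injective s.g := fun a b h => by rw [← s.gg a, h, s.gg]
lemma L_inj : Function.Injective s.L := fun a b h => by rw [← s.LL a, h, s.LL]

lemma gg_image (D : Set Z3) : s.g '' (s.g '' D) = D := by
  ext x
  constructor
  · rintro ⟨_, ⟨y, hy, rfl⟩, rfl⟩; rwa [s.gg]
  · intro hx; exact ⟨s.g x, ⟨x, hx, rfl⟩, s.gg x⟩

lemma df {δ : Z3} (h : Df D δ) : Df (s.g '' D) (s.L δ) := by
  obtain ⟨a, ha, b, hb, rfl⟩ := h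
  exact ⟨_, ⟨a, ha, rfl⟩, _, ⟨b, hb, rfl⟩, s.gsub a b⟩

lemma fx {δ : Z3} (h : Fx D δ) : Fx (s.g '' D) (s.L δ) := by
  have := s.df h
  rwa [s.add] at this

lemma live {δ : Z3} (h : Live D δ) : Live (s.g '' D) (s.L δ) := by
  rcases h with h | ⟨d1, h1, h | ⟨d2, h2, h⟩⟩
  · exact Or.inl (s.fx h)
  · refine Or.inr ⟨s.L d1, ?_, Or.inl (s.fx h)⟩
    have := s.df h1
    rwa [s.sub, s.add, s.add] at this
  · refine Or.inr ⟨s.L d1, ?_, Or.inr ⟨s.L d2, ?_, s.fx h⟩⟩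
    · have := s.df h1
      rwa [s.sub, s.add, s.add] at this
    · have := s.df h2
      rwa [s.sub, s.add, s.add] at this

lemma fx' {δ : Z3} (h : Fx (s.g '' D) (s.L δ)) : Fx D δ := by
  have := s.fx h
  rwa [s.gg_image, s.LL] at this

lemma live' {δ : Z3} (h : Live (s.g '' D) (s.L δ)) : Live D δ := by
  have := s.live h
  rwa [s.gg_image, s.LL] at this

lemma comb (hc : Comb D) : Comb (s.g '' D) where
  box := by rintro _ ⟨d, hd, rfl⟩; exact s.box d (hc.box d hd)
  card := by rw [Set.ncard_image_of_injective _ s.g_inj, hc.card]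
  uniq := by
    rintro _ ⟨d, hd, rfl⟩ _ ⟨e, he, rfl⟩ hde _ ⟨a, ha, rfl⟩ _ ⟨b, hb, rfl⟩ _ ⟨a', ha', rfl⟩ _ ⟨b', hb', rfl⟩ h1 h2
    rw [s.gsub, s.gsub, ← s.add] at h1 h2
    rw [hc.uniq d hd e he (fun h => hde (by rw [h])) a ha b hb a' ha' b' hb' (s.L_inj h1) (s.L_inj h2)]
  conn := by
    intro C hC hne hcl
    have h : s.g '' C = D := by
      refine hc.conn (s.g '' C) ?_ (hne.image _) ?_
      · rw [← s.gg_image D]; exact image_mono hC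
      · rintro _ ⟨d, hd, rfl⟩ e he hl
        refine ⟨s.g e, hcl d hd (s.g e) ⟨e, he, rfl⟩ ?_, s.gg e⟩
        have := s.live hl
        rwa [← s.gsub, s.gg] at this
    rw [← h, s.gg_image]

lemma concl (h : Concl (s.g '' D)) : Concl D := by
  obtain ⟨i, v, hinj, hr, hR, hl⟩ := h
  refine ⟨i, s.g ∘ v, s.g_inj.comp hinj, by rw [Set.range_comp, hr, s.gg_image], ?_, ?_⟩
  · intro d e a b
    rw [← hR d e a b]
    simp only [Function.comp, s.gsub, ← s.add]
    rw [s.L_inj.eq_iff]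
  · intro d e hde hL
    have := hl d e hde ?_
    · simp only [Function.comp, s.gsub]
      apply s.fx'
      rwa [s.LL]
    · have := s.live hL
      simp only [Function.comp, s.gsub] at this
      rwa [s.LL] at this

end Sy

def gen : Fin 3 → Sy := ![
  { g := fun a => (a.2.1, a.1, a.2.2), L := fun a => (a.2.1, a.1, a.2.2), gg := fun _ => rfl, LL := fun _ => rfl,
    add := fun _ _ => rfl, sub := fun _ _ => rfl, gsub := fun _ _ => rfl, box := fun d h => by simp only; omega },
  { g := fun a => (a.1, a.2.2, a.2.1), L := fun a => (a.1, a.2.2, a.2.1), gg := fun _ => rfl, LL := fun _ => rfl,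
    add := fun _ _ => rfl, sub := fun _ _ => rfl, gsub := fun _ _ => rfl, box := fun d h => by simp only; omega },
  { g := fun a => (2 - a.1, a.2.1, a.2.2), L := fun a => (-a.1, a.2.1, a.2.2),
    gg := fun _ => by simp, LL := fun _ => by simp,
    add := fun _ _ => by ext <;> simp; ring
    sub := fun _ _ => by ext <;> simp; ring
    gsub := fun _ _ => by ext <;> simp
    box := fun d h => by simp only; omega }]

def wact : List (Fin 3) → Z3 → Z3
  | [], a => a
  | k :: w, a => wact w ((gen k).g a)

lemma wact_cons (k : Fin 3) (w : List (Fin 3)) (D : Set Z3) : wact (k :: w) '' D = wact w '' ((gen k).g '' D) := by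
  rw [Set.image_image]; rfl

lemma wact_sp (w : List (Fin 3)) : ∀ D, Comb D → Comb (wact w '' D) ∧ (Concl (wact w '' D) → Concl D) := by
  induction w with
  | nil =>
    intro D hD
    have : wact [] '' D = D := by
      show (fun a => a) '' D = D
      simp
    rw [this]; exact ⟨hD, id⟩
  | cons k w ih =>
    intro D hD
    rw [wact_cons]
    obtain ⟨h1, h2⟩ := ih _ ((gen k).comb hD)
    exact ⟨h1, fun h => (gen k).concl (h2 h)⟩

/-- coordinate weight -/
def wt (a b : ℤ) : ℕ := if a = b then (if a = 1 then 10 else 0) else if a - b = 2 ∨ b - a = 2 then 1 else 100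
def rkN : ℕ → ℕ
  | 2 => 0
  | 1 => 1
  | 11 => 2
  | 12 => 3
  | 3 => 4
  | 21 => 5
  | _ => 6
/-- rank of a pair of digits -/
def rk (a b : Z3) : ℕ := rkN (wt a.1 b.1 + wt a.2.1 b.2.1 + wt a.2.2 b.2.2)

lemma wt_flip (a b : ℤ) : wt (2 - a) (2 - b) = wt a b := by
  unfold wt
  split_ifs <;> first | rfl | omega

lemma rk_gen (k : Fin 3) (a b : Z3) : rk ((gen k).g a) ((gen k).g b) = rk a b := by
  fin_cases k <;> simp only [gen, rk]
  · show rkN (wt a.2.1 b.2.1 + wt a.1 b.1 + wt a.2.2 b.2.2) = _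
    congr 1; ring
  · show rkN (wt a.1 b.1 + wt a.2.2 b.2.2 + wt a.2.1 b.2.1) = _
    congr 1; ring
  · show rkN (wt (2 - a.1) (2 - b.1) + wt a.2.1 b.2.1 + wt a.2.2 b.2.2) = _
    rw [wt_flip]

lemma rk_wact (w : List (Fin 3)) : ∀ a b, rk (wact w a) (wact w b) = rk a b := by
  induction w with
  | nil => intro a b; rfl
  | cons k w ih => intro a b; exact (ih _ _).trans (rk_gen k a b)

def wordsL : List (List (Fin 3)) :=
    [[], [0], [1], [2], [0, 1], [0, 2], [1, 0], [1, 2], [2, 0], [0, 1, 0], [0, 1, 2], [0, 2, 0], [1, 0, 2], [1,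
    2, 0], [2, 0, 1], [2, 0, 2], [0, 1, 0, 2], [0, 1, 2, 0], [0, 2, 0, 1], [0, 2, 0, 2], [1, 0, 2, 0], [1, 2, 0,
    1], [1, 2, 0, 2], [2, 0, 1, 2], [0, 1, 0, 2, 0], [0, 1, 2, 0, 1], [0, 1, 2, 0, 2], [0, 2, 0, 1, 2], [1, 0, 2,
    0, 1], [1, 0, 2, 0, 2], [1, 2, 0, 1, 2], [2, 0, 1, 2, 0], [0, 1, 0, 2, 0, 1], [0, 1, 0, 2, 0, 2], [0, 1, 2,
    0, 1, 2], [0, 2, 0, 1, 2, 0], [1, 0, 2, 0, 1, 2], [1, 2, 0, 1, 2, 0], [2, 0, 1, 2, 0, 2], [0, 1, 0, 2, 0, 1,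
    2], [0, 1, 2, 0, 1, 2, 0], [0, 2, 0, 1, 2, 0, 2], [1, 0, 2, 0, 1, 2, 0], [1, 2, 0, 1, 2, 0, 2], [0, 1, 0, 2,
    0, 1, 2, 0], [0, 1, 2, 0, 1, 2, 0, 2], [1, 0, 2, 0, 1, 2, 0, 2], [0, 1, 0, 2, 0, 1, 2, 0, 2]]

/-- start pairs -/
def sta : ℕ → Z3 × Z3
  | 0 => ((0, 0, 0), (2, 2, 0))
  | 1 => ((0, 0, 0), (2, 0, 0))
  | 2 => ((0, 0, 1), (2, 0, 1))
  | 3 => ((0, 0, 1), (2, 2, 1))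
  | 4 => ((0, 0, 0), (2, 2, 2))
  | _ => ((0, 1, 1), (2, 1, 1))

lemma normal_tab : ∀ x y z x' y' z' : Fin 3,
    rk ((x.val : ℤ), (y.val : ℤ), (z.val : ℤ)) ((x'.val : ℤ), (y'.val : ℤ), (z'.val : ℤ)) = 6 ∨
    ∃ w ∈ wordsL, wact w ((x.val : ℤ), (y.val : ℤ), (z.val : ℤ)) =
        (sta (rk ((x.val : ℤ), (y.val : ℤ), (z.val : ℤ)) ((x'.val : ℤ), (y'.val : ℤ), (z'.val : ℤ)))).1 ∧
      wact w ((x'.val : ℤ), (y'.val : ℤ), (z'.val : ℤ)) =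
        (sta (rk ((x.val : ℤ), (y.val : ℤ), (z.val : ℤ)) ((x'.val : ℤ), (y'.val : ℤ), (z'.val : ℤ)))).2 := by
  decide +kernel

lemma even_tab : ∀ x y z x' y' z' : Fin 3,
    rk ((x.val : ℤ), (y.val : ℤ), (z.val : ℤ)) ((x'.val : ℤ), (y'.val : ℤ), (z'.val : ℤ)) = 6 →
    (x = x' ∧ y = y' ∧ z = z') ∨ ((x.val : ℤ) - x'.val) % 2 ≠ 0 ∨ ((y.val : ℤ) - y'.val) % 2 ≠ 0
      ∨ ((z.val : ℤ) - z'.val) % 2 ≠ 0 := by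
  decide +kernel

lemma box_fin {a : ℤ} (h : 0 ≤ a ∧ a ≤ 2) : ∃ x : Fin 3, (x.val : ℤ) = a :=
  ⟨⟨a.toNat, by omega⟩, by simp; omega⟩

lemma rkN_le (n : ℕ) : rkN n ≤ 6 := by
  unfold rkN; split <;> omega

lemma normal {D : Set Z3} (hc : Comb D) {a b : Z3} (ha : a ∈ D) (hb : b ∈ D) (h : rk a b ≠ 6) :
    ∃ w, wact w a = (sta (rk a b)).1 ∧ wact w b = (sta (rk a b)).2 := by
  have h1 := hc.box a ha
  have h2 := hc.box b hb
  obtain ⟨a1, a2, a3⟩ := a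
  obtain ⟨b1, b2, b3⟩ := b
  obtain ⟨x, rfl⟩ := box_fin h1.1
  obtain ⟨y, rfl⟩ := box_fin h1.2.1
  obtain ⟨z, rfl⟩ := box_fin h1.2.2
  obtain ⟨x', rfl⟩ := box_fin h2.1
  obtain ⟨y', rfl⟩ := box_fin h2.2.1
  obtain ⟨z', rfl⟩ := box_fin h2.2.2
  rcases normal_tab x y z x' y' z' with h3 | ⟨w, _, h3⟩
  · exact absurd h3 h
  · exact ⟨w, h3⟩

lemma exists_rk {D : Set Z3} (hc : Comb D) : ∃ a ∈ D, ∃ b ∈ D, rk a b < 6 := by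
  have hne : D.Nonempty := by
    by_contra h
    rw [Set.not_nonempty_iff_eq_empty] at h
    have := hc.card
    rw [h] at this; simp at this
  obtain ⟨d, hd⟩ := hne
  obtain ⟨e, he, hed, hl⟩ := hc.nbr hd
  obtain ⟨δ, h0, a, ha, b, hb, hab⟩ : ∃ δ, δ ≠ 0 ∧ Fx D δ := by
    have h0 : e - d ≠ 0 := sub_ne_zero.2 hed
    rcases hl with h | ⟨d1, h1, h | ⟨d2, h2, h⟩⟩
    · exact ⟨_, h0, h⟩
    · exact ⟨_, h1.pred0 hc h0, h⟩
    · exact ⟨_, h2.pred0 hc (h1.pred0 hc h0), h⟩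
  refine ⟨a, ha, b, hb, ?_⟩
  by_contra hcon
  have h6 : rk a b = 6 := le_antisymm (rkN_le _) (by omega)
  have h1 := hc.box a ha
  have h2 := hc.box b hb
  obtain ⟨a1, a2, a3⟩ := a
  obtain ⟨b1, b2, b3⟩ := b
  obtain ⟨x, rfl⟩ := box_fin h1.1
  obtain ⟨y, rfl⟩ := box_fin h1.2.1
  obtain ⟨z, rfl⟩ := box_fin h1.2.2
  obtain ⟨x', rfl⟩ := box_fin h2.1
  obtain ⟨y', rfl⟩ := box_fin h2.2.1
  obtain ⟨z', rfl⟩ := box_fin h2.2.2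
  obtain ⟨p, q, r⟩ := δ
  simp only [Prod.mk_sub_mk, Prod.mk_add_mk, Prod.mk.injEq] at hab
  rcases even_tab x y z x' y' z' h6 with ⟨rfl, rfl, rfl⟩ | h | h | h
  · apply h0
    ext <;> simp <;> omega
  · omega
  · omega
  · omega

def dec (p : ℕ) : Z3 := ((p / 25 : ℕ), (p / 5 % 5 : ℕ), (p % 5 : ℕ))

lemma dec_TT {D : Set Z3} (hc : Comb D) {d : Z3} (hd : d ∈ D) {n : ℕ} (h : TT d = n) : dec n = d := by
  have h1 := hc.box d hd
  obtain ⟨a1, a2, a3⟩ := d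
  simp only [TT] at h
  simp only [dec, Prod.mk.injEq]
  simp only at h1
  omega

/-- conditions on the search data -/
def Cdl (r : ℕ) (l : List (ℕ × ℕ)) (A : ℕ) : Prop :=
  (∀ x y z : Fin 3, A.testBit (25 * x.val + 5 * y.val + z.val) = true ∨
    ∃ u ∈ l, u.1 = 25 * x.val + 5 * y.val + z.val) ∧
  (∀ u ∈ l, ∀ j < 63, u.2.testBit j = true → rk (dec u.1) (dec j) < r)

instance (r : ℕ) (l : List (ℕ × ℕ)) (A : ℕ) : Decidable (Cdl r l A) := by unfold Cdl; infer_instance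

lemma srch {D : Set Z3} (hc : Comb D) {r k k' A : ℕ} {sl l : List (ℕ × ℕ)} (hgo : go (2 ^ k) sl l 4 A = true)
    (hkk : k ≠ k') (hA : A = 2 ^ k ||| 2 ^ k') (hcd : Cdl r l A) {p q : Z3} (hp : p ∈ D) (hq : q ∈ D)
    (hpk : TT p = k) (hqk : TT q = k') (hmin : ∀ a ∈ D, ∀ b ∈ D, r ≤ rk a b) (hch : ∀ x ∈ sl, Chk x) : Concl D := by
  have hfin : D.Finite := Set.finite_of_ncard_ne_zero (by rw [hc.card]; simp)
  set Q : Finset ℕ := hfin.toFinset.image (fun d => (TT d).toNat) with hQd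
  have hQ : ∀ n : ℕ, n ∈ Q ↔ ∃ d ∈ D, TT d = n := by
    intro n
    simp only [hQd, Finset.mem_image, Set.Finite.mem_toFinset]
    refine exists_congr fun d => and_congr_right fun hd => ?_
    have := TT_nonneg hc hd
    omega
  have hcard : Q.card = 7 := by
    rw [hQd, Finset.card_image_of_injOn, ← Set.ncard_eq_toFinset_card D hfin, hc.card]
    intro a ha b hb hab
    simp only [Set.Finite.coe_toFinset] at ha hb
    have h1 := TT_nonneg hc ha
    have h2 := TT_nonneg hc hb
    have h3 : TT a = TT b := by simp only at hab; omega
    have e1 := dec_TT hc ha (n := (TT a).toNat) (by omega)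
    have e2 := dec_TT hc hb (n := (TT a).toNat) (by omega)
    rw [← e1, e2]
  have hbit : ∀ j, A.testBit j = true ↔ k = j ∨ k' = j := by
    intro j; rw [hA, Nat.testBit_or, Nat.testBit_two_pow, Nat.testBit_two_pow]; simp
  have hkQ : k ∈ Q := (hQ k).2 ⟨p, hp, hpk⟩
  have hkQ' : k' ∈ Q := (hQ k').2 ⟨q, hq, hqk⟩
  suffices h : ∃ x ∈ sl, Msk x.1 D by
    obtain ⟨x, hx, hm⟩ := h
    exact ⟨_, concl_of_chk hc hm (hch x hx)⟩
  refine go_sp hc hQ sl l 4 A hgo ((hbit k).2 (Or.inl rfl)) ?_ ?_ ?_ ?_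
  · intro j hj
    rcases (hbit j).1 hj with rfl | rfl
    · exact hkQ
    · exact hkQ'
  · intro j hj
    obtain ⟨d, hd, hdj⟩ := (hQ j).1 hj
    have h1 := hc.box d hd
    obtain ⟨a1, a2, a3⟩ := d
    obtain ⟨x, rfl⟩ := box_fin h1.1
    obtain ⟨y, rfl⟩ := box_fin h1.2.1
    obtain ⟨z, rfl⟩ := box_fin h1.2.2
    have : j = 25 * x.val + 5 * y.val + z.val := by simp only [TT] at hdj; omega
    rw [this]
    exact hcd.1 x y z
  · have : Q.filter (fun j => A.testBit j = false) = (Q.erase k).erase k' := by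
      ext j
      simp only [Finset.mem_filter, Finset.mem_erase]
      rw [← Bool.not_eq_true, hbit j]
      constructor
      · rintro ⟨h1, h2⟩
        push Not at h2
        exact ⟨fun h => h2.2 h.symm, fun h => h2.1 h.symm, h1⟩
      · rintro ⟨h1, h2, h3⟩
        exact ⟨h3, by rintro (h | h); exacts [h2 h.symm, h1 h.symm]⟩
    rw [this, Finset.card_erase_of_mem (by simp [hkQ', hkk.symm]), Finset.card_erase_of_mem hkQ, hcard]
  · intro u hu huQ j hj
    rw [← Bool.not_eq_true]
    intro hb
    obtain ⟨d, hd, hdj⟩ := (hQ j).1 hj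
    obtain ⟨e, he, heu⟩ := (hQ _).1 huQ
    have h1 := hc.box d hd
    have := hcd.2 u hu j (by simp only [TT] at hdj; omega) hb
    rw [dec_TT hc hd hdj, dec_TT hc he heu] at this
    exact absurd (hmin e he d hd) (by omega)

lemma cdl0 : Cdl 0 cd0 1152921504606846977 := by decide +kernel
lemma cdl1 : Cdl 1 cd1 1125899906842625 := by decide +kernel
lemma cdl2 : Cdl 2 cd2 2251799813685250 := by decide +kernel
lemma cdl3 : Cdl 3 cd3 2305843009213693954 := by decide +kernel
lemma cdl4 : Cdl 4 cd4 4611686018427387905 := by decide +kernel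
lemma cdl5 : Cdl 5 cd5 72057594037928000 := by decide +kernel

theorem classify {D : Set Z3} (hc : Comb D) : Concl D := by
  have hex : ∃ r, ∃ a ∈ D, ∃ b ∈ D, rk a b = r := by
    obtain ⟨a, ha, b, hb, h⟩ := exists_rk hc
    exact ⟨_, a, ha, b, hb, rfl⟩
  classical
  obtain ⟨a, ha, b, hb, hr⟩ := Nat.find_spec hex
  have hmin : ∀ a' ∈ D, ∀ b' ∈ D, rk a b ≤ rk a' b' := by
    intro a' ha' b' hb'
    rw [hr]
    exact Nat.find_min' hex ⟨a', ha', b', hb', rfl⟩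
  have hlt : rk a b < 6 := by
    obtain ⟨a', ha', b', hb', h⟩ := exists_rk hc
    exact lt_of_le_of_lt (hmin a' ha' b' hb') h
  obtain ⟨w, hw1, hw2⟩ := normal hc ha hb hlt.ne
  obtain ⟨hc', hconcl⟩ := wact_sp w D hc
  apply hconcl
  have hmin' : ∀ a' ∈ wact w '' D, ∀ b' ∈ wact w '' D, rk a b ≤ rk a' b' := by
    rintro _ ⟨a', ha', rfl⟩ _ ⟨b', hb', rfl⟩
    rw [rk_wact]; exact hmin a' ha' b' hb'
  have hp : wact w a ∈ wact w '' D := ⟨a, ha, rfl⟩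
  have hq : wact w b ∈ wact w '' D := ⟨b, hb, rfl⟩
  rw [hw1] at hp
  rw [hw2] at hq
  generalize wact w '' D = D' at *
  generalize rk a b = r at *
  interval_cases r
  · exact srch hc' (k := 0) (k' := 60) go0 (by decide) (by decide +kernel) cdl0 hp hq (by decide) (by decide) hmin' chk0
  · exact srch hc' (k := 0) (k' := 50) go1 (by decide) (by decide +kernel) cdl1 hp hq (by decide) (by decide) hmin' chk1
  · exact srch hc' (k := 1) (k' := 51) go2 (by decide) (by decide +kernel) cdl2 hp hq (by decide) (by decide) hmin' chk2
  · exact srch hc' (k := 1) (k' := 61) go3 (by decide) (by decide +kernel) cdl3 hp hq (by decide) (by decide) hmin' chk3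
  · exact srch hc' (k := 0) (k' := 62) go4 (by decide) (by decide +kernel) cdl4 hp hq (by decide) (by decide) hmin' chk4
  · exact srch hc' (k := 6) (k' := 56) go5 (by decide) (by decide +kernel) cdl5 hp hq (by decide) (by decide) hmin' chk5

end FC

set_option linter.unusedSectionVars false
set_option linter.unusedVariables false
namespace FC

open Set Filter Topology
open Pointwise

/-- integer vectors as points -/
noncomputable def io (z : Z3) : E3 := !₂[(z.1 : ℝ), (z.2.1 : ℝ), (z.2.2 : ℝ)]

lemma io0 (z : Z3) : io z 0 = (z.1 : ℝ) := rfl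
lemma io1 (z : Z3) : io z 1 = z.2.1 := rfl
lemma io2 (z : Z3) : io z 2 = z.2.2 := rfl

lemma E3_ext {x y : E3} (h0 : x 0 = y 0) (h1 : x 1 = y 1) (h2 : x 2 = y 2) : x = y := by
  ext i
  fin_cases i
  exacts [h0, h1, h2]

lemma io_add (a b : Z3) : io (a + b) = io a + io b := by
  apply E3_ext <;> simp [io]

lemma io_sub (a b : Z3) : io (a - b) = io a - io b := by
  apply E3_ext <;> simp [io]

lemma io_inj : Function.Injective io := by
  intro a b h
  have h0 := congrArg (fun x : E3 => x 0) h
  have h1 := congrArg (fun x : E3 => x 1) h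
  have h2 := congrArg (fun x : E3 => x 2) h
  simp only [io0, io1, io2, Int.cast_inj] at h0 h1 h2
  ext <;> assumption

/-- integer version of a digit set -/
def Dz (D : Set E3) : Set Z3 := {z | io z ∈ D}

lemma Dz_image {D : Set E3} (hD : IsDigitSet3 D) : io '' (Dz D) = D := by
  ext x
  constructor
  · rintro ⟨z, hz, rfl⟩; exact hz
  · intro hx
    obtain ⟨a, ha, ha'⟩ := hD x hx 0
    obtain ⟨b, hb, hb'⟩ := hD x hx 1
    obtain ⟨c, hc, hc'⟩ := hD x hx 2
    have : io ((a : ℤ), (b : ℤ), (c : ℤ)) = x := by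
      apply E3_ext
      · rw [ha', io0]; simp
      · rw [hb', io1]; simp
      · rw [hc', io2]; simp
    exact ⟨_, by show io _ ∈ D; rw [this]; exact hx, this⟩

lemma Dz_box {D : Set E3} (hD : IsDigitSet3 D) : ∀ d ∈ Dz D,
    (0 ≤ d.1 ∧ d.1 ≤ 2) ∧ (0 ≤ d.2.1 ∧ d.2.1 ≤ 2) ∧ (0 ≤ d.2.2 ∧ d.2.2 ≤ 2) := by
  intro d hd
  obtain ⟨a, ha, ha'⟩ := hD _ hd 0
  obtain ⟨b, hb, hb'⟩ := hD _ hd 1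
  obtain ⟨c, hc, hc'⟩ := hD _ hd 2
  rw [io0] at ha'
  rw [io1] at hb'
  rw [io2] at hc'
  have h1 : d.1 = (a : ℤ) := by
    have h : (d.1 : ℝ) = (a : ℝ) := ha'
    exact_mod_cast h
  have h2 : d.2.1 = (b : ℤ) := by
    have h : (d.2.1 : ℝ) = (b : ℝ) := hb'
    exact_mod_cast h
  have h3 : d.2.2 = (c : ℤ) := by
    have h : (d.2.2 : ℝ) = (c : ℝ) := hc'
    exact_mod_cast h
  omega

section cube
variable {D K : Set E3}

lemma cube_in (h : IsFractalCube3 D K) {x d : E3} (hx : x ∈ K) (hd : d ∈ D) : (3 : ℝ)⁻¹ • (x + d) ∈ K := by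
  have : x + d ∈ (3 : ℝ) • K := by rw [h.2.2]; exact Set.add_mem_add hx hd
  obtain ⟨y, hy, hxy⟩ := this
  simp only at hxy
  rw [← hxy, smul_smul]; norm_num; exact hy

lemma cube_out (h : IsFractalCube3 D K) {x : E3} (hx : x ∈ K) : ∃ y ∈ K, ∃ d ∈ D, x = (3 : ℝ)⁻¹ • (y + d) := by
  have : (3 : ℝ) • x ∈ K + D := by rw [← h.2.2]; exact Set.smul_mem_smul_set hx
  obtain ⟨y, hy, d, hd, hyd⟩ := Set.mem_add.1 this
  refine ⟨y, hy, d, hd, ?_⟩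
  rw [hyd, smul_smul]; norm_num

lemma cube_box (hD : IsDigitSet3 D) (h : IsFractalCube3 D K) {x : E3} (hx : x ∈ K) (i : Fin 3) :
    0 ≤ x i ∧ x i ≤ 1 := by
  have hcont : Continuous fun x : E3 => x i := by fun_prop
  constructor
  · obtain ⟨m, hm, hmin⟩ := h.2.1.exists_isMinOn h.1 hcont.continuousOn
    obtain ⟨y, hy, d, hd, hmy⟩ := cube_out h hm
    have h1 : m i ≤ y i := hmin hy
    have h2 : m i ≤ x i := hmin hx
    obtain ⟨k, hk, hk'⟩ := hD d hd i
    have h3 : m i = 3⁻¹ * (y i + d i) := by rw [hmy]; simp; ring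
    rw [hk'] at h3
    have : (0 : ℝ) ≤ k := by positivity
    linarith
  · obtain ⟨m, hm, hmax⟩ := h.2.1.exists_isMaxOn h.1 hcont.continuousOn
    obtain ⟨y, hy, d, hd, hmy⟩ := cube_out h hm
    have h1 : y i ≤ m i := hmax hy
    have h2 : x i ≤ m i := hmax hx
    obtain ⟨k, hk, hk'⟩ := hD d hd i
    have h3 : m i = 3⁻¹ * (y i + d i) := by rw [hmy]; simp; ring
    rw [hk'] at h3
    have : (k : ℝ) ≤ 2 := by exact_mod_cast Nat.le_of_lt_succ hk
    linarith

lemma cube_sub {K' : Set E3} (h : IsFractalCube3 D K) (h' : IsFractalCube3 D K') : K ⊆ K' := by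
  obtain ⟨m, hm, hmax⟩ := h.2.1.exists_isMaxOn h.1 (Metric.continuous_infDist_pt K').continuousOn
  have key : ∀ x ∈ K, ∃ y ∈ K, Metric.infDist x K' ≤ 3⁻¹ * Metric.infDist y K' := by
    intro x hx
    obtain ⟨y, hy, d, hd, rfl⟩ := cube_out h hx
    refine ⟨y, hy, ?_⟩
    obtain ⟨z, hz, hyz⟩ := h'.2.1.exists_infDist_eq_dist h'.1 y
    rw [hyz]
    refine (Metric.infDist_le_dist_of_mem (cube_in h' hz hd)).trans ?_
    rw [dist_smul₀, dist_add_right]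
    simp
  obtain ⟨y, hy, hle⟩ := key m hm
  have h1 : Metric.infDist y K' ≤ Metric.infDist m K' := hmax hy
  have h2 : 0 ≤ Metric.infDist y K' := Metric.infDist_nonneg
  intro x hx
  have h3 : Metric.infDist x K' ≤ Metric.infDist m K' := hmax hx
  have h4 : 0 ≤ Metric.infDist x K' := Metric.infDist_nonneg
  have : Metric.infDist x K' = 0 := by linarith
  rwa [h'.2.1.isClosed.mem_iff_infDist_zero h'.1]

lemma cube_unique {K' : Set E3} (h : IsFractalCube3 D K) (h' : IsFractalCube3 D K') : K = K' :=
  (cube_sub h h').antisymm (cube_sub h' h)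

lemma center_mem (h : IsFractalCube3 D K) {d : E3} (hd : d ∈ D) : (2 : ℝ)⁻¹ • d ∈ K := by
  obtain ⟨x, hx⟩ := h.1
  have key : ∀ n : ℕ, (2 : ℝ)⁻¹ • d + ((3 : ℝ)⁻¹ ^ n) • (x - (2 : ℝ)⁻¹ • d) ∈ K := by
    intro n
    induction n with
    | zero => simpa using hx
    | succ n ih =>
      convert cube_in h ih hd using 1
      rw [pow_succ]
      module
  refine h.2.1.isClosed.mem_of_tendsto (f := fun n : ℕ => (2 : ℝ)⁻¹ • d + ((3 : ℝ)⁻¹ ^ n) • (x - (2 : ℝ)⁻¹ • d)) (b := atTop) ?_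
    (Eventually.of_forall key)
  have h1 : Tendsto (fun n : ℕ => (3 : ℝ)⁻¹ ^ n) atTop (𝓝 0) :=
    tendsto_pow_atTop_nhds_zero_of_lt_one (by norm_num) (by norm_num)
  have h2 := (h1.smul_const (x - (2 : ℝ)⁻¹ • d)).const_add ((2 : ℝ)⁻¹ • d)
  simpa using h2

lemma diff_bx (hD : IsDigitSet3 D) (h : IsFractalCube3 D K) {x y : E3} (hx : x ∈ K) (hy : y ∈ K) {δ : Z3}
    (hxy : x - y = io δ) : Bx 1 δ := by
  have key : ∀ i, -1 ≤ io δ i ∧ io δ i ≤ 1 := by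
    intro i
    rw [← hxy]
    have h1 := cube_box hD h hx i
    have h2 := cube_box hD h hy i
    have : (x - y) i = x i - y i := rfl
    rw [this]
    constructor <;> linarith
  have h0 := key 0
  have h1 := key 1
  have h2 := key 2
  rw [io0] at h0
  rw [io1] at h1
  rw [io2] at h2
  have a0 : (-1 : ℤ) ≤ δ.1 := by
    have h : -1 ≤ (δ.1 : ℝ) := h0.1
    exact_mod_cast h
  have a1 : δ.1 ≤ (1 : ℤ) := by
    have h : (δ.1 : ℝ) ≤ 1 := h0.2
    exact_mod_cast h
  have a2 : (-1 : ℤ) ≤ δ.2.1 := by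
    have h : -1 ≤ (δ.2.1 : ℝ) := h1.1
    exact_mod_cast h
  have a3 : δ.2.1 ≤ (1 : ℤ) := by
    have h : (δ.2.1 : ℝ) ≤ 1 := h1.2
    exact_mod_cast h
  have a4 : (-1 : ℤ) ≤ δ.2.2 := by
    have h : -1 ≤ (δ.2.2 : ℝ) := h2.1
    exact_mod_cast h
  have a5 : δ.2.2 ≤ (1 : ℤ) := by
    have h : (δ.2.2 : ℝ) ≤ 1 := h2.2
    exact_mod_cast h
  exact ⟨⟨a0, a1⟩, ⟨a2, a3⟩, ⟨a4, a5⟩⟩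

/-- one step of the path of neighbours -/
lemma diff_step (hD : IsDigitSet3 D) (h : IsFractalCube3 D K) {x y : E3} (hx : x ∈ K) (hy : y ∈ K) {δ : Z3}
    (hxy : x - y = io δ) : ∃ a ∈ Dz D, ∃ b ∈ Dz D, ∃ x' ∈ K, ∃ y' ∈ K, x = (3 : ℝ)⁻¹ • (x' + io a) ∧
      y = (3 : ℝ)⁻¹ • (y' + io b) ∧ x' - y' = io (δ + δ + δ - (a - b)) := by
  obtain ⟨x', hx', d, hd, hx1⟩ := cube_out h hx
  obtain ⟨y', hy', e, he, hy1⟩ := cube_out h hy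
  rw [← Dz_image hD] at hd he
  obtain ⟨a, ha, rfl⟩ := hd
  obtain ⟨b, hb, rfl⟩ := he
  refine ⟨a, ha, b, hb, x', hx', y', hy', hx1, hy1, ?_⟩
  rw [io_sub, io_sub, io_add, io_add, ← hxy, hx1, hy1]
  module

lemma diff_live (hD : IsDigitSet3 D) (h : IsFractalCube3 D K) {x y : E3} (hx : x ∈ K) (hy : y ∈ K) {δ : Z3}
    (hxy : x - y = io δ) : Live (Dz D) δ := by
  obtain ⟨a0, ha0, b0, hb0, x1, hx1, y1, hy1, _, _, h1⟩ := diff_step hD h hx hy hxy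
  obtain ⟨a1, ha1, b1, hb1, x2, hx2, y2, hy2, _, _, h2⟩ := diff_step hD h hx1 hy1 h1
  obtain ⟨a2, ha2, b2, hb2, x3, hx3, y3, hy3, _, _, h3⟩ := diff_step hD h hx2 hy2 h2
  have B0 := diff_bx hD h hx hy hxy
  have B1 := diff_bx hD h hx1 hy1 h1
  have B2 := diff_bx hD h hx2 hy2 h2
  have B3 := diff_bx hD h hx3 hy3 h3
  have D0 : Df (Dz D) (a0 - b0) := ⟨_, ha0, _, hb0, rfl⟩
  have D1 : Df (Dz D) (a1 - b1) := ⟨_, ha1, _, hb1, rfl⟩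
  have D2 : Df (Dz D) (a2 - b2) := ⟨_, ha2, _, hb2, rfl⟩
  have b0' : ∀ {a b : Z3}, a ∈ Dz D → b ∈ Dz D → Bx 2 (a - b) := by
    intro a b ha hb
    have h1 := Dz_box hD a ha
    have h2 := Dz_box hD b hb
    simp only [Bx, Prod.fst_sub, Prod.snd_sub]
    omega
  have C0 := b0' ha0 hb0
  have C1 := b0' ha1 hb1
  have C2 := b0' ha2 hb2
  generalize hδ1 : δ + δ + δ - (a0 - b0) = δ1 at *
  generalize hδ2 : δ1 + δ1 + δ1 - (a1 - b1) = δ2 at *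
  generalize hδ3 : δ2 + δ2 + δ2 - (a2 - b2) = δ3 at *
  have e0 : a0 - b0 = δ + δ + δ - δ1 := by rw [← hδ1]; abel
  have e1 : a1 - b1 = δ1 + δ1 + δ1 - δ2 := by rw [← hδ2]; abel
  have e2 : a2 - b2 = δ2 + δ2 + δ2 - δ3 := by rw [← hδ3]; abel
  rw [e0] at D0 C0
  rw [e1] at D1 C1
  rw [e2] at D2 C2
  have fxs : ∀ {p q : Z3}, Df (Dz D) (p + p + p - q) → p = q → Fx (Dz D) p := by
    rintro p q hd rfl
    have : p + p + p - p = p + p := by abel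
    rwa [this] at hd
  by_cases k0 : δ = 0
  · left
    rw [k0]
    show Df _ _
    exact ⟨a0, ha0, a0, ha0, by simp⟩
  by_cases k1 : δ = δ1
  · exact Or.inl (fxs D0 k1)
  by_cases k2 : δ1 = δ2
  · exact Or.inr ⟨δ1, D0, Or.inl (fxs D1 k2)⟩
  · refine Or.inr ⟨δ1, D0, Or.inr ⟨δ2, D1, fxs D2 ?_⟩⟩
    clear * - B0 B1 B2 B3 C0 C1 C2 k0 k1 k2
    obtain ⟨p0, q0, r0⟩ := δ
    obtain ⟨p1, q1, r1⟩ := δ1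
    obtain ⟨p2, q2, r2⟩ := δ2
    obtain ⟨p3, q3, r3⟩ := δ3
    simp only [Bx, Prod.mk_add_mk, Prod.mk_sub_mk] at *
    rw [Prod.ext_iff, Prod.ext_iff] at k0 k1 k2
    rw [Prod.ext_iff, Prod.ext_iff]
    simp only [Prod.fst_zero, Prod.snd_zero] at *
    have st : ∀ {p q : ℤ}, (-1 ≤ p ∧ p ≤ 1) → (-1 ≤ q ∧ q ≤ 1) → (-2 ≤ p + p + p - q ∧ p + p + p - q ≤ 2) → p = 0 ∨ p = q := by
      intro p q _ _ _; omega
    have s1 := st B0.1 B1.1 C0.1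
    have s2 := st B0.2.1 B1.2.1 C0.2.1
    have s3 := st B0.2.2 B1.2.2 C0.2.2
    have t1 := st B1.1 B2.1 C1.1
    have t2 := st B1.2.1 B2.2.1 C1.2.1
    have t3 := st B1.2.2 B2.2.2 C1.2.2
    have u1 := st B2.1 B3.1 C2.1
    have u2 := st B2.2.1 B3.2.1 C2.2.1
    have u3 := st B2.2.2 B3.2.2 C2.2.2
    clear st B0 B1 B2 B3 C0 C1 C2
    grind

end cube

end FC

set_option linter.unusedSectionVars false
set_option linter.unusedVariables false
namespace FC

open Set Filter Topology
open Pointwise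

lemma mem_piece {K : Set E3} {d x : E3} : x ∈ piece K d ↔ ∃ y ∈ K, x = (3 : ℝ)⁻¹ • (y + d) := by
  unfold piece
  rw [Set.mem_smul_set]
  constructor
  · rintro ⟨z, hz, rfl⟩
    rw [Set.add_singleton] at hz
    obtain ⟨y, hy, rfl⟩ := hz
    exact ⟨y, hy, rfl⟩
  · rintro ⟨y, hy, rfl⟩
    exact ⟨y + d, Set.add_mem_add hy rfl, rfl⟩

lemma piece_compact {K : Set E3} (h : IsCompact K) (d : E3) : IsCompact (piece K d) := by
  unfold piece
  exact (h.add isCompact_singleton).smul _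

lemma third_inj {x y : E3} (h : (3 : ℝ)⁻¹ • x = (3 : ℝ)⁻¹ • y) : x = y :=
  smul_right_injective E3 (r := (3 : ℝ)⁻¹) (by norm_num) h

lemma glue_iff {x y : E3} {d e : Z3} :
    (3 : ℝ)⁻¹ • (x + io d) = (3 : ℝ)⁻¹ • (y + io e) ↔ x - y = io (e - d) := by
  rw [io_sub]
  constructor
  · intro h
    have := third_inj h
    rw [sub_eq_sub_iff_add_eq_add, this, add_comm]
  · intro h
    rw [sub_eq_sub_iff_add_eq_add] at h
    rw [h, add_comm]

lemma half_sub {a b c : Z3} (h : a - b = c + c) : (2 : ℝ)⁻¹ • io a - (2 : ℝ)⁻¹ • io b = io c := by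
  have := congrArg io h
  rw [io_sub, io_add] at this
  rw [← smul_sub, this]
  module

section
variable {D K : Set E3}

/-- the self-similar structure of a fractal cube -/
noncomputable def mkIFS (hD : IsDigitSet3 D) (h : IsFractalCube3 D K) {v : Fin 7 → Z3} (hinj : Function.Injective v)
    (hr : range v = Dz D) {R : Fin 7 → Fin 7 → Fin 7 → Fin 7 → Prop}
    (hR : ∀ d e a b, (d ≠ e ∧ v a - v b = (v e - v d) + (v e - v d)) ↔ R d e a b)
    (H3 : ∀ d e, d ≠ e → ∀ x ∈ K, ∀ y ∈ K, x - y = io (v e - v d) → ∃ a b, v a - v b = (v e - v d) + (v e - v d) ∧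
      x = (2 : ℝ)⁻¹ • io (v a) ∧ y = (2 : ℝ)⁻¹ • io (v b)) : IFS R K where
  S d x := ⟨(3 : ℝ)⁻¹ • (x.1 + io (v d)), cube_in h x.2 (by
    have : v d ∈ Dz D := hr ▸ mem_range_self d
    exact this)⟩
  c d := ⟨(2 : ℝ)⁻¹ • io (v d), center_mem h (by
    have : v d ∈ Dz D := hr ▸ mem_range_self d
    exact this)⟩
  dist_S d x y := by
    rw [Subtype.dist_eq, dist_smul₀, dist_add_right]
    simp [Subtype.dist_eq]; ring
  cover x := by
    obtain ⟨y, hy, d, hd, hx⟩ := cube_out h x.2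
    rw [← Dz_image hD, ← hr] at hd
    obtain ⟨_, ⟨j, rfl⟩, rfl⟩ := hd
    exact ⟨j, ⟨y, hy⟩, Subtype.ext hx.symm⟩
  S_c d := by
    apply Subtype.ext
    show (3 : ℝ)⁻¹ • ((2 : ℝ)⁻¹ • io (v d) + io (v d)) = (2 : ℝ)⁻¹ • io (v d)
    module
  c_inj := by
    intro d e hde
    have h1 : (2 : ℝ)⁻¹ • io (v d) = (2 : ℝ)⁻¹ • io (v e) := congrArg Subtype.val hde
    exact hinj (io_inj (smul_right_injective E3 (r := (2 : ℝ)⁻¹) (by norm_num) h1))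
  glue d e x y hne := by
    constructor
    · intro hxy
      have h1 := glue_iff.1 (congrArg Subtype.val hxy)
      obtain ⟨a, b, hab, hx, hy⟩ := H3 d e hne x x.2 y y.2 h1
      exact ⟨a, b, (hR d e a b).1 ⟨hne, hab⟩, Subtype.ext hx, Subtype.ext hy⟩
    · rintro ⟨a, b, hab, rfl, rfl⟩
      apply Subtype.ext
      exact glue_iff.2 (half_sub ((hR d e a b).2 hab).2)
  glue_dist d e a b x y hab := by
    have h1 := half_sub ((hR d e a b).2 hab).2
    simp only [Subtype.dist_eq, dist_eq_norm]
    have : (3 : ℝ)⁻¹ • ((3 : ℝ)⁻¹ • (x.1 + io (v a)) + io (v d)) - (3 : ℝ)⁻¹ • ((3 : ℝ)⁻¹ • (y.1 + io (v b)) + io (v e))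
        = (3 : ℝ)⁻¹ • ((3 : ℝ)⁻¹ • (x.1 + io (v d)) - (3 : ℝ)⁻¹ • (y.1 + io (v e))) := by
      rw [io_sub] at h1
      have h2 : io (v a) = io (v b) + (2 : ℝ) • (io (v e) - io (v d)) := by
        rw [← h1]; module
      rw [h2]; module
    rw [this, norm_smul]
    simp; ring

lemma Dz_ncard (hD : IsDigitSet3 D) : (Dz D).ncard = D.ncard := by
  conv_rhs => rw [← Dz_image hD]
  exact (Set.ncard_image_of_injective _ io_inj).symm

lemma comb_of_good (hD : IsDigitSet3 D) (h7 : D.ncard = 7) (h : IsFractalCube3 D K) (hK : IsConnected K)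
    (h1 : ∀ di ∈ D, ∀ dj ∈ D, di ≠ dj → (piece K di ∩ piece K dj).Subsingleton) : Comb (Dz D) where
  box := Dz_box hD
  card := by rw [Dz_ncard hD, h7]
  uniq := by
    intro d hd e he hde a ha b hb a' ha' b' hb' hab hab'
    have hs := h1 _ hd _ he (fun h => hde (io_inj h))
    have mem : ∀ {a b : Z3}, a ∈ Dz D → b ∈ Dz D → a - b = (e - d) + (e - d) →
        (3 : ℝ)⁻¹ • ((2 : ℝ)⁻¹ • io a + io d) ∈ piece K (io d) ∩ piece K (io e) := by
      intro a b ha hb hab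
      refine ⟨mem_piece.2 ⟨_, center_mem h ha, rfl⟩, mem_piece.2 ⟨_, center_mem h hb, ?_⟩⟩
      exact glue_iff.2 (half_sub hab)
    have := hs (mem ha hb hab) (mem ha' hb' hab')
    have := add_right_cancel (third_inj this)
    exact io_inj (smul_right_injective E3 (r := (2 : ℝ)⁻¹) (by norm_num) this)
  conn := by
    intro C hC hne hl
    by_contra hCD
    obtain ⟨e, he, heC⟩ : ∃ e ∈ Dz D, e ∉ C := by
      by_contra hh
      push Not at hh
      exact hCD (hC.antisymm hh)
    have hfin : (Dz D).Finite := Set.finite_of_ncard_ne_zero (by rw [Dz_ncard hD, h7]; simp)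
    have hcl : ∀ s ⊆ Dz D, IsClosed (⋃ d ∈ s, piece K (io d)) := fun s hs =>
      (hfin.subset hs).isClosed_biUnion fun d _ => (piece_compact h.2.1 _).isClosed
    have := (isPreconnected_closed_iff.1 hK.isPreconnected) _ _ (hcl C hC) (hcl (Dz D \ C) sdiff_subset) ?_ ?_ ?_
    · obtain ⟨x, hx, hx1, hx2⟩ := this
      simp only [mem_iUnion] at hx1 hx2
      obtain ⟨d, hd, hx1⟩ := hx1
      obtain ⟨e, he, hx2⟩ := hx2
      obtain ⟨y, hy, hxy⟩ := mem_piece.1 hx1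
      obtain ⟨z, hz, hxz⟩ := mem_piece.1 hx2
      exact he.2 (hl d hd e he.1 (diff_live hD h hy hz (glue_iff.1 (hxy ▸ hxz))))
    · intro x hx
      obtain ⟨y, hy, d, hd, hx⟩ := cube_out h hx
      rw [← Dz_image hD] at hd
      obtain ⟨d, hd, rfl⟩ := hd
      by_cases hdC : d ∈ C
      · left
        exact mem_biUnion hdC (mem_piece.2 ⟨y, hy, hx⟩)
      · right
        exact mem_biUnion (⟨hd, hdC⟩ : d ∈ Dz D \ C) (mem_piece.2 ⟨y, hy, hx⟩)
    · obtain ⟨d, hd⟩ := hne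
      obtain ⟨y, hy⟩ := h.1
      exact ⟨_, cube_in h hy (hC hd), mem_biUnion hd (mem_piece.2 ⟨y, hy, rfl⟩)⟩
    · obtain ⟨y, hy⟩ := h.1
      exact ⟨_, cube_in h hy he, mem_biUnion (⟨he, heC⟩ : e ∈ Dz D \ C) (mem_piece.2 ⟨y, hy, rfl⟩)⟩

/-- the self-similar structure from the classification -/
lemma ifs_of_concl (hD : IsDigitSet3 D) (h : IsFractalCube3 D K)
    (h1 : ∀ di ∈ D, ∀ dj ∈ D, di ≠ dj → (piece K di ∩ piece K dj).Subsingleton) {i : Fin 12} {v : Fin 7 → Z3}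
    (hv : ConclI (Dz D) i v) : Nonempty (IFS (Rt i) K) := by
  obtain ⟨hinj, hr, hR, hL⟩ := hv
  have hvD : ∀ d, v d ∈ Dz D := fun d => hr ▸ mem_range_self d
  refine ⟨mkIFS hD h hinj hr hR ?_⟩
  intro d e hne x hx y hy hxy
  obtain ⟨_, ha, _, hb, hab⟩ := hL d e hne (diff_live hD h hx hy hxy)
  rw [← hr] at ha hb
  obtain ⟨a, rfl⟩ := ha
  obtain ⟨b, rfl⟩ := hb
  refine ⟨a, b, hab, ?_⟩
  have hs := h1 _ (hvD d) _ (hvD e) (fun h => hne (hinj (io_inj h)))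
  have m1 : (3 : ℝ)⁻¹ • ((2 : ℝ)⁻¹ • io (v a) + io (v d)) ∈ piece K (io (v d)) ∩ piece K (io (v e)) :=
    ⟨mem_piece.2 ⟨_, center_mem h (hvD a), rfl⟩, mem_piece.2 ⟨_, center_mem h (hvD b), glue_iff.2 (half_sub hab)⟩⟩
  have m2 : (3 : ℝ)⁻¹ • (x + io (v d)) ∈ piece K (io (v d)) ∩ piece K (io (v e)) :=
    ⟨mem_piece.2 ⟨_, hx, rfl⟩, mem_piece.2 ⟨_, hy, glue_iff.2 hxy⟩⟩
  have h5 := add_right_cancel (third_inj (hs m2 m1))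
  refine ⟨h5, ?_⟩
  rw [← half_sub hab, h5] at hxy
  exact sub_right_injective hxy

end

/-- every good digit set has one of the 12 structures -/
theorem good_ifs {D : Set E3} (hD : D ∈ GoodDigitSets) : ∃ i, ∀ K, IsFractalCube3 D K → Nonempty (IFS (Rt i) K) := by
  obtain ⟨h1, h7, K, hK, hcon, hone⟩ := hD
  obtain ⟨i, v, hv⟩ := classify (comb_of_good h1 h7 hK hcon hone)
  refine ⟨i, fun K' hK' => ?_⟩
  rw [← cube_unique hK hK']
  exact ifs_of_concl h1 hK hone hv

end FC

set_option linter.unusedSectionVars false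
set_option linter.unusedVariables false
namespace FC

open Set Filter Topology
open Pointwise

/-- representatives of the 12 classes -/
def rpt : Fin 12 → Fin 7 → ℕ := ![
  ![0, 1, 2, 3, 6, 9, 18], ![0, 1, 2, 3, 6, 10, 18], ![0, 1, 2, 3, 6, 10, 19], ![0, 1, 2, 3, 12, 21, 24],
  ![1, 4, 7, 12, 13, 14, 22], ![0, 1, 2, 4, 7, 10, 19], ![0, 1, 2, 4, 7, 16, 25], ![0, 1, 2, 4, 7, 13, 22],
  ![1, 4, 10, 13, 16, 22, 25], ![4, 10, 12, 13, 14, 16, 22], ![1, 3, 4, 5, 7, 13, 22], ![1, 4, 7, 13, 21, 22, 23]]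

def rp (i : Fin 12) (j : Fin 7) : Z3 := (((rpt i j / 9 : ℕ) : ℤ), ((rpt i j / 3 % 3 : ℕ) : ℤ), ((rpt i j % 3 : ℕ) : ℤ))

def rD (i : Fin 12) : Set E3 := io '' range (rp i)

def bxb (δ : Z3) : Bool := decide (-1 ≤ δ.1) && decide (δ.1 ≤ 1) && decide (-1 ≤ δ.2.1) && decide (δ.2.1 ≤ 1) &&
  decide (-1 ≤ δ.2.2) && decide (δ.2.2 ≤ 1)

lemma bxb_of {δ : Z3} (h : Bx 1 δ) : bxb δ = true := by
  simp only [bxb, Bx] at *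
  simp [h]

/-- no neighbour of type `δ` -/
def dead (v : Fin 7 → Z3) : ℕ → Z3 → Bool
  | 0, δ => !bxb δ
  | n + 1, δ => !bxb δ || (List.finRange 7).all fun a => (List.finRange 7).all fun b => dead v n (δ + δ + δ - (v a - v b))

lemma rp_dead : ∀ i : Fin 12, ∀ d e : Fin 7, d ≠ e → bxb (rp i e - rp i d) = true → ∀ a b : Fin 7,
    rp i a - rp i b = (rp i e - rp i d) + (rp i e - rp i d) ∨
    dead (rp i) 4 ((rp i e - rp i d) + (rp i e - rp i d) + (rp i e - rp i d) - (rp i a - rp i b)) = true := by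
  decide +kernel

lemma rp_inj : ∀ i : Fin 12, Function.Injective (rp i) := by
  have : ∀ i : Fin 12, ∀ d e : Fin 7, rp i d = rp i e → d = e := by decide +kernel
  exact this

lemma rp_Rt1 : ∀ i : Fin 12, ∀ d e a b : Fin 7, d ≠ e ∧ rp i a - rp i b = (rp i e - rp i d) + (rp i e - rp i d) → Rt i d e a b := by
  decide +kernel

lemma rp_Rt (i : Fin 12) (d e a b : Fin 7) : (d ≠ e ∧ rp i a - rp i b = (rp i e - rp i d) + (rp i e - rp i d)) ↔ Rt i d e a b := by
  refine ⟨rp_Rt1 i d e a b, Rt_all i (P := fun d e a b => d ≠ e ∧ rp i a - rp i b = (rp i e - rp i d) + (rp i e - rp i d)) ?_ d e a b⟩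
  revert i
  decide +kernel

lemma Rt_uniq (i : Fin 12) (d e a b a' b' : Fin 7) (h : Rt i d e a b) (h' : Rt i d e a' b') : a = a' ∧ b = b' := by
  have h1 := Rt_all i (P := fun d e a b => ∀ n ∈ tb i, (dc n).1 = d → (dc n).2.1 = e →
      a = (dc n).2.2.1 ∧ b = (dc n).2.2.2) (by clear h h'; revert i; decide +kernel) d e a b h _ h'
  rw [dc_eq] at h1
  exact h1 rfl rfl

lemma rD_digit (i : Fin 12) : IsDigitSet3 (rD i) := by
  rintro _ ⟨_, ⟨j, rfl⟩, rfl⟩ k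
  have h1 : ∀ i : Fin 12, ∀ j : Fin 7, rpt i j < 27 := by decide +kernel
  have h2 := h1 i j
  fin_cases k
  · exact ⟨rpt i j / 9, by omega, Int.cast_natCast _⟩
  · exact ⟨rpt i j / 3 % 3, by omega, Int.cast_natCast _⟩
  · exact ⟨rpt i j % 3, by omega, Int.cast_natCast _⟩

lemma rD_Dz (i : Fin 12) : range (rp i) = Dz (rD i) := by
  ext z
  constructor
  · intro h
    exact mem_image_of_mem _ h
  · rintro ⟨z', hz', h⟩
    rwa [← io_inj h]

lemma rD_card (i : Fin 12) : (rD i).ncard = 7 := by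
  rw [rD, Set.ncard_image_of_injective _ io_inj, ← Set.image_univ, Set.ncard_image_of_injective _ (rp_inj i), Set.ncard_univ]
  simp

/-- existence of the fractal cube -/
lemma exists_cube (v : Fin 7 → Z3) : ∃ K, IsFractalCube3 (io '' range v) K := by
  let f : ℕ → (ℕ → Fin 7) → E3 := fun n ω => ((3 : ℝ)⁻¹ ^ (n + 1)) • io (v (ω n))
  obtain ⟨C, hC⟩ : ∃ C, ∀ j, ‖io (v j)‖ ≤ C := by
    obtain ⟨C, hC⟩ := (Set.finite_range fun j => ‖io (v j)‖).bddAbove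
    exact ⟨C, fun j => hC (mem_range_self j)⟩
  have hb : ∀ n ω, ‖f n ω‖ ≤ (3 : ℝ)⁻¹ ^ (n + 1) * C := by
    intro n ω
    simp only [f, norm_smul]
    rw [Real.norm_of_nonneg (by positivity)]
    exact mul_le_mul_of_nonneg_left (hC _) (by positivity)
  have hs : Summable fun n : ℕ => (3 : ℝ)⁻¹ ^ (n + 1) * C := by
    apply Summable.mul_right
    exact (summable_nat_add_iff 1).2 (summable_geometric_of_lt_one (by norm_num) (by norm_num))
  have hsum : ∀ ω, Summable fun n => f n ω := fun ω => Summable.of_norm_bounded hs (fun n => hb n ω)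
  let π : (ℕ → Fin 7) → E3 := fun ω => ∑' n, f n ω
  have hcont : Continuous π := by
    refine continuous_tsum (fun n => ?_) hs hb
    have : Continuous fun j : Fin 7 => ((3 : ℝ)⁻¹ ^ (n + 1)) • io (v j) := continuous_of_discreteTopology
    exact this.comp (continuous_apply n)
  have hshift : ∀ ω, (3 : ℝ) • π ω = π (fun n => ω (n + 1)) + io (v (ω 0)) := by
    intro ω
    simp only [π]
    rw [(hsum ω).tsum_eq_zero_add, smul_add, ← Summable.tsum_const_smul]
    · rw [add_comm]
      congr 1
      · congr 1
        ext1 n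
        simp only [f, smul_smul]
        congr 1
        rw [pow_succ]; ring
      · simp only [f, smul_smul]
        norm_num
    · exact (summable_nat_add_iff 1).2 (hsum ω)
  refine ⟨range π, ⟨_, mem_range_self fun _ => 0⟩, isCompact_range hcont, ?_⟩
  ext x
  constructor
  · rintro ⟨_, ⟨ω, rfl⟩, rfl⟩
    show (3 : ℝ) • π ω ∈ _
    rw [hshift]
    exact Set.add_mem_add (mem_range_self _) (mem_image_of_mem _ (mem_range_self _))
  · intro hx
    obtain ⟨_, ⟨ω, rfl⟩, _, ⟨_, ⟨j, rfl⟩, rfl⟩, rfl⟩ := Set.mem_add.1 hx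
    refine ⟨π (fun n => Nat.casesOn n j ω), mem_range_self _, ?_⟩
    show (3 : ℝ) • _ = _
    rw [hshift]
    rfl

section
variable {D K : Set E3}

lemma dead_sound (hD : IsDigitSet3 D) (h : IsFractalCube3 D K) {v : Fin 7 → Z3} (hr : range v = Dz D) :
    ∀ n δ, dead v n δ = true → ∀ x ∈ K, ∀ y ∈ K, x - y = io δ → False := by
  intro n
  induction n with
  | zero =>
    intro δ hd x hx y hy hxy
    have := bxb_of (diff_bx hD h hx hy hxy)
    simp [dead, this] at hd
  | succ n ih =>
    intro δ hd x hx y hy hxy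
    have hb := bxb_of (diff_bx hD h hx hy hxy)
    obtain ⟨_, ha, _, hb', x', hx', y', hy', _, _, hxy'⟩ := diff_step hD h hx hy hxy
    rw [← hr] at ha hb'
    obtain ⟨a, rfl⟩ := ha
    obtain ⟨b, rfl⟩ := hb'
    simp only [dead, hb, Bool.not_true, Bool.false_or, List.all_eq_true] at hd
    exact ih _ (hd a (List.mem_finRange a) b (List.mem_finRange b)) x' hx' y' hy' hxy'

/-- a point that can be pulled back forever with the same digit is the fixed point -/
lemma fixed_of_pull (hK : IsCompact K) {P : E3 → Prop} {a : E3} (hP : ∀ x, P x → x ∈ K)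
    (hs : ∀ x, P x → ∃ x', P x' ∧ x = (3 : ℝ)⁻¹ • (x' + a)) {x : E3} (hx : P x) : x = (2 : ℝ)⁻¹ • a := by
  obtain ⟨C, hC⟩ := hK.isBounded.subset_closedBall ((2 : ℝ)⁻¹ • a)
  have key : ∀ n : ℕ, ∀ x, P x → dist x ((2 : ℝ)⁻¹ • a) ≤ (3 : ℝ)⁻¹ ^ n * C := by
    intro n
    induction n with
    | zero =>
      intro x hx
      have : dist x ((2 : ℝ)⁻¹ • a) ≤ C := hC (hP x hx)
      simpa using this
    | succ n ih =>
      intro x hx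
      obtain ⟨x', hx', rfl⟩ := hs x hx
      have h1 := ih x' hx'
      have h2 : (2 : ℝ)⁻¹ • a = (3 : ℝ)⁻¹ • ((2 : ℝ)⁻¹ • a + a) := by module
      rw [h2, dist_smul₀, dist_add_right, pow_succ]
      simp only [norm_inv, Real.norm_ofNat]
      linarith
  have h1 : Tendsto (fun n : ℕ => (3 : ℝ)⁻¹ ^ n * C) atTop (𝓝 (0 * C)) :=
    (tendsto_pow_atTop_nhds_zero_of_lt_one (by norm_num) (by norm_num)).mul_const _
  rw [zero_mul] at h1
  exact dist_le_zero.1 (ge_of_tendsto' h1 fun n => key n x hx)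

lemma rep_H3 (i : Fin 12) (h : IsFractalCube3 (rD i) K) : ∀ d e, d ≠ e → ∀ x ∈ K, ∀ y ∈ K, x - y = io (rp i e - rp i d) →
    ∃ a b, rp i a - rp i b = (rp i e - rp i d) + (rp i e - rp i d) ∧
      x = (2 : ℝ)⁻¹ • io (rp i a) ∧ y = (2 : ℝ)⁻¹ • io (rp i b) := by
  intro d e hne x hx y hy hxy
  have hD := rD_digit i
  have step : ∀ x ∈ K, ∀ y ∈ K, x - y = io (rp i e - rp i d) → ∃ a b, rp i a - rp i b = (rp i e - rp i d) + (rp i e - rp i d) ∧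
      ∃ x' ∈ K, ∃ y' ∈ K, x' - y' = io (rp i e - rp i d) ∧ x = (3 : ℝ)⁻¹ • (x' + io (rp i a)) := by
    intro x hx y hy hxy
    have hb := bxb_of (diff_bx hD h hx hy hxy)
    obtain ⟨_, ha, _, hb', x', hx', y', hy', hx1, _, hxy'⟩ := diff_step hD h hx hy hxy
    rw [← rD_Dz] at ha hb'
    obtain ⟨a, rfl⟩ := ha
    obtain ⟨b, rfl⟩ := hb'
    rcases rp_dead i d e hne hb a b with hh | hh
    · refine ⟨a, b, hh, x', hx', y', hy', ?_, hx1⟩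
      rw [hxy', hh]
      congr 1
      abel
    · exact (dead_sound hD h (rD_Dz i) _ _ hh x' hx' y' hy' hxy').elim
  obtain ⟨a, b, hab, -⟩ := step x hx y hy hxy
  have hxa : x = (2 : ℝ)⁻¹ • io (rp i a) := by
    refine fixed_of_pull (P := fun x => x ∈ K ∧ ∃ y ∈ K, x - y = io (rp i e - rp i d)) h.2.1 (fun x hx => hx.1) ?_ ⟨hx, y, hy, hxy⟩
    rintro x ⟨hx, y, hy, hxy⟩
    obtain ⟨a', b', hab', x', hx', y', hy', hxy', hxx⟩ := step x hx y hy hxy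
    have := Rt_uniq i _ _ _ _ _ _ ((rp_Rt i d e a b).1 ⟨hne, hab⟩) ((rp_Rt i d e a' b').1 ⟨hne, hab'⟩)
    rw [← this.1] at hxx
    exact ⟨x', ⟨hx', y', hy', hxy'⟩, hxx⟩
  refine ⟨a, b, hab, hxa, ?_⟩
  rw [← half_sub hab, hxa] at hxy
  exact sub_right_injective hxy

noncomputable def rIFS (i : Fin 12) (h : IsFractalCube3 (rD i) K) : IFS (Rt i) K :=
  mkIFS (rD_digit i) h (rp_inj i) (rD_Dz i) (rp_Rt i) (rep_H3 i h)

lemma rD_good (i : Fin 12) : rD i ∈ GoodDigitSets := by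
  obtain ⟨K, hK⟩ : ∃ K, IsFractalCube3 (rD i) K := exists_cube (rp i)
  have : CompactSpace K := isCompact_iff_compactSpace.1 hK.2.1
  have : Nonempty K := hK.1.to_subtype
  refine ⟨rD_digit i, rD_card i, K, hK, ⟨hK.1, ?_⟩, ?_⟩
  · rw [isPreconnected_iff_preconnectedSpace]
    exact (rIFS i hK).preconn (okT i)
  · rintro _ ⟨_, ⟨d, rfl⟩, rfl⟩ _ ⟨_, ⟨e, rfl⟩, rfl⟩ hne p hp q hq
    have hde : d ≠ e := fun h => hne (by rw [h])
    have key : ∀ p ∈ piece K (io (rp i d)) ∩ piece K (io (rp i e)), ∃ a b, Rt i d e a b ∧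
        p = (3 : ℝ)⁻¹ • ((2 : ℝ)⁻¹ • io (rp i a) + io (rp i d)) := by
      rintro p ⟨h1, h2⟩
      obtain ⟨x, hx, hpx⟩ := mem_piece.1 h1
      obtain ⟨y, hy, hpy⟩ := mem_piece.1 h2
      obtain ⟨a, b, hab, hxa, -⟩ := rep_H3 i hK d e hde x hx y hy (glue_iff.1 (hpx ▸ hpy))
      exact ⟨a, b, (rp_Rt i d e a b).1 ⟨hde, hab⟩, by rw [hpx, hxa]⟩
    obtain ⟨a, b, hR, hpa⟩ := key p hp
    obtain ⟨a', b', hR', hqa⟩ := key q hq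
    rw [hpa, hqa, (Rt_uniq i _ _ _ _ _ _ hR hR').1]

end

end FC

set_option linter.unusedSectionVars false
set_option linter.unusedVariables false
namespace FC

open Set Filter Topology
open Pointwise

section
variable {D K : Set E3}

/-- three collinear digits give a segment -/
lemma seg_mem (h : IsFractalCube3 D K) {o u : E3} (h0 : o ∈ D) (h1 : o + u ∈ D) (h2 : o + u + u ∈ D) {t : ℝ}
    (ht0 : 0 ≤ t) (ht1 : t ≤ 1) : (2 : ℝ)⁻¹ • o + t • u ∈ K := by
  obtain ⟨z, hz⟩ := h.1
  obtain ⟨C, hC⟩ : ∃ C, ∀ t : ℝ, 0 ≤ t → t ≤ 1 → Metric.infDist ((2 : ℝ)⁻¹ • o + t • u) K ≤ C := by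
    refine ⟨dist ((2 : ℝ)⁻¹ • o) z + ‖u‖, fun t h0 h1 => ?_⟩
    refine (Metric.infDist_le_dist_of_mem hz).trans ?_
    rw [dist_eq_norm, dist_eq_norm]
    have : (2 : ℝ)⁻¹ • o + t • u - z = ((2 : ℝ)⁻¹ • o - z) + t • u := by abel
    rw [this]
    refine (norm_add_le _ _).trans ?_
    rw [norm_smul, Real.norm_of_nonneg h0]
    have := mul_le_mul_of_nonneg_right h1 (norm_nonneg u)
    linarith
  have key : ∀ n : ℕ, ∀ t : ℝ, 0 ≤ t → t ≤ 1 → Metric.infDist ((2 : ℝ)⁻¹ • o + t • u) K ≤ (3 : ℝ)⁻¹ ^ n * C := by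
    intro n
    induction n with
    | zero => intro t a b; simpa using hC t a b
    | succ n ih =>
      intro t a b
      have st : ∀ (s : ℝ) (d : E3), d ∈ D → 0 ≤ s → s ≤ 1 → (2 : ℝ)⁻¹ • o + t • u = (3 : ℝ)⁻¹ • (((2 : ℝ)⁻¹ • o + s • u) + d) →
          Metric.infDist ((2 : ℝ)⁻¹ • o + t • u) K ≤ (3 : ℝ)⁻¹ ^ (n + 1) * C := by
        intro s d hd hs0 hs1 he
        obtain ⟨y, hy, hyd⟩ := h.2.1.exists_infDist_eq_dist h.1 ((2 : ℝ)⁻¹ • o + s • u)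
        have h1 := ih s hs0 hs1
        rw [he]
        refine (Metric.infDist_le_dist_of_mem (cube_in h hy hd)).trans ?_
        rw [dist_smul₀, dist_add_right, ← hyd, pow_succ]
        simp only [norm_inv, Real.norm_ofNat]
        linarith
      rcases le_total t 3⁻¹ with c1 | c1
      · exact st (3 * t) o h0 (by linarith) (by linarith) (by module)
      · rcases le_total t (2 * 3⁻¹) with c2 | c2
        · exact st (3 * t - 1) _ h1 (by linarith) (by linarith) (by module)
        · exact st (3 * t - 2) _ h2 (by linarith) (by linarith) (by module)
  have h1 : Tendsto (fun n : ℕ => (3 : ℝ)⁻¹ ^ n * C) atTop (𝓝 (0 * C)) :=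
    (tendsto_pow_atTop_nhds_zero_of_lt_one (by norm_num) (by norm_num)).mul_const _
  rw [zero_mul] at h1
  rw [h.2.1.isClosed.mem_iff_infDist_zero h.1]
  exact le_antisymm (ge_of_tendsto' h1 fun n => key n t ht0 ht1) Metric.infDist_nonneg

/-- combinatorial condition for a half side -/
def Half (v : Fin 7 → Z3) (A u : Z3) : Prop := ∃ o a b : Fin 7, v a = v o + u ∧ v b = v o + u + u ∧
  ∃ p : Fin 7, A = v o + v p + v p ∨ A = v o + v p + v p + u

instance (v : Fin 7 → Z3) (A u : Z3) : Decidable (Half v A u) := by unfold Half; infer_instance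

lemma half_mem (h : IsFractalCube3 D K) {v : Fin 7 → Z3} (hr : range v = Dz D) {A u : Z3} (hA : Half v A u)
    {t : ℝ} (ht0 : 0 ≤ t) (ht1 : t ≤ 1) : (6 : ℝ)⁻¹ • (io A + t • io u) ∈ K := by
  have hvD : ∀ d, io (v d) ∈ D := fun d => by
    have : v d ∈ Dz D := hr ▸ mem_range_self d
    exact this
  obtain ⟨o, a, b, ha, hb, p, hp⟩ := hA
  have h1 := hvD a
  have h2 := hvD b
  rw [ha, io_add] at h1
  rw [hb, io_add, io_add] at h2
  rcases hp with rfl | rfl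
  · have := cube_in h (seg_mem h (hvD o) h1 h2 (t := t / 2) (by linarith) (by linarith)) (hvD p)
    convert this using 1
    rw [io_add, io_add]; module
  · have := cube_in h (seg_mem h (hvD o) h1 h2 (t := t / 2 + 1 / 2) (by linarith) (by linarith)) (hvD p)
    convert this using 1
    rw [io_add, io_add, io_add]; module

def NC (v : Fin 7 → Z3) (c U W : Z3) : Prop :=
  (Half v (c - U + W) U ∧ Half v (c + W) U) ∧ (Half v (c - U - W) U ∧ Half v (c - W) U) ∧
  (Half v (c - W + U) W ∧ Half v (c + U) W) ∧ (Half v (c - W - U) W ∧ Half v (c - U) W)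

instance (v : Fin 7 → Z3) (c U W : Z3) : Decidable (NC v c U W) := by unfold NC; infer_instance

lemma side_mem (h : IsFractalCube3 D K) {v : Fin 7 → Z3} (hr : range v = Dz D) {A u : Z3} (h1 : Half v (A - u) u)
    (h2 : Half v A u) {t : ℝ} (ht0 : -1 ≤ t) (ht1 : t ≤ 1) : (6 : ℝ)⁻¹ • (io A + t • io u) ∈ K := by
  rcases le_total 0 t with ht | ht
  · exact half_mem h hr h2 ht ht1
  · have := half_mem h hr h1 (t := t + 1) (by linarith) (by linarith)
    rw [io_sub] at this
    convert this using 1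
    module

lemma square_mem (h : IsFractalCube3 D K) {v : Fin 7 → Z3} (hr : range v = Dz D) {c U W : Z3} (hN : NC v c U W)
    {s t : ℝ} (hs : |s| ≤ 1) (ht : |t| ≤ 1) (hst : |s| = 1 ∨ |t| = 1) :
    (6 : ℝ)⁻¹ • (io c + s • io U + t • io W) ∈ K := by
  obtain ⟨⟨a1, a2⟩, ⟨b1, b2⟩, ⟨c1, c2⟩, ⟨d1, d2⟩⟩ := hN
  rw [abs_le] at hs ht
  rcases hst with hh | hh
  · rcases eq_or_eq_neg_of_abs_eq hh with rfl | rfl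
    · have := side_mem h hr (A := c + U) (by convert c1 using 1; abel) c2 ht.1 ht.2
      rw [io_add] at this
      convert this using 1
      module
    · have := side_mem h hr (A := c - U) (by convert d1 using 1; abel) d2 ht.1 ht.2
      rw [io_sub] at this
      convert this using 1
      module
  · rcases eq_or_eq_neg_of_abs_eq hh with rfl | rfl
    · have := side_mem h hr (A := c + W) (by convert a1 using 1; abel) a2 hs.1 hs.2
      rw [io_add] at this
      convert this using 1
      module
    · have := side_mem h hr (A := c - W) (by convert b1 using 1; abel) b2 hs.1 hs.2
      rw [io_sub] at this
      convert this using 1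
      module

lemma circle_exists (h : IsFractalCube3 D K) {v : Fin 7 → Z3} (hr : range v = Dz D) {c U W : Z3} (hN : NC v c U W)
    (hi : ∀ a b : ℝ, a • io U + b • io W = 0 → a = 0 ∧ b = 0) :
    ∃ γ : Cir → K, Continuous γ ∧ Function.Injective γ := by
  let m : Cir → ℝ := fun x => max |x.1 0| |x.1 1|
  have hnorm : ∀ x : Cir, x.1 0 ^ 2 + x.1 1 ^ 2 = 1 := by
    intro x
    have h1 : ‖x.1‖ = 1 := by simpa using x.2
    have h2 := EuclideanSpace.norm_sq_eq x.1
    rw [h1] at h2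
    simp [Fin.sum_univ_two] at h2
    linarith
  have hmpos : ∀ x, 0 < m x := by
    intro x
    by_contra hh
    have h1 : |x.1 0| ≤ 0 := (le_max_left _ _).trans (not_lt.1 hh)
    have h2 : |x.1 1| ≤ 0 := (le_max_right _ _).trans (not_lt.1 hh)
    have h3 := hnorm x
    rw [abs_nonpos_iff.1 h1, abs_nonpos_iff.1 h2] at h3
    norm_num at h3
  have hmc : Continuous m := by fun_prop
  have hmem : ∀ x : Cir, (6 : ℝ)⁻¹ • (io c + (x.1 0 / m x) • io U + (x.1 1 / m x) • io W) ∈ K := by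
    intro x
    have hp := hmpos x
    apply square_mem h hr hN
    · rw [abs_div, abs_of_pos hp, div_le_one hp]; exact le_max_left _ _
    · rw [abs_div, abs_of_pos hp, div_le_one hp]; exact le_max_right _ _
    · rw [abs_div, abs_div, abs_of_pos hp, div_eq_one_iff_eq hp.ne', div_eq_one_iff_eq hp.ne']
      rcases max_choice |x.1 0| |x.1 1| with hh | hh
      · exact Or.inl hh.symm
      · exact Or.inr hh.symm
  refine ⟨fun x => ⟨_, hmem x⟩, ?_, ?_⟩
  · apply Continuous.subtype_mk
    have h0 : Continuous fun x : Cir => x.1 0 / m x :=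
      Continuous.div (by fun_prop) hmc fun x => (hmpos x).ne'
    have h1 : Continuous fun x : Cir => x.1 1 / m x :=
      Continuous.div (by fun_prop) hmc fun x => (hmpos x).ne'
    fun_prop
  · intro x y hxy
    have h1 : (6 : ℝ)⁻¹ • (io c + (x.1 0 / m x) • io U + (x.1 1 / m x) • io W) =
      (6 : ℝ)⁻¹ • (io c + (y.1 0 / m y) • io U + (y.1 1 / m y) • io W) := congrArg Subtype.val hxy
    have h2 := smul_right_injective E3 (r := (6 : ℝ)⁻¹) (by norm_num) h1
    have h3 := hi (x.1 0 / m x - y.1 0 / m y) (x.1 1 / m x - y.1 1 / m y) (by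
      have := sub_eq_zero.2 h2
      rw [← this]
      module)
    have hx := hmpos x
    have hy := hmpos y
    have e0 : x.1 0 = (m x / m y) * y.1 0 := by
      have := sub_eq_zero.1 h3.1
      field_simp at this ⊢
      linarith
    have e1 : x.1 1 = (m x / m y) * y.1 1 := by
      have := sub_eq_zero.1 h3.2
      field_simp at this ⊢
      linarith
    have hp : 0 < m x / m y := div_pos hx hy
    generalize m x / m y = l at e0 e1 hp
    have n1 := hnorm x
    have n2 := hnorm y
    rw [e0, e1] at n1
    have hl : l ^ 2 = 1 := by
      have : l ^ 2 * (y.1 0 ^ 2 + y.1 1 ^ 2) = 1 := by rw [← n1]; ring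
      rwa [n2, mul_one] at this
    have hl1 : l = 1 := by nlinarith
    apply Subtype.ext
    ext j
    fin_cases j
    · show x.1 0 = y.1 0
      rw [e0, hl1, one_mul]
    · show x.1 1 = y.1 1
      rw [e1, hl1, one_mul]

end

lemma indep_of_det {U W : Z3} (h : U.1 * W.2.1 - U.2.1 * W.1 ≠ 0 ∨ U.1 * W.2.2 - U.2.2 * W.1 ≠ 0 ∨ U.2.1 * W.2.2 - U.2.2 * W.2.1 ≠ 0)
    (a b : ℝ) (hab : a • io U + b • io W = 0) : a = 0 ∧ b = 0 := by
  have h0 : a * (U.1 : ℝ) + b * (W.1 : ℝ) = 0 := congrArg (fun x : E3 => x 0) hab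
  have h1 : a * (U.2.1 : ℝ) + b * (W.2.1 : ℝ) = 0 := congrArg (fun x : E3 => x 1) hab
  have h2 : a * (U.2.2 : ℝ) + b * (W.2.2 : ℝ) = 0 := congrArg (fun x : E3 => x 2) hab
  have gen : ∀ p q r s : ℤ, p * s - q * r ≠ 0 → a * (p : ℝ) + b * (r : ℝ) = 0 → a * (q : ℝ) + b * (s : ℝ) = 0 → a = 0 ∧ b = 0 := by
    intro p q r s hd e0 e1
    have hd' : ((p : ℝ) * s - q * r) ≠ 0 := by exact_mod_cast hd
    constructor
    · apply (mul_eq_zero.1 (_ : a * ((p : ℝ) * s - q * r) = 0)).resolve_right hd'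
      linear_combination s * e0 - r * e1
    · apply (mul_eq_zero.1 (_ : b * ((p : ℝ) * s - q * r) = 0)).resolve_right hd'
      linear_combination p * e1 - q * e0
  rcases h with h | h | h
  · exact gen _ _ _ _ h h0 h1
  · exact gen _ _ _ _ h h0 h2
  · exact gen _ _ _ _ h h1 h2

lemma rep_circle (i : Fin 12) (hi : i = 0 ∨ i = 1 ∨ i = 2 ∨ i = 3 ∨ i = 5 ∨ i = 6 ∨ i = 8) {K : Set E3}
    (h : IsFractalCube3 (rD i) K) : ∃ γ : Cir → K, Continuous γ ∧ Function.Injective γ := by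
  obtain ⟨c, U, W, hN, hd⟩ : ∃ c U W, NC (rp i) c U W ∧
      (U.1 * W.2.1 - U.2.1 * W.1 ≠ 0 ∨ U.1 * W.2.2 - U.2.2 * W.1 ≠ 0 ∨ U.2.1 * W.2.2 - U.2.2 * W.2.1 ≠ 0) := by
    rcases hi with rfl | rfl | rfl | rfl | rfl | rfl | rfl
    · exact ⟨(0, 1, 1), (0, 0, 1), (0, 1, 0), by decide +kernel⟩
    · exact ⟨(0, 1, 1), (0, 0, 1), (0, 1, 0), by decide +kernel⟩
    · exact ⟨(0, 1, 1), (0, 0, 1), (0, 1, 0), by decide +kernel⟩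
    · exact ⟨(1, 1, 1), (0, 0, 1), (1, 1, 0), by decide +kernel⟩
    · exact ⟨(1, 1, 3), (0, 1, 0), (1, 0, 0), by decide +kernel⟩
    · exact ⟨(1, 5, 3), (0, -1, 0), (1, 0, 0), by decide +kernel⟩
    · exact ⟨(2, 2, 3), (1, 0, 0), (0, 1, 0), by decide +kernel⟩
  exact circle_exists h (rD_Dz i) hN (indep_of_det hd)

end FC

set_option linter.unusedSectionVars false
set_option linter.unusedVariables false
namespace FC

open Set Filter Topology
open Pointwise

def HasCir (X : Type) [TopologicalSpace X] : Prop := ∃ γ : Cir → X, Continuous γ ∧ Function.Injective γ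

lemma HasCir_h {X Y : Type} [TopologicalSpace X] [TopologicalSpace Y] (φ : X ≃ₜ Y) (h : HasCir X) : HasCir Y := by
  obtain ⟨γ, h1, h2⟩ := h
  exact ⟨φ ∘ γ, φ.continuous.comp h1, φ.injective.comp h2⟩

lemma continuous_of_lip {X Y : Type} [MetricSpace X] [MetricSpace Y] {φ : X → Y} {L : ℝ} (hL : 1 ≤ L)
    (h : ∀ x y, dist (φ x) (φ y) ≤ L * dist x y) : Continuous φ :=
  (LipschitzWith.of_dist_le_mul (K := ⟨L, by linarith⟩) h).continuous

/-- a bi-Lipschitz bijection of compact spaces is a homeomorphism -/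
noncomputable def homeoOfLip {X Y : Type} [MetricSpace X] [CompactSpace X] [MetricSpace Y] {φ : X → Y} {L : ℝ} (hL : 1 ≤ L)
    (hb : Function.Bijective φ) (h : ∀ x y, dist (φ x) (φ y) ≤ L * dist x y) : X ≃ₜ Y :=
  Continuous.homeoOfEquivCompactToT2 (f := Equiv.ofBijective φ hb) (continuous_of_lip hL h)

section
variable {X : Type} [MetricSpace X] [CompactSpace X]

lemma hasCir_of {i : Fin 12} (F : IFS (Rt i) X) (hi : i = 0 ∨ i = 1 ∨ i = 2 ∨ i = 3 ∨ i = 5 ∨ i = 6 ∨ i = 8) : HasCir X := by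
  obtain ⟨K, hK⟩ : ∃ K, IsFractalCube3 (rD i) K := exists_cube (rp i)
  have : CompactSpace K := isCompact_iff_compactSpace.1 hK.2.1
  have : Nonempty K := hK.1.to_subtype
  have : Nonempty X := ⟨F.c 0⟩
  obtain ⟨φ, L, hL, hb, h⟩ := exists_biLip (okT i) (rIFS i hK) F
  exact HasCir_h (homeoOfLip hL hb fun x y => (h x y).2) (rep_circle i hi hK)

lemma not_hasCir {i : Fin 12} (F : IFS (Rt i) X) (hi : i = 4 ∨ i = 7 ∨ i = 9 ∨ i = 10 ∨ i = 11) : ¬ HasCir X := by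
  rintro ⟨γ, h1, h2⟩
  exact F.no_circle (okT i) (treeT i hi) h1 h2
end

/-- the invariants -/
def Av (X : Type) [TopologicalSpace X] : ℕ → Prop
  | 0 => HasCir X
  | 1 => I2 X
  | 2 => I3 X
  | 3 => DC X
  | 4 => T2 X
  | 5 => T1 X
  | 6 => T3 X
  | 7 => I5 X
  | 8 => Q1 X
  | 9 => Q2 X
  | _ => WW X

def posL : ℕ → List (Fin 12)
  | 0 => [0, 1, 2, 3, 5, 6, 8]
  | 1 => [0, 1, 2, 3, 5, 6]
  | 2 => [2, 3, 5, 6]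
  | 3 => [1]
  | 4 => [2, 5, 6]
  | 5 => [5, 6]
  | 6 => [5]
  | 7 => [9, 10, 11]
  | 8 => [11]
  | 9 => [10]
  | _ => [4]

def negL : ℕ → List (Fin 12)
  | 0 => [4, 7, 9, 10, 11]
  | 1 => [8]
  | 2 => [0, 1]
  | 3 => [0]
  | 4 => [3]
  | 5 => [2]
  | 6 => [6]
  | 7 => [4, 7]
  | 8 => [9, 10]
  | 9 => [9]
  | _ => [7]

lemma Av_h {X Y : Type} [TopologicalSpace X] [TopologicalSpace Y] (φ : X ≃ₜ Y) (n : ℕ) (h : Av X n) : Av Y n := by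
  match n, h with
  | 0, h => exact HasCir_h φ h
  | 1, h => exact I2_h φ h
  | 2, h => exact I3_h φ h
  | 3, h => exact DC_h φ h
  | 4, h => exact T2_h φ h
  | 5, h => exact T1_h φ h
  | 6, h => exact T3_h φ h
  | 7, h => exact I5_h φ h
  | 8, h => exact Q1_h φ h
  | 9, h => exact Q2_h φ h
  | _ + 10, h => exact WW_h φ h

section
variable {X : Type} [MetricSpace X] [CompactSpace X]

lemma Av_pos {i : Fin 12} (F : IFS (Rt i) X) (n : ℕ) (h : i ∈ posL n) : Av X n := by
  match n, h with
  | 0, h => exact hasCir_of F (by simpa [posL] using h)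
  | 1, h =>
    simp only [posL, List.mem_cons, List.not_mem_nil, or_false] at h
    refine I2_c F 1 ?_
    clear F
    rcases h with rfl | rfl | rfl | rfl | rfl | rfl <;> decide +kernel
  | 2, h =>
    simp only [posL, List.mem_cons, List.not_mem_nil, or_false] at h
    rcases h with rfl | rfl | rfl | rfl
    · exact I3_c F 1 (by decide +kernel)
    · exact I3_c F 4 (by decide +kernel)
    · exact I3_c F 1 (by decide +kernel)
    · exact I3_c F 1 (by decide +kernel)
  | 3, h =>
    simp only [posL, List.mem_cons, List.not_mem_nil, or_false] at h
    subst h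
    exact DC_1 F
  | 4, h =>
    simp only [posL, List.mem_cons, List.not_mem_nil, or_false] at h
    refine T2_c F 1 ?_
    clear F
    rcases h with rfl | rfl | rfl <;> decide +kernel
  | 5, h =>
    simp only [posL, List.mem_cons, List.not_mem_nil, or_false] at h
    rcases h with rfl | rfl
    · exact T1_5 F
    · exact T1_6 F
  | 6, h =>
    simp only [posL, List.mem_cons, List.not_mem_nil, or_false] at h
    subst h
    exact T3_5 F
  | 7, h =>
    simp only [posL, List.mem_cons, List.not_mem_nil, or_false] at h
    rcases h with rfl | rfl | rfl
    · exact I5_c F 3 (by decide +kernel)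
    · exact I5_c F 2 (by decide +kernel)
    · exact I5_glue F 3 5 5 1 (by decide +kernel) (by decide +kernel)
  | 8, h =>
    simp only [posL, List.mem_cons, List.not_mem_nil, or_false] at h
    subst h
    exact Q1_11 F
  | 9, h =>
    simp only [posL, List.mem_cons, List.not_mem_nil, or_false] at h
    subst h
    exact Q2_10 F
  | _ + 10, h =>
    simp only [posL, List.mem_cons, List.not_mem_nil, or_false] at h
    subst h
    exact WW_4 F

lemma Av_neg {i : Fin 12} (F : IFS (Rt i) X) (n : ℕ) (h : i ∈ negL n) : ¬ Av X n := by
  match n, h with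
  | 0, h => exact not_hasCir F (by simpa [negL] using h)
  | 1, h =>
    simp only [negL, List.mem_cons, List.not_mem_nil, or_false] at h
    subst h
    exact I2_not F
  | 2, h => exact I3_not F (by simpa [negL] using h)
  | 3, h =>
    simp only [negL, List.mem_cons, List.not_mem_nil, or_false] at h
    subst h
    exact DC_not F
  | 4, h =>
    simp only [negL, List.mem_cons, List.not_mem_nil, or_false] at h
    subst h
    exact T2_not F
  | 5, h =>
    simp only [negL, List.mem_cons, List.not_mem_nil, or_false] at h
    subst h
    exact T1_not F
  | 6, h =>
    simp only [negL, List.mem_cons, List.not_mem_nil, or_false] at h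
    subst h
    exact T3_not F
  | 7, h => exact I5_not F (by simpa [negL] using h)
  | 8, h => exact Q1_not F (by simpa [negL] using h)
  | 9, h =>
    simp only [negL, List.mem_cons, List.not_mem_nil, or_false] at h
    subst h
    exact Q2_not F
  | _ + 10, h =>
    simp only [negL, List.mem_cons, List.not_mem_nil, or_false] at h
    subst h
    exact WW_not F

end

lemma tab_sep : ∀ i j : Fin 12, i ≠ j → ∃ n : Fin 11, (i ∈ posL n ∧ j ∈ negL n) ∨ (j ∈ posL n ∧ i ∈ negL n) := by
  decide +kernel

theorem distinct {X Y : Type} [MetricSpace X] [CompactSpace X] [MetricSpace Y] [CompactSpace Y] {i j : Fin 12}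
    (F : IFS (Rt i) X) (G : IFS (Rt j) Y) (φ : X ≃ₜ Y) : i = j := by
  by_contra hne
  obtain ⟨n, ⟨h1, h2⟩ | ⟨h1, h2⟩⟩ := tab_sep i j hne
  · exact Av_neg G n h2 (Av_h φ n (Av_pos F n h1))
  · exact Av_neg F n h2 (Av_h φ.symm n (Av_pos G n h1))

lemma dend_iff {K : Set E3} (hK : IsCompact K) (hne : K.Nonempty) {i : Fin 12} (F : IFS (Rt i) K) :
    IsDendrite K ↔ i ∈ negL 0 := by
  have : CompactSpace K := isCompact_iff_compactSpace.1 hK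
  constructor
  · intro h
    by_contra hi
    have h1 : i ∈ posL 0 := by
      clear F
      revert i
      decide
    obtain ⟨γ, hc, hinj⟩ : HasCir K := Av_pos F 0 h1
    apply h.2.2.2
    let g : Cir → E3 := fun x => (γ x).1
    have hg : IsClosedEmbedding g :=
      Continuous.isClosedEmbedding (continuous_subtype_val.comp hc) (Subtype.val_injective.comp hinj)
    refine ⟨range g, ?_, ⟨hg.isEmbedding.toHomeomorph.symm⟩⟩
    rintro _ ⟨x, rfl⟩
    exact (γ x).2
  · intro hi
    refine ⟨hK, ⟨hne, ?_⟩, F.locConn (okT i), ?_⟩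
    · rw [isPreconnected_iff_preconnectedSpace]
      exact F.preconn (okT i)
    · rintro ⟨C, hC, ⟨ψ⟩⟩
      apply Av_neg F 0 hi
      refine ⟨fun x => ⟨(ψ.symm x).1, hC (ψ.symm x).2⟩, ?_, ?_⟩
      · exact (continuous_subtype_val.comp ψ.symm.continuous).subtype_mk _
      · intro x y hxy
        have h1 : (ψ.symm x).1 = (ψ.symm y).1 := congrArg (fun z : K => (z : E3)) hxy
        exact ψ.symm.injective (Subtype.ext h1)

/-- the class of a good digit set -/
noncomputable def cls (D : GoodDigitSets) : Fin 12 := (good_ifs D.2).choose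

lemma cls_spec (D : GoodDigitSets) {K : Set E3} (hK : IsFractalCube3 D K) : Nonempty (IFS (Rt (cls D)) K) :=
  (good_ifs D.2).choose_spec K hK

lemma exists_K (D : GoodDigitSets) : ∃ K, IsFractalCube3 (D : Set E3) K := by
  obtain ⟨_, _, K, hK, _⟩ := D.2
  exact ⟨K, hK⟩

lemma lip_iff (D D' : GoodDigitSets) : LipEquiv D D' ↔ cls D = cls D' := by
  constructor
  · rintro ⟨K, K', hK, hK', φ, L, hL, hb, h⟩
    have : CompactSpace K := isCompact_iff_compactSpace.1 hK.2.1
    have : CompactSpace K' := isCompact_iff_compactSpace.1 hK'.2.1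
    obtain ⟨F⟩ := cls_spec D hK
    obtain ⟨G⟩ := cls_spec D' hK'
    refine distinct F G (homeoOfLip hL hb fun x y => ?_)
    rw [Subtype.dist_eq, Subtype.dist_eq, dist_eq_norm, dist_eq_norm]
    exact (h x y).2
  · intro he
    obtain ⟨K, hK⟩ := exists_K D
    obtain ⟨K', hK'⟩ := exists_K D'
    have : CompactSpace K := isCompact_iff_compactSpace.1 hK.2.1
    have : CompactSpace K' := isCompact_iff_compactSpace.1 hK'.2.1
    have : Nonempty K := hK.1.to_subtype
    have : Nonempty K' := hK'.1.to_subtype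
    obtain ⟨F⟩ := cls_spec D hK
    obtain ⟨G⟩ := cls_spec D' hK'
    rw [← he] at G
    obtain ⟨φ, L, hL, hb, h⟩ := exists_biLip (okT (cls D)) F G
    refine ⟨K, K', hK, hK', φ, L, hL, hb, fun x y => ?_⟩
    have := h x y
    rwa [Subtype.dist_eq, Subtype.dist_eq, dist_eq_norm, dist_eq_norm] at this

lemma cls_rD (i : Fin 12) : cls ⟨rD i, rD_good i⟩ = i := by
  obtain ⟨K, hK⟩ := exists_K ⟨rD i, rD_good i⟩
  have : CompactSpace K := isCompact_iff_compactSpace.1 hK.2.1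
  obtain ⟨F⟩ := cls_spec _ hK
  exact distinct F (rIFS i hK) (Homeomorph.refl K)

lemma cls_dend (D : GoodDigitSets) {K : Set E3} (hK : IsFractalCube3 D K) : IsDendrite K ↔ cls D ∈ negL 0 := by
  obtain ⟨F⟩ := cls_spec D hK
  exact dend_iff hK.2.1 hK.1 F

noncomputable def qf : Quot LipEquiv → Fin 12 := Quot.lift cls fun D D' h => (lip_iff D D').1 h

lemma qf_bij : Function.Bijective qf := by
  constructor
  · rintro ⟨D⟩ ⟨D'⟩ h
    exact Quot.sound ((lip_iff D D').2 h)
  · intro i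
    exact ⟨Quot.mk _ ⟨rD i, rD_good i⟩, cls_rD i⟩

noncomputable def qe : Quot LipEquiv ≃ Fin 12 := Equiv.ofBijective qf qf_bij

theorem main : Nat.card (Quot LipEquiv) = 12 ∧
    Nat.card {q : Quot LipEquiv // ∀ D : GoodDigitSets, Quot.mk LipEquiv D = q →
      ∃ K : Set E3, IsFractalCube3 D K ∧ IsDendrite K} = 5 ∧
    Nat.card {q : Quot LipEquiv // ∀ D : GoodDigitSets, Quot.mk LipEquiv D = q →
      ∃ K : Set E3, IsFractalCube3 D K ∧ ¬ IsDendrite K} = 7 := by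
  refine ⟨?_, ?_, ?_⟩
  · rw [Nat.card_congr qe, Nat.card_fin]
  · rw [Nat.card_congr (Equiv.subtypeEquiv qe (q := fun i => i ∈ negL 0) ?_)]
    · rw [Nat.card_eq_fintype_card]
      decide
    · rintro ⟨D⟩
      constructor
      · intro h
        obtain ⟨K, hK, hd⟩ := h D rfl
        exact (cls_dend D hK).1 hd
      · intro h D' hD'
        have h1 : cls D' = cls D := congrArg qf hD'
        obtain ⟨K, hK⟩ := exists_K D'
        exact ⟨K, hK, (cls_dend D' hK).2 (by rw [h1]; exact h)⟩
  · rw [Nat.card_congr (Equiv.subtypeEquiv qe (q := fun i => i ∉ negL 0) ?_)]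
    · rw [Nat.card_eq_fintype_card]
      decide
    · rintro ⟨D⟩
      constructor
      · intro h
        obtain ⟨K, hK, hd⟩ := h D rfl
        exact fun hh => hd ((cls_dend D hK).2 hh)
      · intro h D' hD'
        have h1 : cls D' = cls D := congrArg qf hD'
        obtain ⟨K, hK⟩ := exists_K D'
        exact ⟨K, hK, fun hh => h (by have := (cls_dend D' hK).1 hh; rw [h1] at this; exact this)⟩

end FC

/-- The connected fractal 3-cubes of order 3 with 7 pieces possessing the one-point
intersection property form exactly `12` bi-Lipschitz classes: `5` classes of dendrites and
`7` classes of non-dendrites. -/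
theorem biLipschitz_classes_card :
    Nat.card (Quot LipEquiv) = 12 ∧
    Nat.card {q : Quot LipEquiv // ∀ D : GoodDigitSets, Quot.mk LipEquiv D = q →
      ∃ K : Set E3, IsFractalCube3 D K ∧ IsDendrite K} = 5 ∧
    Nat.card {q : Quot LipEquiv // ∀ D : GoodDigitSets, Quot.mk LipEquiv D = q →
      ∃ K : Set E3, IsFractalCube3 D K ∧ ¬ IsDendrite K} = 7 := by
  exact FC.main
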